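/- If in addition s1* < u0'(x0) < s2* for some x0 ∈ (0,1), then there exist infinitely many forward solutions u to the initial–Neumann problem satisfying both |{(x,t) ∈ Ω_T : s1* < u_x(x,t) < s1}| > 0 and |{(x,t) ∈ Ω_T : s2 < u_x(x,t) < s2*}| > 0 (Lebesgue measure), so each such solution takes spatial-gradient values in both forward phases on sets of positive measure. -/

import Mathlib

open MeasureTheory Set
open scoped NNReal

noncomputable section

/-- The open space-time domain `Ω_T = (0,1) × (0,T)`. -/
def OmegaT (T : ℝ) : Set (ℝ × ℝ) := Ioo (0:ℝ) 1 ×ˢ Ioo (0:ℝ) T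

/-- The closed space-time domain `cl Ω_T = [0,1] × [0,T]`. -/
def ClOmegaT (T : ℝ) : Set (ℝ × ℝ) := Icc (0:ℝ) 1 ×ˢ Icc (0:ℝ) T

/-- Parabolic α-Hölder continuity on `cl Ω_T`. -/
def ParabolicHolder (α T : ℝ) (g : ℝ → ℝ → ℝ) : Prop :=
  ∃ C : ℝ, ∀ x ∈ Icc (0:ℝ) 1, ∀ y ∈ Icc (0:ℝ) 1, ∀ t ∈ Icc (0:ℝ) T, ∀ s ∈ Icc (0:ℝ) T,
    |g x t - g y s| ≤ C * (|x - y| ^ α + |t - s| ^ (α / 2))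

/-- Hypotheses on the forward-backward diffusion flux `σ`, with derivative function `σ'`
(one-sided derivative on `(-∞,s1]` and `[s2,∞)`). -/
structure FluxHyp (α s1 s2 lam Lam : ℝ) (sigma sigma' : ℝ → ℝ) : Prop where
  alpha_pos : 0 < α
  alpha_lt_one : α < 1
  s1_pos : 0 < s1
  s1_lt_s2 : s1 < s2
  lam_pos : 0 < lam
  lam_le_Lam : lam ≤ Lam
  deriv_left : ∀ s ∈ Iic s1, HasDerivWithinAt sigma (sigma' s) (Iic s1) s
  deriv_right : ∀ s ∈ Ici s2, HasDerivWithinAt sigma (sigma' s) (Ici s2) s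
  holder_left : ∃ C : ℝ, ∀ s ∈ Iic s1, ∀ t ∈ Iic s1, |sigma' s - sigma' t| ≤ C * |s - t| ^ α
  holder_right : ∃ C : ℝ, ∀ s ∈ Ici s2, ∀ t ∈ Ici s2, |sigma' s - sigma' t| ≤ C * |s - t| ^ α
  deriv_pos : ∀ s : ℝ, s < s1 ∨ s2 < s → 0 < sigma' s
  deriv_lb : ∀ s : ℝ, s < s1 / 2 ∨ 2 * s2 < s → lam ≤ sigma' s
  deriv_ub : ∀ s : ℝ, s < s1 / 2 ∨ 2 * s2 < s → sigma' s ≤ Lam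
  sigma_zero : sigma 0 = 0
  sigma_s2_lt_s1 : sigma s2 < sigma s1
  sigma_s2_nonneg : 0 ≤ sigma s2

/-- Hypotheses on the convection coefficient `b` (with spatial derivative `bx`),
reaction coefficient `c`, source `f` and the function `d` with `c = b_x + d(t)`. -/
structure CoeffHyp (α T : ℝ) (b bx c f : ℝ → ℝ → ℝ) (d : ℝ → ℝ) : Prop where
  b_cont : ContinuousOn (fun p : ℝ × ℝ => b p.1 p.2) (ClOmegaT T)
  b_holder : ParabolicHolder α T b
  b_deriv : ∀ p ∈ ClOmegaT T, HasDerivWithinAt (fun y => b y p.2) (bx p.1 p.2) (Icc (0:ℝ) 1) p.1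
  bx_cont : ContinuousOn (fun p : ℝ × ℝ => bx p.1 p.2) (ClOmegaT T)
  c_cont : ContinuousOn (fun p : ℝ × ℝ => c p.1 p.2) (ClOmegaT T)
  c_holder : ParabolicHolder α T c
  f_cont : ContinuousOn (fun p : ℝ × ℝ => f p.1 p.2) (ClOmegaT T)
  f_holder : ParabolicHolder α T f
  d_cont : ContinuousOn d (Icc (0:ℝ) T)
  c_eq : ∀ p ∈ ClOmegaT T, c p.1 p.2 = bx p.1 p.2 + d p.2

/-- Hypotheses on the initial datum `u0 ∈ C^{2+α}([0,1])` with `u0'(0) = u0'(1) = 0`. -/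
structure InitHyp (α : ℝ) (u0 u0' u0'' : ℝ → ℝ) : Prop where
  deriv1 : ∀ x ∈ Icc (0:ℝ) 1, HasDerivWithinAt u0 (u0' x) (Icc (0:ℝ) 1) x
  deriv2 : ∀ x ∈ Icc (0:ℝ) 1, HasDerivWithinAt u0' (u0'' x) (Icc (0:ℝ) 1) x
  holder : ∃ C : ℝ, ∀ x ∈ Icc (0:ℝ) 1, ∀ y ∈ Icc (0:ℝ) 1, |u0'' x - u0'' y| ≤ C * |x - y| ^ α
  compat0 : u0' 0 = 0
  compat1 : u0' 1 = 0

/-- `u` (with a.e. spatial derivative `ux`) is a Lipschitz (weak) solution of the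
initial–Neumann problem for `u_t = (σ(u_x))_x + b u_x + c u + f` on `Ω_T`. -/
def IsLipschitzSolution (T : ℝ) (sigma : ℝ → ℝ) (b c f : ℝ → ℝ → ℝ) (u0 : ℝ → ℝ)
    (u ux : ℝ → ℝ → ℝ) : Prop :=
  (∃ K : ℝ≥0, LipschitzOnWith K (fun p : ℝ × ℝ => u p.1 p.2) (ClOmegaT T)) ∧
  (∀ᵐ p ∂(volume.restrict (OmegaT T)), HasDerivAt (fun y => u y p.2) (ux p.1 p.2) p.1) ∧
  (∀ ζ : ℝ → ℝ → ℝ, ContDiff ℝ (⊤ : ℕ∞) (fun p : ℝ × ℝ => ζ p.1 p.2) →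
    ∀ s ∈ Icc (0:ℝ) T,
      (∫ t in Ioo (0:ℝ) s, ∫ x in Ioo (0:ℝ) 1,
        (u x t * deriv (fun τ => ζ x τ) t - sigma (ux x t) * deriv (fun y => ζ y t) x
          + (b x t * ux x t + c x t * u x t + f x t) * ζ x t))
      = ∫ x in Ioo (0:ℝ) 1, (u x s * ζ x s - u0 x * ζ x 0))

/-- The forward-phase constraint: `u_x ∈ (-∞,s1) ∪ (s2,∞)` a.e. in `Ω_T`. -/
def ForwardRange (T s1 s2 : ℝ) (ux : ℝ → ℝ → ℝ) : Prop :=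
  ∀ᵐ p ∂(volume.restrict (OmegaT T)), ux p.1 p.2 < s1 ∨ s2 < ux p.1 p.2

namespace FB
open Finset

noncomputable def dker (θ : ℕ → ℝ) : ℕ → ℕ → ℝ
  | 0, m => if m = 0 then 1 else 0
  | n+1, 0 => (1 - 3 * θ n) * dker θ n 0 + θ n * dker θ n 1
  | n+1, m+1 => (1 - 2 * θ n) * dker θ n (m+1) + θ n * (dker θ n (m+2) + dker θ n m)

noncomputable def opS (θ : ℝ) (u : ℤ → ℝ) (y : ℤ) : ℝ :=
  (1 - 2 * θ) * u y + θ * (u (y+1) + u (y-1))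

noncomputable def itS (θ : ℕ → ℝ) : ℕ → (ℤ → ℝ) → ℤ → ℝ
  | 0, u => u
  | n+1, u => opS (θ n) (itS θ n u)

noncomputable def opT (θ : ℝ) (F : ℕ → ℝ) : ℕ → ℝ
  | 0 => (1 - 3 * θ) * F 0 + θ * F 1
  | m+1 => (1 - 2 * θ) * F (m+1) + θ * (F (m+2) + F m)

lemma dker_supp (θ : ℕ → ℝ) (n : ℕ) : ∀ m, n < m → dker θ n m = 0 := by
  induction n with
  | zero => intro m hm; simp [dker]; omega
  | succ n ih =>
    intro m hm
    cases m with
    | zero => omega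
    | succ m =>
      simp only [dker]
      rw [ih _ (by omega), ih _ (by omega), ih _ (by omega)]; ring

lemma dker_nonneg (θ : ℕ → ℝ) (h0 : ∀ n, 0 ≤ θ n) (h1 : ∀ n, θ n ≤ 1/4) (n : ℕ) :
    ∀ m, 0 ≤ dker θ n m := by
  induction n with
  | zero => intro m; simp [dker]; split_ifs <;> norm_num
  | succ n ih =>
    intro m
    have a := h0 n
    have b := h1 n
    cases m with
    | zero =>
      simp only [dker]
      have := mul_nonneg (by linarith : 0 ≤ 1 - 3 * θ n) (ih 0)
      have := mul_nonneg a (ih 1)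
      linarith
    | succ m =>
      simp only [dker]
      have := mul_nonneg (by linarith : 0 ≤ 1 - 2 * θ n) (ih (m+1))
      have := mul_nonneg a (add_nonneg (ih (m+2)) (ih m))
      linarith

lemma dker_green (θ : ℕ → ℝ) (F : ℕ → ℝ) (n L : ℕ) :
    ∑ m ∈ range (L+1), dker θ (n+1) m * F m =
      ∑ m ∈ range (L+1), dker θ n m * opT (θ n) F m
        + θ n * (dker θ n (L+1) * F L - dker θ n L * F (L+1)) := by
  induction L with
  | zero => simp [dker, opT]; ring
  | succ L ih =>
    rw [sum_range_succ, ih, sum_range_succ _ (L+1)]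
    simp only [dker, opT]; ring

lemma dker_dual (θ : ℕ → ℝ) (F : ℕ → ℝ) (n : ℕ) :
    ∑ m ∈ range (n+2), dker θ (n+1) m * F m =
      ∑ m ∈ range (n+1), dker θ n m * opT (θ n) F m := by
  rw [dker_green, dker_supp θ n (n+1+1) (by omega), dker_supp θ n (n+1) (by omega),
    sum_range_succ, dker_supp θ n (n+1) (by omega)]
  ring

lemma dker_repr (θ : ℕ → ℝ) (u : ℤ → ℝ) (n : ℕ) : ∀ y : ℤ,
    itS θ n u (y+1) - itS θ n u y =
      ∑ m ∈ range (n+1), dker θ n m * (u (y+m+1) - u (y-m)) := by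
  induction n with
  | zero => intro y; simp [itS, dker]
  | succ n ih =>
    intro y
    have e : itS θ (n+1) u (y+1) - itS θ (n+1) u y =
      (1 - 2 * θ n) * (itS θ n u (y+1) - itS θ n u y) +
        θ n * ((itS θ n u (y+1+1) - itS θ n u (y+1)) +
          (itS θ n u (y-1+1) - itS θ n u (y-1))) := by
      simp only [itS, opS]
      rw [show y+1-1 = y by ring, show y-1+1 = y by ring]; ring
    rw [e, ih, ih, ih]
    rw [show n+1+1 = n+2 from rfl, dker_dual θ (fun m => u (y+m+1) - u (y-m)) n,
      ← sum_add_distrib, mul_sum, mul_sum, ← sum_add_distrib]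
    apply sum_congr rfl
    intro m _
    cases m with
    | zero =>
      simp only [opT]; push_cast
      rw [show y+1+0+1 = y+2 by ring, show y+1-0=y+1 by ring, show y-1+0+1=y by ring,
        show y-1-0=y-1 by ring, show y+0+1=y+1 by ring, show y-0=y by ring,
        show y+1+1=y+2 by ring]; ring
    | succ m =>
      simp only [opT]; push_cast
      rw [show y+1+(m+1)+1 = y+(m+2)+1 by ring, show y+1-((m:ℤ)+1)=y-m by ring,
        show y-1+((m:ℤ)+1)+1=y+m+1 by ring, show y-1-((m:ℤ)+1)=y-(m+2) by ring]; ring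

lemma dker_m1 (θ : ℕ → ℝ) (n : ℕ) :
    ∑ m ∈ range (n+1), dker θ n m * (2*m+1) = 1 := by
  induction n with
  | zero => simp [dker]
  | succ n ih =>
    refine (dker_dual θ (fun m => 2*(m:ℝ)+1) n).trans ?_
    refine Eq.trans ?_ ih
    apply sum_congr rfl
    intro m _
    cases m with
    | zero => simp only [opT]; push_cast; ring
    | succ m => simp only [opT]; push_cast; ring

lemma dker_m3 (θ : ℕ → ℝ) (n : ℕ) :
    ∑ m ∈ range (n+1), dker θ n m * (2*m+1)^3 = 1 + 24 * ∑ k ∈ range n, θ k := by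
  induction n with
  | zero => simp [dker]
  | succ n ih =>
    refine (dker_dual θ (fun m => (2*(m:ℝ)+1)^3) n).trans ?_
    rw [sum_range_succ (fun k => θ k) n, mul_add, ← add_assoc, ← ih]
    have := dker_m1 θ n
    calc _ = ∑ m ∈ range (n+1), (dker θ n m * (2*m+1)^3 + 24 * θ n * (dker θ n m * (2*m+1))) := by
          apply sum_congr rfl
          intro m _
          cases m with
          | zero => simp only [opT]; push_cast; ring
          | succ m => simp only [opT]; push_cast; ring
      _ = _ := by rw [sum_add_distrib, ← mul_sum, this]; ring

noncomputable def dir (x : ℝ) (m : ℕ) : ℝ := 1 + 2 * ∑ r ∈ range m, Real.cos ((r+1) * x)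

lemma dir_rec (x : ℝ) (m : ℕ) : dir x (m+2) + dir x m = 2 * Real.cos x * dir x (m+1) := by
  induction m with
  | zero =>
    simp [dir, sum_range_succ]
    rw [show (1+1 : ℝ) * x = 2 * x by ring, Real.cos_two_mul]; ring
  | succ m ih =>
    have h1 : dir x (m+3) = dir x (m+2) + 2 * Real.cos ((m+3)*x) := by
      simp only [dir]; rw [sum_range_succ _ (m+2), show (((m+2:ℕ):ℝ)+1) = (m:ℝ)+3 by push_cast; ring]; ring
    have h2 : dir x (m+2) = dir x (m+1) + 2 * Real.cos ((m+2)*x) := by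
      simp only [dir]; rw [sum_range_succ _ (m+1), show (((m+1:ℕ):ℝ)+1) = (m:ℝ)+2 by push_cast; ring]; ring
    have h3 : dir x (m+1) = dir x m + 2 * Real.cos ((m+1)*x) := by
      simp only [dir]; rw [sum_range_succ _ m]; ring
    have h4 : Real.cos ((m+3)*x) + Real.cos ((m+1)*x) = 2 * Real.cos x * Real.cos ((m+2)*x) := by
      rw [show ((m:ℝ)+3)*x = (m+2)*x + x by ring, show ((m:ℝ)+1)*x = (m+2)*x - x by ring,
        Real.cos_add, Real.cos_sub]; ring
    rw [show m+1+2 = m+3 from rfl, show m+1+1 = m+2 from rfl]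
    rw [h2] at ih ⊢
    rw [h1, h2]
    linear_combination ih + 2 * h4 + h3

lemma dker_dir (θ : ℕ → ℝ) (x : ℝ) (n : ℕ) :
    ∑ m ∈ range (n+1), dker θ n m * dir x m = ∏ k ∈ range n, (1 - 2 * θ k * (1 - Real.cos x)) := by
  induction n with
  | zero => simp [dker, dir]
  | succ n ih =>
    rw [show n+1+1 = n+2 from rfl, dker_dual θ (dir x) n, prod_range_succ, ← ih, sum_mul]
    apply sum_congr rfl
    intro m _
    cases m with
    | zero => simp only [opT, dir, sum_range_succ, range_zero, sum_empty, Nat.cast_zero, zero_add, one_mul]; ring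
    | succ m =>
      simp only [opT]; rw [dir_rec]; ring

lemma int_dir (m : ℕ) : ∫ x in (0:ℝ)..Real.pi, dir x m = Real.pi := by
  simp only [dir]
  rw [intervalIntegral.integral_add (by simp) (by
    apply Continuous.intervalIntegrable; fun_prop)]
  rw [intervalIntegral.integral_const_mul, intervalIntegral.integral_finsetSum (by
    intro i _; apply Continuous.intervalIntegrable; fun_prop)]
  have : ∀ r ∈ range m, ∫ x in (0:ℝ)..Real.pi, Real.cos (((r:ℝ)+1) * x) = 0 := by
    intro r _
    rw [intervalIntegral.integral_comp_mul_left (fun x => Real.cos x) (by positivity)]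
    have := Real.sin_nat_mul_pi (r+1)
    push_cast at this
    simp [this]
  rw [sum_congr rfl this]; simp

lemma dker_m0 {θ0 : ℝ} (h0 : 0 < θ0) (θ : ℕ → ℝ) (h1 : ∀ n, θ0 ≤ θ n) (h2 : ∀ n, θ n ≤ 1/4)
    (n : ℕ) (hn : 1 ≤ n) :
    ∑ m ∈ range (n+1), dker θ n m ≤ Real.pi / Real.sqrt (4 * θ0 * n) := by
  have hn' : (1:ℝ) ≤ n := by exact_mod_cast hn
  have key : Real.pi * ∑ m ∈ range (n+1), dker θ n m =
      ∫ x in (0:ℝ)..Real.pi, ∏ k ∈ range n, (1 - 2 * θ k * (1 - Real.cos x)) := by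
    simp_rw [← dker_dir]
    rw [intervalIntegral.integral_finsetSum (by
      intro i _; apply Continuous.intervalIntegrable; unfold dir; fun_prop)]
    simp_rw [intervalIntegral.integral_const_mul, int_dir, ← sum_mul]; ring
  set c := Real.sqrt (4 * θ0 * n) / Real.pi with hc
  have hsq : 0 < Real.sqrt (4 * θ0 * n) := Real.sqrt_pos.mpr (by positivity)
  have hcpos : 0 < c := div_pos hsq Real.pi_pos
  have hc2 : c^2 = 4 * θ0 * n / Real.pi^2 := by
    rw [hc, div_pow, Real.sq_sqrt (by positivity)]
  have bound : ∀ x ∈ Set.Icc (0:ℝ) Real.pi,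
      ∏ k ∈ range n, (1 - 2 * θ k * (1 - Real.cos x)) ≤ (1 + (c*x)^2)⁻¹ := by
    intro x hx
    have hcos := Real.cos_le_one_sub_mul_cos_sq (x := x) (by rw [abs_of_nonneg hx.1]; exact hx.2)
    have hcl := Real.neg_one_le_cos x
    have hcu := Real.cos_le_one x
    have : ∏ k ∈ range n, (1 - 2 * θ k * (1 - Real.cos x)) ≤
        ∏ k ∈ range n, Real.exp (-(4 * θ0 / Real.pi^2 * x^2)) := by
      apply prod_le_prod
      · intro k _
        nlinarith [h1 k, h2 k]
      · intro k _
        have h3 := Real.add_one_le_exp (-(4 * θ0 / Real.pi^2 * x^2))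
        have h4 : 2 * θ0 * (2/Real.pi^2 * x^2) ≤ 2 * θ k * (1 - Real.cos x) := by
          apply mul_le_mul
          · linarith [h1 k]
          · linarith
          · positivity
          · linarith [h1 k]
        have : 2 * θ0 * (2/Real.pi^2 * x^2) = 4 * θ0 / Real.pi^2 * x^2 := by ring
        linarith
    refine this.trans ?_
    rw [prod_const, card_range, ← Real.exp_nat_mul, mul_neg, Real.exp_neg]
    apply inv_anti₀ (by positivity)
    have : (n:ℝ) * (4 * θ0 / Real.pi^2 * x^2) = (c*x)^2 := by rw [mul_pow, hc2]; ring
    rw [this]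
    linarith [Real.add_one_le_exp ((c*x)^2)]
  have hintg : ∫ x in (0:ℝ)..Real.pi, (1 + (c*x)^2)⁻¹ ≤ c⁻¹ * Real.pi := by
    rw [intervalIntegral.integral_comp_mul_left (fun x => (1 + x^2)⁻¹) hcpos.ne', integral_inv_one_add_sq]
    simp only [smul_eq_mul]
    apply mul_le_mul_of_nonneg_left _ (by positivity)
    have := Real.arctan_lt_pi_div_two (c * Real.pi)
    simp
    linarith [Real.pi_pos]
  have h5 : Real.pi * ∑ m ∈ range (n+1), dker θ n m ≤ Real.pi * c⁻¹ := by
    rw [key, mul_comm Real.pi c⁻¹]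
    refine le_trans ?_ hintg
    apply intervalIntegral.integral_mono_on Real.pi_pos.le
    · apply Continuous.intervalIntegrable; fun_prop
    · apply Continuous.intervalIntegrable
      apply Continuous.inv₀ (by fun_prop)
      intro x; positivity
    · exact bound
  have := le_of_mul_le_mul_left h5 Real.pi_pos
  rw [hc, inv_div] at this
  exact this

lemma dker_m2 (θ : ℕ → ℝ) (h1 : ∀ n, 0 ≤ θ n) (h2 : ∀ n, θ n ≤ 1/4)
    (n : ℕ) (hn : 1 ≤ n) :
    ∑ m ∈ range (n+1), dker θ n m * (2*m+1)^2 ≤ 4 * Real.sqrt n := by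
  have hn' : (1:ℝ) ≤ n := by exact_mod_cast hn
  have hs : 1 ≤ Real.sqrt n := Real.one_le_sqrt.mpr hn'
  have hs2 := Real.sq_sqrt (by linarith : (0:ℝ) ≤ n)
  set s := Real.sqrt n with hsdef
  have hth : ∑ k ∈ range n, θ k ≤ n * (1/4) := by
    calc _ ≤ ∑ k ∈ range n, (1/4:ℝ) := sum_le_sum (fun k _ => h2 k)
      _ = _ := by simp
  have h3 := dker_m3 θ n
  have h4 := dker_m1 θ n
  have : ∑ m ∈ range (n+1), dker θ n m * (2*m+1)^2 ≤
      ∑ m ∈ range (n+1), (s/2 * (dker θ n m * (2*m+1)) + (2*s)⁻¹ * (dker θ n m * (2*m+1)^3)) := by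
    apply sum_le_sum
    intro m _
    have hd := dker_nonneg θ h1 h2 n m
    have : (2*(m:ℝ)+1)^2 ≤ s/2 * (2*m+1) + (2*s)⁻¹ * (2*m+1)^3 := by
      have e : s/2 * (2*(m:ℝ)+1) + (2*s)⁻¹ * (2*m+1)^3 - (2*(m:ℝ)+1)^2 =
        (2*m+1) * (2*s)⁻¹ * (s - (2*m+1))^2 := by field_simp; ring
      have : 0 ≤ (2*(m:ℝ)+1) * (2*s)⁻¹ * (s - (2*m+1))^2 := by positivity
      linarith
    nlinarith
  refine this.trans ?_
  rw [sum_add_distrib, ← mul_sum, ← mul_sum, h3, h4]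
  have : (2*s)⁻¹ * (1 + 24 * ∑ k ∈ range n, θ k) ≤ (2*s)⁻¹ * (7 * s^2) := by
    apply mul_le_mul_of_nonneg_left _ (by positivity)
    rw [hs2]; linarith
  have e : (2*s)⁻¹ * (7 * s^2) = 7/2*s := by field_simp
  linarith

end FB

namespace FB
open Finset

noncomputable def lapZ (u : ℤ → ℝ) (y : ℤ) : ℝ := u (y+1) - 2 * u y + u (y-1)

lemma itS_add_steps (θ : ℕ → ℝ) (u : ℤ → ℝ) (n1 n2 : ℕ) :
    itS θ (n1+n2) u = itS (fun k => θ (n1+k)) n2 (itS θ n1 u) := by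
  induction n2 with
  | zero => rfl
  | succ n ih => rw [← add_assoc]; simp only [itS, ih]

lemma itS_diff (θ : ℕ → ℝ) (u : ℤ → ℝ) (n : ℕ) (y : ℤ) :
    itS θ n (fun y => u (y+1) - u y) y = itS θ n u (y+1) - itS θ n u y := by
  induction n generalizing y with
  | zero => rfl
  | succ n ih =>
    simp only [itS, opS, ih]
    rw [show y+1-1 = y by ring, show y-1+1 = y by ring]; ring

lemma itS_add (θ : ℕ → ℝ) (u v : ℤ → ℝ) (n : ℕ) (y : ℤ) :
    itS θ n (fun y => u y + v y) y = itS θ n u y + itS θ n v y := by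
  induction n generalizing y with
  | zero => rfl
  | succ n ih => simp only [itS, opS, ih]; ring

lemma itS_const (θ : ℕ → ℝ) (c : ℝ) (n : ℕ) (y : ℤ) :
    itS θ n (fun _ => c) y = c := by
  induction n generalizing y with
  | zero => rfl
  | succ n ih => simp only [itS, opS, ih]; ring

lemma itS_lap (θ : ℕ → ℝ) (u : ℤ → ℝ) (n : ℕ) (y : ℤ) :
    itS θ n (lapZ u) y = lapZ (itS θ n u) y := by
  induction n generalizing y with
  | zero => rfl
  | succ n ih =>
    simp only [itS, opS, ih]
    simp only [lapZ, opS]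
    rw [show y+1-1 = y by ring, show y-1+1 = y by ring]; ring

lemma itS_bound (θ : ℕ → ℝ) (h0 : ∀ n, 0 ≤ θ n) (h1 : ∀ n, θ n ≤ 1/4) (u : ℤ → ℝ) (Q : ℝ)
    (hu : ∀ y, |u y| ≤ Q) (n : ℕ) (y : ℤ) : |itS θ n u y| ≤ Q := by
  induction n generalizing y with
  | zero => exact hu y
  | succ n ih =>
    simp only [itS, opS]
    have a := abs_le.mp (ih y)
    have b := abs_le.mp (ih (y+1))
    have c := abs_le.mp (ih (y-1))
    have t0 := h0 n
    have t1 := h1 n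
    rw [abs_le]; constructor <;> nlinarith

lemma weight_step {θ0 : ℝ} (h0 : 0 < θ0) (θ : ℕ → ℝ) (h1 : ∀ n, θ0 ≤ θ n) (h2 : ∀ n, θ n ≤ 1/4)
    (n : ℕ) (hn : 1 ≤ n) (s : ℝ) (hs : n ≤ s) (x : ℤ) (A : ℝ) (hA : 0 ≤ A) (u : ℤ → ℝ)
    (hu : ∀ y : ℤ, |u y| ≤ A * (1 + ((y:ℝ) - x)^2 / s)) (y : ℤ) :
    |itS θ n u (y+1) - itS θ n u y| ≤
      ((2 * Real.pi / Real.sqrt θ0 + 8) / Real.sqrt n * A) * (1 + ((y:ℝ) - x)^2 / s) := by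
  have hn' : (1:ℝ) ≤ n := by exact_mod_cast hn
  have hs0 : 0 < s := by linarith
  have hd := dker_nonneg θ (fun n => h0.le.trans (h1 n)) h2 n
  have m0 := dker_m0 h0 θ h1 h2 n hn
  have m2 := dker_m2 θ (fun n => h0.le.trans (h1 n)) h2 n hn
  set W := 1 + ((y:ℝ) - x)^2 / s with hW
  have hW1 : 1 ≤ W := by rw [hW]; have : 0 ≤ ((y:ℝ) - x)^2 / s := by positivity
                         linarith
  rw [dker_repr]
  have hterm : ∀ m ∈ range (n+1), |dker θ n m * (u (y+m+1) - u (y-m))| ≤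
      4 * A * W * dker θ n m + 2 * A / s * (dker θ n m * (2*m+1)^2) := by
    intro m _
    rw [abs_mul, abs_of_nonneg (hd m)]
    have e1 := hu (y+m+1)
    have e2 := hu (y-m)
    have e3 : |u (y+m+1) - u (y-m)| ≤ |u (y+m+1)| + |u (y-m)| := abs_sub _ _
    have e4 : A * (1 + (((y+m+1:ℤ):ℝ) - x)^2 / s) + A * (1 + (((y-m:ℤ):ℝ) - x)^2 / s) ≤
        4 * A * W + 2 * A / s * (2*m+1)^2 := by
      rw [hW]
      have : 4 * A * (1 + ((y:ℝ) - x)^2 / s) + 2 * A / s * (2*m+1)^2 -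
        (A * (1 + (((y+m+1:ℤ):ℝ) - x)^2 / s) + A * (1 + (((y-m:ℤ):ℝ) - x)^2 / s)) =
        2 * A + A / s * (4 * ((y:ℝ)-x)^2 + 2 * (2*m+1)^2 - ((y:ℝ)+m+1-x)^2 - ((y:ℝ)-m-x)^2) := by
        push_cast; field_simp; ring
      have h5 : 0 ≤ 4 * ((y:ℝ)-x)^2 + 2 * (2*m+1)^2 - ((y:ℝ)+m+1-x)^2 - ((y:ℝ)-m-x)^2 := by
        have hm : (0:ℝ) ≤ m := by positivity
        nlinarith [sq_nonneg ((y:ℝ)-x-(m+1)), sq_nonneg ((y:ℝ)-x+m)]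
      have h6 : 0 ≤ A / s * (4 * ((y:ℝ)-x)^2 + 2 * (2*m+1)^2 - ((y:ℝ)+m+1-x)^2 - ((y:ℝ)-m-x)^2) :=
        mul_nonneg (by positivity) h5
      linarith
    have : dker θ n m * |u (y+m+1) - u (y-m)| ≤ dker θ n m * (4 * A * W + 2 * A / s * (2*m+1)^2) :=
      mul_le_mul_of_nonneg_left (by linarith) (hd m)
    refine this.trans (le_of_eq ?_); ring
  refine (abs_sum_le_sum_abs _ _).trans ((sum_le_sum hterm).trans ?_)
  rw [sum_add_distrib, ← mul_sum, ← mul_sum]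
  set r := Real.sqrt n with hr
  have hr1 : 1 ≤ r := Real.one_le_sqrt.mpr hn'
  have hr2 : r^2 = n := Real.sq_sqrt (by linarith)
  have hq : 0 < Real.sqrt θ0 := Real.sqrt_pos.mpr h0
  have e5 : Real.sqrt (4 * θ0 * n) = 2 * Real.sqrt θ0 * r := by
    rw [Real.sqrt_mul (by positivity), Real.sqrt_mul (by norm_num), show (4:ℝ) = 2^2 by norm_num,
      Real.sqrt_sq (by norm_num)]
  rw [e5] at m0
  have t1 : 4 * A * W * ∑ m ∈ range (n+1), dker θ n m ≤ 4 * A * W * (Real.pi / (2 * Real.sqrt θ0 * r)) :=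
    mul_le_mul_of_nonneg_left m0 (by positivity)
  have t2 : 2 * A / s * ∑ m ∈ range (n+1), dker θ n m * (2*m+1)^2 ≤ 2 * A / s * (4 * r) :=
    mul_le_mul_of_nonneg_left m2 (by positivity)
  have t3 : 2 * A / s * (4 * r) ≤ 8 / r * A * W := by
    have : r / s ≤ 1 / r := by
      rw [div_le_div_iff₀ hs0 (by linarith)]; nlinarith
    calc 2 * A / s * (4 * r) = 8 * A * (r / s) := by ring
      _ ≤ 8 * A * (1 / r) := mul_le_mul_of_nonneg_left this (by positivity)
      _ = 8 / r * A * 1 := by ring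
      _ ≤ _ := mul_le_mul_of_nonneg_left hW1 (by positivity)
  have t4 : 4 * A * W * (Real.pi / (2 * Real.sqrt θ0 * r)) = (2 * Real.pi / Real.sqrt θ0) / r * A * W := by
    field_simp; ring
  have : (2 * Real.pi / Real.sqrt θ0 + 8) / r * A * W = (2 * Real.pi / Real.sqrt θ0) / r * A * W + 8 / r * A * W := by
    ring
  rw [this]; linarith

noncomputable def kC (θ0 : ℝ) : ℝ := 12 * (2 * Real.pi / Real.sqrt θ0 + 8)^2

lemma kC_pos {θ0 : ℝ} (h0 : 0 < θ0) : 0 < kC θ0 := by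
  have := Real.pi_pos
  unfold kC; positivity

lemma kC_ge {θ0 : ℝ} (h0 : 0 < θ0) : 20 ≤ kC θ0 := by
  have : 0 ≤ 2 * Real.pi / Real.sqrt θ0 := by have := Real.pi_pos; positivity
  unfold kC; nlinarith

lemma lap_itS_weight {θ0 : ℝ} (h0 : 0 < θ0) (θ : ℕ → ℝ) (h1 : ∀ n, θ0 ≤ θ n) (h2 : ∀ n, θ n ≤ 1/4)
    (n : ℕ) (x : ℤ) (A : ℝ) (hA : 0 ≤ A) (u : ℤ → ℝ)
    (hu : ∀ y : ℤ, |u y| ≤ A * (1 + ((y:ℝ) - x)^2 / (n+1))) :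
    |lapZ (itS θ n u) x| ≤ kC θ0 * A / (n+1) := by
  have hk := kC_ge h0
  rcases Nat.lt_or_ge n 2 with hlt | hge
  · have hx := hu x
    have hx1 := hu (x+1)
    have hx2 := hu (x-1)
    have hx3 := hu (x+1+1)
    have hx4 := hu (x-1-1)
    push_cast at hx hx1 hx2 hx3 hx4
    ring_nf at hx hx1 hx2 hx3 hx4
    rw [show (2:ℤ)+x = x+1+1 by ring] at hx3
    rw [show (1:ℤ)+x = x+1 by ring] at hx1
    rw [show -(2:ℤ)+x = x-1-1 by ring] at hx4
    rw [show -(1:ℤ)+x = x-1 by ring] at hx2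
    interval_cases n
    · simp only [itS, lapZ]
      norm_num at hx hx1 hx2 hx3 hx4 ⊢
      rw [abs_le] at *
      constructor <;> nlinarith
    · have a := h0.le.trans (h1 0)
      have b := h2 0
      simp only [itS, lapZ, opS]
      rw [show x+1-1 = x by ring, show x-1+1 = x by ring]
      norm_num at hx hx1 hx2 hx3 hx4 ⊢
      have e : (1 - 2 * θ 0) * u (x+1) + θ 0 * (u (x+1+1) + u x) -
        2 * ((1 - 2 * θ 0) * u x + θ 0 * (u (x+1) + u (x-1))) +
        ((1 - 2 * θ 0) * u (x-1) + θ 0 * (u x + u (x-1-1))) =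
        (1 - 4 * θ 0) * (u (x+1) + u (x-1)) - (2 - 6 * θ 0) * u x +
          θ 0 * (u (x+1+1) + u (x-1-1)) := by ring
      rw [e]
      rw [abs_le] at *
      constructor <;> nlinarith
  · obtain ⟨n1, n2, hn, g1, g2, g3, g4⟩ : ∃ n1 n2 : ℕ, n = n1 + n2 ∧ 1 ≤ n1 ∧ 1 ≤ n2 ∧
        n + 1 ≤ 6 * n1 ∧ n + 1 ≤ 6 * n2 :=
      ⟨n/2, n - n/2, by omega, by omega, by omega, by omega, by omega⟩
    have hs1 : (n1:ℝ) ≤ (n:ℝ)+1 := by rw [hn]; push_cast; linarith [Nat.cast_nonneg (α := ℝ) n2]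
    have hs2 : (n2:ℝ) ≤ (n:ℝ)+1 := by rw [hn]; push_cast; linarith [Nat.cast_nonneg (α := ℝ) n1]
    have st1 := weight_step h0 θ h1 h2 n1 g1 _ hs1 x A hA u hu
    set c := (2 * Real.pi / Real.sqrt θ0 + 8) with hc
    have hcpos : 0 < c := by have := Real.pi_pos; positivity
    have st2 := weight_step h0 (fun k => θ (n1+k)) (fun k => h1 _) (fun k => h2 _) n2 g2 _ hs2 x
      (c / Real.sqrt n1 * A) (by positivity) (fun y => itS θ n1 u (y+1) - itS θ n1 u y) st1 (x-1)
    rw [itS_diff, itS_diff, ← itS_add_steps, ← hn] at st2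
    rw [show x-1+1 = x by ring] at st2
    have e1 : lapZ (itS θ n u) x = itS θ n u (x+1) - itS θ n u x - (itS θ n u x - itS θ n u (x-1)) := by
      unfold lapZ; ring
    rw [e1]
    refine st2.trans ?_
    have hw : 1 + (((x-1:ℤ):ℝ) - x)^2 / ((n:ℝ)+1) ≤ 2 := by
      push_cast
      have : ((x:ℝ) - 1 - x)^2 / ((n:ℝ)+1) ≤ 1 := by
        rw [div_le_one (by positivity)]
        have : (0:ℝ) ≤ n := by positivity
        nlinarith
      linarith
    have p1 : (0:ℝ) < n1 := by exact_mod_cast g1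
    have p2 : (0:ℝ) < n2 := by exact_mod_cast g2
    have hsq : ((n:ℝ)+1)/6 ≤ Real.sqrt n1 * Real.sqrt n2 := by
      rw [← Real.sqrt_mul p1.le]
      apply Real.le_sqrt_of_sq_le
      have q1 : ((n:ℝ)+1) ≤ 6 * n1 := by exact_mod_cast g3
      have q2 : ((n:ℝ)+1) ≤ 6 * n2 := by exact_mod_cast g4
      have : (0:ℝ) ≤ n := by positivity
      nlinarith
    have hinv : (Real.sqrt n1 * Real.sqrt n2)⁻¹ ≤ 6 / ((n:ℝ)+1) := by
      rw [show 6 / ((n:ℝ)+1) = (((n:ℝ)+1)/6)⁻¹ by rw [inv_div]]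
      exact inv_anti₀ (by positivity) hsq
    calc c / Real.sqrt n2 * (c / Real.sqrt n1 * A) * (1 + (((x-1:ℤ):ℝ) - x)^2 / ((n:ℝ)+1))
        ≤ c / Real.sqrt n2 * (c / Real.sqrt n1 * A) * 2 := mul_le_mul_of_nonneg_left hw (by positivity)
      _ = 2 * c^2 * A * (Real.sqrt n1 * Real.sqrt n2)⁻¹ := by rw [mul_inv]; ring
      _ ≤ 2 * c^2 * A * (6 / ((n:ℝ)+1)) := mul_le_mul_of_nonneg_left hinv (by positivity)
      _ = kC θ0 * A / (n+1) := by unfold kC; rw [← hc]; ring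

lemma rpow_weight {β : ℝ} (hβ0 : 0 < β) (hβ : β ≤ 1) (j : ℝ) (n : ℕ) :
    |j| ^ β ≤ ((n:ℝ)+1)^(β/2) * (1 + j^2 / (n+1)) := by
  have hn : (0:ℝ) < n + 1 := by positivity
  have e : |j| ^ β = ((n:ℝ)+1)^(β/2) * (j^2/(n+1))^(β/2) := by
    rw [← Real.mul_rpow hn.le (by positivity), mul_div_cancel₀ _ hn.ne', ← sq_abs,
      ← Real.rpow_natCast, ← Real.rpow_mul (abs_nonneg _)]
    congr 1; push_cast; ring
  rw [e]
  apply mul_le_mul_of_nonneg_left _ (by positivity)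
  have hr : 0 ≤ j^2/((n:ℝ)+1) := by positivity
  set r := j^2/((n:ℝ)+1)
  rcases le_total r 1 with h | h
  · have := Real.rpow_le_one hr h (by positivity : 0 ≤ β/2)
    linarith
  · have := Real.rpow_le_rpow_of_exponent_le h (by linarith : β/2 ≤ 1)
    rw [Real.rpow_one] at this
    linarith

lemma lap_itS_holder {θ0 : ℝ} (h0 : 0 < θ0) (θ : ℕ → ℝ) (h1 : ∀ n, θ0 ≤ θ n) (h2 : ∀ n, θ n ≤ 1/4)
    {β : ℝ} (hβ0 : 0 < β) (hβ : β ≤ 1)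
    (n : ℕ) (x : ℤ) (H : ℝ) (hH : 0 ≤ H) (u : ℤ → ℝ)
    (hu : ∀ y : ℤ, |u y| ≤ H * |(y:ℝ) - x| ^ β) :
    |lapZ (itS θ n u) x| ≤ kC θ0 * H * ((n:ℝ)+1)^(β/2-1) := by
  have hn : (0:ℝ) < n + 1 := by positivity
  have := lap_itS_weight h0 θ h1 h2 n x (H * ((n:ℝ)+1)^(β/2)) (by positivity) u (by
    intro y
    refine (hu y).trans ?_
    have := mul_le_mul_of_nonneg_left (rpow_weight hβ0 hβ ((y:ℝ)-x) n) hH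
    linarith)
  refine this.trans (le_of_eq ?_)
  rw [Real.rpow_sub_one hn.ne']; ring

lemma lap_itS_sup {θ0 : ℝ} (h0 : 0 < θ0) (θ : ℕ → ℝ) (h1 : ∀ n, θ0 ≤ θ n) (h2 : ∀ n, θ n ≤ 1/4)
    (n : ℕ) (x : ℤ) (B : ℝ) (hB : 0 ≤ B) (u : ℤ → ℝ) (hu : ∀ y : ℤ, |u y| ≤ B) :
    |lapZ (itS θ n u) x| ≤ kC θ0 * B / (n+1) := by
  apply lap_itS_weight h0 θ h1 h2 n x B hB u
  intro y
  refine (hu y).trans ?_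
  have : 0 ≤ B * (((y:ℝ) - x)^2 / (n+1)) := by positivity
  linarith

lemma sum_rpow_le {β : ℝ} (hβ0 : 0 < β) (hβ : β ≤ 1) (m : ℕ) :
    ∑ r ∈ range m, ((r:ℝ)+1)^(β/2-1) ≤ 2/β * (m:ℝ)^(β/2) := by
  induction m with
  | zero => simp; positivity
  | succ m ih =>
    rw [sum_range_succ]
    have hm : (0:ℝ) < m + 1 := by positivity
    have hb := rpow_one_add_le_one_add_mul_self (s := -1/((m:ℝ)+1)) (p := β/2)
      (by rw [le_div_iff₀ hm]; have : (0:ℝ) ≤ m := by positivity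
          linarith) (by positivity) (by linarith)
    have e1 : (m:ℝ)^(β/2) = ((m:ℝ)+1)^(β/2) * (1 + -1/((m:ℝ)+1))^(β/2) := by
      rw [← Real.mul_rpow hm.le]
      · congr 1; field_simp; ring
      · have : 1 + -1/((m:ℝ)+1) = m/(m+1) := by field_simp; ring
        rw [this]; positivity
    have e2 : (m:ℝ)^(β/2) ≤ ((m:ℝ)+1)^(β/2) - β/2 * ((m:ℝ)+1)^(β/2-1) := by
      rw [e1]
      refine (mul_le_mul_of_nonneg_left hb (by positivity)).trans (le_of_eq ?_)
      rw [Real.rpow_sub_one hm.ne']; field_simp; ring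
    have e3 := mul_le_mul_of_nonneg_left e2 (by positivity : 0 ≤ 2/β)
    have e4 : 2/β * (((m:ℝ)+1)^(β/2) - β/2 * ((m:ℝ)+1)^(β/2-1)) =
       2/β * ((m:ℝ)+1)^(β/2) - ((m:ℝ)+1)^(β/2-1) := by field_simp
    push_cast
    linarith

lemma duhamel (θ : ℕ → ℝ) (U E : ℕ → ℤ → ℝ) (m : ℕ)
    (hU : ∀ l < m, ∀ y, U (l+1) y = opS (θ l) (U l) y + E l y) (y : ℤ) :
    U m y = itS θ m (U 0) y +
      ∑ l ∈ range m, itS (fun k => θ (l+1+k)) (m-1-l) (E l) y := by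
  induction m generalizing y with
  | zero => simp [itS]
  | succ m ih =>
    have ih' := ih (fun l hl => hU l (by omega))
    rw [hU m (by omega), sum_range_succ]
    have e : ∀ l ∈ range m, itS (fun k => θ (l+1+k)) (m+1-1-l) (E l) y =
        opS (θ m) (itS (fun k => θ (l+1+k)) (m-1-l) (E l)) y := by
      intro l hl
      rw [Finset.mem_range] at hl
      obtain ⟨k, rfl⟩ : ∃ k, m = l + 1 + k := ⟨m - (l+1), by omega⟩
      rw [show l+1+k+1-1-l = k+1 by omega, show l+1+k-1-l = k by omega]
      rfl
    rw [sum_congr rfl e]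
    simp only [itS, opS]
    rw [ih', ih', ih']
    simp only [sum_add_distrib, ← mul_sum]
    rw [show m+1-1-m = 0 by omega]
    simp only [itS]
    ring

lemma kernel_main {θ0 : ℝ} (h0 : 0 < θ0) (θ : ℕ → ℝ) (h1 : ∀ n, θ0 ≤ θ n) (h2 : ∀ n, θ n ≤ 1/4)
    {β : ℝ} (hβ0 : 0 < β) (hβ : β ≤ 1) (U E : ℕ → ℤ → ℝ) (m : ℕ)
    (hU : ∀ l < m, ∀ y, U (l+1) y = opS (θ l) (U l) y + E l y)
    (x : ℤ) (e : ℕ → ℝ) (H : ℝ) (hH : 0 ≤ H)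
    (hE : ∀ l < m, ∀ y : ℤ, |E l y - e l| ≤ H * |(y:ℝ) - x| ^ β)
    (Y Z : ℤ → ℝ) (hYZ : ∀ y, U 0 y = Y y + Z y) (B Q : ℝ) (hB : 0 ≤ B)
    (hY : ∀ y, |Y y| ≤ B) (hZ : ∀ y, |lapZ Z y| ≤ Q) :
    |lapZ (U m) x| ≤ Q + kC θ0 * B / (m+1) + kC θ0 * H * (2/β * (m:ℝ)^(β/2)) := by
  have hd := duhamel θ U E m hU
  have hU0 : U 0 = fun y => Y y + Z y := funext hYZ
  have elap : lapZ (U m) x = lapZ (itS θ m Y) x + lapZ (itS θ m Z) x +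
      ∑ l ∈ range m, lapZ (itS (fun k => θ (l+1+k)) (m-1-l) (fun y => E l y - e l)) x := by
    have e1 : ∀ l y, itS (fun k => θ (l+1+k)) (m-1-l) (E l) y =
        itS (fun k => θ (l+1+k)) (m-1-l) (fun y => E l y - e l) y + e l := by
      intro l y
      have := itS_add (fun k => θ (l+1+k)) (fun y => E l y - e l) (fun _ => e l) (m-1-l) y
      simp only [sub_add_cancel, itS_const] at this
      exact this
    unfold lapZ
    rw [hd, hd, hd, hU0]
    simp only [itS_add, e1, sum_add_distrib, sum_sub_distrib, ← mul_sum]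
    ring
  rw [elap]
  have b1 := lap_itS_sup h0 θ h1 h2 m x B hB Y hY
  have b2 : |lapZ (itS θ m Z) x| ≤ Q := by
    rw [← itS_lap]
    exact itS_bound θ (fun n => h0.le.trans (h1 n)) h2 _ Q hZ m x
  have b3 : |∑ l ∈ range m, lapZ (itS (fun k => θ (l+1+k)) (m-1-l) (fun y => E l y - e l)) x| ≤
      kC θ0 * H * (2/β * (m:ℝ)^(β/2)) := by
    refine (abs_sum_le_sum_abs _ _).trans ?_
    have : ∀ l ∈ range m, |lapZ (itS (fun k => θ (l+1+k)) (m-1-l) (fun y => E l y - e l)) x| ≤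
        kC θ0 * H * (((m-1-l:ℕ):ℝ)+1)^(β/2-1) := by
      intro l hl
      exact lap_itS_holder h0 _ (fun k => h1 _) (fun k => h2 _) hβ0 hβ _ x H hH _ (hE l (mem_range.mp hl))
    refine (sum_le_sum this).trans ?_
    rw [← mul_sum]
    apply mul_le_mul_of_nonneg_left _ (mul_nonneg (kC_pos h0).le hH)
    rw [sum_range_reflect (fun r => ((r:ℝ)+1)^(β/2-1))]
    exact sum_rpow_le hβ0 hβ m
  calc _ ≤ |lapZ (itS θ m Y) x + lapZ (itS θ m Z) x| + _ := abs_add_le _ _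
    _ ≤ |lapZ (itS θ m Y) x| + |lapZ (itS θ m Z) x| + _ := by gcongr; exact abs_add_le _ _
    _ ≤ _ := by linarith

end FB

namespace FB
open Finset

noncomputable def grad (N : ℕ) (v : ℕ → ℝ) (j : ℕ) : ℝ := (v (min j (N-1)) - v (j-1)) * N

noncomputable def lap (N : ℕ) (v : ℕ → ℝ) (j : ℕ) : ℝ := (grad N v (j+1) - grad N v j) * N

noncomputable def dv (v : ℕ → ℝ) (j : ℕ) : ℝ := v j - v (j-1)

lemma grad_zero (N : ℕ) (v : ℕ → ℝ) : grad N v 0 = 0 := by simp [grad]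
lemma grad_top (N : ℕ) (v : ℕ → ℝ) : grad N v N = 0 := by simp [grad]
lemma grad_lt {N j : ℕ} (h : j < N) (v : ℕ → ℝ) : grad N v j = dv v j * N := by
  simp only [grad, dv]; rw [min_eq_left (by omega)]

lemma sbp (F e : ℕ → ℝ) (n : ℕ) : ∑ j ∈ range n, (F (j+1) - F j) * e j =
    F n * e (n-1) - F 0 * e 0 - ∑ j ∈ range n, F j * (e j - e (j-1)) := by
  induction n with
  | zero => simp
  | succ n ih => rw [sum_range_succ, ih, sum_range_succ, Nat.add_sub_cancel]; ring

lemma sbp0 (F e : ℕ → ℝ) (n : ℕ) (h0 : F 0 = 0) (hn : F n = 0) :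
    ∑ j ∈ range n, (F (j+1) - F j) * e j = - ∑ j ∈ range n, F j * dv e j := by
  rw [sbp, h0, hn]; simp [dv]

lemma sum_shift (F : ℕ → ℝ) (n : ℕ) (h : F 0 = F n) :
    ∑ j ∈ range n, F (j+1) = ∑ j ∈ range n, F j := by
  have h1 := sum_range_succ' F n
  have h2 := sum_range_succ F n
  linarith

/-- one explicit step of a divergence form scheme; `α` are edge coefficients. -/
noncomputable def stepD (N : ℕ) (μ : ℝ) (α v : ℕ → ℝ) (j : ℕ) : ℝ :=
  v j + μ * (α (j+1) * (v (min (j+1) (N-1)) - v j) - α j * (v j - v (j-1)))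

lemma stepD_sup {N : ℕ} {μ lam Lam : ℝ} (hμ : 0 ≤ μ) (hl : 0 ≤ lam) (hμL : 4 * μ * Lam ≤ 1)
    (α v : ℕ → ℝ) (ha : ∀ j, lam ≤ α j) (hb : ∀ j, α j ≤ Lam) (Q : ℝ) (hv : ∀ j < N, |v j| ≤ Q)
    (j : ℕ) (hj : j < N) : |stepD N μ α v j| ≤ Q := by
  unfold stepD
  have a0 := abs_le.mp (hv j hj)
  have a1 := abs_le.mp (hv (min (j+1) (N-1)) (by omega))
  have a2 := abs_le.mp (hv (j-1) (by omega))
  have b0 : 0 ≤ μ * α j := mul_nonneg hμ (hl.trans (ha j))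
  have b1 : 0 ≤ μ * α (j+1) := mul_nonneg hμ (hl.trans (ha _))
  have c0 : μ * α j ≤ 1/4 := by nlinarith [mul_le_mul_of_nonneg_left (hb j) hμ]
  have c1 : μ * α (j+1) ≤ 1/4 := by nlinarith [mul_le_mul_of_nonneg_left (hb (j+1)) hμ]
  set x := μ * α j
  set y := μ * α (j+1)
  have e : v j + μ * (α (j+1) * (v (min (j+1) (N-1)) - v j) - α j * (v j - v (j-1))) =
    (1 - x - y) * v j + y * v (min (j+1) (N-1)) + x * v (j-1) := by simp only [x, y]; ring
  rw [e, abs_le]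
  constructor <;> nlinarith

lemma sum_dv_sq_le {N : ℕ} (v : ℕ → ℝ) : ∑ j ∈ range N, (dv v j)^2 ≤ 4 * ∑ j ∈ range N, (v j)^2 := by
  have h : ∀ j ∈ range N, (dv v j)^2 ≤ 2 * (if j = 0 then 0 else (v (j-1))^2) + 2 * (v j)^2 := by
    intro j _
    split_ifs with h
    · subst h; simp [dv]; positivity
    · unfold dv; nlinarith [sq_nonneg (v j + v (j-1))]
  refine (sum_le_sum h).trans ?_
  rw [sum_add_distrib, ← mul_sum, ← mul_sum]
  have : ∑ j ∈ range N, (if j = 0 then 0 else (v (j-1))^2) ≤ ∑ j ∈ range N, (v j)^2 := by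
    cases N with
    | zero => simp
    | succ n =>
      rw [sum_range_succ', sum_range_succ (fun j => (v j)^2)]
      simp
      positivity
  linarith

lemma stepD_l2 {N : ℕ} {μ lam Lam : ℝ} (hμ : 0 ≤ μ) (hl : 0 ≤ lam) (hμL : 4 * μ * Lam ≤ 1)
    (α v : ℕ → ℝ) (ha : ∀ j, lam ≤ α j) (hb : ∀ j, α j ≤ Lam) :
    ∑ j ∈ range N, (stepD N μ α v j)^2 + μ * lam * ∑ j ∈ range N, (dv v j)^2 ≤
      ∑ j ∈ range N, (v j)^2 := by
  set F : ℕ → ℝ := fun j => α j * (v (min j (N-1)) - v (j-1)) with hF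
  have F0 : F 0 = 0 := by simp [hF]
  have FN : F N = 0 := by simp [hF]
  have hFj : ∀ j ∈ range N, F j = α j * dv v j := by
    intro j hj
    rw [Finset.mem_range] at hj
    simp only [hF, dv]; rw [min_eq_left (by omega)]
  have e1 : ∀ j ∈ range N, stepD N μ α v j = v j + μ * (F (j+1) - F j) := by
    intro j hj
    rw [hFj j hj]
    simp only [stepD, hF, dv, Nat.add_sub_cancel]
  have e2 : ∑ j ∈ range N, (stepD N μ α v j)^2 = ∑ j ∈ range N, (v j)^2 +
      2 * μ * ∑ j ∈ range N, (F (j+1) - F j) * v j + μ^2 * ∑ j ∈ range N, (F (j+1) - F j)^2 := by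
    rw [mul_sum, mul_sum, ← sum_add_distrib, ← sum_add_distrib]
    apply sum_congr rfl
    intro j hj; rw [e1 j hj]; ring
  have e3 : ∑ j ∈ range N, (F (j+1) - F j)^2 ≤ 4 * ∑ j ∈ range N, (F j)^2 := by
    have : ∀ j ∈ range N, (F (j+1) - F j)^2 ≤ 2 * (F (j+1))^2 + 2 * (F j)^2 := by
      intro j _; nlinarith [sq_nonneg (F (j+1) + F j)]
    refine (sum_le_sum this).trans ?_
    rw [sum_add_distrib, ← mul_sum, ← mul_sum, sum_shift (fun j => (F j)^2) N (by simp [F0, FN])]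
    linarith
  rw [e2, sbp0 F v N F0 FN]
  have e4 : μ^2 * ∑ j ∈ range N, (F (j+1) - F j)^2 ≤ μ * ∑ j ∈ range N, α j * (dv v j)^2 := by
    calc _ ≤ μ^2 * (4 * ∑ j ∈ range N, (F j)^2) := mul_le_mul_of_nonneg_left e3 (by positivity)
      _ = ∑ j ∈ range N, μ * (4 * μ * α j) * (α j * (dv v j)^2) := by
        rw [mul_sum, mul_sum]; apply sum_congr rfl; intro j hj; rw [hFj j hj]; ring
      _ ≤ ∑ j ∈ range N, μ * 1 * (α j * (dv v j)^2) := by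
        apply sum_le_sum; intro j _
        have := mul_le_mul_of_nonneg_left (hb j) hμ
        have h3 : 0 ≤ α j * (dv v j)^2 := mul_nonneg (hl.trans (ha j)) (sq_nonneg _)
        exact mul_le_mul_of_nonneg_right (mul_le_mul_of_nonneg_left (by linarith) hμ) h3
      _ = _ := by rw [mul_sum]; simp
  have e5 : ∑ j ∈ range N, F j * dv v j = ∑ j ∈ range N, α j * (dv v j)^2 := by
    apply sum_congr rfl; intro j hj; rw [hFj j hj]; ring
  have e6 : lam * ∑ j ∈ range N, (dv v j)^2 ≤ ∑ j ∈ range N, α j * (dv v j)^2 := by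
    rw [mul_sum]; apply sum_le_sum; intro j _
    exact mul_le_mul_of_nonneg_right (ha j) (sq_nonneg _)
  rw [e5]
  have := mul_le_mul_of_nonneg_left e6 hμ
  nlinarith

lemma sup_sq_le {N : ℕ} (hN : 1 ≤ N) (q : ℕ → ℝ) (η : ℝ) (hη : 0 < η) (j : ℕ) (hj : j < N) :
    (q j)^2 ≤ (1/N) * ∑ i ∈ range N, (q i)^2 + η / 2 * ∑ i ∈ range N, (dv q i)^2 +
      3 / η * ∑ i ∈ range N, (q i)^2 := by
  have hN' : (0:ℝ) < N := by exact_mod_cast hN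
  set V := ∑ i ∈ range N, |dv (fun i => (q i)^2) i| with hV
  have tele : ∀ i < N, ∀ k, i + k < N → |(q (i+k))^2 - (q i)^2| ≤
      ∑ e ∈ Ico (i+1) (i+k+1), |dv (fun i => (q i)^2) e| := by
    intro i hi k
    induction k with
    | zero => intro _; simp
    | succ k ih =>
      intro hk
      rw [show i+(k+1)+1 = (i+k+1)+1 by ring, sum_Ico_succ_top (by omega)]
      have := ih (by omega)
      have e : (q (i+(k+1)))^2 - (q i)^2 = ((q (i+k))^2 - (q i)^2) + dv (fun i => (q i)^2) (i+k+1) := by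
        simp only [dv]; rw [show i+k+1-1 = i+k by omega, show i+(k+1) = i+k+1 by ring]; ring
      rw [e]
      exact (abs_add_le _ _).trans (by linarith)
  have sub : ∀ a b, b ≤ N → ∑ e ∈ Ico a b, |dv (fun i => (q i)^2) e| ≤ V := by
    intro a b hb
    apply sum_le_sum_of_subset_of_nonneg
    · intro e he; rw [Finset.mem_Ico] at he; rw [Finset.mem_range]; omega
    · intro _ _ _; exact abs_nonneg _
  have osc : ∀ i < N, (q j)^2 ≤ (q i)^2 + V := by
    intro i hi
    rcases le_total i j with h | h
    · obtain ⟨k, rfl⟩ := Nat.exists_eq_add_of_le h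
      have := (abs_le.mp ((tele i hi k hj).trans (sub _ _ (by omega)))).2
      linarith
    · obtain ⟨k, rfl⟩ := Nat.exists_eq_add_of_le h
      have := (abs_le.mp ((tele j hj k hi).trans (sub _ _ (by omega)))).1
      linarith
  have avg : (q j)^2 ≤ (1/N) * ∑ i ∈ range N, (q i)^2 + V := by
    have : ∑ i ∈ range N, (q j)^2 ≤ ∑ i ∈ range N, ((q i)^2 + V) :=
      sum_le_sum (fun i hi => osc i (mem_range.mp hi))
    rw [sum_add_distrib, sum_const, sum_const, card_range, nsmul_eq_mul, nsmul_eq_mul] at this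
    have h2 : (q j)^2 = (1/N) * (N * (q j)^2) := by field_simp
    rw [h2]
    calc _ ≤ (1/(N:ℝ)) * (∑ i ∈ range N, (q i)^2 + N * V) := mul_le_mul_of_nonneg_left this (by positivity)
      _ = _ := by field_simp
  have hVb : V ≤ η / 2 * ∑ i ∈ range N, (dv q i)^2 + 3 / η * ∑ i ∈ range N, (q i)^2 := by
    have h1 : ∀ i ∈ range N, |dv (fun i => (q i)^2) i| ≤ η / 2 * (dv q i)^2 +
        1/η * ((q i)^2 + (if i = 0 then 0 else (q (i-1))^2)) := by
      intro i _
      split_ifs with h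
      · subst h; simp [dv]; positivity
      · have e : dv (fun i => (q i)^2) i = dv q i * (q i + q (i-1)) := by simp only [dv]; ring
        rw [e, abs_mul]
        have h3 : η / 2 * (dv q i)^2 + 1/η * ((q i)^2 + (q (i-1))^2) - |dv q i| * |q i + q (i-1)| =
          1/(2*η) * ((η * |dv q i| - |q i + q (i-1)|)^2 + (q i - q (i-1))^2) := by
          rw [← sq_abs (dv q i)]
          have : |q i + q (i-1)|^2 = (q i + q (i-1))^2 := sq_abs _
          field_simp
          nlinarith
        have : 0 ≤ 1/(2*η) * ((η * |dv q i| - |q i + q (i-1)|)^2 + (q i - q (i-1))^2) := by positivity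
        linarith
    refine (sum_le_sum h1).trans ?_
    rw [sum_add_distrib, ← mul_sum, ← mul_sum, sum_add_distrib]
    have : ∑ j ∈ range N, (if j = 0 then 0 else (q (j-1))^2) ≤ ∑ j ∈ range N, (q j)^2 := by
      cases N with
      | zero => simp
      | succ n =>
        rw [sum_range_succ', sum_range_succ (fun j => (q j)^2)]
        simp
        positivity
    have h5 : 0 ≤ ∑ j ∈ range N, (q j)^2 := sum_nonneg (fun _ _ => sq_nonneg _)
    have h4 : 1/η * (∑ i ∈ range N, (q i)^2 + ∑ i ∈ range N, (if i = 0 then 0 else (q (i-1))^2)) ≤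
       1/η * (3 * ∑ i ∈ range N, (q i)^2) := mul_le_mul_of_nonneg_left (by linarith) (by positivity)
    have : 1/η * (3 * ∑ i ∈ range N, (q i)^2) = 3 / η * ∑ i ∈ range N, (q i)^2 := by ring
    linarith
  linarith

/-- a smooth uniformly monotone flux -/
structure Flux (lam Lam Hs α : ℝ) (S S' : ℝ → ℝ) : Prop where
  lam_pos : 0 < lam
  α_pos : 0 < α
  α_le : α ≤ 1
  Hs_nonneg : 0 ≤ Hs
  deriv : ∀ s, HasDerivAt S (S' s) s
  lb : ∀ s, lam ≤ S' s
  ub : ∀ s, S' s ≤ Lam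
  holder : ∀ s t, |S' s - S' t| ≤ Hs * |s - t| ^ α

lemma Flux.lam_le {lam Lam Hs α : ℝ} {S S' : ℝ → ℝ} (h : Flux lam Lam Hs α S S') : lam ≤ Lam :=
  (h.lb 0).trans (h.ub 0)

/-- mean value -/
lemma Flux.mvt {lam Lam Hs α : ℝ} {S S' : ℝ → ℝ} (h : Flux lam Lam Hs α S S') (x y : ℝ) :
    ∃ ξ ∈ Set.uIcc x y, S y - S x = S' ξ * (y - x) := by
  have key : ∀ a b, a < b → ∃ ξ ∈ Set.Icc a b, S b - S a = S' ξ * (b - a) := by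
    intro a b hab
    obtain ⟨c, hc, he⟩ := exists_hasDerivAt_eq_slope S S' hab
      (fun x _ => (h.deriv x).continuousAt.continuousWithinAt) (fun x _ => h.deriv x)
    refine ⟨c, ⟨hc.1.le, hc.2.le⟩, ?_⟩
    rw [he]; field_simp [sub_ne_zero.mpr hab.ne']
  rcases lt_trichotomy x y with hxy | hxy | hxy
  · obtain ⟨c, hc, he⟩ := key x y hxy
    exact ⟨c, by rwa [Set.uIcc_of_le hxy.le], he⟩
  · subst hxy; exact ⟨x, by simp, by simp⟩
  · obtain ⟨c, hc, he⟩ := key y x hxy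
    exact ⟨c, by rwa [Set.uIcc_of_ge hxy.le], by linarith⟩

lemma Flux.mvt_coef {lam Lam Hs α : ℝ} {S S' : ℝ → ℝ} (h : Flux lam Lam Hs α S S') :
    ∃ A : ℝ → ℝ → ℝ, (∀ x y, S y - S x = A x y * (y - x)) ∧ (∀ x y, lam ≤ A x y) ∧
      (∀ x y, A x y ≤ Lam) ∧ ∀ x y, ∃ ξ ∈ Set.uIcc x y, A x y = S' ξ := by
  choose ξ hξ he using h.mvt
  exact ⟨fun x y => S' (ξ x y), he, fun x y => h.lb _, fun x y => h.ub _, fun x y => ⟨_, hξ x y, rfl⟩⟩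

/-- right side without source -/
noncomputable def fdiv (S : ℝ → ℝ) (N : ℕ) (v : ℕ → ℝ) (j : ℕ) : ℝ :=
  (S (grad N v (j+1)) - S (grad N v j)) * N

noncomputable def zseq (S : ℝ → ℝ) (N : ℕ) (τ : ℝ) (v : ℕ → ℝ) : ℕ → ℕ → ℝ
  | 0 => v
  | k+1 => fun j => zseq S N τ v k j + τ * fdiv S N (zseq S N τ v k) j

/-- difference of two flux divergences as edge form -/
lemma fdiv_sub {lam Lam Hs α : ℝ} {S S' : ℝ → ℝ} (h : Flux lam Lam Hs α S S') {N : ℕ}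
    (v w : ℕ → ℝ) (μ τ : ℝ) (hτ : τ * (N:ℝ)^2 = μ) :
    ∃ c : ℕ → ℝ, (∀ j, lam ≤ c j) ∧ (∀ j, c j ≤ Lam) ∧ ∀ j < N,
      (v j - w j) + τ * (fdiv S N v j - fdiv S N w j) = stepD N μ c (fun i => v i - w i) j := by
  obtain ⟨A, hA, hl, hu, _⟩ := h.mvt_coef
  refine ⟨fun j => A (grad N w j) (grad N v j), fun j => hl _ _, fun j => hu _ _, ?_⟩
  intro j hj
  have e : fdiv S N v j - fdiv S N w j = ((S (grad N v (j+1)) - S (grad N w (j+1))) -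
    (S (grad N v j) - S (grad N w j))) * N := by unfold fdiv; ring
  rw [e, hA, hA]
  unfold stepD
  rw [← hτ]
  beta_reduce
  generalize A (grad N w j) (grad N v j) = x
  generalize A (grad N w (j+1)) (grad N v (j+1)) = y
  rw [grad_lt hj, grad_lt hj]
  simp only [grad, dv, Nat.add_sub_cancel]
  ring

lemma fdiv_lap {lam Lam Hs α : ℝ} {S S' : ℝ → ℝ} (h : Flux lam Lam Hs α S S') (N : ℕ)
    (v : ℕ → ℝ) (j : ℕ) : ∃ a, lam ≤ a ∧ a ≤ Lam ∧ fdiv S N v j = a * lap N v j := by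
  obtain ⟨A, hA, hl, hu, _⟩ := h.mvt_coef
  refine ⟨A (grad N v j) (grad N v (j+1)), hl _ _, hu _ _, ?_⟩
  unfold fdiv lap
  rw [hA]; ring

/-- comparison between the scheme with and without source -/
lemma zseq_close {lam Lam Hs α : ℝ} {S S' : ℝ → ℝ} (h : Flux lam Lam Hs α S S') {N : ℕ}
    (μ τ : ℝ) (hτ0 : 0 ≤ τ) (hτ : τ * (N:ℝ)^2 = μ) (hμL : 4 * μ * Lam ≤ 1)
    (u g : ℕ → ℕ → ℝ) (n : ℕ) (G : ℝ) (hg : ∀ k < n, ∀ j < N, |g k j| ≤ G)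
    (hu : ∀ k < n, ∀ j < N, u (k+1) j = u k j + τ * (fdiv S N (u k) j + g k j)) :
    ∀ k ≤ n, ∀ j < N, |u k j - zseq S N τ (u 0) k j| ≤ k * τ * G := by
  intro k
  have hμ : 0 ≤ μ := by rw [← hτ]; positivity
  induction k with
  | zero => intro _ j _; simp [zseq]
  | succ k ih =>
    intro hk j hj
    obtain ⟨c, c1, c2, c3⟩ := fdiv_sub h (u k) (zseq S N τ (u 0) k) μ τ hτ
    have h1 := stepD_sup hμ h.lam_pos.le hμL c _ c1 c2 (k*τ*G) (ih (by omega)) j hj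
    rw [← c3 j hj] at h1
    have h2 := hg k (by omega) j hj
    rw [hu k (by omega) j hj]
    simp only [zseq]
    have : u k j + τ * (fdiv S N (u k) j + g k j) - (zseq S N τ (u 0) k j + τ * fdiv S N (zseq S N τ (u 0) k) j) =
      (u k j - zseq S N τ (u 0) k j + τ * (fdiv S N (u k) j - fdiv S N (zseq S N τ (u 0) k) j)) + τ * g k j := by
      ring
    rw [this]
    refine (abs_add_le _ _).trans ?_
    rw [abs_mul, abs_of_nonneg hτ0]
    push_cast
    nlinarith [mul_le_mul_of_nonneg_left h2 hτ0]

/-- the time difference quotient obeys an edge form scheme -/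
lemma q_step {lam Lam Hs α : ℝ} {S S' : ℝ → ℝ} (h : Flux lam Lam Hs α S S') {N : ℕ}
    {μ τ : ℝ} (hτ0 : 0 < τ) (hτ : τ * (N:ℝ)^2 = μ) (v : ℕ → ℝ)
    (k : ℕ) : ∃ c : ℕ → ℝ, (∀ j, lam ≤ c j) ∧ (∀ j, c j ≤ Lam) ∧ ∀ j < N,
    fdiv S N (zseq S N τ v (k+1)) j = stepD N μ c (fdiv S N (zseq S N τ v k)) j := by
  obtain ⟨c, c1, c2, c3⟩ := fdiv_sub h (zseq S N τ v (k+1)) (zseq S N τ v k) μ τ hτ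
  refine ⟨c, c1, c2, fun j hj => ?_⟩
  have e : ∀ i, zseq S N τ v (k+1) i - zseq S N τ v k i = τ * fdiv S N (zseq S N τ v k) i := by
    intro i; simp only [zseq]; ring
  have := c3 j hj
  simp only [e] at this
  have e2 : stepD N μ c (fun i => τ * fdiv S N (zseq S N τ v k) i) j =
      τ * stepD N μ c (fdiv S N (zseq S N τ v k)) j := by unfold stepD; ring
  rw [e2] at this
  have h3 : τ * fdiv S N (zseq S N τ v (k+1)) j = τ * stepD N μ c (fdiv S N (zseq S N τ v k)) j := by
    linarith
  exact mul_left_cancel₀ hτ0.ne' h3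

lemma q_sup_mono {lam Lam Hs α : ℝ} {S S' : ℝ → ℝ} (h : Flux lam Lam Hs α S S') {N : ℕ}
    {μ τ : ℝ} (hτ0 : 0 < τ) (hτ : τ * (N:ℝ)^2 = μ) (hμL : 4 * μ * Lam ≤ 1) (v : ℕ → ℝ)
    (k n : ℕ) (Q : ℝ) (hQ : ∀ j < N, |fdiv S N (zseq S N τ v k) j| ≤ Q) :
    ∀ j < N, |fdiv S N (zseq S N τ v (k+n)) j| ≤ Q := by
  have hμ : 0 ≤ μ := by rw [← hτ]; positivity
  induction n with
  | zero => exact hQ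
  | succ n ih =>
    intro j hj
    obtain ⟨c, c1, c2, c3⟩ := q_step h hτ0 hτ v (k+n)
    rw [← add_assoc, c3 j hj]
    exact stepD_sup hμ h.lam_pos.le hμL c _ c1 c2 Q ih j hj

lemma q_l2 {lam Lam Hs α : ℝ} {S S' : ℝ → ℝ} (h : Flux lam Lam Hs α S S') {N : ℕ}
    {μ τ : ℝ} (hτ0 : 0 < τ) (hτ : τ * (N:ℝ)^2 = μ) (hμL : 4 * μ * Lam ≤ 1) (v : ℕ → ℝ)
    (k : ℕ) : ∑ j ∈ range N, (fdiv S N (zseq S N τ v (k+1)) j)^2 +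
    μ * lam * ∑ j ∈ range N, (dv (fdiv S N (zseq S N τ v k)) j)^2 ≤
      ∑ j ∈ range N, (fdiv S N (zseq S N τ v k) j)^2 := by
  have hμ : 0 ≤ μ := by rw [← hτ]; positivity
  obtain ⟨c, c1, c2, c3⟩ := q_step h hτ0 hτ v k
  have := stepD_l2 (N := N) hμ h.lam_pos.le hμL c (fdiv S N (zseq S N τ v k)) c1 c2
  rw [sum_congr rfl (fun j hj => by rw [c3 j (mem_range.mp hj)])]
  exact this

lemma z_energy {lam Lam Hs α : ℝ} {S S' : ℝ → ℝ} (h : Flux lam Lam Hs α S S') {N : ℕ} (hN : 1 ≤ N)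
    {μ τ : ℝ} (hτ0 : 0 < τ) (hτ : τ * (N:ℝ)^2 = μ) (hμL : 4 * μ * Lam ≤ 1) (v : ℕ → ℝ)
    (k : ℕ) : ∑ j ∈ range N, (dv (zseq S N τ v (k+1)) j)^2 +
    τ / ((N:ℝ)^2 * Lam) * ∑ j ∈ range N, (fdiv S N (zseq S N τ v k) j)^2 ≤
      ∑ j ∈ range N, (dv (zseq S N τ v k) j)^2 := by
  have hN' : (0:ℝ) < N := by exact_mod_cast hN
  have hμ : 0 < μ := by rw [← hτ]; positivity
  have hLp : 0 < Lam := h.lam_pos.trans_le h.lam_le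
  set z := zseq S N τ v k with hz
  set q := fdiv S N z with hq
  have e0 : ∀ j, zseq S N τ v (k+1) j = z j + τ * q j := fun j => rfl
  have e1 : ∑ j ∈ range N, (dv (zseq S N τ v (k+1)) j)^2 = ∑ j ∈ range N, (dv z j)^2 +
      2 * τ * ∑ j ∈ range N, dv z j * dv q j + τ^2 * ∑ j ∈ range N, (dv q j)^2 := by
    rw [mul_sum, mul_sum, ← sum_add_distrib, ← sum_add_distrib]
    apply sum_congr rfl
    intro j _; simp only [dv, e0]; ring
  have e2 : ∑ j ∈ range N, dv z j * dv q j = - ∑ j ∈ range N, (lap N z j / N^2) * q j := by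
    have := sbp0 (fun j => grad N z j / N) q N (by simp [grad_zero]) (by simp [grad_top])
    rw [eq_comm, neg_eq_iff_eq_neg]
    rw [← neg_eq_iff_eq_neg, neg_eq_iff_eq_neg]
    calc _ = ∑ j ∈ range N, (grad N z (j+1) / N - grad N z j / N) * q j := by
          apply sum_congr rfl; intro j _; unfold lap; field_simp
      _ = _ := by
          rw [this]; congr 1; apply sum_congr rfl; intro j hj
          rw [grad_lt (mem_range.mp hj)]; field_simp
  have e3 : 1 / Lam * ∑ j ∈ range N, (q j)^2 ≤ ∑ j ∈ range N, lap N z j * q j := by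
    rw [mul_sum]
    apply sum_le_sum; intro j _
    obtain ⟨a, a1, a2, a3⟩ := fdiv_lap h N z j
    rw [← hq] at a3
    have ha : 0 < a := h.lam_pos.trans_le a1
    have : lap N z j = q j / a := by rw [a3]; field_simp
    rw [this]
    have h2 : 1 / Lam ≤ 1 / a := one_div_le_one_div_of_le ha a2
    calc _ ≤ 1 / a * (q j)^2 := mul_le_mul_of_nonneg_right h2 (sq_nonneg _)
      _ = _ := by ring
  have e4 := sum_dv_sq_le (N := N) q
  have e5 : ∑ j ∈ range N, (lap N z j / N^2) * q j = (1/(N:ℝ)^2) * ∑ j ∈ range N, lap N z j * q j := by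
    rw [mul_sum]; apply sum_congr rfl; intro j _; ring
  rw [e1, e2, e5]
  set X := ∑ j ∈ range N, (q j)^2 with hX
  have hX0 : 0 ≤ X := sum_nonneg (fun _ _ => sq_nonneg _)
  have f1 : τ^2 * ∑ j ∈ range N, (dv q j)^2 ≤ τ / ((N:ℝ)^2 * Lam) * X := by
    have : τ^2 * 4 ≤ τ / ((N:ℝ)^2 * Lam) := by
      rw [le_div_iff₀ (by positivity)]
      have : τ^2 * 4 * ((N:ℝ)^2 * Lam) = τ * (4 * μ * Lam) := by rw [← hτ]; ring
      rw [this]; nlinarith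
    calc _ ≤ τ^2 * (4 * X) := mul_le_mul_of_nonneg_left e4 (by positivity)
      _ = (τ^2 * 4) * X := by ring
      _ ≤ _ := mul_le_mul_of_nonneg_right this hX0
  have f2 : 2 * (τ / ((N:ℝ)^2 * Lam) * X) ≤ 2 * τ * ((1/(N:ℝ)^2) * ∑ j ∈ range N, lap N z j * q j) := by
    have := mul_le_mul_of_nonneg_left e3 (by positivity : 0 ≤ 2 * τ / (N:ℝ)^2)
    calc _ = 2 * τ / (N:ℝ)^2 * (1 / Lam * X) := by field_simp
      _ ≤ _ := this
      _ = _ := by ring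
  linarith

/-- smoothing over a time window -/
lemma window {lam Lam Hs α : ℝ} {S S' : ℝ → ℝ} (h : Flux lam Lam Hs α S S') {N : ℕ} (hN : 1 ≤ N)
    {μ τ : ℝ} (hτ0 : 0 < τ) (hτ : τ * (N:ℝ)^2 = μ) (hμL : 4 * μ * Lam ≤ 1) (v : ℕ → ℝ)
    (K : ℝ) (hK : ∀ j ≤ N, |grad N v j| ≤ K) (n1 n2 : ℕ) (_hn1 : 1 ≤ n1) (hn2 : 1 ≤ n2)
    (t ν : ℝ) (ht : 0 < t) (hν : 0 < ν) (ht1 : t ≤ n1 * τ) (ht2 : t ≤ n2 * τ) :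
    ∀ j < N, (fdiv S N (zseq S N τ v (n1+n2)) j)^2 ≤ K^2 * Lam * (1/t + ν/(2*lam*t^2) + 3/(ν*t)) := by
  have hN' : (0:ℝ) < N := by exact_mod_cast hN
  have hμ : 0 < μ := by rw [← hτ]; positivity
  have hl := h.lam_pos
  have hLp : 0 < Lam := h.lam_pos.trans_le h.lam_le
  set X : ℕ → ℝ := fun k => ∑ j ∈ range N, (fdiv S N (zseq S N τ v k) j)^2 with hX
  set D : ℕ → ℝ := fun k => ∑ j ∈ range N, (dv (fdiv S N (zseq S N τ v k)) j)^2 with hD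
  set E : ℕ → ℝ := fun k => ∑ j ∈ range N, (dv (zseq S N τ v k) j)^2 with hE
  have hX0 : ∀ k, 0 ≤ X k := fun k => sum_nonneg (fun _ _ => sq_nonneg _)
  have hD0 : ∀ k, 0 ≤ D k := fun k => sum_nonneg (fun _ _ => sq_nonneg _)
  have hE0 : ∀ k, 0 ≤ E k := fun k => sum_nonneg (fun _ _ => sq_nonneg _)
  have s1 : ∀ k, X (k+1) + μ * lam * D k ≤ X k := fun k => q_l2 h hτ0 hτ hμL v k
  have s2 : ∀ k, E (k+1) + τ / ((N:ℝ)^2 * Lam) * X k ≤ E k := fun k => z_energy h hN hτ0 hτ hμL v k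
  have anti : Antitone X := antitone_nat_of_succ_le (fun k => by
    have := s1 k
    have : 0 ≤ μ * lam * D k := mul_nonneg (by positivity) (hD0 k)
    linarith)
  have E0 : E 0 ≤ K^2 / N := by
    have : ∀ j ∈ range N, (dv (zseq S N τ v 0) j)^2 ≤ K^2 / N^2 := by
      intro j hj
      have h1 := hK j (mem_range.mp hj).le
      rw [grad_lt (mem_range.mp hj)] at h1
      rw [le_div_iff₀ (by positivity), ← mul_pow, ← sq_abs]
      exact pow_le_pow_left₀ (abs_nonneg _) h1 2
    refine (sum_le_sum this).trans ?_
    rw [sum_const, card_range, nsmul_eq_mul]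
    apply le_of_eq; field_simp
  have sumE : ∀ n, E n + τ / ((N:ℝ)^2 * Lam) * ∑ k ∈ range n, X k ≤ E 0 := by
    intro n
    induction n with
    | zero => simp
    | succ n ih => rw [sum_range_succ, mul_add]; linarith [s2 n]
  have X1 : n1 * X n1 ≤ ∑ k ∈ range n1, X k := by
    calc (n1:ℝ) * X n1 = ∑ k ∈ range n1, X n1 := by simp
      _ ≤ _ := sum_le_sum (fun k hk => anti (mem_range.mp hk).le)
  set P := K^2 * Lam / t with hP
  have XP : X n1 ≤ N * P := by
    have h1 := sumE n1
    have h2 := hE0 n1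
    have h3 : τ / ((N:ℝ)^2 * Lam) * (n1 * X n1) ≤ K^2 / N :=
      (mul_le_mul_of_nonneg_left X1 (by positivity)).trans (by linarith)
    have h4 : t * X n1 ≤ K^2 * Lam * N := by
      have h5 : t * X n1 ≤ n1 * τ * X n1 := mul_le_mul_of_nonneg_right ht1 (hX0 _)
      have h6 : τ / ((N:ℝ)^2 * Lam) * (n1 * X n1) = (n1 * τ * X n1) / (N^2 * Lam) := by ring
      rw [h6, div_le_iff₀ (by positivity)] at h3
      have h7 : K^2 / N * (N^2 * Lam) = K^2 * Lam * N := by field_simp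
      linarith
    rw [hP, ← mul_div_assoc, le_div_iff₀ ht]
    linarith
  have sumX : ∀ n, X (n1+n) + μ * lam * ∑ k ∈ range n, D (n1+k) ≤ X n1 := by
    intro n
    induction n with
    | zero => simp
    | succ n ih => rw [sum_range_succ, mul_add, ← add_assoc n1]; linarith [s1 (n1+n)]
  obtain ⟨l, hl2, hDl⟩ : ∃ l < n2, n2 * D (n1+l) ≤ ∑ k ∈ range n2, D (n1+k) := by
    by_contra hcon
    push Not at hcon
    have : ∑ k ∈ range n2, (∑ k ∈ range n2, D (n1+k)) < ∑ k ∈ range n2, n2 * D (n1+k) :=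
      sum_lt_sum_of_nonempty ⟨0, by simp; omega⟩ (fun k hk => hcon k (mem_range.mp hk))
    rw [sum_const, card_range, nsmul_eq_mul, ← mul_sum] at this
    exact lt_irrefl _ this
  have Db : μ * lam * (n2 * D (n1+l)) ≤ N * P := by
    have h1 := sumX n2
    have h2 := hX0 (n1+n2)
    have h3 := mul_le_mul_of_nonneg_left hDl (by positivity : 0 ≤ μ * lam)
    linarith
  have Xl : X (n1+l) ≤ N * P := (anti (by omega)).trans XP
  have hPnn : 0 ≤ P := by rw [hP]; positivity
  have supl : ∀ j < N, (fdiv S N (zseq S N τ v (n1+l)) j)^2 ≤ K^2 * Lam * (1/t + ν/(2*lam*t^2) + 3/(ν*t)) := by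
    intro j hj
    have h1 := sup_sq_le hN (fdiv S N (zseq S N τ v (n1+l))) (ν * N) (by positivity) j hj
    refine h1.trans ?_
    change 1/(N:ℝ) * X (n1+l) + ν * N / 2 * D (n1+l) + 3/(ν*N) * X (n1+l) ≤ _
    have a1 : 1/(N:ℝ) * X (n1+l) ≤ K^2 * Lam * (1/t) := by
      calc _ ≤ 1/(N:ℝ) * (N * P) := mul_le_mul_of_nonneg_left Xl (by positivity)
        _ = _ := by rw [hP]; field_simp
    have a3 : 3/(ν*N) * X (n1+l) ≤ K^2 * Lam * (3/(ν*t)) := by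
      calc _ ≤ 3/(ν*(N:ℝ)) * (N * P) := mul_le_mul_of_nonneg_left Xl (by positivity)
        _ = _ := by rw [hP]; field_simp
    have a2 : ν * N / 2 * D (n1+l) ≤ K^2 * Lam * (ν/(2*lam*t^2)) := by
      have b1 : lam * t * N * D (n1+l) ≤ P := by
        have c1 : lam * t * N * D (n1+l) ≤ lam * (n2 * τ) * N * D (n1+l) := by
          apply mul_le_mul_of_nonneg_right _ (hD0 _)
          apply mul_le_mul_of_nonneg_right _ hN'.le
          exact mul_le_mul_of_nonneg_left ht2 hl.le
        have c2 : lam * (n2 * τ) * N * D (n1+l) * N = μ * lam * (n2 * D (n1+l)) := by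
          rw [← hτ]; ring
        have c3 : lam * (n2 * τ) * N * D (n1+l) * N ≤ P * N := by rw [c2]; linarith
        exact c1.trans (le_of_mul_le_mul_right c3 hN')
      have b2 : N * D (n1+l) ≤ P / (lam * t) := by
        rw [le_div_iff₀ (by positivity)]; linarith
      calc _ = ν / 2 * (N * D (n1+l)) := by ring
        _ ≤ ν / 2 * (P / (lam * t)) := mul_le_mul_of_nonneg_left b2 (by positivity)
        _ = _ := by rw [hP]; field_simp
    linarith
  intro j hj
  set R := K^2 * Lam * (1/t + ν/(2*lam*t^2) + 3/(ν*t)) with hR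
  have hR0 : 0 ≤ R := (sq_nonneg _).trans (supl j hj)
  have h1 : ∀ j < N, |fdiv S N (zseq S N τ v (n1+l)) j| ≤ Real.sqrt R := by
    intro j hj; exact Real.abs_le_sqrt (supl j hj)
  have h2 := q_sup_mono h hτ0 hτ hμL v (n1+l) (n2-l) _ h1 j hj
  rw [show n1+l+(n2-l) = n1+n2 by omega] at h2
  rw [← sq_abs, ← Real.sq_sqrt hR0]
  exact pow_le_pow_left₀ (abs_nonneg _) h2 2

end FB

namespace FB
open Finset

/-- even reflection with period `2N` -/
noncomputable def fold (N : ℕ) (y : ℤ) : ℕ :=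
  if y % (2*N) < N then (y % (2*N)).toNat else (2*N - 1 - y % (2*N)).toNat

lemma fold_lo {N : ℕ} (q r : ℤ) (h0 : 0 ≤ r) (h1 : r < N) : fold N (2*N*q + r) = r.toNat := by
  have : (2*N*q + r) % (2*N) = r := by
    rw [Int.mul_add_emod_self_left]
    exact Int.emod_eq_of_lt h0 (by omega)
  unfold fold; rw [this, if_pos h1]

lemma fold_hi {N : ℕ} (q r : ℤ) (h0 : N ≤ r) (h1 : r < 2*N) :
    fold N (2*N*q + r) = (2*N - 1 - r).toNat := by
  have : (2*N*q + r) % (2*N) = r := by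
    rw [Int.mul_add_emod_self_left]
    exact Int.emod_eq_of_lt (by omega) h1
  unfold fold; rw [this, if_neg (by omega)]

lemma fold_nat {N j : ℕ} (h : j < N) : fold N (j:ℤ) = j := by
  have := fold_lo (N := N) 0 (j:ℤ) (by omega) (by omega)
  simpa using this

lemma fold_repr {N : ℕ} (hN : 1 ≤ N) (y : ℤ) : ∃ q r : ℤ, y = 2*N*q + r ∧ 0 ≤ r ∧ r < 2*N :=
  ⟨y / (2*N), y % (2*N), (Int.mul_ediv_add_emod y (2*N)).symm, Int.emod_nonneg _ (by omega),
    Int.emod_lt_of_pos _ (by omega)⟩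

lemma fold_nbr {N : ℕ} (hN : 1 ≤ N) (y : ℤ) : fold N y < N ∧
    ((fold N (y+1) = min (fold N y + 1) (N-1) ∧ fold N (y-1) = fold N y - 1) ∨
     (fold N (y-1) = min (fold N y + 1) (N-1) ∧ fold N (y+1) = fold N y - 1)) := by
  obtain ⟨q, r, rfl, h0, h1⟩ := fold_repr hN y
  have s1 : ∀ a : ℤ, 2*N*q + r + a = 2*N*q + (r + a) := fun a => by ring
  rw [sub_eq_add_neg, s1, s1]
  by_cases hr : r < N
  · rw [fold_lo q r h0 hr]
    refine ⟨by omega, Or.inl ⟨?_, ?_⟩⟩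
    · by_cases h2 : r + 1 < N
      · rw [fold_lo q (r+1) (by omega) h2]; omega
      · rw [fold_hi q (r+1) (by omega) (by omega)]; omega
    · by_cases h2 : r = 0
      · subst h2
        rw [show 2*(N:ℤ)*q + (0 + -1) = 2*N*(q-1) + (2*N-1) by ring, fold_hi (q-1) (2*N-1) (by omega) (by omega)]
        omega
      · rw [fold_lo q (r + -1) (by omega) (by omega)]; omega
  · rw [fold_hi q r (by omega) h1]
    refine ⟨by omega, Or.inr ⟨?_, ?_⟩⟩
    · by_cases h2 : r = N
      · rw [fold_lo q (r + -1) (by omega) (by omega)]; omega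
      · rw [fold_hi q (r + -1) (by omega) (by omega)]; omega
    · by_cases h2 : r = 2*N-1
      · subst h2
        rw [show 2*(N:ℤ)*q + (2*N-1+1) = 2*N*(q+1) + 0 by ring, fold_lo (q+1) 0 (by omega) (by omega)]
        omega
      · rw [fold_hi q (r+1) (by omega) (by omega)]; omega

lemma fold_lt {N : ℕ} (hN : 1 ≤ N) (y : ℤ) : fold N y < N := (fold_nbr hN y).1

lemma lapZ_fold {N : ℕ} (hN : 1 ≤ N) (v : ℕ → ℝ) (y : ℤ) :
    lapZ (fun y => v (fold N y)) y * (N:ℝ)^2 = lap N v (fold N y) := by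
  obtain ⟨h0, h⟩ := fold_nbr hN y
  have e : lapZ (fun y => v (fold N y)) y = v (min (fold N y + 1) (N-1)) - 2 * v (fold N y) + v (fold N y - 1) := by
    unfold lapZ
    rcases h with ⟨a, b⟩ | ⟨a, b⟩ <;> simp only [a, b] <;> ring
  rw [e]; unfold lap; rw [grad_lt h0]; simp only [grad, dv, Nat.add_sub_cancel]; ring

lemma fold_lip {N : ℕ} (hN : 1 ≤ N) (x y : ℤ) : |(fold N x : ℝ) - fold N y| ≤ |(x:ℝ) - y| := by
  have step : ∀ y : ℤ, |(fold N (y+1) : ℝ) - fold N y| ≤ 1 := by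
    intro y
    obtain ⟨h0, h⟩ := fold_nbr hN y
    have : |((fold N (y+1) : ℤ) - fold N y)| ≤ 1 := by
      rw [abs_le]; rcases h with ⟨a, b⟩ | ⟨a, b⟩ <;> constructor <;> omega
    exact_mod_cast this
  have pos : ∀ (y : ℤ) (k : ℕ), |(fold N (y+k) : ℝ) - fold N y| ≤ k := by
    intro y k
    induction k with
    | zero => simp
    | succ k ih =>
      have := step (y+k)
      push_cast
      rw [← add_assoc]
      calc _ = |((fold N (y+k+1) : ℝ) - fold N (y+k)) + ((fold N (y+k) : ℝ) - fold N y)| := by ring_nf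
        _ ≤ _ := (abs_add_le _ _).trans (by linarith)
  rcases le_total x y with h | h
  · obtain ⟨k, rfl⟩ := Int.le.dest h
    have := pos x k
    rw [abs_sub_comm]; push_cast; rw [abs_sub_comm (x:ℝ), add_sub_cancel_left]
    simpa using this
  · obtain ⟨k, rfl⟩ := Int.le.dest h
    have := pos y k
    push_cast; rw [add_sub_cancel_left]
    simpa using this

lemma grad_lip {N : ℕ} (hN : 1 ≤ N) (v : ℕ → ℝ) (M : ℝ) (hM : ∀ j < N, |lap N v j| ≤ M)
    (i j : ℕ) (hi : i ≤ N) (hj : j ≤ N) : |grad N v i - grad N v j| ≤ M / N * |(i:ℝ) - j| := by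
  have hN' : (0:ℝ) < N := by exact_mod_cast hN
  have key : ∀ i k : ℕ, i + k ≤ N → |grad N v (i+k) - grad N v i| ≤ M / N * k := by
    intro i k
    induction k with
    | zero => intro _; simp
    | succ k ih =>
      intro hk
      have h1 := ih (by omega)
      have h2 := hM (i+k) (by omega)
      have h3 : |grad N v (i+k+1) - grad N v (i+k)| ≤ M / N := by
        rw [le_div_iff₀ hN']
        have : lap N v (i+k) = (grad N v (i+k+1) - grad N v (i+k)) * N := rfl
        rw [this, abs_mul, abs_of_pos hN'] at h2
        exact h2
      rw [← add_assoc]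
      calc _ = |(grad N v (i+k+1) - grad N v (i+k)) + (grad N v (i+k) - grad N v i)| := by ring_nf
        _ ≤ _ := (abs_add_le _ _).trans (by push_cast; linarith)
  rcases le_total i j with h | h
  · obtain ⟨k, rfl⟩ := Nat.exists_eq_add_of_le h
    have := key i k hj
    rw [abs_sub_comm]; push_cast; rw [abs_sub_comm (i:ℝ), add_sub_cancel_left]
    simpa using this
  · obtain ⟨k, rfl⟩ := Nat.exists_eq_add_of_le h
    have := key j k hi
    push_cast; rw [add_sub_cancel_left]
    simpa using this

lemma coef_holder {lam Lam Hs α : ℝ} {S S' : ℝ → ℝ} (h : Flux lam Lam Hs α S S') {N : ℕ} (hN : 1 ≤ N) :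
    ∃ a : (ℕ → ℝ) → ℕ → ℝ, (∀ v j, lam ≤ a v j) ∧ (∀ v j, a v j ≤ Lam) ∧
      (∀ v j, fdiv S N v j = a v j * lap N v j) ∧
      ∀ v M, (∀ j < N, |lap N v j| ≤ M) → ∀ i < N, ∀ j < N,
        |a v i - a v j| ≤ Hs * (3 * M * (|(i:ℝ) - j| / N)) ^ α := by
  have hN' : (0:ℝ) < N := by exact_mod_cast hN
  obtain ⟨A, hA, hl, hu, hξ⟩ := h.mvt_coef
  refine ⟨fun v j => A (grad N v j) (grad N v (j+1)), fun v j => hl _ _, fun v j => hu _ _, ?_, ?_⟩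
  · intro v j; unfold fdiv lap; rw [hA]; ring
  · intro v M hM i hi j hj
    have hM0 : 0 ≤ M := (abs_nonneg _).trans (hM i hi)
    by_cases hij : i = j
    · subst hij
      rw [sub_self, abs_zero]
      exact mul_nonneg h.Hs_nonneg (Real.rpow_nonneg (by positivity) _)
    obtain ⟨x, hx, ex⟩ := hξ (grad N v i) (grad N v (i+1))
    obtain ⟨y, hy, ey⟩ := hξ (grad N v j) (grad N v (j+1))
    simp only
    rw [ex, ey]
    refine (h.holder x y).trans ?_
    apply mul_le_mul_of_nonneg_left _ h.Hs_nonneg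
    apply Real.rpow_le_rpow (abs_nonneg _) _ h.α_pos.le
    have near : ∀ (i : ℕ) (x : ℝ), i < N → x ∈ Set.uIcc (grad N v i) (grad N v (i+1)) →
        |x - grad N v i| ≤ M / N := by
      intro i x hi hx
      have h1 := Set.abs_sub_left_of_mem_uIcc hx
      have h2 := grad_lip hN v M hM (i+1) i (by omega) (by omega)
      push_cast at h2
      rw [add_sub_cancel_left, abs_one, mul_one] at h2
      linarith
    have n1 := near i x hi hx
    have n2 := near j y hj hy
    have n3 := grad_lip hN v M hM i j hi.le hj.le
    have one : (1:ℝ) ≤ |(i:ℝ) - j| := by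
      have : (1:ℤ) ≤ |(i:ℤ) - j| := by
        apply Int.one_le_abs; omega
      exact_mod_cast this
    have e : x - y = (x - grad N v i) + (grad N v i - grad N v j) - (y - grad N v j) := by ring
    have h5 : |x - y| ≤ |x - grad N v i| + |grad N v i - grad N v j| + |y - grad N v j| := by
      rw [e]
      exact (abs_sub _ _).trans (by linarith [abs_add_le (x - grad N v i) (grad N v i - grad N v j)])
    have h6 : M / N ≤ M / N * |(i:ℝ) - j| := le_mul_of_one_le_right (by positivity) one
    calc |x - y| ≤ 3 * (M / N * |(i:ℝ) - j|) := by linarith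
      _ = _ := by ring

lemma lap_freeze {lam Lam Hs α : ℝ} {S S' : ℝ → ℝ} (h : Flux lam Lam Hs α S S') {N : ℕ} (hN : 1 ≤ N)
    {μ τ : ℝ} (hτ0 : 0 < τ) (hτ : τ * (N:ℝ)^2 = μ) (hμL : 4 * μ * Lam ≤ 1)
    (u g : ℕ → ℕ → ℝ) (m : ℕ) (M Hg : ℝ) (hM0 : 0 ≤ M) (hHg : 0 ≤ Hg)
    (hu : ∀ k < m, ∀ j < N, u (k+1) j = u k j + τ * (fdiv S N (u k) j + g k j))
    (hM : ∀ k < m, ∀ j < N, |lap N (u k) j| ≤ M)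
    (hg : ∀ k < m, ∀ i < N, ∀ j < N, |g k i - g k j| ≤ Hg * (1+M) * (|(i:ℝ) - j| / N) ^ α)
    (Z : ℕ → ℝ) (B Q : ℝ) (hB0 : 0 ≤ B) (hB : ∀ j < N, |u 0 j - Z j| ≤ B) (hQ : ∀ j < N, |lap N Z j| ≤ Q) :
    ∀ j < N, |lap N (u m) j| ≤ Q + kC (μ*lam) * B * N^2 / (m+1) +
      kC (μ*lam) * (2/α) * μ * (((m:ℝ) / N^2) ^ (α/2)) * (Hs * (3*M)^α * M + Hg * (1+M)) := by
  intro j hj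
  have hN' : (0:ℝ) < N := by exact_mod_cast hN
  have hμ : 0 < μ := by rw [← hτ]; positivity
  have hα := h.α_pos
  have hHs := h.Hs_nonneg
  obtain ⟨a, al, au, af, ah⟩ := coef_holder h hN
  have hb : ∀ x, x ≤ Lam → μ * x ≤ 1/4 := by
    intro x hx
    have := mul_le_mul_of_nonneg_left hx hμ.le
    linarith
  set Ec := Hs * (3*M)^α * M + Hg * (1+M) with hEc
  have hEc0 : 0 ≤ Ec := by positivity
  have main := kernel_main (θ0 := μ*lam) (mul_pos hμ h.lam_pos) (fun k => μ * a (u k) j)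
    (fun n => mul_le_mul_of_nonneg_left (al _ _) hμ.le) (fun n => hb _ (au _ _)) h.α_pos h.α_le
    (fun k y => u k (fold N y))
    (fun k y => τ * ((a (u k) (fold N y) - a (u k) j) * lap N (u k) (fold N y) + g k (fold N y)))
    m (by
      intro l hl y
      have e := lapZ_fold hN (u l) y
      rw [hu l hl _ (fold_lt hN y), af, ← e, ← hτ]
      simp only [opS, lapZ]; ring)
    (j:ℤ) (fun k => τ * g k j) (τ * ((1/(N:ℝ))^α * Ec)) (by positivity) (by
      intro l hl y
      have hf := fold_lt hN y
      have hlip := fold_lip hN y (j:ℤ)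
      rw [fold_nat hj] at hlip
      set i := fold N y with hi
      have h1 := ah (u l) M (hM l hl) i hf j hj
      have h2 := hM l hl i hf
      have h3 := hg l hl i hf j hj
      have hd : (|(i:ℝ) - j| / N)^α ≤ (1/(N:ℝ))^α * |(y:ℝ) - (j:ℤ)|^α := by
        rw [← Real.mul_rpow (by positivity) (abs_nonneg _)]
        apply Real.rpow_le_rpow (by positivity) _ hα.le
        rw [div_eq_mul_one_div, mul_comm]
        exact mul_le_mul_of_nonneg_left (by exact_mod_cast hlip) (by positivity)
      rw [Real.mul_rpow (by positivity) (by positivity)] at h1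
      have h4 : |(a (u l) i - a (u l) j) * lap N (u l) i| ≤ Hs * ((3*M)^α * (|(i:ℝ) - j| / N)^α) * M := by
        rw [abs_mul]; exact mul_le_mul h1 h2 (abs_nonneg _) ((abs_nonneg _).trans h1)
      have e : τ * ((a (u l) i - a (u l) j) * lap N (u l) i + g l i) - τ * g l j =
        τ * ((a (u l) i - a (u l) j) * lap N (u l) i + (g l i - g l j)) := by ring
      rw [e, abs_mul, abs_of_pos hτ0, mul_assoc τ]
      apply mul_le_mul_of_nonneg_left _ hτ0.le
      refine (abs_add_le _ _).trans ?_
      calc _ ≤ Ec * (|(i:ℝ) - j| / N)^α := by rw [hEc]; linarith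
        _ ≤ Ec * ((1/(N:ℝ))^α * |(y:ℝ) - (j:ℤ)|^α) := mul_le_mul_of_nonneg_left hd hEc0
        _ = _ := by ring)
    (fun y => u 0 (fold N y) - Z (fold N y)) (fun y => Z (fold N y)) (fun y => by ring)
    B (Q / N^2) hB0 (fun y => hB _ (fold_lt hN y)) (by
      intro y
      rw [le_div_iff₀ (by positivity)]
      have e := lapZ_fold hN Z y
      have := hQ _ (fold_lt hN y)
      rw [← e, abs_mul, abs_of_pos (by positivity : 0 < (N:ℝ)^2)] at this
      exact this)
  have e := lapZ_fold hN (u m) (j:ℤ)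
  rw [fold_nat hj] at e
  rw [← e, abs_mul, abs_of_pos (by positivity : 0 < (N:ℝ)^2)]
  refine (mul_le_mul_of_nonneg_right main (by positivity)).trans (le_of_eq ?_)
  have e1 : ((m:ℝ) / N^2) ^ (α/2) = (1/(N:ℝ))^α * (m:ℝ)^(α/2) := by
    rw [Real.div_rpow (by positivity) (by positivity), ← Real.rpow_natCast (N:ℝ) 2,
      ← Real.rpow_mul hN'.le, Real.div_rpow (by norm_num) hN'.le, Real.one_rpow]
    rw [show ((2:ℕ):ℝ) * (α/2) = α by push_cast; ring]; ring
  rw [e1, ← hτ]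
  field_simp

lemma lap_start {lam Lam Hs α : ℝ} {S S' : ℝ → ℝ} (h : Flux lam Lam Hs α S S') {N : ℕ} (hN : 1 ≤ N)
    {μ τ : ℝ} (hτ0 : 0 < τ) (hτ : τ * (N:ℝ)^2 = μ) (hμL : 4 * μ * Lam ≤ 1)
    (u g : ℕ → ℕ → ℝ) (n : ℕ) (G K Mi L : ℝ) (hL : 1 ≤ L) (hG : 0 ≤ G)
    (hL1 : 64 * (K^2 * Lam * (16 + 8/lam)) / lam^2 ≤ L) (hL2 : 8 * (Lam * Mi / lam) ≤ L)
    (hτs : 4 * τ * L^7 ≤ 1)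
    (hu : ∀ k < n, ∀ j < N, u (k+1) j = u k j + τ * (fdiv S N (u k) j + g k j))
    (hg : ∀ k < n, ∀ j < N, |g k j| ≤ G)
    (hK : ∀ k ≤ n, ∀ j ≤ N, |grad N (u k) j| ≤ K)
    (hi : ∀ j < N, |lap N (u 0) j| ≤ Mi) :
    ∃ Z : ℕ → ℝ, (∀ j < N, |u n j - Z j| ≤ G / L^7) ∧ (∀ j < N, |lap N Z j| ≤ L^6 / 8) := by
  have hl := h.lam_pos
  have hLam : 0 < Lam := hl.trans_le h.lam_le
  have hLp : 0 < L := by linarith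
  set Tw := 1 / L^7 with hTw
  have hTw0 : 0 < Tw := by positivity
  set n1 := ⌊Tw / 2 / τ⌋₊ with hn1
  have f1 : n1 * τ ≤ Tw / 2 := by
    have := Nat.floor_le (by positivity : 0 ≤ Tw / 2 / τ)
    rwa [le_div_iff₀ hτ0] at this
  have f2 : Tw / 4 ≤ n1 * τ := by
    have := Nat.lt_floor_add_one (Tw / 2 / τ)
    rw [div_lt_iff₀ hτ0, ← hn1] at this
    have h3 : τ ≤ Tw / 4 := by
      rw [hTw, div_div, le_div_iff₀ (by positivity)]; linarith
    linarith
  have hn1p : 1 ≤ n1 := by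
    by_contra hcon
    have : n1 = 0 := by omega
    rw [this] at f2; simp at f2; linarith
  have hquot : ∀ (w : ℕ → ℝ) (X : ℝ) (j : ℕ), |fdiv S N w j| ≤ X → |lap N w j| ≤ X / lam := by
    intro w X j hX
    obtain ⟨a, a1, a2, a3⟩ := fdiv_lap h N w j
    rw [a3, abs_mul, abs_of_pos (hl.trans_le a1)] at hX
    rw [le_div_iff₀ hl]
    nlinarith [abs_nonneg (lap N w j)]
  have hL6 : L ≤ L^6 := le_self_pow₀ hL (by norm_num)
  by_cases hc : n1 + n1 ≤ n
  · obtain ⟨l, rfl⟩ := Nat.exists_eq_add_of_le' hc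
    have cl := zseq_close h μ τ hτ0.le hτ hμL (fun k => u (l+k)) (fun k => g (l+k)) (n1+n1) G
      (fun k hk j hj => hg (l+k) (by omega) j hj) (fun k hk j hj => hu (l+k) (by omega) j hj) (n1+n1) le_rfl
    refine ⟨zseq S N τ (u l) (n1+n1), ?_, ?_⟩
    · intro j hj
      refine (cl j hj).trans ?_
      push_cast
      calc ((n1:ℝ)+n1) * τ * G ≤ Tw * G := mul_le_mul_of_nonneg_right (by linarith) hG
        _ = _ := by rw [hTw]; ring
    · intro j hj
      have w := window h hN hτ0 hτ hμL (u l) K (hK l (by omega)) n1 n1 hn1p hn1p (Tw/4) (1/L^3)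
        (by positivity) (by positivity) f2 f2 j hj
      have e : 1 / (Tw/4) + 1/L^3/(2*lam*(Tw/4)^2) + 3/(1/L^3*(Tw/4)) = 4 * L^7 + 8/lam * L^11 + 12 * L^10 := by
        rw [hTw]; field_simp; ring
      rw [e] at w
      have b1 : L^7 ≤ L^11 := pow_le_pow_right₀ hL (by norm_num)
      have b2 : L^10 ≤ L^11 := pow_le_pow_right₀ hL (by norm_num)
      have b3 : (fdiv S N (zseq S N τ (u l) (n1+n1)) j)^2 ≤ (lam * (L^6/8))^2 := by
        refine w.trans ?_
        have c1 : K^2 * Lam * (4 * L^7 + 8/lam * L^11 + 12 * L^10) ≤ K^2 * Lam * ((16 + 8/lam) * L^11) := by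
          apply mul_le_mul_of_nonneg_left _ (by positivity)
          linarith
        refine c1.trans ?_
        rw [div_le_iff₀ (by positivity)] at hL1
        have c2 := mul_le_mul_of_nonneg_right hL1 (by positivity : 0 ≤ L^11)
        have c3 : (lam * (L^6/8))^2 = L * lam^2 * L^11 / 64 := by ring
        rw [c3]; linarith
      have b4 := abs_le_of_sq_le_sq b3 (by positivity)
      have b5 := hquot _ _ j b4
      rwa [mul_div_cancel_left₀ _ hl.ne'] at b5
  · have cl := zseq_close h μ τ hτ0.le hτ hμL u g n G hg hu n le_rfl
    refine ⟨zseq S N τ (u 0) n, ?_, ?_⟩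
    · intro j hj
      refine (cl j hj).trans ?_
      have : (n:ℝ) ≤ n1 + n1 := by
        have : n ≤ n1 + n1 := by omega
        exact_mod_cast this
      calc (n:ℝ) * τ * G ≤ Tw * G := mul_le_mul_of_nonneg_right (by nlinarith) hG
        _ = _ := by rw [hTw]; ring
    · intro j hj
      have q0 : ∀ j < N, |fdiv S N (zseq S N τ (u 0) 0) j| ≤ Lam * Mi := by
        intro j hj
        obtain ⟨a, a1, a2, a3⟩ := fdiv_lap h N (u 0) j
        simp only [zseq]
        rw [a3, abs_mul, abs_of_pos (hl.trans_le a1)]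
        exact mul_le_mul a2 (hi j hj) (abs_nonneg _) hLam.le
      have q1 := q_sup_mono h hτ0 hτ hμL (u 0) 0 n _ q0 j hj
      rw [zero_add] at q1
      have := hquot _ _ j q1
      linarith

lemma lap_bound {lam Lam Hs α : ℝ} {S S' : ℝ → ℝ} (h : Flux lam Lam Hs α S S') 
    {μ : ℝ} (hμ : 0 < μ) (hμL : 4 * μ * Lam ≤ 1) (G Hg K Mi : ℝ) (hG : 0 ≤ G) (hHg : 0 ≤ Hg) :
    ∃ M : ℝ, 0 < M ∧ ∃ N0 : ℕ, 1 ≤ N0 ∧ ∀ N ≥ N0, ∀ τ : ℝ, τ * (N:ℝ)^2 = μ →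
      ∀ (u g : ℕ → ℕ → ℝ) (n : ℕ),
      (∀ k < n, ∀ j < N, u (k+1) j = u k j + τ * (fdiv S N (u k) j + g k j)) →
      (∀ k < n, ∀ j < N, |g k j| ≤ G) →
      (∀ k ≤ n, ∀ j ≤ N, |grad N (u k) j| ≤ K) →
      (∀ j < N, |lap N (u 0) j| ≤ Mi) →
      (∀ k < n, (∀ j < N, |lap N (u k) j| ≤ M) → ∀ i < N, ∀ j < N,
        |g k i - g k j| ≤ Hg * (1+M) * (|(i:ℝ) - j| / N) ^ α) →
      ∀ k ≤ n, ∀ j < N, |lap N (u k) j| ≤ M := by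
  have hl := h.lam_pos
  have hα := h.α_pos
  have hHs := h.Hs_nonneg
  set C := kC (μ*lam) with hC
  have hCpos : 0 < C := kC_pos (mul_pos hμ hl)
  set X := C * (2/α) * μ * (Hs * 3^α) with hX
  have hX0 : 0 ≤ X := by positivity
  obtain ⟨ε, hε, hεX⟩ : ∃ ε : ℝ, 0 < ε ∧ X * ε^α ≤ 1/8 := by
    refine ⟨(1/(8*(X+1)))^(1/α), by positivity, ?_⟩
    rw [← Real.rpow_mul (by positivity), one_div_mul_cancel hα.ne', Real.rpow_one]
    rw [mul_one_div, div_le_iff₀ (by positivity)]; linarith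
  set Y := C * (2/α) * μ * ε^α * Hg with hY
  have hY0 : 0 ≤ Y := by positivity
  obtain ⟨L, hL1, hL2, hL3, hL4, hL5, hL6⟩ : ∃ L : ℝ, 1 ≤ L ∧
      64 * (K^2 * Lam * (16 + 8/lam)) / lam^2 ≤ L ∧ 8 * (Lam * Mi / lam) ≤ L ∧ 8 * C * G / ε^2 ≤ L ∧
      8 * Mi ≤ L ∧ 16 * Y ≤ L^(6*α) := by
    have t1 := tendsto_rpow_atTop (by positivity : 0 < 6*α)
    have := (Filter.eventually_ge_atTop (1:ℝ)).and <| (Filter.eventually_ge_atTop (64 * (K^2 * Lam * (16 + 8/lam)) / lam^2)).and <|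
      (Filter.eventually_ge_atTop (8 * (Lam * Mi / lam))).and <| (Filter.eventually_ge_atTop (8 * C * G / ε^2)).and <|
      (Filter.eventually_ge_atTop (8*Mi)).and (t1.eventually_ge_atTop (16*Y))
    obtain ⟨L, hh⟩ := this.exists
    exact ⟨L, hh.1, hh.2.1, hh.2.2.1, hh.2.2.2.1, hh.2.2.2.2.1, hh.2.2.2.2.2⟩
  have hLp : 0 < L := by linarith
  set M := L^6 with hMd
  have hMp : 0 < M := by positivity
  have hM1 : 1 ≤ M := one_le_pow₀ hL1
  have hLM : L ≤ M := le_self_pow₀ hL1 (by norm_num)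
  obtain ⟨N0, hN0⟩ := exists_nat_ge (4 * μ * L^7)
  refine ⟨M, hMp, N0 + 1, by omega, ?_⟩
  intro N hN τ hτ u g n hu hg hK hi hh
  have hN1 : 1 ≤ N := by omega
  have hN' : (1:ℝ) ≤ N := by exact_mod_cast hN1
  have hτ0 : 0 < τ := by
    by_contra hcon
    have : τ * (N:ℝ)^2 ≤ 0 := mul_nonpos_of_nonpos_of_nonneg (by linarith) (by positivity)
    linarith
  have hτs : 4 * τ * L^7 ≤ 1 := by
    have h1 : (N0:ℝ) ≤ N := by exact_mod_cast (by omega : N0 ≤ N)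
    have h2 : (N:ℝ) ≤ N^2 := le_self_pow₀ hN' (by norm_num)
    have h3 : 4 * τ * L^7 * (N:ℝ)^2 ≤ 1 * (N:ℝ)^2 := by
      calc 4 * τ * L^7 * (N:ℝ)^2 = 4 * (τ * (N:ℝ)^2) * L^7 := by ring
        _ = 4 * μ * L^7 := by rw [hτ]
        _ ≤ _ := by linarith
    exact le_of_mul_le_mul_right h3 (by positivity)
  have base : ∀ j < N, |lap N (u 0) j| ≤ M := fun j hj => (hi j hj).trans (by
    rcases le_total 0 Mi with h0 | h0 <;> linarith)
  -- frozen estimate with small window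
  have b3 : ∀ m : ℕ, (m:ℝ) ≤ ε^2 * N^2 / M^2 →
      C * (2/α) * μ * (((m:ℝ) / N^2) ^ (α/2)) * (Hs * (3*M)^α * M + Hg * (1+M)) ≤ M / 4 := by
    intro m hm
    have e1 : ((m:ℝ) / N^2) ^ (α/2) ≤ ε^α / M^α := by
      have : (m:ℝ) / N^2 ≤ (ε/M)^2 := by
        rw [div_le_iff₀ (by positivity)]
        calc (m:ℝ) ≤ _ := hm
          _ = _ := by ring
      calc _ ≤ ((ε/M)^2)^(α/2) := Real.rpow_le_rpow (by positivity) this (by positivity)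
        _ = (ε/M)^α := by
          rw [← Real.rpow_natCast (ε/M) 2, ← Real.rpow_mul (by positivity)]
          congr 1; push_cast; ring
        _ = _ := Real.div_rpow hε.le hMp.le _
    have e2 : 16 * Y ≤ M^α := by
      refine hL6.trans (le_of_eq ?_)
      rw [hMd, ← Real.rpow_natCast L 6, ← Real.rpow_mul hLp.le]; norm_num
    have hMα : 0 < M^α := by positivity
    calc _ ≤ C * (2/α) * μ * (ε^α / M^α) * (Hs * (3*M)^α * M + Hg * (1+M)) := by gcongr
      _ = X * ε^α * M + Y * (1+M) / M^α := by
        rw [hX, hY, Real.mul_rpow (by norm_num) hMp.le]; field_simp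
      _ ≤ 1/8 * M + M / 8 := by
        apply add_le_add
        · exact mul_le_mul_of_nonneg_right hεX hMp.le
        · rw [div_le_iff₀ hMα]
          have : Y * (1+M) ≤ Y * (2*M) := mul_le_mul_of_nonneg_left (by linarith) hY0
          nlinarith
      _ = M/4 := by ring
  have all : ∀ k ≤ n, ∀ l ≤ k, ∀ j < N, |lap N (u l) j| ≤ M := by
    intro k
    induction k with
    | zero => intro _ l hl; obtain rfl : l = 0 := by omega
              exact base
    | succ k ih =>
      intro hk l hlk
      have ih' := ih (by omega)
      by_cases hlk' : l ≤ k
      · exact ih' l hlk'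
      obtain rfl : l = k + 1 := by omega
      set m := ⌊ε^2 * N^2 / M^2⌋₊ with hm
      have hmle : (m:ℝ) ≤ ε^2 * N^2 / M^2 := Nat.floor_le (by positivity)
      have hmlt : ε^2 * N^2 / M^2 < m + 1 := Nat.lt_floor_add_one _
      by_cases hcase : m ≤ k + 1
      · obtain ⟨l0, hl0⟩ := Nat.exists_eq_add_of_le' hcase
        obtain ⟨Z, Z1, Z2⟩ := lap_start h hN1 hτ0 hτ hμL u g l0 G K Mi L hL1 hG hL2 hL3 hτs
          (fun k hk => hu k (by omega)) (fun k hk => hg k (by omega)) (fun k hk => hK k (by omega)) hi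
        have fr := lap_freeze h hN1 hτ0 hτ hμL (fun k => u (l0+k)) (fun k => g (l0+k)) m M Hg hMp.le hHg
          (fun k hk => hu (l0+k) (by omega)) (fun k hk => ih' _ (by omega))
          (fun k hk => hh _ (by omega) (ih' _ (by omega))) Z (G / L^7) (L^6/8) (by positivity) Z1 Z2
        intro j hj
        have f := fr j hj
        rw [← hl0] at f
        refine f.trans ?_
        have b2 : C * (G / L^7) * N^2 / (m+1) ≤ M / 8 := by
          rw [div_le_iff₀ (by positivity)]
          have h1 : ε^2 * N^2 / M^2 * (M/8) ≤ (m+1) * (M/8) := mul_le_mul_of_nonneg_right hmlt.le (by positivity)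
          have h2 : C * (G / L^7) * N^2 ≤ ε^2 * N^2 / M^2 * (M/8) := by
            rw [div_le_iff₀ (by positivity)] at hL4
            have : ε^2 * N^2 / M^2 * (M/8) - C * (G / L^7) * N^2 = N^2 / (8 * L^7) * (L * ε^2 - 8 * C * G) := by
              rw [hMd]; field_simp
            have : 0 ≤ N^2 / (8 * L^7) * (L * ε^2 - 8 * C * G) := mul_nonneg (by positivity) (by linarith)
            linarith
          linarith
        have := b3 m hmle
        linarith
      · have fr := lap_freeze h hN1 hτ0 hτ hμL u g (k+1) M Hg hMp.le hHg
          (fun k hk => hu k (by omega)) (fun k hk => ih' _ (by omega))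
          (fun k hk => hh _ (by omega) (ih' _ (by omega))) (u 0) 0 Mi le_rfl (by simp) hi
        intro j hj
        refine (fr j hj).trans ?_
        have : ((k+1:ℕ):ℝ) ≤ ε^2 * N^2 / M^2 := by
          have : ((k+1:ℕ):ℝ) ≤ m := by exact_mod_cast (by omega : k+1 ≤ m)
          linarith
        have := b3 (k+1) this
        simp only [mul_zero, zero_mul, zero_div, add_zero]
        linarith
  intro k hk
  exact all k hk k le_rfl

end FB

namespace FB
open Finset

/-- bounded, Hölder continuous coefficients -/
structure Coef (α Q : ℝ) (b c f : ℝ → ℝ → ℝ) : Prop where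
  Q_nonneg : 0 ≤ Q
  bb : ∀ x t, |b x t| ≤ Q
  bc : ∀ x t, |c x t| ≤ Q
  bf : ∀ x t, |f x t| ≤ Q
  hb : ∀ x y t, |b x t - b y t| ≤ Q * |x - y| ^ α
  hc : ∀ x y t, |c x t - c y t| ≤ Q * |x - y| ^ α
  hf : ∀ x y t, |f x t - f y t| ≤ Q * |x - y| ^ α
  cb : Continuous (fun p : ℝ × ℝ => b p.1 p.2)
  cc : Continuous (fun p : ℝ × ℝ => c p.1 p.2)
  cf : Continuous (fun p : ℝ × ℝ => f p.1 p.2)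

/-- initial datum -/
structure Ini (L : ℝ) (u0 u0' : ℝ → ℝ) : Prop where
  L_nonneg : 0 ≤ L
  deriv : ∀ x ∈ Set.Icc (0:ℝ) 1, HasDerivWithinAt u0 (u0' x) (Set.Icc (0:ℝ) 1) x
  b0 : ∀ x ∈ Set.Icc (0:ℝ) 1, |u0 x| ≤ L
  b1 : ∀ x ∈ Set.Icc (0:ℝ) 1, |u0' x| ≤ L
  lip : ∀ x ∈ Set.Icc (0:ℝ) 1, ∀ y ∈ Set.Icc (0:ℝ) 1, |u0' x - u0' y| ≤ L * |x - y|
  z0 : u0' 0 = 0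
  z1 : u0' 1 = 0

/-- source term of the scheme at time level `k` -/
noncomputable def src (b c f : ℝ → ℝ → ℝ) (τ : ℝ) (N : ℕ) (v : ℕ → ℝ) (k j : ℕ) : ℝ :=
  b (j/N) (k*τ) * grad N v j + c (j/N) (k*τ) * v j + f (j/N) (k*τ)

/-- the explicit scheme -/
noncomputable def sch (S : ℝ → ℝ) (b c f : ℝ → ℝ → ℝ) (u0 : ℝ → ℝ) (τ : ℝ) (N : ℕ) : ℕ → ℕ → ℝ
  | 0 => fun j => u0 (j/N)
  | k+1 => fun j => sch S b c f u0 τ N k j + τ * (fdiv S N (sch S b c f u0 τ N k) j +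
      src b c f τ N (sch S b c f u0 τ N k) k j)

/-- one step written with neighbours -/
lemma step_form {lam Lam Hs α : ℝ} {S S' : ℝ → ℝ} (h : Flux lam Lam Hs α S S') {N : ℕ} (hN : 1 ≤ N)
    {μ τ : ℝ} (hτ : τ * (N:ℝ)^2 = μ) (v : ℕ → ℝ) : ∃ a : ℕ → ℝ, (∀ j, lam ≤ a j) ∧ (∀ j, a j ≤ Lam) ∧
      ∀ (β G : ℝ), ∀ j < N, v j + τ * (fdiv S N v j + (β * grad N v j + G)) =
        v j + μ * a j * (v (min (j+1) (N-1)) + v (j-1) - 2 * v j) + μ / N * β * (v j - v (j-1)) + τ * G := by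
  have hN' : (0:ℝ) < N := by exact_mod_cast hN
  choose a a1 a2 a3 using fun j => fdiv_lap h N v j
  refine ⟨a, a1, a2, ?_⟩
  intro β G j hj
  rw [a3]
  unfold lap
  rw [grad_lt hj, ← hτ]
  simp only [grad, dv, Nat.add_sub_cancel]
  field_simp
  ring

lemma sup_step {N : ℕ} (hN : 1 ≤ N) {μ τ lam Lam B X G : ℝ} (hμ : 0 < μ) (hτ : 0 ≤ τ) (hl : 0 < lam)
    (hμL : 8 * μ * Lam ≤ 1) (hB : B ≤ lam * N)
    (v : ℕ → ℝ) (hX : ∀ j < N, |v j| ≤ X) (a β g j) (hj : j < N) (ha : lam ≤ a) (ha' : a ≤ Lam)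
    (hβ : |β| ≤ B) (hg : |g| ≤ G) :
    |v j + μ * a * (v (min (j+1) (N-1)) + v (j-1) - 2 * v j) + μ / N * β * (v j - v (j-1)) + τ * g|
      ≤ X + τ * G := by
  have hN' : (0:ℝ) < N := by exact_mod_cast hN
  have e1 : |β / N| ≤ lam := by
    rw [abs_div, abs_of_pos hN', div_le_iff₀ hN']; linarith
  obtain ⟨e2, e3⟩ := abs_le.mp e1
  have q1 : 0 ≤ μ * a := by nlinarith
  have q2 : 0 ≤ μ * (a - β/N) := mul_nonneg hμ.le (by linarith)
  have q3 : 0 ≤ 1 - 2 * (μ * a) + μ * (β/N) := by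
    have : μ * a ≤ μ * Lam := mul_le_mul_of_nonneg_left ha' hμ.le
    have : μ * (-lam) ≤ μ * (β/N) := mul_le_mul_of_nonneg_left e2 hμ.le
    have : μ * lam ≤ μ * Lam := mul_le_mul_of_nonneg_left (ha.trans ha') hμ.le
    linarith
  have e : v j + μ * a * (v (min (j+1) (N-1)) + v (j-1) - 2 * v j) + μ / N * β * (v j - v (j-1)) + τ * g
    = (1 - 2 * (μ * a) + μ * (β/N)) * v j + μ * a * v (min (j+1) (N-1)) + μ * (a - β/N) * v (j-1) + τ * g := by
    ring
  rw [e]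
  have b1 := abs_le.mp (hX j hj)
  have b2 := abs_le.mp (hX (min (j+1) (N-1)) (by omega))
  have b3 := abs_le.mp (hX (j-1) (by omega))
  have b4 := abs_le.mp hg
  rw [abs_le]
  constructor
  · have := mul_le_mul_of_nonneg_left b1.1 q3
    have := mul_le_mul_of_nonneg_left b2.1 q1
    have := mul_le_mul_of_nonneg_left b3.1 q2
    have := mul_le_mul_of_nonneg_left b4.1 hτ
    nlinarith
  · have := mul_le_mul_of_nonneg_left b1.2 q3
    have := mul_le_mul_of_nonneg_left b2.2 q1
    have := mul_le_mul_of_nonneg_left b3.2 q2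
    have := mul_le_mul_of_nonneg_left b4.2 hτ
    nlinarith

/-- barrier -/
noncomputable def psi (A q : ℝ) (N : ℕ) (d : ℕ) : ℝ := A / N * ∑ i ∈ range d, q ^ i

lemma psi_succ (A q : ℝ) (N d : ℕ) : psi A q N (d+1) = psi A q N d + A / N * q ^ d := by
  unfold psi; rw [sum_range_succ]; ring

lemma grad_step_one {N : ℕ} (hN : 1 ≤ N) {μ τ lam Lam B G A γ : ℝ} (hμ : 0 < μ) (hτ : τ * (N:ℝ)^2 = μ) (hl : 0 < lam)
    (hμL : 8 * μ * Lam ≤ 1) (hB : B ≤ lam * N) (hB0 : 0 ≤ B) (hA : 0 ≤ A) (hγ : lam * γ = B + 1) (hγN : 2 * γ ≤ N)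
    (hq : G ≤ A * (1 - γ/N)^N)
    (v : ℕ → ℝ) (hX : ∀ i < N, ∀ j ≤ i, |v i - v j| ≤ psi A (1-γ/N) N (i-j)) (a β g : ℕ → ℝ)
    (ha : ∀ j, lam ≤ a j) (ha' : ∀ j, a j ≤ Lam)
    (hβ : ∀ j, |β j| ≤ B) (hg : ∀ j < N, |g j| ≤ G) (w : ℕ → ℝ) (hw : ∀ j < N, w j =
      v j + μ * a j * (v (min (j+1) (N-1)) + v (j-1) - 2 * v j) + μ / N * β j * (v j - v (j-1)) + τ * g j) 
    (j d : ℕ) (hi : j + 1 + d < N) : w (j+1+d) - w j ≤ psi A (1-γ/N) N (d+1) := by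
  have hN' : (0:ℝ) < N := by exact_mod_cast hN
  have hγ0 : 0 < γ := by
    by_contra hc
    push Not at hc
    nlinarith
  have hq0 : 0 ≤ 1 - γ/N := by
    rw [sub_nonneg, div_le_one hN']; linarith
  have hq1 : 1 - γ/N ≤ 1 := by
    have : 0 ≤ γ/N := by positivity
    linarith
  set q := 1 - γ/N with hqd
  set P := psi A q N with hP
  have s1 : P (d+2) = P (d+1) + A/N * q^(d+1) := psi_succ _ _ _ _
  have s2 : P (d+1) = P d + A/N * q^d := psi_succ _ _ _ _
  have hqd0 : 0 ≤ q^d := by positivity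
  have hAN : 0 ≤ A/N := by positivity
  have e1 : ∀ j, |β j / N| ≤ lam := by
    intro j
    rw [abs_div, abs_of_pos hN', div_le_iff₀ hN']; linarith [hβ j]
  set i := j+1+d with hid
  have c1 : v (min (i+1) (N-1)) - v j ≤ P (d+2) := by
    by_cases hc : i + 1 < N
    · rw [min_eq_left (by omega)]
      have := (abs_le.mp (hX (i+1) hc j (by omega))).2
      rwa [show i + 1 - j = d + 2 by omega] at this
    · rw [min_eq_right (by omega)]
      have := (abs_le.mp (hX (N-1) (by omega) j (by omega))).2
      rw [show N - 1 - j = d + 1 by omega] at this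
      have : 0 ≤ A/N * q^(d+1) := by positivity
      linarith
  have c2 : v (i-1) - v j ≤ P d := by
    have := (abs_le.mp (hX (i-1) (by omega) j (by omega))).2
    rwa [show i - 1 - j = d by omega] at this
  have c3 : v i - v (min (j+1) (N-1)) ≤ P d := by
    rw [min_eq_left (by omega)]
    have := (abs_le.mp (hX i (by omega) (j+1) (by omega))).2
    rwa [show i - (j+1) = d by omega] at this
  have c0 : v i - v j ≤ P (d+1) := by
    have := (abs_le.mp (hX i (by omega) j (by omega))).2
    rwa [show i - j = d + 1 by omega] at this
  have c4 : v i - v (j-1) ≤ P (d+2) := by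
    rcases Nat.eq_zero_or_pos j with hj | hj
    · have e : j - 1 = j := by omega
      rw [e]
      have : 0 ≤ A/N * q^(d+1) := by positivity
      linarith
    · have := (abs_le.mp (hX i (by omega) (j-1) (by omega))).2
      rwa [show i - (j-1) = d + 2 by omega] at this
  rw [hw i (by omega), hw j (by omega)]
  have hai := ha i
  have haj := ha j
  obtain ⟨bi1, bi2⟩ := abs_le.mp (e1 i)
  obtain ⟨bj1, bj2⟩ := abs_le.mp (e1 j)
  have m1 := mul_le_mul_of_nonneg_left (ha' i) hμ.le
  have m2 := mul_le_mul_of_nonneg_left (ha' j) hμ.le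
  have m3 := mul_le_mul_of_nonneg_left (hai.trans (ha' i)) hμ.le
  have m4 := mul_le_mul_of_nonneg_left bi1 hμ.le
  have m5 := mul_le_mul_of_nonneg_left bj1 hμ.le
  have k0 : 0 ≤ 1 - 2 * (μ * a i) + μ * (β i/N) - 2 * (μ * a j) + μ * (β j / N) := by linarith
  have k1 : 0 ≤ μ * a i := mul_nonneg hμ.le (by linarith)
  have k2 : 0 ≤ μ * (a i - β i / N) := mul_nonneg hμ.le (by linarith)
  have k3 : 0 ≤ μ * a j := mul_nonneg hμ.le (by linarith)
  have k4 : 0 ≤ μ * (a j - β j / N) := mul_nonneg hμ.le (by linarith)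
  have t0 := mul_le_mul_of_nonneg_left c0 k0
  have t1 := mul_le_mul_of_nonneg_left c1 k1
  have t2 := mul_le_mul_of_nonneg_left c2 k2
  have t3 := mul_le_mul_of_nonneg_left c3 k3
  have t4 := mul_le_mul_of_nonneg_left c4 k4
  have hτ' : τ = μ / (N:ℝ)^2 := by rw [← hτ]; field_simp
  have hτ0 : 0 ≤ τ := by rw [hτ']; positivity
  have g1 := mul_le_mul_of_nonneg_left (abs_le.mp (hg i (by omega))).2 hτ0
  have g2 := mul_le_mul_of_nonneg_left (abs_le.mp (hg j (by omega))).1 hτ0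
  have key : μ * a i * (P (d+2) + P d - 2 * P (d+1)) + μ * a j * (P (d+2) + P d - 2 * P (d+1)) +
    μ * (β i / N) * (P (d+1) - P d) + μ * (β j / N) * (P (d+1) - P (d+2)) + 2 * (τ * G) ≤ 0 := by
    have r1 : P (d+2) + P d - 2 * P (d+1) = - (A/N * q^d * (γ/N)) := by
      rw [s1, s2, pow_succ]; rw [show γ/N = 1 - q by rw [hqd]; ring]; ring
    have r2 : P (d+1) - P d = A/N*q^d := by rw [s2]; ring
    have r3 : P (d+1) - P (d+2) = -(A/N*q^d*q) := by rw [s1, pow_succ]; ring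
    rw [r1, r2, r3]
    set Z := A/N*q^d with hZ
    have hZ0 : 0 ≤ Z := by positivity
    have bbi := abs_le.mp (hβ i)
    have bbj := abs_le.mp (hβ j)
    have y1 : μ * (β i / N) * Z ≤ μ * (B / N) * Z := by
      have := bbi.2
      gcongr
    have y2 : μ * (β j / N) * (-(Z*q)) ≤ μ * (B / N) * Z := by
      have : -(β j) * q ≤ B := by
        have : -(β j) * q ≤ B * q := mul_le_mul_of_nonneg_right (by linarith) hq0
        have : B * q ≤ B * 1 := mul_le_mul_of_nonneg_left hq1 hB0
        linarith
      calc μ * (β j / N) * (-(Z*q)) = μ * ((-(β j) * q) / N) * Z := by ring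
        _ ≤ _ := by gcongr
    have y3 : μ * lam * (Z * (γ/N)) ≤ μ * a i * (Z * (γ/N)) := by gcongr
    have y4 : μ * lam * (Z * (γ/N)) ≤ μ * a j * (Z * (γ/N)) := by gcongr
    have y5 : μ * lam * (Z * (γ/N)) = μ * (B/N) * Z + μ * (Z/N) := by
      calc μ * lam * (Z * (γ/N)) = μ * ((lam*γ)/N) * Z := by ring
        _ = _ := by rw [hγ]; ring
    have y6 : τ * G ≤ μ * (Z/N) := by
      have : G ≤ A * q^d := hq.trans (mul_le_mul_of_nonneg_left (pow_le_pow_of_le_one hq0 hq1 (by omega)) hA)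
      calc τ * G ≤ τ * (A * q^d) := mul_le_mul_of_nonneg_left this hτ0
        _ = _ := by rw [hτ', hZ]; ring
    linarith
  have id1 : μ / N * β i * (v i - v (i-1)) = μ * (β i / N) * (v i - v (i-1)) := by ring
  have id2 : μ / N * β j * (v j - v (j-1)) = μ * (β j / N) * (v j - v (j-1)) := by ring
  rw [id1, id2]
  generalize β i / N = x at *
  generalize β j / N = y at *
  linarith

lemma grad_step {N : ℕ} (hN : 1 ≤ N) {μ τ lam Lam B G A γ : ℝ} (hμ : 0 < μ) (hτ : τ * (N:ℝ)^2 = μ) (hl : 0 < lam)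
    (hμL : 8 * μ * Lam ≤ 1) (hB : B ≤ lam * N) (hB0 : 0 ≤ B) (hA : 0 ≤ A) (hγ : lam * γ = B + 1) (hγN : 2 * γ ≤ N)
    (hq : G ≤ A * (1 - γ/N)^N)
    (v : ℕ → ℝ) (hX : ∀ i < N, ∀ j ≤ i, |v i - v j| ≤ psi A (1-γ/N) N (i-j)) (a β g : ℕ → ℝ)
    (ha : ∀ j, lam ≤ a j) (ha' : ∀ j, a j ≤ Lam)
    (hβ : ∀ j, |β j| ≤ B) (hg : ∀ j < N, |g j| ≤ G) (w : ℕ → ℝ) (hw : ∀ j < N, w j =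
      v j + μ * a j * (v (min (j+1) (N-1)) + v (j-1) - 2 * v j) + μ / N * β j * (v j - v (j-1)) + τ * g j) :
    ∀ i < N, ∀ j ≤ i, |w i - w j| ≤ psi A (1-γ/N) N (i-j) := by
  intro i hi j hj
  rcases hj.eq_or_lt with rfl | hj
  · simp [psi]
  obtain ⟨d, rfl⟩ := Nat.exists_eq_add_of_le (show j + 1 ≤ i by omega)
  rw [show j + 1 + d - j = d + 1 by omega]
  have h1 := grad_step_one hN hμ hτ hl hμL hB hB0 hA hγ hγN hq v hX a β g ha ha' hβ hg w hw j d hi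
  have h2 := grad_step_one hN hμ hτ hl hμL hB hB0 hA hγ hγN hq (fun i => -v i)
    (fun i hi j hj => by rw [show - v i - - v j = -(v i - v j) by ring, abs_neg]; exact hX i hi j hj) a β (fun j => - g j) ha ha' hβ
    (fun j hj => by rw [abs_neg]; exact hg j hj)
    (fun j => - w j) (fun j hj => by simp only [hw j hj]; ring) j d hi
  rw [abs_le]
  constructor <;> linarith

end FB

namespace FB
open Finset

lemma psi_le {A q : ℝ} {N : ℕ} (hA : 0 ≤ A) (hq0 : 0 ≤ q) (hq1 : q ≤ 1) (d : ℕ) :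
    psi A q N d ≤ A / N * d := by
  unfold psi
  apply mul_le_mul_of_nonneg_left _ (by positivity)
  calc ∑ i ∈ range d, q^i ≤ ∑ i ∈ range d, (1:ℝ) := sum_le_sum (fun i _ => pow_le_one₀ hq0 hq1)
    _ = d := by simp

lemma psi_ge {A q : ℝ} {N : ℕ} (hA : 0 ≤ A) (hq0 : 0 ≤ q) (hq1 : q ≤ 1) (d : ℕ) (hd : d ≤ N) :
    A * q^N / N * d ≤ psi A q N d := by
  unfold psi
  calc A * q^N / N * d = A / N * ∑ i ∈ range d, q^N := by simp; ring
    _ ≤ _ := by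
      apply mul_le_mul_of_nonneg_left _ (by positivity)
      exact sum_le_sum (fun i hi => pow_le_pow_of_le_one hq0 hq1 (by rw [Finset.mem_range] at hi; omega))

lemma Ini.diff {L : ℝ} {u0 u0' : ℝ → ℝ} (h : Ini L u0 u0') {x y : ℝ} (hx : 0 ≤ x) (hxy : x < y) (hy : y ≤ 1) :
    ∃ ξ ∈ Set.Icc x y, u0 y - u0 x = u0' ξ * (y - x) := by
  have hs : Set.Icc x y ⊆ Set.Icc 0 1 := Set.Icc_subset_Icc hx hy
  obtain ⟨c, hc, he⟩ := exists_hasDerivAt_eq_slope u0 u0' hxy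
    (fun z hz => ((h.deriv z (hs hz)).continuousWithinAt).mono hs)
    (fun z hz => (h.deriv z (hs ⟨hz.1.le, hz.2.le⟩)).hasDerivAt (Icc_mem_nhds (by linarith [hz.1]) (by linarith [hz.2])))
  refine ⟨c, ⟨hc.1.le, hc.2.le⟩, ?_⟩
  rw [he]; field_simp [sub_ne_zero.mpr hxy.ne']

lemma Ini.lipu {L : ℝ} {u0 u0' : ℝ → ℝ} (h : Ini L u0 u0') {x y : ℝ} (hx : 0 ≤ x) (hxy : x ≤ y) (hy : y ≤ 1) :
    |u0 y - u0 x| ≤ L * (y - x) := by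
  rcases hxy.eq_or_lt with rfl | hxy
  · simp
  obtain ⟨ξ, h1, h2⟩ := h.diff hx hxy hy
  rw [h2, abs_mul, abs_of_pos (by linarith : 0 < y - x)]
  exact mul_le_mul_of_nonneg_right (h.b1 _ ⟨hx.trans h1.1, h1.2.trans hy⟩) (by linarith)

/-- discrete initial second differences are bounded -/
lemma Ini.lap {L : ℝ} {u0 u0' : ℝ → ℝ} (h : Ini L u0 u0') {N : ℕ} (hN : 1 ≤ N) :
    ∀ j < N, |FB.lap N (fun j => u0 (j/N)) j| ≤ 2 * L := by
  have hN' : (0:ℝ) < N := by exact_mod_cast hN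
  have key : ∀ j ≤ N, ∃ ξ ∈ Set.Icc (0:ℝ) 1, ((j:ℝ) - 1)/N ≤ ξ ∧ ξ ≤ j/N ∧ grad N (fun j => u0 (j/N)) j = u0' ξ := by
    intro j hj
    rcases Nat.eq_zero_or_pos j with rfl | hj0
    · refine ⟨0, by simp, ?_, by simp, by rw [grad_zero, h.z0]⟩
      rw [div_le_iff₀ hN']; simp
    rcases hj.eq_or_lt with rfl | hj
    · refine ⟨1, by simp, ?_, ?_, by rw [grad_top, h.z1]⟩
      · rw [div_le_iff₀ hN']; simp
      · rw [div_self hN'.ne']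
    have c : ((j-1:ℕ):ℝ) = j - 1 := by rw [Nat.cast_sub hj0]; simp
    have j1 : (1:ℝ) ≤ j := by exact_mod_cast hj0
    have jN : (j:ℝ) ≤ N := by exact_mod_cast hj.le
    have a1 : 0 ≤ ((j:ℝ)-1)/N := div_nonneg (by linarith) hN'.le
    have a2 : (j:ℝ)/N ≤ 1 := by rw [div_le_one hN']; exact jN
    obtain ⟨ξ, h1, h2⟩ := h.diff (x := ((j:ℝ)-1)/N) (y := j/N) a1 (by gcongr; linarith) a2
    refine ⟨ξ, ⟨a1.trans h1.1, h1.2.trans a2⟩, h1.1, h1.2, ?_⟩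
    rw [grad_lt hj]
    simp only [dv]
    rw [c, h2]; field_simp; ring
  intro j hj
  obtain ⟨ξ, m1, p1, p2, p3⟩ := key j hj.le
  obtain ⟨η, m2, r1, r2, r3⟩ := key (j+1) hj
  unfold FB.lap
  rw [p3, r3, abs_mul, abs_of_pos hN']
  have := h.lip η m2 ξ m1
  have : |η - ξ| ≤ 2 / N := by
    rw [abs_le]
    push_cast at r1 r2
    rw [add_sub_cancel_right] at r1
    have e1 : ((j:ℝ)+1)/N - ((j:ℝ)-1)/N = 2/N := by ring
    have : (0:ℝ) ≤ 2/N := by positivity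
    constructor <;> linarith
  have := mul_le_mul_of_nonneg_left this h.L_nonneg
  calc |u0' η - u0' ξ| * N ≤ (L * (2/N)) * N := by gcongr; linarith
    _ = 2 * L := by field_simp

lemma exp_pow_lower {γ : ℝ} {N : ℕ} (hN : 1 ≤ N) (hγ : 0 ≤ γ) (hγN : 2 * γ ≤ N) :
    Real.exp (-(2*γ)) ≤ (1 - γ/N)^N := by
  have hN' : (0:ℝ) < N := by exact_mod_cast hN
  set x := γ/N with hx
  have hx0 : 0 ≤ x := by positivity
  have hx1 : x ≤ 1/2 := by rw [hx, div_le_iff₀ hN']; linarith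
  have h1 : Real.exp (-(2*x)) ≤ 1 - x := by
    rw [Real.exp_neg, inv_le_comm₀ (Real.exp_pos _) (by linarith)]
    have := Real.add_one_le_exp (2*x)
    have h3 : (1-x)⁻¹ ≤ 2*x+1 := by
      rw [inv_le_comm₀ (by linarith) (by linarith), inv_le_iff_one_le_mul₀ (by linarith)]
      nlinarith
    linarith
  calc Real.exp (-(2*γ)) = (Real.exp (-(2*x)))^N := by
        rw [← Real.exp_nat_mul]; congr 1; rw [hx]; field_simp
    _ ≤ _ := pow_le_pow_left₀ (Real.exp_pos _).le h1 N

set_option maxHeartbeats 1000000 in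
/-- uniform bounds for the scheme -/
theorem sch_bounds {lam Lam Hs α : ℝ} {S S' : ℝ → ℝ} (h : Flux lam Lam Hs α S S') {Q L T : ℝ} {b c f : ℝ → ℝ → ℝ}
    {u0 u0' : ℝ → ℝ} (hc : Coef α Q b c f) (hi : Ini L u0 u0') (hT : 0 < T)
    {μ : ℝ} (hμ : 0 < μ) (hμL : 8 * μ * Lam ≤ 1) :
    ∃ M : ℝ, 0 ≤ M ∧ ∃ N0 : ℕ, 1 ≤ N0 ∧ ∀ N ≥ N0, ∀ k : ℕ, k * (μ / (N:ℝ)^2) ≤ T →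
      (∀ j < N, |sch S b c f u0 (μ/(N:ℝ)^2) N k j| ≤ M) ∧
      (∀ j ≤ N, |grad N (sch S b c f u0 (μ/(N:ℝ)^2) N k) j| ≤ M) ∧
      (∀ j < N, |lap N (sch S b c f u0 (μ/(N:ℝ)^2) N k) j| ≤ M) := by
  have hl := h.lam_pos
  have hQ := hc.Q_nonneg
  have hL := hi.L_nonneg
  set X := Real.exp (Q*T) * (L + T * Q) with hX
  have hX0 : 0 ≤ X := by positivity
  set G := Q * X + Q with hG
  have hG0 : 0 ≤ G := by positivity
  set γ := (Q+1)/lam with hγ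
  have hγ0 : 0 < γ := by positivity
  have hγ' : lam * γ = Q + 1 := by rw [hγ]; field_simp
  set A := (G + L) * Real.exp (2*γ) with hA
  have hA0 : 0 ≤ A := by positivity
  obtain ⟨M, hM, N1, hN1, main⟩ := lap_bound h hμ (by nlinarith [h.lam_le, hμ, hl] : 4 * μ * Lam ≤ 1) (Q*A+G) (Q*(2*A+X+2)) A (2*L)
    (by positivity) (by positivity)
  obtain ⟨N2, hN2⟩ := exists_nat_ge (2*γ)
  obtain ⟨N3, hN3⟩ := exists_nat_ge (Q/lam)
  refine ⟨max M (max A X), le_max_of_le_left hM.le, max N1 (max N2 N3), le_max_of_le_left hN1, ?_⟩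
  intro N hN n hn
  have a1 : N1 ≤ N := (le_max_left _ _).trans hN
  have a2 : N2 ≤ N := ((le_max_left _ _).trans (le_max_right _ _)).trans hN
  have a3 : N3 ≤ N := ((le_max_right _ _).trans (le_max_right _ _)).trans hN
  have hNp : 1 ≤ N := hN1.trans a1
  have hN' : (0:ℝ) < N := by exact_mod_cast hNp
  set τ := μ / (N:ℝ)^2 with hτd
  have hτ0 : 0 < τ := by positivity
  have hτ : τ * (N:ℝ)^2 = μ := by rw [hτd]; field_simp
  have hγN : 2 * γ ≤ N := hN2.trans (by exact_mod_cast a2)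
  have hBN : Q ≤ lam * N := by
    rw [div_le_iff₀ hl] at hN3
    have : (N3:ℝ) ≤ N := by exact_mod_cast a3
    nlinarith
  set u := sch S b c f u0 τ N with hu
  have hstep : ∀ k j, u (k+1) j = u k j + τ * (fdiv S N (u k) j + src b c f τ N (u k) k j) := fun k j => rfl
  -- step form
  have hform : ∀ k, ∃ a : ℕ → ℝ, (∀ j, lam ≤ a j) ∧ (∀ j, a j ≤ Lam) ∧ ∀ j < N, u (k+1) j =
      u k j + μ * a j * (u k (min (j+1) (N-1)) + u k (j-1) - 2 * u k j) + μ / N * b (j/N) (k*τ) * (u k j - u k (j-1))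
       + τ * (c (j/N) (k*τ) * u k j + f (j/N) (k*τ)) := by
    intro k
    obtain ⟨a, e1, e2, e3⟩ := step_form h hNp hτ (u k)
    refine ⟨a, e1, e2, fun j hj => ?_⟩
    rw [← e3 _ _ j hj, hstep]; unfold src; ring
  -- sup bound
  have sup1 : ∀ k : ℕ, ∀ j < N, |u k j| ≤ (1 + τ*Q)^k * (L + k*τ*Q) := by
    intro k
    induction k with
    | zero =>
      intro j hj
      simp only [pow_zero, Nat.cast_zero, zero_mul, add_zero, one_mul]
      apply hi.b0
      constructor
      · positivity
      · rw [div_le_one hN']; exact_mod_cast hj.le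
    | succ k ih =>
      intro j hj
      obtain ⟨a, e1, e2, e3⟩ := hform k
      rw [e3 j hj]
      set Y := (1 + τ*Q)^k * (L + k*τ*Q) with hY
      have := sup_step hNp (τ := τ) (lam := lam) (Lam := Lam) hμ hτ0.le hl hμL hBN (u k) ih (a j) (b (j/N) (k*τ)) (c (j/N) (k*τ) * u k j + f (j/N) (k*τ)) j hj
        (e1 j) (e2 j) (hc.bb _ _) (G := Q * Y + Q) (by
          refine (abs_add_le _ _).trans (add_le_add ?_ (hc.bf _ _))
          rw [abs_mul]
          exact mul_le_mul (hc.bc _ _) (ih j hj) (abs_nonneg _) hQ)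
      refine this.trans ?_
      have one : (1:ℝ) ≤ (1+τ*Q)^(k+1) := one_le_pow₀ (by nlinarith [mul_nonneg hτ0.le hQ])
      have e : (1+τ*Q)^(k+1) * (L + ((k+1:ℕ):ℝ)*τ*Q) = (1 + τ*Q) * Y + (1+τ*Q)^(k+1) * (τ*Q) := by
        rw [hY, pow_succ]; push_cast; ring
      rw [e]
      have : τ * Q ≤ (1+τ*Q)^(k+1) * (τ*Q) := le_mul_of_one_le_left (by positivity) one
      linarith
  have sup2 : ∀ k ≤ n, ∀ j < N, |u k j| ≤ X := by
    intro k hk j hj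
    have hkT : k * τ ≤ T := le_trans (mul_le_mul_of_nonneg_right (by exact_mod_cast hk) hτ0.le) hn
    refine (sup1 k j hj).trans ?_
    have e1 : (1 + τ*Q)^k ≤ Real.exp (Q*T) := by
      calc (1+τ*Q)^k ≤ (Real.exp (τ*Q))^k := pow_le_pow_left₀ (by positivity) (by linarith [Real.add_one_le_exp (τ*Q)]) k
        _ = Real.exp (Q * (k*τ)) := by rw [← Real.exp_nat_mul]; congr 1; ring
        _ ≤ _ := Real.exp_le_exp.mpr (mul_le_mul_of_nonneg_left hkT hQ)
    rw [hX]
    gcongr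
  have q0 : 0 ≤ 1 - γ/N := by
    rw [sub_nonneg, div_le_one hN']; linarith
  have q1 : 1 - γ/N ≤ 1 := by
    have : 0 ≤ γ/N := by positivity
    linarith
  have hqG : G + L ≤ A * (1-γ/N)^N := by
    have := mul_le_mul_of_nonneg_left (exp_pow_lower hNp hγ0.le hγN) hA0
    refine le_trans (le_of_eq ?_) this
    rw [hA, mul_assoc, ← Real.exp_add]; simp
  have bar : ∀ k ≤ n, ∀ i < N, ∀ j ≤ i, |u k i - u k j| ≤ psi A (1-γ/N) N (i-j) := by
    intro k
    induction k with
    | zero =>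
      intro _ i hiN j hj
      have := hi.lipu (x := j/N) (y := i/N) (by positivity) (by gcongr) (by rw [div_le_one hN']; exact_mod_cast hiN.le)
      refine this.trans ?_
      refine le_trans ?_ (psi_ge hA0 q0 q1 (i-j) (by omega))
      rw [Nat.cast_sub hj]
      have : 0 ≤ (i:ℝ) - j := by rw [sub_nonneg]; exact_mod_cast hj
      calc L * (i/N - j/N) = L / N * (i - j) := by ring
        _ ≤ _ := by
          apply mul_le_mul_of_nonneg_right _ this
          gcongr; linarith
    | succ k ih =>
      intro hk
      obtain ⟨a, e1, e2, e3⟩ := hform k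
      exact grad_step hNp hμ hτ hl hμL hBN hQ hA0 hγ' hγN (G := G) (by linarith) (u k) (ih (by omega)) a (fun j => b (j/N) (k*τ)) 
        (fun j => c (j/N) (k*τ) * u k j + f (j/N) (k*τ)) e1 e2 (fun j => hc.bb _ _) (fun j hj => by
          refine (abs_add_le _ _).trans (add_le_add ?_ (hc.bf _ _))
          rw [abs_mul]
          exact mul_le_mul (hc.bc _ _) (sup2 k (by omega) j hj) (abs_nonneg _) hQ) (u (k+1)) e3
  have lipk : ∀ k ≤ n, ∀ i < N, ∀ j < N, |u k i - u k j| ≤ A * (|(i:ℝ) - j| / N) := by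
    have : ∀ k ≤ n, ∀ i < N, ∀ j ≤ i, |u k i - u k j| ≤ A * (|(i:ℝ) - j| / N) := by
      intro k hk i hi j hj
      refine (bar k hk i hi j hj).trans ((psi_le hA0 q0 q1 _).trans ?_)
      rw [Nat.cast_sub hj, abs_of_nonneg (by rw [sub_nonneg]; exact_mod_cast hj)]
      apply le_of_eq; ring
    intro k hk i hi j hj
    rcases le_total j i with hij | hij
    · exact this k hk i hi j hij
    · rw [abs_sub_comm, abs_sub_comm (i:ℝ)]; exact this k hk j hj i hij
  have grd : ∀ k ≤ n, ∀ j ≤ N, |grad N (u k) j| ≤ A := by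
    intro k hk j hj
    rcases hj.eq_or_lt with rfl | hj
    · rw [grad_top]; simpa using hA0
    rw [grad_lt hj]
    rcases Nat.eq_zero_or_pos j with rfl | hj0
    · simpa [dv] using hA0
    have := lipk k hk j hj (j-1) (by omega)
    rw [Nat.cast_sub hj0] at this
    simp only [Nat.cast_one, sub_sub_cancel, abs_one] at this
    unfold dv
    rw [abs_mul, abs_of_pos hN']
    calc _ ≤ A * (1/N) * N := mul_le_mul_of_nonneg_right this hN'.le
      _ = A := by field_simp
  have lp := main N a1 τ hτ u (fun k j => src b c f τ N (u k) k j) n (fun k _ j _ => hstep k j) ?_ grd ?_ ?_ n le_rfl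
  · exact ⟨fun j hj => (sup2 n le_rfl j hj).trans (le_max_of_le_right (le_max_right _ _)),
      fun j hj => (grd n le_rfl j hj).trans (le_max_of_le_right (le_max_left _ _)),
      fun j hj => (lp j hj).trans (le_max_left _ _)⟩
  · intro k hk j hj
    unfold src
    refine (abs_add_le _ _).trans ?_
    refine (add_le_add (abs_add_le _ _) (hc.bf _ _)).trans ?_
    rw [abs_mul, abs_mul, hG]
    have := mul_le_mul (hc.bb (j/N) (k*τ)) (grd k hk.le j hj.le) (abs_nonneg _) hQ
    have := mul_le_mul (hc.bc (j/N) (k*τ)) (sup2 k hk.le j hj) (abs_nonneg _) hQ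
    linarith
  · exact hi.lap hNp
  · intro k hk hlap i hi j hj
    set r := |(i:ℝ) - j| / N with hr
    have hr0 : 0 ≤ r := by positivity
    have hr1 : r ≤ 1 := by
      rw [hr, div_le_one hN', abs_le]
      have : (i:ℝ) ≤ N := by exact_mod_cast hi.le
      have : (j:ℝ) ≤ N := by exact_mod_cast hj.le
      have : (0:ℝ) ≤ i := by positivity
      have : (0:ℝ) ≤ j := by positivity
      constructor <;> linarith
    have hrα : r ≤ r^α := by
      calc r = r^(1:ℝ) := (Real.rpow_one r).symm
        _ ≤ r^α := Real.rpow_le_rpow_of_exponent_ge_of_imp hr0 hr1 h.α_le (fun _ e => absurd e one_ne_zero)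
    have hrr : |(i:ℝ)/N - j/N| = r := by rw [hr, ← sub_div, abs_div, abs_of_pos hN']
    have z1 := hc.hb (i/N) (j/N) (k*τ)
    have z2 := hc.hc (i/N) (j/N) (k*τ)
    have z3 := hc.hf (i/N) (j/N) (k*τ)
    rw [hrr] at z1 z2 z3
    have z4 : |grad N (u k) i - grad N (u k) j| ≤ M * r := by
      refine (grad_lip hNp (u k) M hlap i j hi.le hj.le).trans (le_of_eq ?_)
      rw [hr]; ring
    have z5 := lipk k hk.le i hi j hj
    have z6 := grd k hk.le i hi.le
    have z7 := sup2 k hk.le i hi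
    have e : src b c f τ N (u k) k i - src b c f τ N (u k) k j =
      (b (i/N) (k*τ) - b (j/N) (k*τ)) * grad N (u k) i + b (j/N) (k*τ) * (grad N (u k) i - grad N (u k) j)
      + (c (i/N) (k*τ) - c (j/N) (k*τ)) * u k i + c (j/N) (k*τ) * (u k i - u k j) + (f (i/N) (k*τ) - f (j/N) (k*τ)) := by
      unfold src; ring
    rw [e]
    have hrp : 0 ≤ r^α := by positivity
    have p1 := mul_le_mul z1 z6 (abs_nonneg _) (by positivity)
    have p2 := mul_le_mul (hc.bb (j/N) (k*τ)) z4 (abs_nonneg _) hQ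
    have p3 := mul_le_mul z2 z7 (abs_nonneg _) (by positivity)
    have p4 := mul_le_mul (hc.bc (j/N) (k*τ)) z5 (abs_nonneg _) hQ
    rw [← abs_mul] at p1 p2 p3 p4
    refine (abs_add_le _ _).trans ((add_le_add ((abs_add_le _ _).trans (add_le_add ((abs_add_le _ _).trans
      (add_le_add ((abs_add_le _ _).trans (add_le_add p1 p2)) p3)) p4)) z3).trans ?_)
    have p5 : Q * (M * r) ≤ Q * (M * r^α) := by gcongr
    have p6 : Q * (A * r) ≤ Q * (A * r^α) := by gcongr
    have p7 : 0 ≤ Q * M * (2*A+X+1) * r^α := by positivity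
    have p8 : 0 ≤ Q * r^α := by positivity
    have p9 : Q * (2*A+X+2) * (1+M) * r^α = Q * r^α * A + Q * (M * r^α) + Q * r^α * X + Q * (A * r^α)
      + Q * r^α + Q * M * (2*A+X+1) * r^α + Q * r^α := by ring
    rw [p9]
    linarith

end FB

namespace FB
open Finset Filter

lemma ascoli {X : Type*} [PseudoMetricSpace X] {K : Set X} (hK : IsCompact K) (F : ℕ → X → ℝ × ℝ) (M : ℝ) (N0 : ℕ)
    (hM : ∀ N ≥ N0, ∀ p ∈ K, ‖F N p‖ ≤ M)
    (heq : ∀ ε > 0, ∃ δ > 0, ∃ N1 : ℕ, ∀ N ≥ N1, ∀ p ∈ K, ∀ q ∈ K, dist p q < δ → dist (F N p) (F N q) ≤ ε) :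
    ∃ φ : ℕ → ℕ, StrictMono φ ∧ ∃ F' : X → ℝ × ℝ, ContinuousOn F' K ∧
      ∀ ε > 0, ∀ᶠ n in atTop, ∀ p ∈ K, dist (F (φ n) p) (F' p) ≤ ε := by
  have hle : (hyperfilter ℕ : Filter ℕ) ≤ atTop := Nat.hyperfilter_le_atTop
  have ex : ∀ p, ∃ z, p ∈ K → Tendsto (fun N => F N p) (hyperfilter ℕ : Filter ℕ) (nhds z) := by
    intro p
    by_cases hp : p ∈ K
    · have hc : IsCompact (Metric.closedBall (0:ℝ×ℝ) M) := isCompact_closedBall 0 M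
      obtain ⟨z, _, hz⟩ := hc.ultrafilter_le_nhds ((hyperfilter ℕ).map (fun N => F N p)) (by
        rw [le_principal_iff, Ultrafilter.mem_coe, Ultrafilter.mem_map]
        have : ∀ᶠ N in (hyperfilter ℕ : Filter ℕ), N ≥ N0 := hle (eventually_ge_atTop N0)
        filter_upwards [this] with N hN
        simpa using hM N hN p hp)
      exact ⟨z, fun _ => hz⟩
    · exact ⟨0, fun h => absurd h hp⟩
  choose F' hF' using ex
  have eq' : ∀ ε > 0, ∃ δ > 0, ∀ p ∈ K, ∀ q ∈ K, dist p q < δ → dist (F' p) (F' q) ≤ ε := by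
    intro ε hε
    obtain ⟨δ, hδ, N1, h1⟩ := heq ε hε
    refine ⟨δ, hδ, fun p hp q hq hpq => ?_⟩
    refine le_of_tendsto ((hF' p hp).dist (hF' q hq)) ?_
    filter_upwards [hle (eventually_ge_atTop N1)] with N hN
    exact h1 N hN p hp q hq hpq
  have close : ∀ ε > 0, ∃ᶠ N in atTop, ∀ p ∈ K, dist (F N p) (F' p) ≤ ε := by
    intro ε hε
    obtain ⟨δ1, hδ1, N1, h1⟩ := heq (ε/3) (by positivity)
    obtain ⟨δ2, hδ2, h2⟩ := eq' (ε/3) (by positivity)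
    obtain ⟨t, htK, htf, htc⟩ := hK.finite_cover_balls (lt_min hδ1 hδ2)
    have ev : ∀ᶠ N in (hyperfilter ℕ : Filter ℕ), ∀ q ∈ t, dist (F N q) (F' q) < ε/3 := by
      rw [htf.eventually_all]
      intro q hq
      exact (hF' q (htK hq)).eventually (Metric.ball_mem_nhds _ (by positivity))
    have ev2 : ∀ᶠ N in (hyperfilter ℕ : Filter ℕ), ∀ p ∈ K, dist (F N p) (F' p) ≤ ε := by
      filter_upwards [ev, hle (eventually_ge_atTop N1)] with N hN hN1 p hp
      obtain ⟨q, hq, hpq⟩ := Set.mem_iUnion₂.mp (htc hp)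
      rw [Metric.mem_ball] at hpq
      have a1 := h1 N hN1 p hp q (htK hq) (hpq.trans_le (min_le_left _ _))
      have a2 := hN q hq
      have a3 := h2 p hp q (htK hq) (hpq.trans_le (min_le_right _ _))
      rw [dist_comm] at a3
      have := dist_triangle4 (F N p) (F N q) (F' q) (F' p)
      linarith
    exact (ev2.frequently).filter_mono hle
  obtain ⟨φ, hφ, hφc⟩ := extraction_forall_of_frequently (P := fun n N => ∀ p ∈ K, dist (F N p) (F' p) ≤ 1/((n:ℝ)+1))
    (fun n => close _ (by positivity))
  refine ⟨φ, hφ, F', ?_, ?_⟩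
  · rw [Metric.continuousOn_iff]
    intro p hp ε hε
    obtain ⟨δ, hδ, h⟩ := eq' (ε/2) (by positivity)
    exact ⟨δ, hδ, fun q hq hqp => (h q hq p hp hqp).trans_lt (by linarith)⟩
  · intro ε hε
    filter_upwards [(tendsto_one_div_add_atTop_nhds_zero_nat (𝕜 := ℝ)).eventually (Iic_mem_nhds hε)] with n hn p hp
    exact (hφc n p hp).trans hn

/-- index of the cell -/
noncomputable def cel (N : ℕ) (x : ℝ) : ℕ := min ⌊x*N⌋₊ (N-1)

lemma cel_lt {N : ℕ} (hN : 1 ≤ N) (x : ℝ) : cel N x < N := by unfold cel; omega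

lemma cel_le {N : ℕ} (hN : 1 ≤ N) {x : ℝ} (hx : x ∈ Set.Icc (0:ℝ) 1) : (cel N x : ℝ) / N ≤ x := by
  have hN' : (0:ℝ) < N := by exact_mod_cast hN
  rw [div_le_iff₀ hN']
  refine le_trans ?_ (Nat.floor_le (mul_nonneg hx.1 hN'.le))
  exact_mod_cast min_le_left _ _

lemma le_cel {N : ℕ} (hN : 1 ≤ N) {x : ℝ} (hx : x ∈ Set.Icc (0:ℝ) 1) : x ≤ (cel N x : ℝ) / N + 1/N := by
  have hN' : (0:ℝ) < N := by exact_mod_cast hN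
  rw [← add_div, le_div_iff₀ hN']
  unfold cel
  rcases le_total ⌊x*N⌋₊ (N-1) with h | h
  · rw [min_eq_left h]; exact (Nat.lt_floor_add_one _).le
  · rw [min_eq_right h, Nat.cast_sub hN]; simp; nlinarith [hx.2]

lemma cel_grid {N : ℕ} {j : ℕ} (hj : j < N) : cel N ((j:ℝ)/N) = j := by
  have hN' : (0:ℝ) < N := by exact_mod_cast (by omega : 0 < N)
  unfold cel
  rw [div_mul_cancel₀ _ hN'.ne', Nat.floor_natCast, min_eq_left (by omega)]

lemma cel_diff {N : ℕ} (hN : 1 ≤ N) {x y : ℝ} (hx : x ∈ Set.Icc (0:ℝ) 1) (hy : y ∈ Set.Icc (0:ℝ) 1) :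
    |((cel N x : ℝ) - cel N y) / N - (x - y)| ≤ 1/N := by
  have a1 := cel_le hN hx
  have a2 := le_cel hN hx
  have a3 := cel_le hN hy
  have a4 := le_cel hN hy
  rw [sub_div, abs_le]
  constructor <;> linarith

/-- discrete Taylor -/
lemma disc_taylor {N : ℕ} (hN : 1 ≤ N) (v : ℕ → ℝ) (M : ℝ) (hM : ∀ j < N, |lap N v j| ≤ M) (i j : ℕ) (hi : i < N)
    (hj : j < N) : |v j - v i - ((j:ℝ) - i)/N * grad N v i| ≤ M * (((j:ℝ) - i)/N)^2 := by
  have hN' : (0:ℝ) < N := by exact_mod_cast hN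
  have hM0 : 0 ≤ M := (abs_nonneg _).trans (hM 0 (by omega))
  have st : ∀ l, l + 1 < N → v (l+1) - v l = grad N v (l+1) / N := by
    intro l hl
    rw [grad_lt hl]; unfold dv; simp; field_simp
  have up : ∀ k, i + k < N → |v (i+k) - v i - (k:ℝ)/N * grad N v i| ≤ M * ((k:ℝ)/N)^2 := by
    intro k
    induction k with
    | zero => intro _; simp
    | succ k ih =>
      intro hk
      have h1 := ih (by omega)
      have h2 := grad_lip hN v M hM (i+k+1) i (by omega) (by omega)
      have h3 := st (i+k) (by omega)
      push_cast at h2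
      rw [show (i:ℝ)+k+1-i = k+1 by ring, abs_of_pos (by positivity : (0:ℝ) < k+1)] at h2
      have e : v (i+(k+1)) - v i - ((k+1:ℕ):ℝ)/N * grad N v i = (v (i+k) - v i - (k:ℝ)/N * grad N v i) +
        (grad N v (i+k+1) - grad N v i)/N := by
        rw [← add_assoc, show v (i+k+1) = v (i+k) + grad N v (i+k+1)/N by linarith]; push_cast; ring
      rw [e]
      refine (abs_add_le _ _).trans ?_
      rw [abs_div, abs_of_pos hN']
      have h4 : |grad N v (i+k+1) - grad N v i| / N ≤ M / N * (k+1) / N := by gcongr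
      have h5 : M * (((k+1:ℕ):ℝ)/N)^2 = M * ((k:ℝ)/N)^2 + M / N * (k+1) / N + M * k / N^2 := by push_cast; ring
      have : 0 ≤ M * k / (N:ℝ)^2 := by positivity
      linarith
  have dn : ∀ k, k ≤ i → |v (i-k) - v i + (k:ℝ)/N * grad N v i| ≤ M * ((k:ℝ)/N)^2 := by
    intro k
    induction k with
    | zero => intro _; simp
    | succ k ih =>
      intro hk
      have h1 := ih (by omega)
      have h2 := grad_lip hN v M hM (i-k) i (by omega) (by omega)
      have h3 := st (i-(k+1)) (by omega)
      rw [show i-(k+1)+1 = i - k by omega] at h3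
      rw [Nat.cast_sub (by omega : k ≤ i), show (i:ℝ)-k-i = -k by ring, abs_neg, abs_of_nonneg (by positivity : (0:ℝ) ≤ k)] at h2
      have e : v (i-(k+1)) - v i + ((k+1:ℕ):ℝ)/N * grad N v i = (v (i-k) - v i + (k:ℝ)/N * grad N v i) -
        (grad N v (i-k) - grad N v i)/N := by
        rw [show v (i-(k+1)) = v (i-k) - grad N v (i-k)/N by linarith]; push_cast; ring
      rw [e]
      refine (abs_sub _ _).trans ?_
      rw [abs_div, abs_of_pos hN']
      have h4 : |grad N v (i-k) - grad N v i| / N ≤ M / N * k / N := by gcongr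
      have h5 : M * (((k+1:ℕ):ℝ)/N)^2 = M * ((k:ℝ)/N)^2 + M / N * k / N + M * (k+1) / N^2 := by push_cast; ring
      have : 0 ≤ M * (k+1) / (N:ℝ)^2 := by positivity
      linarith
  rcases le_total i j with hij | hij
  · obtain ⟨k, rfl⟩ := Nat.exists_eq_add_of_le hij
    have := up k hj
    push_cast
    rwa [show (i:ℝ) + k - i = k by ring]
  · obtain ⟨k, rfl⟩ := Nat.exists_eq_add_of_le hij
    have := dn k (by omega)
    rw [show j + k - k = j by omega] at this
    push_cast
    rw [show (j:ℝ) - (j+k) = -k by ring, neg_div, neg_sq]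
    rw [show v j - v (j+k) - -((k:ℝ)/N) * grad N v (j+k) = v j - v (j+k) + (k:ℝ)/N * grad N v (j+k) by ring]
    exact this

/-- Riemann sums -/
lemma riemann (H : ℝ → ℝ) (hH : Continuous H) (a : ℕ → ℝ) {h x ε C : ℝ} (hh : 0 < h) (m : ℕ) (h1 : m * h ≤ x) (h2 : x ≤ (m+1) * h)
    (hε : 0 ≤ ε) (hC : ∀ s ∈ Set.Icc 0 x, |H s| ≤ C) (ha : ∀ j < m, ∀ s ∈ Set.Icc ((j:ℝ)*h) ((j+1)*h), |a j - H s| ≤ ε) :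
    |h * ∑ j ∈ range m, a j - ∫ s in (0:ℝ)..x, H s| ≤ ε * x + C * h := by
  have hx0 : 0 ≤ x := le_trans (by positivity) h1
  have ii : ∀ p q, IntervalIntegrable H MeasureTheory.volume p q := fun p q => hH.intervalIntegrable _ _
  have e1 : ∫ s in (0:ℝ)..x, H s = (∑ j ∈ range m, ∫ s in ((j:ℕ):ℝ)*h..((j+1:ℕ):ℝ)*h, H s) + ∫ s in (m*h)..x, H s := by
    rw [intervalIntegral.sum_integral_adjacent_intervals (a := fun j : ℕ => (j:ℝ)*h) (fun k _ => ii _ _)]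
    simp only [Nat.cast_zero, zero_mul]
    rw [intervalIntegral.integral_add_adjacent_intervals (ii _ _) (ii _ _)]
  have e2 : h * ∑ j ∈ range m, a j - ∫ s in (0:ℝ)..x, H s =
     ∑ j ∈ range m, (∫ s in ((j:ℕ):ℝ)*h..((j+1:ℕ):ℝ)*h, (a j - H s)) - ∫ s in (m*h)..x, H s := by
    rw [e1, mul_sum, ← sub_sub, ← sum_sub_distrib]
    congr 1
    apply sum_congr rfl
    intro j hj
    rw [intervalIntegral.integral_sub (by simp) (ii _ _), intervalIntegral.integral_const]
    push_cast
    rw [smul_eq_mul]; ring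
  rw [e2]
  refine (abs_sub _ _).trans ?_
  have b1 : |∑ j ∈ range m, (∫ s in ((j:ℕ):ℝ)*h..((j+1:ℕ):ℝ)*h, (a j - H s))| ≤ ∑ j ∈ range m, ε * h := by
    refine (abs_sum_le_sum_abs _ _).trans (sum_le_sum fun j hj => ?_)
    have hle : ((j:ℕ):ℝ)*h ≤ ((j+1:ℕ):ℝ)*h := by push_cast; nlinarith
    have := intervalIntegral.norm_integral_le_of_norm_le_const (a := ((j:ℕ):ℝ)*h) (b := ((j+1:ℕ):ℝ)*h) (C := ε)
      (f := fun s => a j - H s) (by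
        intro s hs
        rw [Set.uIoc_of_le hle] at hs
        have := hs.2
        push_cast at this
        exact ha j (mem_range.mp hj) s ⟨hs.1.le, this⟩)
    rw [Real.norm_eq_abs] at this
    refine this.trans (le_of_eq ?_)
    push_cast
    rw [show ((j:ℝ)+1)*h - j*h = h by ring, abs_of_pos hh]
  have b2 : |∫ s in (m*h)..x, H s| ≤ C * h := by
    have hC0 : 0 ≤ C := (abs_nonneg _).trans (hC 0 ⟨le_rfl, hx0⟩)
    have := intervalIntegral.norm_integral_le_of_norm_le_const (a := m*h) (b := x) (C := C) (f := H) (by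
        intro s hs
        rw [Set.uIoc_of_le h1] at hs
        exact hC s ⟨le_trans (by positivity) hs.1.le, hs.2⟩)
    rw [Real.norm_eq_abs] at this
    refine this.trans (mul_le_mul_of_nonneg_left ?_ hC0)
    rw [abs_of_nonneg (by linarith)]; linarith
  rw [sum_const, card_range, nsmul_eq_mul] at b1
  have : (m:ℝ) * (ε * h) ≤ ε * x := by
    calc (m:ℝ) * (ε * h) = ε * (m*h) := by ring
      _ ≤ _ := by gcongr
  linarith

end FB

namespace FB
open Finset Filter

noncomputable def Us (v : ℕ → ℕ → ℕ → ℝ) (μ : ℝ) (N : ℕ) (x t : ℝ) : ℝ := v N ⌊t/(μ/(N:ℝ)^2)⌋₊ (cel N x)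
noncomputable def Ws (v : ℕ → ℕ → ℕ → ℝ) (μ : ℝ) (N : ℕ) (x t : ℝ) : ℝ := grad N (v N ⌊t/(μ/(N:ℝ)^2)⌋₊) (cel N x)

lemma reg_Ws {v : ℕ → ℕ → ℕ → ℝ} {μ M T : ℝ} {N : ℕ} (hN : 1 ≤ N) (hμ : 0 < μ)
    (hM : ∀ k : ℕ, k * (μ/(N:ℝ)^2) ≤ T → (∀ j < N, |v N k j| ≤ M) ∧ (∀ j ≤ N, |grad N (v N k) j| ≤ M) ∧ (∀ j < N, |lap N (v N k) j| ≤ M))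
    {x y t : ℝ} (hx : x ∈ Set.Icc (0:ℝ) 1) (hy : y ∈ Set.Icc (0:ℝ) 1) (ht : t ∈ Set.Icc (0:ℝ) T) :
    |Us v μ N x t| ≤ M ∧ |Ws v μ N x t| ≤ M ∧ |Ws v μ N x t - Ws v μ N y t| ≤ M * (|x - y| + 1/N) ∧
    |Us v μ N y t - Us v μ N x t - (y - x) * Ws v μ N x t| ≤ M * |y - x|^2 + 4 * M / N := by
  have hN' : (0:ℝ) < N := by exact_mod_cast hN
  have hτ : 0 < μ/(N:ℝ)^2 := by positivity
  have hk : (⌊t/(μ/(N:ℝ)^2)⌋₊:ℝ) * (μ/(N:ℝ)^2) ≤ T := by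
    have := Nat.floor_le (div_nonneg ht.1 hτ.le)
    rw [le_div_iff₀ hτ] at this
    exact this.trans ht.2
  obtain ⟨m1, m2, m3⟩ := hM _ hk
  have hM0 : 0 ≤ M := (abs_nonneg _).trans (m1 0 hN)
  have cx := cel_lt hN x
  have cy := cel_lt hN y
  unfold Us Ws
  refine ⟨m1 _ cx, m2 _ cx.le, ?_, ?_⟩
  · refine (grad_lip hN _ M m3 _ _ cx.le cy.le).trans ?_
    have d := cel_diff hN hx hy
    have : |(cel N x:ℝ) - cel N y| / N ≤ |x - y| + 1/N := by
      rw [← abs_of_pos hN', ← abs_div, abs_of_pos hN']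
      have := abs_sub_abs_le_abs_sub (((cel N x:ℝ) - cel N y)/N) (x-y)
      linarith
    calc M / N * |(cel N x:ℝ) - cel N y| = M * (|(cel N x:ℝ) - cel N y|/N) := by ring
      _ ≤ _ := mul_le_mul_of_nonneg_left this hM0
  · have t1 := disc_taylor hN _ M m3 _ _ cx cy
    have d := cel_diff hN hy hx
    set r := ((cel N y:ℝ) - cel N x)/N with hr
    set g := grad N (v N ⌊t/(μ/(N:ℝ)^2)⌋₊) (cel N x) with hg
    have g1 : |g| ≤ M := m2 _ cx.le
    have e : v N ⌊t/(μ/(N:ℝ)^2)⌋₊ (cel N y) - v N ⌊t/(μ/(N:ℝ)^2)⌋₊ (cel N x) - (y - x) * g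
      = (v N ⌊t/(μ/(N:ℝ)^2)⌋₊ (cel N y) - v N ⌊t/(μ/(N:ℝ)^2)⌋₊ (cel N x) - r * g) + (r - (y-x)) * g := by ring
    rw [e]
    refine (abs_add_le _ _).trans ?_
    rw [abs_mul]
    have p1 : |r - (y-x)| * |g| ≤ 1/N * M := mul_le_mul d g1 (abs_nonneg _) (by positivity)
    have p2 : r^2 ≤ |y-x|^2 + 3/N := by
      have a1 : |r| ≤ |y-x| + 1/N := by
        have := abs_sub_abs_le_abs_sub r (y-x)
        linarith
      have a2 : |y-x| ≤ 1 := by rw [abs_le]; constructor <;> linarith [hx.1, hx.2, hy.1, hy.2]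
      have a3 : (1:ℝ)/N ≤ 1 := by rw [div_le_one hN']; exact_mod_cast hN
      have a4 : (0:ℝ) ≤ 1/N := by positivity
      rw [← sq_abs r]
      have : |r|^2 ≤ (|y-x|+1/N)^2 := pow_le_pow_left₀ (abs_nonneg _) a1 2
      have e3 : (3:ℝ)/N = 3 * (1/N) := by ring
      rw [e3]
      nlinarith [abs_nonneg (y-x)]
    have p3 : M * r^2 ≤ M * (|y-x|^2 + 3/N) := mul_le_mul_of_nonneg_left p2 hM0
    have e4 : M * (|y-x|^2 + 3/N) + 1/N*M = M * |y-x|^2 + 4*M/N := by ring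
    linarith

lemma reg_time {v : ℕ → ℕ → ℕ → ℝ} {μ C T : ℝ} {N : ℕ} (hN : 1 ≤ N) (hμ : 0 < μ) (hC0 : 0 ≤ C)
    (hC : ∀ k : ℕ, k * (μ/(N:ℝ)^2) ≤ T → ∀ j < N, |v N (k+1) j - v N k j| ≤ C * (μ/(N:ℝ)^2))
    {x s t : ℝ} (hs : s ∈ Set.Icc (0:ℝ) T) (ht : t ∈ Set.Icc (0:ℝ) T) :
    |Us v μ N x t - Us v μ N x s| ≤ C * (|t - s| + μ/N) := by
  have hN' : (0:ℝ) < N := by exact_mod_cast hN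
  have hτ : 0 < μ/(N:ℝ)^2 := by positivity
  have hτle : μ/(N:ℝ)^2 ≤ μ/N := by
    apply div_le_div_of_nonneg_left hμ.le hN'
    have : (1:ℝ) ≤ N := by exact_mod_cast hN
    nlinarith
  have cx := cel_lt hN x
  have main : ∀ s ∈ Set.Icc (0:ℝ) T, ∀ t ∈ Set.Icc (0:ℝ) T, s ≤ t → |Us v μ N x t - Us v μ N x s| ≤ C * (|t - s| + μ/N) := by
    intro s hs t ht hst
    unfold Us
    set k := ⌊s/(μ/(N:ℝ)^2)⌋₊ with hk
    have hkle : k ≤ ⌊t/(μ/(N:ℝ)^2)⌋₊ := Nat.floor_mono (div_le_div_of_nonneg_right hst hτ.le)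
    obtain ⟨m, hm⟩ := Nat.exists_eq_add_of_le hkle
    have hkT := Nat.floor_le (div_nonneg ht.1 hτ.le)
    rw [hm] at hkT ⊢
    rw [le_div_iff₀ hτ] at hkT
    have step : ∀ l ≤ m, |v N (k+l) (cel N x) - v N k (cel N x)| ≤ C * (l * (μ/(N:ℝ)^2)) := by
      intro l
      induction l with
      | zero => simp
      | succ l ih =>
        intro hl
        have h1 := ih (by omega)
        have h2 := hC (k+l) (by
          refine le_trans ?_ (hkT.trans ht.2)
          apply mul_le_mul_of_nonneg_right _ hτ.le
          exact_mod_cast (by omega)) _ cx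
        rw [← add_assoc]
        push_cast
        have := abs_sub_le (v N (k+l+1) (cel N x)) (v N (k+l) (cel N x)) (v N k (cel N x))
        linarith
    refine (step m le_rfl).trans (mul_le_mul_of_nonneg_left ?_ hC0)
    have h3 := Nat.lt_floor_add_one (s/(μ/(N:ℝ)^2))
    rw [div_lt_iff₀ hτ, ← hk] at h3
    push_cast at hkT
    rw [abs_of_nonneg (by linarith)]
    linarith
  rcases le_total s t with h | h
  · exact main s hs t ht h
  · rw [abs_sub_comm, abs_sub_comm t]; exact main t ht s hs h

/-- limit functions -/
lemma limit_fn {v : ℕ → ℕ → ℕ → ℝ} {μ C M T : ℝ} {N0 : ℕ} (hN0 : 1 ≤ N0) (hμ : 0 < μ) (hC0 : 0 ≤ C) (hM0 : 0 ≤ M)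
    (hM : ∀ N ≥ N0, ∀ k : ℕ, k * (μ/(N:ℝ)^2) ≤ T → (∀ j < N, |v N k j| ≤ M) ∧ (∀ j ≤ N, |grad N (v N k) j| ≤ M) ∧ (∀ j < N, |lap N (v N k) j| ≤ M))
    (hC : ∀ N ≥ N0, ∀ k : ℕ, k * (μ/(N:ℝ)^2) ≤ T → ∀ j < N, |v N (k+1) j - v N k j| ≤ C * (μ/(N:ℝ)^2)) :
    ∃ φ : ℕ → ℕ, StrictMono φ ∧ ∃ u w : ℝ → ℝ → ℝ, 
      ContinuousOn (fun p : ℝ × ℝ => u p.1 p.2) (Set.Icc (0:ℝ) 1 ×ˢ Set.Icc (0:ℝ) T) ∧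
      ContinuousOn (fun p : ℝ × ℝ => w p.1 p.2) (Set.Icc (0:ℝ) 1 ×ˢ Set.Icc (0:ℝ) T) ∧
      ∀ ε > 0, ∀ᶠ n in atTop, ∀ x ∈ Set.Icc (0:ℝ) 1, ∀ t ∈ Set.Icc (0:ℝ) T, |Us v μ (φ n) x t - u x t| ≤ ε ∧
        |Ws v μ (φ n) x t - w x t| ≤ ε := by
  have A := ascoli (K := Set.Icc (0:ℝ) 1 ×ˢ Set.Icc (0:ℝ) T) (isCompact_Icc.prod isCompact_Icc)
    (fun N p => (Us v μ N p.1 p.2, Ws v μ N p.1 p.2)) M N0 ?_ ?_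
  · obtain ⟨φ, h1, F, h2, h3⟩ := A
    refine ⟨φ, h1, fun x t => (F (x,t)).1, fun x t => (F (x,t)).2, continuous_fst.comp_continuousOn h2,
      continuous_snd.comp_continuousOn h2, ?_⟩
    intro ε hε
    filter_upwards [h3 ε hε] with n hn x hx t ht
    have := hn (x,t) ⟨hx, ht⟩
    rw [Prod.dist_eq, max_le_iff] at this
    exact this
  · intro N hN p hp
    obtain ⟨a, b, _⟩ := reg_Ws (hN0.trans hN) hμ (hM N hN) hp.1 hp.1 hp.2
    exact max_le a b
  · intro ε hε
    obtain ⟨r, hr0, hr1, hr2⟩ : ∃ r : ℝ, 0 < r ∧ r ≤ 1/2 ∧ 2 * M * r ≤ ε/4 := by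
      refine ⟨min (1/2) (ε/(8*M+8)), by positivity, min_le_left _ _, ?_⟩
      have : min (1/2) (ε/(8*M+8)) ≤ ε/(8*M+8) := min_le_right _ _
      calc 2 * M * min (1/2) (ε/(8*M+8)) ≤ 2 * M * (ε/(8*M+8)) := by gcongr
        _ ≤ ε/4 := by
          rw [← mul_div_assoc, div_le_div_iff₀ (by positivity) (by norm_num)]
          nlinarith
    set Z := 7*M + C + C*μ + 2*C/r + (8*M+2*C*μ)/r + 1 with hZ
    have hZ0 : 0 < Z := by positivity
    obtain ⟨N1, hN1⟩ := exists_nat_ge (4*Z/ε)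
    refine ⟨min 1 (ε/(4*Z)), by positivity, max N0 N1, ?_⟩
    intro N hN p hp q hq hpq
    have hN0' : N0 ≤ N := (le_max_left _ _).trans hN
    have hNp : 1 ≤ N := hN0.trans hN0'
    have hN' : (0:ℝ) < N := by exact_mod_cast hNp
    have hNZ : Z * (1/N) ≤ ε/4 := by
      have : (N1:ℝ) ≤ N := by exact_mod_cast (le_max_right _ _).trans hN
      have : 4*Z/ε ≤ N := hN1.trans this
      rw [div_le_iff₀ hε] at this
      rw [mul_one_div, div_le_iff₀ hN']; linarith
    obtain ⟨x, t⟩ := p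
    obtain ⟨y, s⟩ := q
    obtain ⟨hx, ht⟩ := hp
    obtain ⟨hy, hs⟩ := hq
    rw [Prod.dist_eq, max_lt_iff] at hpq
    obtain ⟨d1, d2⟩ := hpq
    simp only [Real.dist_eq] at d1 d2 hx ht hy hs
    have d1' : |x-y| ≤ 1 := d1.le.trans (min_le_left _ _)
    have d1'' : Z * |x-y| ≤ ε/4 := by
      calc Z * |x-y| ≤ Z * (ε/(4*Z)) := by
            apply mul_le_mul_of_nonneg_left _ hZ0.le; exact d1.le.trans (min_le_right _ _)
        _ = ε/4 := by field_simp
    have d2'' : Z * |t-s| ≤ ε/4 := by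
      calc Z * |t-s| ≤ Z * (ε/(4*Z)) := by
            apply mul_le_mul_of_nonneg_left _ hZ0.le; exact d2.le.trans (min_le_right _ _)
        _ = ε/4 := by field_simp
    have R := fun {x y t : ℝ} => reg_Ws (x := x) (y := y) (t := t) hNp hμ (hM N hN0')
    have RT := fun {x s t : ℝ} => reg_time (x := x) (s := s) (t := t) hNp hμ hC0 (hC N hN0')
    have inN : (0:ℝ) ≤ 1/N := by positivity
    have pos1 : 0 ≤ 2*C/r := by positivity
    have pos2 : 0 ≤ (8*M+2*C*μ)/r := by positivity
    have pos3 : 0 ≤ C * μ := by positivity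
    rw [Prod.dist_eq]
    apply max_le
    · rw [Real.dist_eq]
      obtain ⟨_, w1, _, w2⟩ := R hy hx ht
      have w3 := RT (x := y) hs ht
      have w4 : |Us v μ N x t - Us v μ N y t| ≤ M * |x-y| + M * |x-y|^2 + 4*M/N := by
        have e : Us v μ N x t - Us v μ N y t = (Us v μ N x t - Us v μ N y t - (x-y) * Ws v μ N y t) + (x-y) * Ws v μ N y t := by ring
        rw [e]
        refine (abs_add_le _ _).trans ?_
        rw [abs_mul]
        have := mul_le_mul_of_nonneg_left w1 (abs_nonneg (x-y))
        linarith
      have w5 : |x-y|^2 ≤ |x-y| := by nlinarith [abs_nonneg (x-y)]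
      have w6 := abs_sub_le (Us v μ N x t) (Us v μ N y t) (Us v μ N y s)
      have w7 : M * |x-y|^2 ≤ M * |x-y| := mul_le_mul_of_nonneg_left w5 hM0
      have w8 : 2 * M * |x-y| ≤ Z * |x-y| := mul_le_mul_of_nonneg_right (by linarith) (abs_nonneg _)
      have w9 : C * |t-s| ≤ Z * |t-s| := mul_le_mul_of_nonneg_right (by linarith) (abs_nonneg _)
      have w10 : (4*M + C*μ) * (1/N) ≤ Z * (1/N) := mul_le_mul_of_nonneg_right (by linarith) inN
      have w11 : (4*M + C*μ) * (1/N) = 4*M/N + C*(μ/N) := by ring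
      linarith
    · rw [Real.dist_eq]
      obtain ⟨_, _, w1, _⟩ := R hx hy ht
      have w2 : |Ws v μ N y t - Ws v μ N y s| ≤ 2*C/r*|t-s| + 2*M*r + (8*M+2*C*μ)/r * (1/N) := by
        obtain ⟨z, hz, hzr⟩ : ∃ z ∈ Set.Icc (0:ℝ) 1, |z - y| = r := by
          rcases le_total y (1/2) with h | h
          · exact ⟨y + r, ⟨by linarith [hy.1], by linarith⟩, by rw [add_sub_cancel_left, abs_of_pos hr0]⟩
          · exact ⟨y - r, ⟨by linarith, by linarith [hy.2]⟩, by rw [sub_sub_cancel_left, abs_neg, abs_of_pos hr0]⟩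
        obtain ⟨_, _, _, q1⟩ := R hy hz ht
        obtain ⟨_, _, _, q2⟩ := R hy hz hs
        have q3 := RT (x := y) hs ht
        have q4 := RT (x := z) hs ht
        have e : (z-y) * (Ws v μ N y t - Ws v μ N y s) = 
          (Us v μ N z s - Us v μ N y s - (z-y)*Ws v μ N y s) - (Us v μ N z t - Us v μ N y t - (z-y)*Ws v μ N y t)
          + ((Us v μ N z t - Us v μ N z s) - (Us v μ N y t - Us v μ N y s)) := by ring
        have q5 : r * |Ws v μ N y t - Ws v μ N y s| ≤ 2 * (M * r^2 + 4*M/N) + 2 * (C * (|t-s| + μ/N)) := by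
          rw [← hzr, ← abs_mul, e]
          refine (abs_add_le _ _).trans ?_
          have := abs_sub (Us v μ N z s - Us v μ N y s - (z-y)*Ws v μ N y s) (Us v μ N z t - Us v μ N y t - (z-y)*Ws v μ N y t)
          have := abs_sub (Us v μ N z t - Us v μ N z s) (Us v μ N y t - Us v μ N y s)
          linarith
        have e2 : 2 * (M * r^2 + 4*M/N) + 2 * (C * (|t-s| + μ/N)) = r * (2*C/r*|t-s| + 2*M*r + (8*M+2*C*μ)/r * (1/N)) := by
          field_simp; ring
        rw [e2] at q5
        exact le_of_mul_le_mul_left q5 hr0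
      have w6 := abs_sub_le (Ws v μ N x t) (Ws v μ N y t) (Ws v μ N y s)
      have w8 : M * |x-y| ≤ Z * |x-y| := mul_le_mul_of_nonneg_right (by linarith) (abs_nonneg _)
      have w9 : 2*C/r * |t-s| ≤ Z * |t-s| := mul_le_mul_of_nonneg_right (by linarith) (abs_nonneg _)
      have w10 : (M + (8*M+2*C*μ)/r) * (1/N) ≤ Z * (1/N) := mul_le_mul_of_nonneg_right (by linarith) inN
      rw [add_mul] at w10
      rw [mul_add] at w1
      linarith

end FB

namespace FB
open Finset Filter

/-- clamp to `[0,a]` -/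
noncomputable def cl (a x : ℝ) : ℝ := max 0 (min a x)
lemma cl_mem {a : ℝ} (ha : 0 ≤ a) (x : ℝ) : cl a x ∈ Set.Icc 0 a :=
  ⟨le_max_left _ _, max_le ha (min_le_left _ _)⟩
lemma cl_eq {a x : ℝ} (hx : x ∈ Set.Icc 0 a) : cl a x = x := by
  unfold cl; rw [min_eq_right hx.2, max_eq_right hx.1]
lemma cl_cont (a : ℝ) : Continuous (cl a) := by unfold cl; fun_prop
lemma cl_cont2 {a : ℝ} (ha : 0 ≤ a) {g : ℝ → ℝ → ℝ} (hg : ContinuousOn (fun p : ℝ × ℝ => g p.1 p.2) (Set.Icc (0:ℝ) 1 ×ˢ Set.Icc (0:ℝ) a)) :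
    Continuous (fun p : ℝ × ℝ => g (cl 1 p.1) (cl a p.2)) := by
  have h1 : Continuous (fun p : ℝ × ℝ => (cl 1 p.1, cl a p.2)) :=
    ((cl_cont 1).comp continuous_fst).prodMk ((cl_cont a).comp continuous_snd)
  exact hg.comp_continuous h1 (fun p => ⟨cl_mem zero_le_one _, cl_mem ha _⟩)

lemma Flux.lips {lam Lam Hs α : ℝ} {S S' : ℝ → ℝ} (h : Flux lam Lam Hs α S S') (x y : ℝ) : |S y - S x| ≤ Lam * |y - x| := by
  obtain ⟨ξ, _, e⟩ := h.mvt x y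
  rw [e, abs_mul, abs_of_pos (h.lam_pos.trans_le (h.lb ξ))]
  exact mul_le_mul_of_nonneg_right (h.ub ξ) (abs_nonneg _)

lemma sum_fdiv (S : ℝ → ℝ) (N : ℕ) (v : ℕ → ℝ) (m : ℕ) : ∑ j ∈ range m, fdiv S N v j = (S (grad N v m) - S 0) * N := by
  unfold fdiv
  rw [← sum_mul, sum_range_sub (fun j => S (grad N v j)), grad_zero]

lemma disc_identity {S : ℝ → ℝ} {b c f : ℝ → ℝ → ℝ} {u0 : ℝ → ℝ} {τ : ℝ} {N : ℕ} (hN : 1 ≤ N) (m k : ℕ) :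
    (1/N:ℝ) * ∑ j ∈ range m, (sch S b c f u0 τ N k j - sch S b c f u0 τ N 0 j) =
     τ * ∑ l ∈ range k, (S (grad N (sch S b c f u0 τ N l) m) - S 0 + (1/N:ℝ) * ∑ j ∈ range m, src b c f τ N (sch S b c f u0 τ N l) l j) := by
  have hN' : (0:ℝ) < N := by exact_mod_cast hN
  induction k with
  | zero => simp
  | succ k ih =>
    rw [sum_range_succ, mul_add, ← ih]
    have e : ∀ j, sch S b c f u0 τ N (k+1) j - sch S b c f u0 τ N 0 j = (sch S b c f u0 τ N k j - sch S b c f u0 τ N 0 j)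
      + τ * (fdiv S N (sch S b c f u0 τ N k) j + src b c f τ N (sch S b c f u0 τ N k) k j) := by
      intro j
      rw [show sch S b c f u0 τ N (k+1) j = sch S b c f u0 τ N k j + τ * (fdiv S N (sch S b c f u0 τ N k) j +
        src b c f τ N (sch S b c f u0 τ N k) k j) from rfl]
      ring
    simp only [e]
    rw [sum_add_distrib, ← mul_sum, sum_add_distrib, sum_fdiv]
    field_simp

lemma ucont {a : ℝ} {g : ℝ × ℝ → ℝ} (hg : Continuous g) {η : ℝ} (hη : 0 < η) :
    ∃ δ > 0, ∀ x ∈ Set.Icc (0:ℝ) 1, ∀ y ∈ Set.Icc (0:ℝ) 1, ∀ t ∈ Set.Icc (0:ℝ) a, ∀ s ∈ Set.Icc (0:ℝ) a,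
      |x - y| < δ → |t - s| < δ → |g (x,t) - g (y,s)| ≤ η := by
  have hK : IsCompact (Set.Icc (0:ℝ) 1 ×ˢ Set.Icc (0:ℝ) a) := isCompact_Icc.prod isCompact_Icc
  have := hK.uniformContinuousOn_of_continuous hg.continuousOn
  rw [Metric.uniformContinuousOn_iff] at this
  obtain ⟨δ, hδ, h⟩ := this η hη
  refine ⟨δ, hδ, fun x hx y hy t ht s hs h1 h2 => ?_⟩
  have := h (x,t) ⟨hx,ht⟩ (y,s) ⟨hy,hs⟩ (by rw [Prod.dist_eq]; exact max_lt h1 h2)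
  exact this.le

lemma zero_of_small {A K : ℝ} (h : ∀ η > 0, |A| ≤ K * η) : A = 0 := by
  by_contra hA
  have hA' : 0 < |A| := abs_pos.mpr hA
  have h1 := h 1 one_pos
  have hK : 0 < K := by linarith
  have := h (|A|/(2*K)) (by positivity)
  rw [show K * (|A|/(2*K)) = |A|/2 by field_simp] at this
  linarith

lemma limit_identity {lam Lam Hs α : ℝ} {S S' : ℝ → ℝ} (h : Flux lam Lam Hs α S S') {Q T : ℝ} {b c f : ℝ → ℝ → ℝ}
    {u0 : ℝ → ℝ} (hc : Coef α Q b c f) {μ : ℝ} (hμ : 0 < μ)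
    {v : ℕ → ℕ → ℕ → ℝ} (hv : v = fun N : ℕ => sch S b c f u0 (μ/(N:ℝ)^2) N) {φ : ℕ → ℕ} (hφ : StrictMono φ)
    {u w : ℝ → ℝ → ℝ} (hu : Continuous (fun p : ℝ × ℝ => u p.1 p.2)) (hw : Continuous (fun p : ℝ × ℝ => w p.1 p.2))
    (hlim : ∀ ε > 0, ∀ᶠ n in atTop, ∀ x ∈ Set.Icc (0:ℝ) 1, ∀ t ∈ Set.Icc (0:ℝ) T, |Us v μ (φ n) x t - u x t| ≤ ε ∧
        |Ws v μ (φ n) x t - w x t| ≤ ε) (x t : ℝ) (hx : x ∈ Set.Icc (0:ℝ) 1) (ht : t ∈ Set.Icc (0:ℝ) T) :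
    ∫ y in (0:ℝ)..x, (u y t - u y 0) = ∫ s in (0:ℝ)..t, (S (w x s) - S 0 + ∫ y in (0:ℝ)..x, (b y s * w y s + c y s * u y s + f y s)) := by
  have hQ := hc.Q_nonneg
  have hLam : 0 < Lam := h.lam_pos.trans_le h.lam_le
  have hT : 0 ≤ T := ht.1.trans ht.2
  set G : ℝ × ℝ → ℝ := fun p => b p.1 p.2 * w p.1 p.2 + c p.1 p.2 * u p.1 p.2 + f p.1 p.2 with hG
  have hGc : Continuous G := ((hc.cb.mul hw).add (hc.cc.mul hu)).add hc.cf
  have hSc : Continuous S := continuous_iff_continuousAt.mpr fun s => (h.deriv s).continuousAt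
  set H : ℝ → ℝ := fun s => S (w x s) - S 0 + ∫ y in (0:ℝ)..x, G (y,s) with hH
  have hHc : Continuous H := by
    refine Continuous.add ?_ ?_
    · refine Continuous.sub (hSc.comp ?_) continuous_const
      exact hw.comp (Continuous.prodMk continuous_const continuous_id)
    · exact intervalIntegral.continuous_parametric_intervalIntegral_of_continuous' (f := fun s y => G (y,s))
        (hGc.comp (continuous_snd.prodMk continuous_fst)) 0 x
  have hK : IsCompact (Set.Icc (0:ℝ) 1 ×ˢ Set.Icc (0:ℝ) T) := isCompact_Icc.prod isCompact_Icc
  obtain ⟨CG, hCG⟩ := hK.exists_bound_of_continuousOn hGc.continuousOn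
  obtain ⟨CU, hCU⟩ := hK.exists_bound_of_continuousOn hu.continuousOn
  obtain ⟨CH, hCH⟩ := (isCompact_Icc (a := (0:ℝ)) (b := T)).exists_bound_of_continuousOn hHc.continuousOn
  rw [← sub_eq_zero]
  apply zero_of_small (K := 5 + ((2*Lam + 2*Q + 2) * T + 1))
  intro η hη
  obtain ⟨δ1, hδ1, uc1⟩ := ucont (a := T) hu hη
  obtain ⟨δ2, hδ2, uc2⟩ := ucont (a := T) hw hη
  obtain ⟨δ3, hδ3, uc3⟩ := ucont (a := T) hGc hη
  set δ := min δ1 (min δ2 δ3) with hδd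
  have hδ : 0 < δ := by positivity
  have tN : Tendsto (fun n => (1:ℝ)/(φ n:ℝ)) atTop (nhds 0) :=
    tendsto_one_div_atTop_nhds_zero_nat.comp hφ.tendsto_atTop
  have ev : ∀ K : ℝ, ∀ ε > 0, ∀ᶠ n in atTop, K * (1/(φ n:ℝ)) < ε := by
    intro K ε hε
    have := (tN.const_mul K)
    rw [mul_zero] at this
    exact this.eventually (Iio_mem_nhds hε)
  obtain ⟨n, hn1, hn2, hn3, hn4, hn5, hn6, hn7⟩ := (((hφ.tendsto_atTop).eventually_ge_atTop 1).and <| (hlim η hη).and <| (ev 1 δ hδ).and <|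
    (ev μ δ hδ).and <| (ev CG η hη).and <| (ev (2*CU) η hη).and (ev (|CH| * μ) η hη)).exists
  set N := φ n with hNd
  have hN' : (0:ℝ) < N := by exact_mod_cast hn1
  set τ := μ/(N:ℝ)^2 with hτ
  have hτ0 : 0 < τ := by positivity
  have hτle : τ ≤ μ * (1/N) := by
    rw [hτ, mul_one_div]
    apply div_le_div_of_nonneg_left hμ.le hN'
    have : (1:ℝ) ≤ N := by exact_mod_cast hn1
    nlinarith
  have hτδ : τ < δ := hτle.trans_lt hn4
  have hNδ : 1/(N:ℝ) < δ := by linarith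
  set m := cel N x with hm
  set k := ⌊t/τ⌋₊ with hk
  have hmN : m < N := cel_lt hn1 x
  have m1 : (m:ℝ) * (1/N) ≤ x := by rw [mul_one_div]; exact cel_le hn1 hx
  have m2 : x ≤ ((m:ℝ)+1) * (1/N) := by rw [add_mul, mul_one_div, one_mul]; exact le_cel hn1 hx
  have k1 : (k:ℝ) * τ ≤ t := by
    have := Nat.floor_le (div_nonneg ht.1 hτ0.le)
    rwa [le_div_iff₀ hτ0] at this
  have k2 : t ≤ ((k:ℝ)+1) * τ := by
    have := Nat.lt_floor_add_one (t/τ)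
    rw [div_lt_iff₀ hτ0] at this
    exact this.le
  have gridx : ∀ j < N, (j:ℝ)/N ∈ Set.Icc (0:ℝ) 1 := by
    intro j hj
    exact ⟨by positivity, by rw [div_le_one hN']; exact_mod_cast hj.le⟩
  have cellx : ∀ j < m, ∀ y ∈ Set.Icc ((j:ℝ)*(1/N)) ((j+1)*(1/N)), y ∈ Set.Icc (0:ℝ) 1 ∧ |(j:ℝ)/N - y| < δ := by
    intro j hj y hy
    rw [mul_one_div, add_mul, mul_one_div, one_mul] at hy
    have hj1 : (j:ℝ) + 1 ≤ N := by exact_mod_cast (by omega : j + 1 ≤ N)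
    have : (j:ℝ)/N + 1/N ≤ 1 := by rw [← add_div, div_le_one hN']; exact hj1
    have h0 : (0:ℝ) ≤ (j:ℝ)/N := by positivity
    refine ⟨⟨h0.trans hy.1, hy.2.trans this⟩, ?_⟩
    rw [abs_lt]; constructor <;> linarith [hy.1, hy.2]
  have UsE : ∀ l j : ℕ, j < N → Us v μ N (j/N) (l*τ) = sch S b c f u0 τ N l j := by
    intro l j hj
    unfold Us
    rw [cel_grid hj, ← hτ, mul_div_cancel_right₀ _ hτ0.ne', Nat.floor_natCast, hv]
  have WsE : ∀ l j : ℕ, j < N → Ws v μ N (j/N) (l*τ) = grad N (sch S b c f u0 τ N l) j := by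
    intro l j hj
    unfold Ws
    rw [cel_grid hj, ← hτ, mul_div_cancel_right₀ _ hτ0.ne', Nat.floor_natCast, hv]
  have Ust : ∀ j : ℕ, j < N → Us v μ N (j/N) t = sch S b c f u0 τ N k j := by
    intro j hj
    unfold Us
    rw [cel_grid hj, ← hτ, hv]
  have t0 : (0:ℝ) ∈ Set.Icc (0:ℝ) T := ⟨le_rfl, hT⟩
  -- left side
  have L := riemann (fun y => u y t - u y 0) (by
      exact (hu.comp (Continuous.prodMk continuous_id continuous_const)).sub (hu.comp (Continuous.prodMk continuous_id continuous_const)))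
    (fun j => sch S b c f u0 τ N k j - sch S b c f u0 τ N 0 j) (h := 1/N) (x := x) (ε := 4*η) (C := 2*CU) (by positivity) m m1 m2 (by positivity)
    (by
      intro y hy
      have hy' : y ∈ Set.Icc (0:ℝ) 1 := ⟨hy.1, hy.2.trans hx.2⟩
      have a1 := hCU (y,t) ⟨hy', ht⟩
      have a2 := hCU (y,0) ⟨hy', t0⟩
      simp only [Real.norm_eq_abs] at a1 a2
      refine (abs_sub _ _).trans ?_
      linarith)
    (by
      intro j hj y hy
      obtain ⟨y1, y2⟩ := cellx j hj y hy
      have g := gridx j (by omega)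
      have a1 := (hn2 _ g t ht).1
      have a2 := (hn2 _ g 0 t0).1
      rw [Ust j (by omega)] at a1
      rw [show (0:ℝ) = ((0:ℕ):ℝ) * τ by simp, UsE 0 j (by omega)] at a2
      simp only [Nat.cast_zero, zero_mul] at a2
      have a3 := uc1 _ g y y1 t ht t ht (y2.trans_le (min_le_left _ _)) (by simpa using hδ1)
      have a4 := uc1 _ g y y1 0 t0 0 t0 (y2.trans_le (min_le_left _ _)) (by simpa using hδ1)
      simp only at a3 a4
      rw [abs_le] at a1 a2 a3 a4 ⊢
      constructor <;> linarith [a1.1, a1.2, a2.1, a2.2, a3.1, a3.2, a4.1, a4.2])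
  -- right side
  have R := riemann H hHc (fun l => S (grad N (sch S b c f u0 τ N l) m) - S 0 + (1/N:ℝ) * ∑ j ∈ range m, src b c f τ N (sch S b c f u0 τ N l) l j)
    (h := τ) (x := t) (ε := (2*Lam + 2*Q + 2)*η) (C := |CH|) hτ0 k k1 k2 (by positivity)
    (by
      intro s hs
      exact (hCH s ⟨hs.1, hs.2.trans ht.2⟩).trans (le_abs_self _))
    (by
      intro l hl s hs
      have l1 : ((l:ℝ)+1) * τ ≤ T := by
        refine le_trans ?_ (k1.trans ht.2)
        apply mul_le_mul_of_nonneg_right _ hτ0.le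
        exact_mod_cast hl
      have l0 : 0 ≤ (l:ℝ)*τ := by positivity
      have hsT : s ∈ Set.Icc (0:ℝ) T := ⟨l0.trans hs.1, hs.2.trans l1⟩
      have hlT : (l:ℝ)*τ ∈ Set.Icc (0:ℝ) T := ⟨l0, by linarith⟩
      have hls : |(l:ℝ)*τ - s| < δ := by
        rw [abs_lt]; constructor <;> linarith [hs.1, hs.2]
      have I := riemann (fun y => G (y,s)) (hGc.comp (Continuous.prodMk continuous_id continuous_const))
        (fun j => src b c f τ N (sch S b c f u0 τ N l) l j) (h := 1/N) (x := x) (ε := (2*Q+1)*η) (C := CG) (by positivity) m m1 m2 (by positivity)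
        (by
          intro y hy
          exact hCG (y,s) ⟨⟨hy.1, hy.2.trans hx.2⟩, hsT⟩)
        (by
          intro j hj y hy
          obtain ⟨y1, y2⟩ := cellx j hj y hy
          have g := gridx j (by omega)
          obtain ⟨a1, a2⟩ := hn2 _ g _ hlT
          rw [UsE l j (by omega)] at a1
          rw [WsE l j (by omega)] at a2
          have a3 := uc3 _ g y y1 _ hlT s hsT (y2.trans_le ((min_le_right _ _).trans (min_le_right _ _))) (hls.trans_le ((min_le_right _ _).trans (min_le_right _ _)))
          have e : src b c f τ N (sch S b c f u0 τ N l) l j - G (y,s) = b (j/N) (l*τ) * (grad N (sch S b c f u0 τ N l) j - w (j/N) (l*τ))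
            + c (j/N) (l*τ) * (sch S b c f u0 τ N l j - u (j/N) (l*τ)) + (G (j/N, l*τ) - G (y,s)) := by
            unfold src; simp only [hG]; ring
          rw [e]
          refine (abs_add_le _ _).trans ((add_le_add (abs_add_le _ _) a3).trans ?_)
          rw [abs_mul, abs_mul]
          have b1 := mul_le_mul (hc.bb (j/N) (l*τ)) a2 (abs_nonneg _) hQ
          have b2 := mul_le_mul (hc.bc (j/N) (l*τ)) a1 (abs_nonneg _) hQ
          linarith)
      have x1 : (2*Q+1)*η * x ≤ (2*Q+1)*η := mul_le_of_le_one_right (by positivity) hx.2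
      have a1 := (hn2 _ (gridx m hmN) _ hlT).2
      rw [WsE l m hmN] at a1
      have hxm : |(m:ℝ)/N - x| < δ := by
        rw [mul_one_div] at m1
        rw [add_mul, mul_one_div, one_mul] at m2
        rw [abs_lt]; constructor <;> linarith
      have a2 := uc2 _ (gridx m hmN) x hx _ hlT s hsT (hxm.trans_le ((min_le_right _ _).trans (min_le_left _ _))) (hls.trans_le ((min_le_right _ _).trans (min_le_left _ _)))
      simp only at a2
      have a3 : |grad N (sch S b c f u0 τ N l) m - w x s| ≤ 2*η := by
        have := abs_sub_le (grad N (sch S b c f u0 τ N l) m) (w (m/N) (l*τ)) (w x s)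
        linarith
      have a4 := h.lips (w x s) (grad N (sch S b c f u0 τ N l) m)
      have a5 : Lam * |grad N (sch S b c f u0 τ N l) m - w x s| ≤ Lam * (2*η) := mul_le_mul_of_nonneg_left a3 hLam.le
      have e : S (grad N (sch S b c f u0 τ N l) m) - S 0 + (1/N:ℝ) * ∑ j ∈ range m, src b c f τ N (sch S b c f u0 τ N l) l j - H s =
        (S (grad N (sch S b c f u0 τ N l) m) - S (w x s)) + ((1/N:ℝ) * ∑ j ∈ range m, src b c f τ N (sch S b c f u0 τ N l) l j - ∫ y in (0:ℝ)..x, G (y,s)) := by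
        simp only [hH]; ring
      rw [e]
      refine (abs_add_le _ _).trans ?_
      linarith)
  rw [disc_identity hn1 m k] at L
  rw [abs_sub_comm] at L
  have fin := abs_sub_le (∫ y in (0:ℝ)..x, (u y t - u y 0)) (τ * ∑ l ∈ range k, (S (grad N (sch S b c f u0 τ N l) m) - S 0 + (1/N:ℝ) * ∑ j ∈ range m, src b c f τ N (sch S b c f u0 τ N l) l j)) (∫ s in (0:ℝ)..t, H s)
  refine fin.trans ?_
  have z1 : 4 * η * x ≤ 4 * η := mul_le_of_le_one_right (by positivity) hx.2
  have z2 : (2*Lam+2*Q+2)*η*t ≤ (2*Lam+2*Q+2)*η*T := mul_le_mul_of_nonneg_left ht.2 (by positivity)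
  have z3 : |CH| * τ ≤ |CH| * (μ * (1/N)) := mul_le_mul_of_nonneg_left hτle (abs_nonneg _)
  have z4 : (5 + ((2*Lam + 2*Q + 2) * T + 1)) * η = 4*η + η + ((2*Lam+2*Q+2)*η*T + η) := by ring
  rw [z4]
  linarith

end FB

namespace FB
open Finset Filter

lemma le_of_small {A B K : ℝ} (h : ∀ η > 0, A ≤ B + K * η) : A ≤ B := by
  by_contra hA
  push Not at hA
  have h1 := h 1 one_pos
  have hK : 0 < K := by linarith
  have := h ((A-B)/(2*K)) (by apply div_pos <;> linarith)
  rw [show K * ((A-B)/(2*K)) = (A-B)/2 by field_simp] at this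
  linarith

/-- Theorem E -/
theorem thmE {lam Lam Hs α : ℝ} {S S' : ℝ → ℝ} (h : Flux lam Lam Hs α S S') {Q L T : ℝ} {b c f : ℝ → ℝ → ℝ}
    {u0 u0' : ℝ → ℝ} (hc : Coef α Q b c f) (hi : Ini L u0 u0') (hT : 0 < T) :
    ∃ (u w : ℝ → ℝ → ℝ) (M : ℝ), 0 ≤ M ∧ Continuous (fun p : ℝ × ℝ => u p.1 p.2) ∧ Continuous (fun p : ℝ × ℝ => w p.1 p.2) ∧
      (∀ x ∈ Set.Icc (0:ℝ) 1, ∀ y ∈ Set.Icc (0:ℝ) 1, ∀ t ∈ Set.Icc (0:ℝ) T, |u y t - u x t - (y - x) * w x t| ≤ M * |y - x|^2) ∧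
      (∀ x ∈ Set.Icc (0:ℝ) 1, ∀ t ∈ Set.Icc (0:ℝ) T, ∀ s ∈ Set.Icc (0:ℝ) T, |u x t - u x s| ≤ M * |t - s|) ∧
      (∀ x ∈ Set.Icc (0:ℝ) 1, ∀ y ∈ Set.Icc (0:ℝ) 1, ∀ t ∈ Set.Icc (0:ℝ) T, |w x t - w y t| ≤ M * |x - y|) ∧
      (∀ x ∈ Set.Icc (0:ℝ) 1, u x 0 = u0 x) ∧ (∀ t ∈ Set.Icc (0:ℝ) T, w 0 t = 0) ∧ (∀ t ∈ Set.Icc (0:ℝ) T, w 1 t = 0) ∧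
      (∀ x ∈ Set.Icc (0:ℝ) 1, ∀ t ∈ Set.Icc (0:ℝ) T, ∫ y in (0:ℝ)..x, (u y t - u y 0) =
        ∫ s in (0:ℝ)..t, (S (w x s) - S 0 + ∫ y in (0:ℝ)..x, (b y s * w y s + c y s * u y s + f y s))) := by
  have hLam : 0 < Lam := h.lam_pos.trans_le h.lam_le
  have hQ := hc.Q_nonneg
  set μ := 1/(8*Lam) with hμd
  have hμ : 0 < μ := by positivity
  obtain ⟨M, hM0, N0, hN0, hM⟩ := sch_bounds h hc hi hT hμ (by rw [hμd]; field_simp; exact le_rfl)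
  set C := Lam * M + (Q * M + Q * M + Q) with hCd
  have hC0 : 0 ≤ C := by positivity
  set v : ℕ → ℕ → ℕ → ℝ := fun N : ℕ => sch S b c f u0 (μ/(N:ℝ)^2) N with hv
  have hC : ∀ N ≥ N0, ∀ k : ℕ, k * (μ/(N:ℝ)^2) ≤ T → ∀ j < N, |v N (k+1) j - v N k j| ≤ C * (μ/(N:ℝ)^2) := by
    intro N hN k hk j hj
    obtain ⟨m1, m2, m3⟩ := hM N hN k hk
    have e : v N (k+1) j - v N k j = (μ/(N:ℝ)^2) * (fdiv S N (v N k) j + src b c f (μ/(N:ℝ)^2) N (v N k) k j) := by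
      have : v N (k+1) j = v N k j + (μ/(N:ℝ)^2) * (fdiv S N (v N k) j + src b c f (μ/(N:ℝ)^2) N (v N k) k j) := rfl
      rw [this]; ring
    have hτ : 0 ≤ μ/(N:ℝ)^2 := by positivity
    rw [e, abs_mul, abs_of_nonneg hτ, mul_comm]
    apply mul_le_mul_of_nonneg_right _ hτ
    refine (abs_add_le _ _).trans (add_le_add ?_ ?_)
    · obtain ⟨a, a1, a2, a3⟩ := fdiv_lap h N (v N k) j
      rw [a3, abs_mul, abs_of_pos (h.lam_pos.trans_le a1)]
      exact mul_le_mul a2 (m3 j hj) (abs_nonneg _) hLam.le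
    · unfold src
      refine (abs_add_le _ _).trans (add_le_add ((abs_add_le _ _).trans (add_le_add ?_ ?_)) (hc.bf _ _))
      · rw [abs_mul]; exact mul_le_mul (hc.bb _ _) (m2 j hj.le) (abs_nonneg _) hQ
      · rw [abs_mul]; exact mul_le_mul (hc.bc _ _) (m1 j hj) (abs_nonneg _) hQ
  obtain ⟨φ, hφ, u1, w1, hu1, hw1, hlim1⟩ := limit_fn (v := v) hN0 hμ hC0 hM0 hM hC
  set u : ℝ → ℝ → ℝ := fun x t => u1 (cl 1 x) (cl T t) with hud
  set w : ℝ → ℝ → ℝ := fun x t => w1 (cl 1 x) (cl T t) with hwd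
  have hu : Continuous (fun p : ℝ × ℝ => u p.1 p.2) := cl_cont2 hT.le hu1
  have hw : Continuous (fun p : ℝ × ℝ => w p.1 p.2) := cl_cont2 hT.le hw1
  have hlim : ∀ ε > 0, ∀ᶠ n in atTop, ∀ x ∈ Set.Icc (0:ℝ) 1, ∀ t ∈ Set.Icc (0:ℝ) T, |Us v μ (φ n) x t - u x t| ≤ ε ∧
        |Ws v μ (φ n) x t - w x t| ≤ ε := by
    intro ε hε
    filter_upwards [hlim1 ε hε] with n hn x hx t ht
    simp only [hud, hwd, cl_eq hx, cl_eq ht]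
    exact hn x hx t ht
  have tN : Tendsto (fun n => (1:ℝ)/(φ n:ℝ)) atTop (nhds 0) :=
    tendsto_one_div_atTop_nhds_zero_nat.comp hφ.tendsto_atTop
  have key : ∀ η > 0, ∃ N ≥ N0, 1/(N:ℝ) ≤ η ∧ ∀ x ∈ Set.Icc (0:ℝ) 1, ∀ t ∈ Set.Icc (0:ℝ) T, |Us v μ N x t - u x t| ≤ η ∧
        |Ws v μ N x t - w x t| ≤ η := by
    intro η hη
    obtain ⟨n, n1, n2, n3⟩ := (((hφ.tendsto_atTop).eventually_ge_atTop N0).and ((tN.eventually (Iio_mem_nhds hη)).and (hlim η hη))).exists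
    exact ⟨φ n, n1, n2.le, n3⟩
  set M' := M + C with hM'
  have t0 : (0:ℝ) ∈ Set.Icc (0:ℝ) T := ⟨le_rfl, hT.le⟩
  refine ⟨u, w, M', by positivity, hu, hw, ?_, ?_, ?_, ?_, ?_, ?_, ?_⟩
  · intro x hx y hy t ht
    have : |u y t - u x t - (y - x) * w x t| ≤ M * |y - x|^2 := by
      apply le_of_small (K := 4 * M + 3)
      intro η hη
      obtain ⟨N, n1, n2, n3⟩ := key η hη
      have r := (reg_Ws (v := v) (hN0.trans n1) hμ (hM N n1) hx hy ht).2.2.2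
      have a1 := (n3 y hy t ht).1
      obtain ⟨a2, a3⟩ := n3 x hx t ht
      have e : u y t - u x t - (y - x) * w x t = (Us v μ N y t - Us v μ N x t - (y - x) * Ws v μ N x t) - (Us v μ N y t - u y t)
        + (Us v μ N x t - u x t) + (y - x) * (Ws v μ N x t - w x t) := by ring
      have hyx : |y - x| ≤ 1 := by rw [abs_le]; constructor <;> linarith [hx.1, hx.2, hy.1, hy.2]
      have a4 : |(y-x) * (Ws v μ N x t - w x t)| ≤ 1 * η := by
        rw [abs_mul]; exact mul_le_mul hyx a3 (abs_nonneg _) zero_le_one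
      have a5 : 4 * M / N ≤ 4 * M * η := by
        have := mul_le_mul_of_nonneg_left n2 (by positivity : 0 ≤ 4 * M)
        rwa [mul_one_div] at this
      rw [e]
      refine (abs_add_le _ _).trans ((add_le_add ((abs_add_le _ _).trans (add_le_add (abs_sub _ _) le_rfl)) le_rfl).trans ?_)
      linarith
    refine this.trans (mul_le_mul_of_nonneg_right (by linarith) (by positivity))
  · intro x hx t ht s hs
    have : |u x t - u x s| ≤ C * |t - s| := by
      apply le_of_small (K := C * μ + 2)
      intro η hη
      obtain ⟨N, n1, n2, n3⟩ := key η hη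
      have r := reg_time (x := x) (hN0.trans n1) hμ hC0 (hC N n1) hs ht
      have a1 := (n3 x hx t ht).1
      have a2 := (n3 x hx s hs).1
      have e : u x t - u x s = (Us v μ N x t - Us v μ N x s) - (Us v μ N x t - u x t) + (Us v μ N x s - u x s) := by ring
      have a3 : C * (μ / N) ≤ C * μ * η := by
        have := mul_le_mul_of_nonneg_left n2 (by positivity : 0 ≤ C * μ)
        rwa [mul_one_div, mul_div_assoc] at this
      rw [e]
      refine (abs_add_le _ _).trans ((add_le_add (abs_sub _ _) le_rfl).trans ?_)
      linarith
    exact this.trans (mul_le_mul_of_nonneg_right (by linarith) (abs_nonneg _))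
  · intro x hx y hy t ht
    have : |w x t - w y t| ≤ M * |x - y| := by
      apply le_of_small (K := M + 2)
      intro η hη
      obtain ⟨N, n1, n2, n3⟩ := key η hη
      have r := (reg_Ws (v := v) (hN0.trans n1) hμ (hM N n1) hx hy ht).2.2.1
      have a1 := (n3 x hx t ht).2
      have a2 := (n3 y hy t ht).2
      have e : w x t - w y t = (Ws v μ N x t - Ws v μ N y t) - (Ws v μ N x t - w x t) + (Ws v μ N y t - w y t) := by ring
      have a3 := mul_le_mul_of_nonneg_left n2 hM0
      rw [e]
      refine (abs_add_le _ _).trans ((add_le_add (abs_sub _ _) le_rfl).trans ?_)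
      linarith
    exact this.trans (mul_le_mul_of_nonneg_right (by linarith) (abs_nonneg _))
  · intro x hx
    rw [← sub_eq_zero]
    apply zero_of_small (K := 1 + L)
    intro η hη
    obtain ⟨N, n1, n2, n3⟩ := key η hη
    have hN1 := hN0.trans n1
    have a1 := (n3 x hx 0 t0).1
    have e : Us v μ N x 0 = u0 (cel N x / N) := by
      unfold Us; rw [zero_div, Nat.floor_zero]; rfl
    rw [e] at a1
    have c1 := cel_le hN1 hx
    have c2 := le_cel hN1 hx
    have a2 := hi.lipu (by positivity) c1 hx.2
    have a3 : L * (x - cel N x / N) ≤ L * η := mul_le_mul_of_nonneg_left (by linarith) hi.L_nonneg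
    have a4 := abs_sub_le (u x 0) (u0 (cel N x / N)) (u0 x)
    rw [abs_sub_comm] at a1
    rw [abs_sub_comm] at a2
    linarith
  · intro t ht
    apply zero_of_small (K := 1)
    intro η hη
    obtain ⟨N, n1, n2, n3⟩ := key η hη
    have a1 := (n3 0 ⟨le_rfl, zero_le_one⟩ t ht).2
    have e : Ws v μ N 0 t = 0 := by
      unfold Ws
      rw [show cel N 0 = 0 by simp [cel], grad_zero]
    rw [e, abs_sub_comm, sub_zero] at a1
    linarith
  · intro t ht
    apply zero_of_small (K := 1 + M)
    intro η hη
    obtain ⟨N, n1, n2, n3⟩ := key η hη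
    have hN1 := hN0.trans n1
    have hN' : (0:ℝ) < N := by exact_mod_cast hN1
    have a1 := (n3 1 ⟨zero_le_one, le_rfl⟩ t ht).2
    have hτ : 0 < μ/(N:ℝ)^2 := by positivity
    have hk : (⌊t/(μ/(N:ℝ)^2)⌋₊:ℝ) * (μ/(N:ℝ)^2) ≤ T := by
      have := Nat.floor_le (div_nonneg ht.1 hτ.le)
      rw [le_div_iff₀ hτ] at this
      exact this.trans ht.2
    have r := grad_lip hN1 _ M (hM N n1 _ hk).2.2 (cel N 1) N (cel_lt hN1 1).le le_rfl
    rw [grad_top, sub_zero] at r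
    have e : Ws v μ N 1 t = grad N (sch S b c f u0 (μ/(N:ℝ)^2) N ⌊t/(μ/(N:ℝ)^2)⌋₊) (cel N 1) := rfl
    rw [← e] at r
    have c2 := le_cel hN1 (x := 1) ⟨zero_le_one, le_rfl⟩
    have c1 := cel_le hN1 (x := 1) ⟨zero_le_one, le_rfl⟩
    rw [div_le_one hN'] at c1
    rw [← add_div, le_div_iff₀ hN'] at c2
    have : |((cel N 1:ℕ):ℝ) - N| ≤ 1 := by rw [abs_le]; constructor <;> linarith
    have r2 : M / N * |((cel N 1:ℕ):ℝ) - N| ≤ M * η := by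
      calc M / N * |((cel N 1:ℕ):ℝ) - N| ≤ M / N * 1 := mul_le_mul_of_nonneg_left this (by positivity)
        _ = M * (1/N) := by ring
        _ ≤ M * η := mul_le_mul_of_nonneg_left n2 hM0
    have := abs_sub_abs_le_abs_sub (w 1 t) (Ws v μ N 1 t)
    rw [abs_sub_comm] at a1
    linarith
  · intro x hx t ht
    exact limit_identity h hc hμ hv hφ hu hw hlim x t hx ht

end FB

namespace FB
open Filter Topology

lemma min_one_le_rpow {z α : ℝ} (hz : 0 ≤ z) (h0 : 0 < α) (h1 : α ≤ 1) : min 1 z ≤ z ^ α := by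
  rcases le_total z 1 with h | h
  · rw [min_eq_right h]
    calc z = z ^ (1:ℝ) := (Real.rpow_one z).symm
      _ ≤ z ^ α := Real.rpow_le_rpow_of_exponent_ge' hz h h0.le h1
  · rw [min_eq_left h]
    exact Real.one_le_rpow h h0.le

/-- a bounded Lipschitz function is Hölder -/
lemma holder_of_lip {χ : ℝ → ℝ} {e K α : ℝ} (he : 0 < e) (hK : 0 ≤ K) (h0 : 0 < α) (h1 : α ≤ 1)
    (hb : ∀ s t, |χ s - χ t| ≤ K) (hl : ∀ s t, |χ s - χ t| ≤ K * (|s - t| / e)) (s t : ℝ) :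
    |χ s - χ t| ≤ K * (1/e)^α * |s - t|^α := by
  have hz : 0 ≤ |s - t|/e := by positivity
  have h2 := min_one_le_rpow hz h0 h1
  have h3 : |χ s - χ t| ≤ K * min 1 (|s-t|/e) := by
    rcases le_total 1 (|s-t|/e) with h | h
    · rw [min_eq_left h, mul_one]; exact hb s t
    · rw [min_eq_right h]; exact hl s t
  refine h3.trans ((mul_le_mul_of_nonneg_left h2 hK).trans (le_of_eq ?_))
  rw [show |s-t|/e = (1/e) * |s-t| by ring, Real.mul_rpow (by positivity) (abs_nonneg _)]
  ring

lemma left_part {σ σ' : ℝ → ℝ} {s1 r1 e1 m G C α : ℝ} (h0 : 0 < α) (h1 : α ≤ 1) (hr : r1 < e1) (he : e1 < s1)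
    (hm0 : 0 < m) (hm : ∀ s ≤ e1, m ≤ σ' s) (hG : ∀ s ≤ e1, σ' s ≤ G)
    (hd : ∀ s ∈ Set.Iic s1, HasDerivWithinAt σ (σ' s) (Set.Iic s1) s)
    (hC : ∀ s ∈ Set.Iic s1, ∀ t ∈ Set.Iic s1, |σ' s - σ' t| ≤ C * |s - t| ^ α)
    (hmono : StrictMonoOn σ (Set.Iic s1)) :
    ∃ c0 > 0, ∀ c, 0 < c → c ≤ c0 → ∃ (P P' : ℝ → ℝ) (H : ℝ), 0 ≤ H ∧ (∀ s, HasDerivAt P (P' s) s) ∧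
      (∀ s, c ≤ P' s) ∧ (∀ s, P' s ≤ G) ∧ (∀ s t, |P' s - P' t| ≤ H * |s - t|^α) ∧ (∀ s ≤ r1, P s = σ s) ∧
      (∀ s, r1 < s → s ≤ s1 → P s < σ s) ∧ P s1 < σ e1 ∧ (∀ s ≥ e1, P s = P s1 + c * (s - s1)) := by
  set e := e1 - r1 with hed
  have hepos : 0 < e := by linarith
  have hse : 0 < s1 - e1 := by linarith
  have hGm : m ≤ G := (hm e1 le_rfl).trans (hG e1 le_rfl)
  refine ⟨m * e / (4 * (s1 - e1) + 2 * e), by positivity, ?_⟩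
  intro c hc hcle
  have hc2 : c * (4 * (s1 - e1) + 2 * e) ≤ m * e := by rwa [le_div_iff₀ (by positivity)] at hcle
  have hcm : c ≤ m := by nlinarith
  have hcs : c * (s1 - e1) < (m - c) * e / 2 := by nlinarith
  set χ : ℝ → ℝ := fun s => max 0 (min 1 ((e1 - s)/e)) with hχ
  have χ0 : ∀ s, 0 ≤ χ s := fun s => le_max_left _ _
  have χ1 : ∀ s, χ s ≤ 1 := fun s => max_le zero_le_one (min_le_left _ _)
  have χc : Continuous χ := by rw [hχ]; fun_prop
  have χb : ∀ s t, |χ s - χ t| ≤ 1 := fun s t => by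
    rw [abs_le]; constructor <;> linarith [χ0 s, χ0 t, χ1 s, χ1 t]
  have χl : ∀ s t, |χ s - χ t| ≤ 1 * (|s - t|/e) := fun s t => by
    have a1 := abs_max_sub_max_le_max 0 (min 1 ((e1 - s)/e)) 0 (min 1 ((e1 - t)/e))
    have a2 := abs_min_sub_min_le_max 1 ((e1 - s)/e) 1 ((e1 - t)/e)
    simp only [sub_self, abs_zero, abs_nonneg, sup_of_le_right] at a1 a2
    have a3 : |(e1 - s)/e - (e1 - t)/e| = |s - t|/e := by
      rw [← sub_div, abs_div, abs_of_pos hepos, abs_sub_comm s t]; congr 2; ring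
    rw [one_mul, ← a3]; exact a1.trans a2
  have χle : ∀ s ≤ r1, χ s = 1 := fun s hs => by
    have : 1 ≤ (e1 - s)/e := by rw [le_div_iff₀ hepos]; linarith
    simp only [hχ]; rw [min_eq_left this]; norm_num
  have χge : ∀ s ≥ e1, χ s = 0 := fun s hs => by
    have : (e1 - s)/e ≤ 0 := div_nonpos_of_nonpos_of_nonneg (by linarith) hepos.le
    simp only [hχ]; exact max_eq_left ((min_le_right _ _).trans this)
  set P' : ℝ → ℝ := fun s => c + χ s * (σ' (min s e1) - c) with hP'
  have g1 : ∀ s, m ≤ σ' (min s e1) := fun s => hm _ (min_le_right _ _)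
  have g2 : ∀ s, σ' (min s e1) ≤ G := fun s => hG _ (min_le_right _ _)
  have hC0 : 0 ≤ C := by
    have := hC s1 (Set.mem_Iic.mpr le_rfl) (s1 - 1) (Set.mem_Iic.mpr (by linarith))
    rw [show s1 - (s1 - 1) = 1 by ring, abs_one, Real.one_rpow, mul_one] at this
    exact (abs_nonneg _).trans this
  have gh : ∀ s t, |σ' (min s e1) - σ' (min t e1)| ≤ C * |s - t|^α := fun s t => by
    refine (hC _ (Set.mem_Iic.mpr ((min_le_right _ _).trans he.le)) _ (Set.mem_Iic.mpr ((min_le_right _ _).trans he.le))).trans ?_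
    apply mul_le_mul_of_nonneg_left _ hC0
    apply Real.rpow_le_rpow (abs_nonneg _) _ h0.le
    have := abs_min_sub_min_le_max s e1 t e1
    simpa using this
  set H := C + G * (1 * (1/e)^α) with hH
  have hG0 : 0 ≤ G := hm0.le.trans hGm
  have hPH : ∀ s t, |P' s - P' t| ≤ H * |s - t|^α := fun s t => by
    have e2 : P' s - P' t = χ s * (σ' (min s e1) - σ' (min t e1)) + (σ' (min t e1) - c) * (χ s - χ t) := by
      simp only [hP']; ring
    rw [e2]
    refine (abs_add_le _ _).trans ?_
    rw [abs_mul, abs_mul, abs_of_nonneg (χ0 s), abs_of_nonneg (by linarith [g1 t] : 0 ≤ σ' (min t e1) - c)]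
    have a1 := mul_le_mul (χ1 s) (gh s t) (abs_nonneg _) zero_le_one
    have a2 := mul_le_mul (by linarith [g2 t] : σ' (min t e1) - c ≤ G) (holder_of_lip hepos zero_le_one h0 h1 χb χl s t) (abs_nonneg _) hG0
    calc _ ≤ _ := add_le_add a1 a2
      _ = H * |s-t|^α := by rw [hH]; ring
  have hH0 : 0 ≤ H := by positivity
  have Pc : Continuous P' := by
    have gc : Continuous (fun s => σ' (min s e1)) := by
      have c1 : ContinuousOn σ' (Set.Iic s1) := by
        intro s hs
        rw [ContinuousWithinAt, tendsto_iff_norm_sub_tendsto_zero]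
        have l1 : Tendsto (fun t => C * |t - s|^α) (𝓝[Set.Iic s1] s) (𝓝 0) := by
          have : ContinuousAt (fun t : ℝ => C * |t - s|^α) s := by
            apply ContinuousAt.mul continuousAt_const
            apply ContinuousAt.rpow_const (by fun_prop) (Or.inr h0.le)
          have := this.tendsto.mono_left (nhdsWithin_le_nhds (s := Set.Iic s1))
          simpa [Real.zero_rpow h0.ne'] using this
        refine squeeze_zero' (Eventually.of_forall fun t => norm_nonneg _) ?_ l1
        filter_upwards [self_mem_nhdsWithin] with t ht
        exact hC t ht s hs
      exact c1.comp_continuous (by fun_prop) (fun s => Set.mem_Iic.mpr ((min_le_right _ _).trans he.le))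
    exact continuous_const.add (χc.mul (gc.sub continuous_const))
  set P : ℝ → ℝ := fun s => σ r1 + ∫ y in r1..s, P' y with hP
  have hPd : ∀ s, HasDerivAt P (P' s) s := fun s => by
    have := (Pc.integral_hasStrictDerivAt r1 s).hasDerivAt
    exact this.const_add _
  have hP1 : ∀ s ≤ r1, P s = σ s := by
    intro s hs
    have hi : ∫ y in s..r1, P' y = σ r1 - σ s := by
      apply intervalIntegral.integral_eq_sub_of_hasDerivAt_of_le hs
      · intro y hy
        exact ((hd y (by simp only [Set.mem_Iic]; linarith [hy.2])).continuousWithinAt).mono (fun z hz => by simp only [Set.mem_Iic]; linarith [hz.2])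
      · intro y hy
        have : P' y = σ' y := by
          simp only [hP']; rw [χle y hy.2.le, min_eq_left (by linarith [hy.2])]; ring
        rw [this]
        exact (hd y (by simp only [Set.mem_Iic]; linarith [hy.2])).hasDerivAt (Iic_mem_nhds (by linarith [hy.2]))
      · exact Pc.intervalIntegrable _ _
    simp only [hP]
    rw [intervalIntegral.integral_symm, hi]; ring
  have hP2 : ∀ s ∈ Set.Icc r1 e1, P s ≤ σ s - (m - c) * (s - r1)^2 / (2*e) := by
    intro s hs
    set F : ℝ → ℝ := fun s => σ s - P s - (m - c)/(2*e) * (s - r1)^2 with hF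
    have hFc : ContinuousOn F (Set.Icc r1 e1) := by
      apply ContinuousOn.sub
      · apply ContinuousOn.sub
        · intro y hy
          exact ((hd y (by simp only [Set.mem_Iic]; linarith [hy.2])).continuousWithinAt).mono (fun z hz => by simp only [Set.mem_Iic]; linarith [hz.2])
        · exact fun y _ => (hPd y).continuousAt.continuousWithinAt
      · fun_prop
    have hFd : ∀ y ∈ interior (Set.Icc r1 e1), HasDerivWithinAt F (σ' y - P' y - (m-c)/(2*e) * (2 * (y - r1))) (interior (Set.Icc r1 e1)) y := by
      intro y hy
      rw [interior_Icc] at hy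
      apply HasDerivAt.hasDerivWithinAt
      have d1 : HasDerivAt σ (σ' y) y := (hd y (by simp only [Set.mem_Iic]; linarith [hy.2])).hasDerivAt (Iic_mem_nhds (by linarith [hy.2]))
      have d2 : HasDerivAt (fun s => (s - r1)^2) (2 * (y - r1)) y := by
        have := ((hasDerivAt_id' y).sub_const r1).fun_pow 2
        simpa using this
      exact (d1.sub (hPd y)).sub (d2.const_mul _)
    have mono := monotoneOn_of_hasDerivWithinAt_nonneg (convex_Icc r1 e1) hFc hFd (by
      intro y hy
      rw [interior_Icc] at hy
      have q1 : χ y ≤ (e1 - y)/e := by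
        simp only [hχ]
        exact max_le (div_nonneg (by linarith [hy.2]) hepos.le) (min_le_right _ _)
      have q2 := hm y hy.2.le
      have q3 : σ' y - P' y = (1 - χ y) * (σ' y - c) := by
        simp only [hP']; rw [min_eq_left hy.2.le]; ring
      have q4 : (y - r1)/e ≤ 1 - χ y := by
        have : (y - r1)/e + (e1 - y)/e = 1 := by rw [← add_div, div_eq_one_iff_eq hepos.ne']; linarith
        linarith
      have q5 : (y-r1)/e * (m - c) ≤ (1 - χ y) * (σ' y - c) :=
        mul_le_mul q4 (by linarith) (by linarith) (by linarith [χ1 y])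
      rw [q3]
      have : (m-c)/(2*e) * (2 * (y - r1)) = (y-r1)/e * (m - c) := by field_simp
      rw [this]; linarith)
    have := mono ⟨le_rfl, hr.le⟩ hs hs.1
    simp only [hF] at this
    rw [hP1 r1 le_rfl] at this
    have e3 : (m - c) * (s - r1)^2 / (2*e) = (m - c)/(2*e) * (s - r1)^2 := by ring
    rw [e3]
    have : σ r1 - σ r1 - (m - c) / (2 * e) * (r1 - r1) ^ 2 = 0 := by ring
    linarith
  have hlin : ∀ s ≥ e1, P s = P e1 + c * (s - e1) := by
    intro s hs
    have : ∫ y in e1..s, P' y = c * (s - e1) := by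
      have : ∫ y in e1..s, P' y = ∫ y in e1..s, c := by
        apply intervalIntegral.integral_congr
        intro y hy
        rw [Set.uIcc_of_le hs] at hy
        simp only [hP']; rw [χge y hy.1]; ring
      rw [this, intervalIntegral.integral_const, smul_eq_mul, mul_comm]
    rw [← this]
    simp only [hP]
    rw [← intervalIntegral.integral_add_adjacent_intervals (Pc.intervalIntegrable r1 e1) (Pc.intervalIntegrable e1 s)]
    ring
  have hPe : P e1 ≤ σ e1 - (m - c) * e / 2 := by
    have := hP2 e1 ⟨hr.le, le_rfl⟩
    rw [← hed] at this
    have e4 : (m - c) * e^2 / (2*e) = (m - c) * e / 2 := by field_simp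
    linarith
  have hPs : ∀ s, e1 ≤ s → s ≤ s1 → P s < σ e1 := by
    intro s a1 a2
    rw [hlin s a1]
    have : c * (s - e1) ≤ c * (s1 - e1) := mul_le_mul_of_nonneg_left (by linarith) hc.le
    linarith
  refine ⟨P, P', H, hH0, hPd, ?_, ?_, hPH, hP1, ?_, hPs s1 he.le le_rfl, ?_⟩
  · intro s
    have := mul_nonneg (χ0 s) (by linarith [g1 s] : 0 ≤ σ' (min s e1) - c)
    simp only [hP']; linarith
  · intro s
    have := mul_le_mul (χ1 s) (by linarith [g2 s] : σ' (min s e1) - c ≤ G - c) (by linarith [g1 s]) zero_le_one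
    simp only [hP']; linarith
  · intro s a1 a2
    rcases le_total s e1 with h | h
    · have := hP2 s ⟨a1.le, h⟩
      have hcm' : c < m := by nlinarith
      have : 0 < (m - c) * (s - r1)^2 / (2*e) := by
        apply div_pos (mul_pos (by linarith) (pow_pos (by linarith) 2)) (by linarith)
      linarith
    · refine (hPs s h a2).trans_le (hmono.monotoneOn (Set.mem_Iic.mpr he.le) (Set.mem_Iic.mpr a2) h)
  · intro s hs
    rw [hlin s hs, hlin s1 he.le]; ring

end FB

namespace FB
open Filter Topology

/-- one-sided structure of the flux -/
structure LeftHyp (α s1 a lam Lam C : ℝ) (σ σ' : ℝ → ℝ) : Prop where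
  α0 : 0 < α
  α1 : α ≤ 1
  lam0 : 0 < lam
  d : ∀ s ∈ Set.Iic s1, HasDerivWithinAt σ (σ' s) (Set.Iic s1) s
  h : ∀ s ∈ Set.Iic s1, ∀ t ∈ Set.Iic s1, |σ' s - σ' t| ≤ C * |s - t| ^ α
  pos : ∀ s < s1, 0 < σ' s
  lb : ∀ s < a, lam ≤ σ' s
  ub : ∀ s < a, σ' s ≤ Lam

lemma LeftHyp.cont' {α s1 a lam Lam C : ℝ} {σ σ' : ℝ → ℝ} (H : LeftHyp α s1 a lam Lam C σ σ') : ContinuousOn σ' (Set.Iic s1) := by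
  intro s hs
  rw [ContinuousWithinAt, tendsto_iff_norm_sub_tendsto_zero]
  have l1 : Tendsto (fun t => C * |t - s|^α) (𝓝[Set.Iic s1] s) (𝓝 0) := by
    have : ContinuousAt (fun t : ℝ => C * |t - s|^α) s := by
      apply ContinuousAt.mul continuousAt_const
      apply ContinuousAt.rpow_const (by fun_prop) (Or.inr H.α0.le)
    have := this.tendsto.mono_left (nhdsWithin_le_nhds (s := Set.Iic s1))
    simpa [Real.zero_rpow H.α0.ne'] using this
  refine squeeze_zero' (Eventually.of_forall fun t => norm_nonneg _) ?_ l1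
  filter_upwards [self_mem_nhdsWithin] with t ht
  exact H.h t ht s hs

lemma LeftHyp.cont {α s1 a lam Lam C : ℝ} {σ σ' : ℝ → ℝ} (H : LeftHyp α s1 a lam Lam C σ σ') : ContinuousOn σ (Set.Iic s1) :=
  fun s hs => (H.d s hs).continuousWithinAt

lemma LeftHyp.mono {α s1 a lam Lam C : ℝ} {σ σ' : ℝ → ℝ} (H : LeftHyp α s1 a lam Lam C σ σ') : StrictMonoOn σ (Set.Iic s1) := by
  apply strictMonoOn_of_hasDerivWithinAt_pos (f' := σ') (convex_Iic s1) H.cont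
  · intro s hs
    rw [interior_Iic] at hs ⊢
    exact (H.d s (Set.mem_Iic.mpr (le_of_lt (Set.mem_Iio.mp hs)))).mono Set.Iio_subset_Iic_self
  · intro s hs
    rw [interior_Iic] at hs
    exact H.pos s hs

lemma LeftHyp.ubd {α s1 a lam Lam C : ℝ} {σ σ' : ℝ → ℝ} (H : LeftHyp α s1 a lam Lam C σ σ') : ∃ G, ∀ s ≤ s1, |σ' s| ≤ G := by
  obtain ⟨G1, hG1⟩ := (isCompact_Icc (a := a) (b := s1)).exists_bound_of_continuousOn (H.cont'.mono Set.Icc_subset_Iic_self)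
  refine ⟨max G1 Lam, fun s hs => ?_⟩
  rcases lt_or_ge s a with h | h
  · rw [abs_of_pos (H.lam0.trans_le (H.lb s h))]; exact (H.ub s h).trans (le_max_right _ _)
  · exact (hG1 s ⟨h, hs⟩).trans (le_max_left _ _)

lemma LeftHyp.lbd {α s1 a lam Lam C : ℝ} {σ σ' : ℝ → ℝ} (H : LeftHyp α s1 a lam Lam C σ σ') {e1 : ℝ} (he : e1 < s1) :
    ∃ m > 0, ∀ s ≤ e1, m ≤ σ' s := by
  rcases (Set.Icc a e1).eq_empty_or_nonempty with hE | hE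
  · refine ⟨lam, H.lam0, fun s hs => H.lb s ?_⟩
    rw [Set.Icc_eq_empty_iff] at hE
    linarith
  · obtain ⟨x, hx, hmin⟩ := (isCompact_Icc (a := a) (b := e1)).exists_isMinOn hE
      (H.cont'.mono (fun z hz => Set.mem_Iic.mpr (hz.2.trans he.le)))
    refine ⟨min lam (σ' x), lt_min H.lam0 (H.pos x (hx.2.trans_lt he)), fun s hs => ?_⟩
    rcases lt_or_ge s a with h | h
    · exact (min_le_left _ _).trans (H.lb s h)
    · exact (min_le_right _ _).trans (hmin ⟨h, hs⟩)

/-- Lipschitz bound on the left branch -/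
lemma LeftHyp.lip {α s1 a lam Lam C : ℝ} {σ σ' : ℝ → ℝ} (H : LeftHyp α s1 a lam Lam C σ σ') :
    ∃ G, 0 ≤ G ∧ ∀ s ≤ s1, ∀ t ≤ s1, |σ s - σ t| ≤ G * |s - t| := by
  obtain ⟨G, hG⟩ := H.ubd
  refine ⟨G, (abs_nonneg _).trans (hG s1 le_rfl), fun s hs t ht => ?_⟩
  exact (convex_Iic s1).norm_image_sub_le_of_norm_hasDerivWithin_le H.d hG ht hs

lemma LeftHyp.left {α s1 a lam Lam C : ℝ} {σ σ' : ℝ → ℝ} (H : LeftHyp α s1 a lam Lam C σ σ') {r1 e1 : ℝ} (hr : r1 < e1) (he : e1 < s1) :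
    ∃ G, ∃ c0 > 0, ∀ c, 0 < c → c ≤ c0 → ∃ (P P' : ℝ → ℝ) (H : ℝ), 0 ≤ H ∧ (∀ s, HasDerivAt P (P' s) s) ∧
      (∀ s, c ≤ P' s) ∧ (∀ s, P' s ≤ G) ∧ (∀ s t, |P' s - P' t| ≤ H * |s - t|^α) ∧ (∀ s ≤ r1, P s = σ s) ∧
      (∀ s, r1 < s → s ≤ s1 → P s < σ s) ∧ P s1 < σ e1 ∧ (∀ s ≥ e1, P s = P s1 + c * (s - s1)) := by
  obtain ⟨m, hm0, hm⟩ := H.lbd he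
  obtain ⟨G, hG⟩ := H.ubd
  exact ⟨G, left_part H.α0 H.α1 hr he hm0 hm (fun s hs => (le_abs_self _).trans (hG s (by linarith))) H.d H.h H.mono⟩

/-- choice of the truncation points -/
lemma LeftHyp.pts {α s1 a lam Lam C : ℝ} {σ σ' : ℝ → ℝ} (H : LeftHyp α s1 a lam Lam C σ σ') {p z mid : ℝ} (hp : p < s1)
    (hz : p < z) (hmid : σ p < mid) : ∃ e1, p < e1 ∧ e1 < s1 ∧ e1 < z ∧ σ e1 < mid := by
  have hc : ContinuousAt σ p := (H.cont p hp.le).continuousAt (Iic_mem_nhds hp)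
  have h1 : ∀ᶠ y in 𝓝[>] p, σ y < mid := (hc.eventually (Iio_mem_nhds hmid)).filter_mono nhdsWithin_le_nhds
  have h2 : ∀ᶠ y in 𝓝[>] p, y < s1 := (Iio_mem_nhds hp : Set.Iio s1 ∈ 𝓝 p) |> fun h => mem_nhdsWithin_of_mem_nhds h
  have h3 : ∀ᶠ y in 𝓝[>] p, y < z := (Iio_mem_nhds hz : Set.Iio z ∈ 𝓝 p) |> fun h => mem_nhdsWithin_of_mem_nhds h
  have h4 : ∀ᶠ y in 𝓝[>] p, p < y := self_mem_nhdsWithin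
  obtain ⟨y, y1, y2, y3, y4⟩ := (h1.and (h2.and (h3.and h4))).exists
  exact ⟨y, y4, y2, y3, y1⟩

lemma leftHyp_of {α s1 s2 lam Lam : ℝ} {σ σ' : ℝ → ℝ} (hf : FluxHyp α s1 s2 lam Lam σ σ') : ∃ C, LeftHyp α s1 (s1/2) lam Lam C σ σ' := by
  obtain ⟨C, hC⟩ := hf.holder_left
  exact ⟨C, hf.alpha_pos, hf.alpha_lt_one.le, hf.lam_pos, hf.deriv_left, hC, fun s hs => hf.deriv_pos s (Or.inl hs),
    fun s hs => hf.deriv_lb s (Or.inl hs), fun s hs => hf.deriv_ub s (Or.inl hs)⟩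

lemma rightHyp_of {α s1 s2 lam Lam : ℝ} {σ σ' : ℝ → ℝ} (hf : FluxHyp α s1 s2 lam Lam σ σ') :
    ∃ C, LeftHyp α (-s2) (-(2*s2)) lam Lam C (fun s => -σ (-s)) (fun s => σ' (-s)) := by
  obtain ⟨C, hC⟩ := hf.holder_right
  refine ⟨C, hf.alpha_pos, hf.alpha_lt_one.le, hf.lam_pos, ?_, ?_, ?_, ?_, ?_⟩
  · intro s hs
    have hs' : -s ∈ Set.Ici s2 := by simp only [Set.mem_Iic, Set.mem_Ici] at *; linarith
    have h1 := (hf.deriv_right (-s) hs').scomp (h := fun s => -s) s ((hasDerivAt_neg s).hasDerivWithinAt (s := Set.Iic (-s2)))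
      (fun t ht => by simp only [Set.mem_Iic, Set.mem_Ici] at *; linarith)
    have := h1.fun_neg
    simpa [Function.comp_def] using this
  · intro s hs t ht
    have := hC (-s) (by simp only [Set.mem_Iic, Set.mem_Ici] at *; linarith) (-t) (by simp only [Set.mem_Iic, Set.mem_Ici] at *; linarith)
    rwa [show -s - -t = -(s - t) by ring, abs_neg] at this
  · exact fun s hs => hf.deriv_pos (-s) (Or.inr (by linarith))
  · exact fun s hs => hf.deriv_lb (-s) (Or.inr (by linarith))
  · exact fun s hs => hf.deriv_ub (-s) (Or.inr (by linarith))

theorem sigma_tilde {α s1 s2 lam Lam s1star s2star z : ℝ} {σ σ' : ℝ → ℝ} (hf : FluxHyp α s1 s2 lam Lam σ σ')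
    (hs1star' : s1star < s1) (hs1star_eq : σ s1star = σ s2)
    (hs2star : s2 < s2star) (hs2star_eq : σ s2star = σ s1) (hz1 : s1star < z) (hz2 : z < s2star) :
    ∃ (r1 r2 : ℝ) (S S' : ℝ → ℝ) (lam0 Lam0 Hs : ℝ), s1star < r1 ∧ r1 < s1 ∧ s2 < r2 ∧ r2 < s2star ∧ r1 < z ∧ z < r2 ∧
      Flux lam0 Lam0 Hs α S S' ∧ (∀ s ≤ r1, S s = σ s) ∧ (∀ s ≥ r2, S s = σ s) ∧
      (∀ s, r1 < s → s ≤ s1 → S s < σ s) ∧ (∀ s, s2 ≤ s → s < r2 → σ s < S s) := by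
  obtain ⟨C1, H1⟩ := leftHyp_of hf
  obtain ⟨C2, H2⟩ := rightHyp_of hf
  have h12 := hf.s1_lt_s2
  have hlt := hf.sigma_s2_lt_s1
  obtain ⟨e1, p1, p2, p3, p4⟩ := H1.pts (mid := (σ s1 + σ s2)/2) hs1star' hz1 (by rw [hs1star_eq]; linarith)
  obtain ⟨e2, q1, q2, q3, q4⟩ := H2.pts (p := -s2star) (z := -z) (mid := -((σ s1 + σ s2)/2)) (by linarith) (by linarith) (by
    simp only [neg_neg]; rw [hs2star_eq]; linarith)
  set r1 := (s1star + e1)/2 with hr1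
  set r2 := (-s2star + e2)/2 with hr2
  obtain ⟨G1, c1, c1pos, L1⟩ := H1.left (r1 := r1) (e1 := e1) (by rw [hr1]; linarith) p2
  obtain ⟨G2, c2, c2pos, L2⟩ := H2.left (r1 := r2) (e1 := e2) (by rw [hr2]; linarith) q2
  have hD : 0 < σ (-e2) - σ e1 := by linarith
  set c := min (min c1 c2) ((σ (-e2) - σ e1)/(s2 - s1)) with hc
  have hs12 : 0 < s2 - s1 := by linarith
  have hcpos : 0 < c := lt_min (lt_min c1pos c2pos) (div_pos hD hs12)
  have hcD : c * (s2 - s1) ≤ σ (-e2) - σ e1 := by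
    rw [← le_div_iff₀ hs12]; exact min_le_right _ _
  obtain ⟨P, P', HP, hP0, Pd, Plb, Pub, Ph, Peq, Plt, Ps, Plin⟩ := L1 c hcpos ((min_le_left _ _).trans (min_le_left _ _))
  obtain ⟨R, R', HR, hR0, Rd, Rlb, Rub, Rh, Req, Rlt, Rs, Rlin⟩ := L2 c hcpos ((min_le_left _ _).trans (min_le_right _ _))
  -- right part
  set Q : ℝ → ℝ := fun s => - R (-s) with hQ
  have Qd : ∀ s, HasDerivAt Q (R' (-s)) s := fun s => by
    have := ((Rd (-s)).scomp s (hasDerivAt_neg s)).fun_neg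
    simpa [Function.comp_def] using this
  have Qlin : ∀ s ≤ s2, Q s = Q s2 + c * (s - s2) := fun s hs => by
    simp only [hQ]
    rw [Rlin (-s) (by linarith)]; ring
  -- bump
  set χ : ℝ → ℝ := fun s => max 0 (min (s - s1) (s2 - s)) with hχ
  have χ0 : ∀ s, 0 ≤ χ s := fun s => le_max_left _ _
  have χ1 : ∀ s, χ s ≤ s2 - s1 := fun s => max_le hs12.le (by
    rcases le_total s s2 with h | h
    · exact (min_le_left _ _).trans (by linarith)
    · exact (min_le_right _ _).trans (by linarith))
  have χc : Continuous χ := by rw [hχ]; fun_prop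
  have χb : ∀ s t, |χ s - χ t| ≤ s2 - s1 := fun s t => by
    rw [abs_le]; constructor <;> linarith [χ0 s, χ0 t, χ1 s, χ1 t]
  have χl : ∀ s t, |χ s - χ t| ≤ (s2 - s1) * (|s - t|/(s2 - s1)) := fun s t => by
    have a1 := abs_max_sub_max_le_max 0 (min (s - s1) (s2 - s)) 0 (min (t - s1) (s2 - t))
    have a2 := abs_min_sub_min_le_max (s - s1) (s2 - s) (t - s1) (s2 - t)
    simp only [sub_self, abs_zero, abs_nonneg, sup_of_le_right] at a1
    rw [show s - s1 - (t - s1) = s - t by ring, show s2 - s - (s2 - t) = -(s - t) by ring, abs_neg, max_self] at a2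
    rw [mul_div_cancel₀ _ hs12.ne']
    exact a1.trans a2
  have χz : ∀ s, s ≤ s1 ∨ s2 ≤ s → χ s = 0 := fun s hs => by
    simp only [hχ]
    apply max_eq_left
    rcases hs with h | h
    · exact (min_le_left _ _).trans (by linarith)
    · exact (min_le_right _ _).trans (by linarith)
  set X : ℝ → ℝ := fun s => ∫ y in s1..s, χ y with hX
  have Xd : ∀ s, HasDerivAt X (χ s) s := fun s => (χc.integral_hasStrictDerivAt s1 s).hasDerivAt
  have Xl : ∀ s ≤ s1, X s = 0 := fun s hs => by
    have : ∫ y in s1..s, χ y = ∫ y in s1..s, (0:ℝ) := by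
      apply intervalIntegral.integral_congr
      intro y hy
      rw [Set.uIcc_of_ge hs] at hy
      exact χz y (Or.inl hy.2)
    simp only [hX]; rw [this]; simp
  have Xr : ∀ s ≥ s2, X s = X s2 := fun s hs => by
    have : ∫ y in s2..s, χ y = ∫ y in s2..s, (0:ℝ) := by
      apply intervalIntegral.integral_congr
      intro y hy
      rw [Set.uIcc_of_le hs] at hy
      exact χz y (Or.inr hy.1)
    simp only [hX]
    rw [← intervalIntegral.integral_add_adjacent_intervals (χc.intervalIntegrable s1 s2) (χc.intervalIntegrable s2 s), this]
    simp
  have X2 : 0 < X s2 := by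
    apply intervalIntegral.intervalIntegral_pos_of_pos_on (χc.intervalIntegrable _ _) _ h12
    intro y hy
    exact lt_max_of_lt_right (lt_min (by linarith [hy.1]) (by linarith [hy.2]))
  set A := (Q s2 - P s1 - c * (s2 - s1)) / X s2 with hA
  have hA0 : 0 ≤ A := by
    apply div_nonneg _ X2.le
    have : σ (-e2) < Q s2 := by simp only [hQ]; linarith
    linarith
  have hAX : A * X s2 = Q s2 - P s1 - c * (s2 - s1) := div_mul_cancel₀ _ X2.ne'
  set S : ℝ → ℝ := fun s => P s + (Q s - (Q s2 + c * (s - s2))) + A * X s with hS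
  set S' : ℝ → ℝ := fun s => P' s + (R' (-s) - c) + A * χ s with hS'
  have SP : ∀ s ≤ s1, S s = P s := fun s hs => by
    simp only [hS]; rw [Xl s hs, Qlin s (by linarith)]; ring
  have SQ : ∀ s ≥ s2, S s = Q s := fun s hs => by
    simp only [hS]; rw [Xr s hs, hAX, Plin s (by linarith)]; ring
  refine ⟨r1, -r2, S, S', c, G1 + (G2 - c) + A * (s2 - s1), HP + HR + A * ((s2-s1) * (1/(s2-s1))^α), by linarith, by linarith,
    by linarith, by linarith, by linarith, by linarith, ⟨hcpos, hf.alpha_pos, hf.alpha_lt_one.le, ?_, ?_, ?_, ?_, ?_⟩, ?_, ?_, ?_, ?_⟩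
  · have : 0 ≤ (1/(s2-s1))^α := Real.rpow_nonneg (by positivity) _
    positivity
  · intro s
    have l1 : HasDerivAt (fun s => Q s2 + c * (s - s2)) c s := by
      have := (((hasDerivAt_id' s).sub_const s2).const_mul c).const_add (Q s2)
      simpa using this
    exact ((Pd s).add ((Qd s).sub l1)).add ((Xd s).const_mul A)
  · intro s
    have := mul_nonneg hA0 (χ0 s)
    have := Plb s
    have := Rlb (-s)
    simp only [hS']; linarith
  · intro s
    have := mul_le_mul_of_nonneg_left (χ1 s) hA0
    have := Pub s
    have := Rub (-s)
    simp only [hS']; linarith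
  · intro s t
    have e : S' s - S' t = (P' s - P' t) + (R' (-s) - R' (-t)) + A * (χ s - χ t) := by simp only [hS']; ring
    rw [e]
    have a1 := Ph s t
    have a2 := Rh (-s) (-t)
    rw [show -s - -t = -(s - t) by ring, abs_neg] at a2
    have a3 := mul_le_mul_of_nonneg_left (holder_of_lip hs12 hs12.le hf.alpha_pos hf.alpha_lt_one.le χb χl s t) hA0
    have a4 : |A * (χ s - χ t)| = A * |χ s - χ t| := by rw [abs_mul, abs_of_nonneg hA0]
    calc _ ≤ |P' s - P' t| + |R' (-s) - R' (-t)| + |A * (χ s - χ t)| := (abs_add_le _ _).trans (add_le_add (abs_add_le _ _) le_rfl)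
      _ ≤ _ := by rw [a4]; linarith
  · intro s hs
    rw [SP s (by linarith), Peq s hs]
  · intro s hs
    rw [SQ s (by linarith)]
    simp only [hQ]
    rw [Req (-s) (by linarith)]; simp
  · intro s a1 a2
    rw [SP s a2]; exact Plt s a1 a2
  · intro s a1 a2
    rw [SQ s a1]
    have := Rlt (-s) (by linarith) (by linarith)
    simp only [neg_neg] at this
    simp only [hQ]; linarith

end FB

namespace FB
open Filter Topology MeasureTheory

/-- partial derivatives of functions on the plane -/
noncomputable def px (f : ℝ × ℝ → ℝ) (p : ℝ × ℝ) : ℝ := fderiv ℝ f p (1, 0)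
noncomputable def pt (f : ℝ × ℝ → ℝ) (p : ℝ × ℝ) : ℝ := fderiv ℝ f p (0, 1)

abbrev Smooth (f : ℝ × ℝ → ℝ) : Prop := ContDiff ℝ (⊤ : ℕ∞) f

lemma Smooth.diff {f : ℝ × ℝ → ℝ} (hf : Smooth f) : Differentiable ℝ f := hf.differentiable (by simp)
lemma Smooth.px {f : ℝ × ℝ → ℝ} (hf : Smooth f) : Smooth (px f) := by
  unfold FB.px Smooth; exact (hf.fderiv_right (m := (⊤ : ℕ∞)) (by simp)).clm_apply contDiff_const
lemma Smooth.pt {f : ℝ × ℝ → ℝ} (hf : Smooth f) : Smooth (pt f) := by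
  unfold FB.pt Smooth; exact (hf.fderiv_right (m := (⊤ : ℕ∞)) (by simp)).clm_apply contDiff_const
lemma px_add {f g : ℝ × ℝ → ℝ} (hf : Smooth f) (hg : Smooth g) : px (f + g) = px f + px g := by
  funext p; simp [px, fderiv_add (hf.diff p) (hg.diff p)]
lemma pt_add {f g : ℝ × ℝ → ℝ} (hf : Smooth f) (hg : Smooth g) : pt (f + g) = pt f + pt g := by
  funext p; simp [pt, fderiv_add (hf.diff p) (hg.diff p)]
lemma px_mul {f g : ℝ × ℝ → ℝ} (hf : Smooth f) (hg : Smooth g) : px (f * g) = px f * g + f * px g := by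
  funext p; simp [px, fderiv_mul (hf.diff p) (hg.diff p)]; ring
lemma pt_mul {f g : ℝ × ℝ → ℝ} (hf : Smooth f) (hg : Smooth g) : pt (f * g) = pt f * g + f * pt g := by
  funext p; simp [pt, fderiv_mul (hf.diff p) (hg.diff p)]; ring
lemma px_smul {f : ℝ × ℝ → ℝ} (hf : Smooth f) (c : ℝ) : px (c • f) = c • px f := by
  funext p; simp [px, fderiv_const_smul (hf.diff p)]
lemma pt_smul {f : ℝ × ℝ → ℝ} (hf : Smooth f) (c : ℝ) : pt (c • f) = c • pt f := by
  funext p; simp [pt, fderiv_const_smul (hf.diff p)]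

lemma tsupport_px (f : ℝ × ℝ → ℝ) : tsupport (px f) ⊆ tsupport f := by
  refine closure_minimal ?_ (isClosed_tsupport f)
  intro p hp
  by_contra h
  apply hp
  have : fderiv ℝ f p = 0 := by
    by_contra h2
    exact h (support_fderiv_subset ℝ h2)
  simp [px, this]
lemma tsupport_pt (f : ℝ × ℝ → ℝ) : tsupport (pt f) ⊆ tsupport f := by
  refine closure_minimal ?_ (isClosed_tsupport f)
  intro p hp
  by_contra h
  apply hp
  have : fderiv ℝ f p = 0 := by
    by_contra h2
    exact h (support_fderiv_subset ℝ h2)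
  simp [pt, this]

lemma cs_px {f : ℝ × ℝ → ℝ} (hf : HasCompactSupport f) : HasCompactSupport (px f) :=
  hf.mono' ((subset_tsupport _).trans (tsupport_px f))
lemma cs_pt {f : ℝ × ℝ → ℝ} (hf : HasCompactSupport f) : HasCompactSupport (pt f) :=
  hf.mono' ((subset_tsupport _).trans (tsupport_pt f))

noncomputable def cN (N : ℕ) (p : ℝ × ℝ) : ℝ := Real.cos (N * p.1)
noncomputable def sN (N : ℕ) (p : ℝ × ℝ) : ℝ := Real.sin (N * p.1)
lemma cN_smooth (N : ℕ) : Smooth (cN N) := by unfold cN Smooth; fun_prop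
lemma sN_smooth (N : ℕ) : Smooth (sN N) := by unfold sN Smooth; fun_prop
lemma lin_fd (N : ℕ) (p : ℝ × ℝ) : HasFDerivAt (fun p : ℝ × ℝ => (N:ℝ) * p.1) ((N:ℝ) • ContinuousLinearMap.fst ℝ ℝ ℝ) p :=
  (hasFDerivAt_fst (𝕜 := ℝ) (p := p)).const_mul (N:ℝ)
lemma px_cN (N : ℕ) : px (cN N) = (-(N:ℝ)) • sN N := by
  funext p
  have := (lin_fd N p).cos.fderiv
  simp [px, sN, show cN N = fun p => Real.cos ((N:ℝ) * p.1) from rfl, this]; ring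
lemma px_sN (N : ℕ) : px (sN N) = (N:ℝ) • cN N := by
  funext p
  have := (lin_fd N p).sin.fderiv
  simp [px, cN, show sN N = fun p => Real.sin ((N:ℝ) * p.1) from rfl, this]; ring
lemma pt_cN (N : ℕ) : pt (cN N) = 0 := by
  funext p
  have := (lin_fd N p).cos.fderiv
  simp [pt, show cN N = fun p => Real.cos ((N:ℝ) * p.1) from rfl, this]
lemma pt_sN (N : ℕ) : pt (sN N) = 0 := by
  funext p
  have := (lin_fd N p).sin.fderiv
  simp [pt, show sN N = fun p => Real.sin ((N:ℝ) * p.1) from rfl, this]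

/-- oscillating perturbation -/
lemma osc {A : ℝ × ℝ → ℝ} (hA : Smooth A) (hc : HasCompactSupport A) : ∃ C : ℝ, 0 ≤ C ∧ ∀ N : ℕ, 1 ≤ N → ∃ ψ : ℝ × ℝ → ℝ, Smooth ψ ∧
    HasCompactSupport ψ ∧ tsupport ψ ⊆ tsupport A ∧ ∀ p, |ψ p| ≤ C / N ∧ |px ψ p| ≤ C / N ∧ |pt ψ p| ≤ C / N ∧ |pt (px ψ) p| ≤ C / N ∧
      |px (px ψ) p + A p * cN N p| ≤ C / N := by
  obtain ⟨C0, h0⟩ := hA.continuous.bounded_above_of_compact_support hc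
  obtain ⟨C1, h1⟩ := hA.px.continuous.bounded_above_of_compact_support (cs_px hc)
  obtain ⟨C2, h2⟩ := hA.pt.continuous.bounded_above_of_compact_support (cs_pt hc)
  obtain ⟨C3, h3⟩ := hA.px.px.continuous.bounded_above_of_compact_support (cs_px (cs_px hc))
  obtain ⟨C4, h4⟩ := hA.px.pt.continuous.bounded_above_of_compact_support (cs_pt (cs_px hc))
  simp only [Real.norm_eq_abs] at h0 h1 h2 h3 h4
  have k0 := (abs_nonneg _).trans (h0 0)
  have k1 := (abs_nonneg _).trans (h1 0)
  have k2 := (abs_nonneg _).trans (h2 0)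
  have k3 := (abs_nonneg _).trans (h3 0)
  have k4 := (abs_nonneg _).trans (h4 0)
  refine ⟨C0 + 3 * C1 + 2 * C2 + C3 + C4, by positivity, ?_⟩
  intro N hN
  have hN' : (0:ℝ) < N := by exact_mod_cast hN
  have hN1 : (1:ℝ) ≤ N := by exact_mod_cast hN
  set q : ℝ := 1/(N:ℝ) with hq
  have q0 : 0 < q := by positivity
  have q1 : q ≤ 1 := by rw [hq, div_le_one hN']; exact hN1
  have qN : q * N = 1 := by rw [hq]; field_simp
  have q2 : q^2 ≤ q := by nlinarith
  have hcN := cN_smooth N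
  have hsN := sN_smooth N
  have S1 : Smooth (A * cN N) := hA.mul hcN
  set ψ : ℝ × ℝ → ℝ := q^2 • (A * cN N) with hψ
  have Sψ : Smooth ψ := contDiff_const.smul S1
  have e1 : px ψ = q^2 • (px A * cN N) + (-q) • (A * sN N) := by
    rw [hψ, px_smul S1, px_mul hA hcN, px_cN]
    funext p; simp only [Pi.smul_apply, Pi.add_apply, Pi.mul_apply, smul_eq_mul]
    linear_combination (-q * A p * sN N p) * qN
  have e2 : pt ψ = q^2 • (pt A * cN N) := by
    rw [hψ, pt_smul S1, pt_mul hA hcN, pt_cN]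
    funext p; simp
  have S2 : Smooth (px A * cN N) := hA.px.mul hcN
  have S3 : Smooth (A * sN N) := hA.mul hsN
  have S4 : Smooth (q^2 • (px A * cN N)) := contDiff_const.smul S2
  have S5 : Smooth ((-q) • (A * sN N)) := contDiff_const.smul S3
  have e3 : pt (px ψ) = q^2 • (pt (px A) * cN N) + (-q) • (pt A * sN N) := by
    rw [e1, pt_add S4 S5, pt_smul S2, pt_smul S3, pt_mul hA.px hcN, pt_mul hA hsN, pt_cN, pt_sN]
    funext p; simp
  have e4 : ∀ p, px (px ψ) p + A p * cN N p = q^2 * (px (px A) p * cN N p) + (-(2*q)) * (px A p * sN N p) := by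
    intro p
    rw [e1, px_add S4 S5, px_smul S2, px_smul S3, px_mul hA.px hcN, px_mul hA hsN, px_cN, px_sN]
    simp only [Pi.smul_apply, Pi.add_apply, Pi.mul_apply, smul_eq_mul]
    linear_combination (-q * px A p * sN N p - A p * cN N p) * qN
  have bc : ∀ p, |cN N p| ≤ 1 := fun p => Real.abs_cos_le_one _
  have bs : ∀ p, |sN N p| ≤ 1 := fun p => Real.abs_sin_le_one _
  have prod : ∀ {x y X : ℝ}, |x| ≤ X → |y| ≤ 1 → |x * y| ≤ X := fun {x y X} hx hy => by
    rw [abs_mul]; exact (mul_le_of_le_one_right (abs_nonneg _) hy).trans hx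
  have sc : ∀ {x X r : ℝ}, 0 ≤ r → |x| ≤ X → |r * x| ≤ r * X := fun {x X r} hr hx => by
    rw [abs_mul, abs_of_nonneg hr]; exact mul_le_mul_of_nonneg_left hx hr
  have sc' : ∀ {x X r : ℝ}, 0 ≤ r → |x| ≤ X → |(-r) * x| ≤ r * X := fun {x X r} hr hx => by
    rw [neg_mul, abs_neg]; exact sc hr hx
  have sup : tsupport ψ ⊆ tsupport A := by
    refine closure_mono ?_
    intro p hp h
    apply hp
    simp [hψ, h]
  have hCN : ∀ C : ℝ, C / N = C * q := fun C => by rw [hq]; ring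
  refine ⟨ψ, Sψ, hc.mono' ((subset_tsupport ψ).trans sup), sup, fun p => ?_⟩
  simp only [hCN]
  have b2 : ∀ {X : ℝ}, 0 ≤ X → q^2 * X ≤ q * X := fun hX => mul_le_mul_of_nonneg_right q2 hX
  have z0 := mul_nonneg q0.le k0
  have z1 := mul_nonneg q0.le k1
  have z2 := mul_nonneg q0.le k2
  have z3 := mul_nonneg q0.le k3
  have z4 := mul_nonneg q0.le k4
  refine ⟨?_, ?_, ?_, ?_, ?_⟩
  · have := sc (sq_nonneg q) (prod (h0 p) (bc p))
    have := b2 k0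
    simp only [hψ, Pi.smul_apply, Pi.mul_apply, smul_eq_mul]; linarith
  · have a1 := sc (sq_nonneg q) (prod (h1 p) (bc p))
    have a2 := sc' q0.le (prod (h0 p) (bs p))
    have := b2 k1
    rw [e1]
    simp only [Pi.smul_apply, Pi.add_apply, Pi.mul_apply, smul_eq_mul]
    refine (abs_add_le _ _).trans ?_
    linarith
  · have a1 := sc (sq_nonneg q) (prod (h2 p) (bc p))
    have := b2 k2
    rw [e2]
    simp only [Pi.smul_apply, Pi.mul_apply, smul_eq_mul]; linarith
  · have a1 := sc (sq_nonneg q) (prod (h4 p) (bc p))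
    have a2 := sc' q0.le (prod (h2 p) (bs p))
    have := b2 k4
    rw [e3]
    simp only [Pi.smul_apply, Pi.add_apply, Pi.mul_apply, smul_eq_mul]
    refine (abs_add_le _ _).trans ?_
    linarith
  · have a1 := sc (sq_nonneg q) (prod (h3 p) (bc p))
    have a2 := sc' (by positivity : 0 ≤ 2*q) (prod (h1 p) (bs p))
    have := b2 k3
    rw [e4]
    refine (abs_add_le _ _).trans ?_
    linarith

/-- Riemann–Lebesgue in the first variable -/
lemma riem_leb {F : ℝ × ℝ → ℝ} (hF : Integrable F) : Tendsto (fun N : ℕ => ∫ p, F p * cN N p) atTop (𝓝 0) := by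
  have h := tendsto_integral_exp_smul_cocompact (V := ℝ × ℝ) (fun p => (F p : ℂ)) volume
  set ℓ : ℕ → StrongDual ℝ (ℝ × ℝ) := fun N => ((N:ℝ) / (2 * Real.pi)) • ContinuousLinearMap.fst ℝ ℝ ℝ with hℓ
  have hl : Tendsto ℓ atTop (cocompact _) := by
    rw [← Metric.cobounded_eq_cocompact, ← tendsto_norm_atTop_iff_cobounded]
    have : ∀ N : ℕ, (N:ℝ) / (2 * Real.pi) ≤ ‖ℓ N‖ := by
      intro N
      have := (ℓ N).le_opNorm (1, 0)
      simp only [hℓ, smul_apply, ContinuousLinearMap.coe_fst', smul_eq_mul, mul_one] at this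
      have h1 : ‖((1:ℝ), (0:ℝ))‖ = 1 := by simp [Prod.norm_def]
      rw [h1, mul_one] at this
      exact (le_abs_self _).trans this
    refine tendsto_atTop_mono this ?_
    exact tendsto_natCast_atTop_atTop.atTop_div_const (by positivity)
  have h2 := h.comp hl
  have h3 := (Complex.continuous_re.tendsto 0).comp h2
  rw [Complex.zero_re] at h3
  refine h3.congr ?_
  intro N
  have hintg : Integrable (fun p : ℝ × ℝ => (Real.fourierChar (-(ℓ N p))) • (F p : ℂ)) := by
    have hFc : Integrable (fun p : ℝ × ℝ => (F p : ℂ)) := hF.ofReal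
    have c : Continuous fun p => Real.fourierChar (-(ℓ N p)) := Real.continuous_fourierChar.comp (ℓ N).continuous.neg
    rw [← integrable_norm_iff (c.aestronglyMeasurable.fun_smul hFc.1)]
    simp_rw [Circle.norm_smul]
    exact hFc.norm
  have e : ∀ p : ℝ × ℝ, F p * cN N p = Complex.reCLM ((Real.fourierChar (-(ℓ N p))) • (F p : ℂ)) := by
    intro p
    have : 2 * Real.pi * (-(ℓ N p)) = -(N * p.1) := by
      simp [hℓ]; field_simp
    rw [Circle.smul_def, Real.fourierChar_apply, this, smul_eq_mul, Complex.reCLM_apply, mul_comm (Complex.exp _), Complex.re_ofReal_mul, Complex.exp_ofReal_mul_I_re, Real.cos_neg]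
    rfl
  simp only [Function.comp]
  rw [← Complex.reCLM_apply, ← ContinuousLinearMap.integral_comp_comm _ hintg]
  exact (integral_congr_ae (Eventually.of_forall e)).symm

end FB

namespace FB
section M6b
open Filter Topology MeasureTheory

/-- data of the convex integration scheme -/
structure CI (U : Set (ℝ × ℝ)) (w B0 D b : ℝ × ℝ → ℝ) (h1 h2 : ℝ → ℝ) (L : ℝ) : Prop where
  opn : IsOpen U
  bdd : Bornology.IsBounded U
  cw : Continuous w
  cB : Continuous B0
  cD : Continuous D
  cb : Continuous b
  Dpos : ∀ p, 0 < D p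
  Lpos : 0 < L
  lip1 : ∀ s t, |h1 s - h1 t| ≤ L * |s - t|
  lip2 : ∀ s t, |h2 s - h2 t| ≤ L * |s - t|

noncomputable def gam (w D φ : ℝ × ℝ → ℝ) (p : ℝ × ℝ) : ℝ := w p + D p * px (px φ) p
noncomputable def Bf (B0 D b φ : ℝ × ℝ → ℝ) (p : ℝ × ℝ) : ℝ := B0 p + D p * (pt φ p - b p * px φ p)
noncomputable def rho (w B0 D b : ℝ × ℝ → ℝ) (h1 h2 : ℝ → ℝ) (φ : ℝ × ℝ → ℝ) (p : ℝ × ℝ) : ℝ :=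
  min (h1 (gam w D φ p) - Bf B0 D b φ p) (Bf B0 D b φ p - h2 (gam w D φ p))

structure Adm (U : Set (ℝ × ℝ)) (w B0 D b : ℝ × ℝ → ℝ) (h1 h2 : ℝ → ℝ) (φ : ℝ × ℝ → ℝ) : Prop where
  sm : Smooth φ
  cs : HasCompactSupport φ
  ts : tsupport φ ⊆ U
  pos : ∀ p ∈ U, 0 < rho w B0 D b h1 h2 φ p

lemma cont_of_lip {h : ℝ → ℝ} {L : ℝ} (hL : ∀ s t, |h s - h t| ≤ L * |s - t|) : Continuous h := by
  have : LipschitzWith (Real.toNNReal L) h := LipschitzWith.of_dist_le_mul fun s t => by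
    rw [Real.dist_eq, Real.dist_eq]
    exact (hL s t).trans (mul_le_mul_of_nonneg_right (Real.le_coe_toNNReal L) (abs_nonneg _))
  exact this.continuous

variable {U : Set (ℝ × ℝ)} {w B0 D b : ℝ × ℝ → ℝ} {h1 h2 : ℝ → ℝ} {L : ℝ}

lemma CI.c_gam (h : CI U w B0 D b h1 h2 L) {φ : ℝ × ℝ → ℝ} (hφ : Smooth φ) : Continuous (gam w D φ) := by
  unfold gam; exact h.cw.add (h.cD.mul hφ.px.px.continuous)
lemma CI.c_Bf (h : CI U w B0 D b h1 h2 L) {φ : ℝ × ℝ → ℝ} (hφ : Smooth φ) : Continuous (Bf B0 D b φ) := by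
  unfold Bf; exact h.cB.add (h.cD.mul (hφ.pt.continuous.sub (h.cb.mul hφ.px.continuous)))
lemma CI.c_rho (h : CI U w B0 D b h1 h2 L) {φ : ℝ × ℝ → ℝ} (hφ : Smooth φ) : Continuous (rho w B0 D b h1 h2 φ) := by
  unfold rho
  have k1 := cont_of_lip h.lip1
  have k2 := cont_of_lip h.lip2
  have := h.c_gam hφ
  have := h.c_Bf hφ
  exact ((k1.comp (h.c_gam hφ)).sub (h.c_Bf hφ)).min ((h.c_Bf hφ).sub (k2.comp (h.c_gam hφ)))

lemma bdd_on {U : Set (ℝ × ℝ)} (hU : Bornology.IsBounded U) {F : ℝ × ℝ → ℝ} (hF : Continuous F) :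
    ∃ M : ℝ, 0 ≤ M ∧ ∀ p ∈ U, |F p| ≤ M := by
  obtain ⟨M, hM⟩ := hU.isCompact_closure.exists_bound_of_continuousOn hF.continuousOn
  exact ⟨max M 0, le_max_right _ _, fun p hp => (hM p (subset_closure hp)).trans (le_max_left _ _)⟩

lemma int_on {U : Set (ℝ × ℝ)} (hU : Bornology.IsBounded U) {F : ℝ × ℝ → ℝ} (hF : Continuous F) :
    IntegrableOn F U volume :=
  (hF.continuousOn.integrableOn_compact hU.isCompact_closure).mono_set subset_closure

lemma fin_on {U : Set (ℝ × ℝ)} (hU : Bornology.IsBounded U) : volume U < ⊤ := hU.measure_lt_top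

lemma ds_zero {ψ : ℝ × ℝ → ℝ} {p : ℝ × ℝ} (hp : p ∉ tsupport ψ) : px ψ p = 0 ∧ pt ψ p = 0 ∧ px (px ψ) p = 0 := by
  refine ⟨?_, ?_, ?_⟩
  · by_contra h; exact hp (tsupport_px ψ (subset_tsupport _ h))
  · by_contra h; exact hp (tsupport_pt ψ (subset_tsupport _ h))
  · by_contra h; exact hp (tsupport_px ψ (tsupport_px _ (subset_tsupport _ h)))

open scoped Manifold ContDiff in
/-- amplitude -/
lemma amplitude {U K K' : Set (ℝ × ℝ)} (hK : IsCompact K) (hK' : IsCompact K') (hKK : K ⊆ interior K') (hKU : K' ⊆ U)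
    {r : ℝ × ℝ → ℝ} (hr : Continuous r) (hp : ∀ p ∈ U, 0 < r p) :
    ∃ A : ℝ × ℝ → ℝ, Smooth A ∧ HasCompactSupport A ∧ tsupport A ⊆ K' ∧ (∀ p, 0 ≤ A p) ∧ (∀ p ∈ U, A p < r p) ∧ (∀ p ∈ K, r p / 2 < A p) := by
  have := exists_contMDiffMap_forall_mem_convex_of_local_const (n := (⊤ : ℕ∞)) (I := 𝓘(ℝ, ℝ × ℝ)) (M := ℝ × ℝ) (F := ℝ)
    (t := fun p => {y : ℝ | 0 ≤ y ∧ (p ∈ U → y < r p) ∧ (p ∉ K' → y = 0) ∧ (p ∈ K → r p / 2 < y)}) ?_ ?_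
  · obtain ⟨g, hg⟩ := this
    have sup : tsupport g ⊆ K' := by
      refine closure_minimal ?_ hK'.isClosed
      intro p hp
      by_contra h
      exact hp ((hg p).2.2.1 h)
    refine ⟨g, g.contMDiff.contDiff, HasCompactSupport.of_support_subset_isCompact hK' ((subset_tsupport _).trans sup), sup, fun p => (hg p).1,
      fun p h => (hg p).2.1 h, fun p h => (hg p).2.2.2 h⟩
  · intro p x hx y hy a c ha hc hac
    obtain ⟨x1, x2, x3, x4⟩ := hx
    obtain ⟨y1, y2, y3, y4⟩ := hy
    simp only [smul_eq_mul, Set.mem_ofPred_eq]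
    refine ⟨by positivity, fun h => ?_, fun h => by rw [x3 h, y3 h]; simp, fun h => ?_⟩
    · exact (convex_Iio (r p)) (x2 h) (y2 h) ha hc hac
    · exact (convex_Ioi (r p / 2)) (x4 h) (y4 h) ha hc hac
  · intro p
    by_cases h : p ∈ K
    · have hpU : p ∈ U := hKU (interior_subset (hKK h))
      have h0 := hp p hpU
      refine ⟨3/4 * r p, ?_⟩
      have e1 : ∀ᶠ q in 𝓝 p, 3/4 * r p < r q := hr.continuousAt.eventually_const_lt (by linarith)
      have e2 : ∀ᶠ q in 𝓝 p, r q < 3/2 * r p := hr.continuousAt.eventually_lt_const (by linarith)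
      have e3 : ∀ᶠ q in 𝓝 p, q ∈ K' := mem_interior_iff_mem_nhds.1 (hKK h)
      filter_upwards [e1, e2, e3] with q q1 q2 q3
      exact ⟨by linarith, fun _ => q1, fun h => absurd q3 h, fun _ => by linarith⟩
    · refine ⟨0, ?_⟩
      filter_upwards [hK.isClosed.isOpen_compl.mem_nhds h] with q hq
      exact ⟨le_rfl, fun h => hp q h, fun _ => rfl, fun h => absurd h hq⟩

/-- integrals of nearby functions -/
lemma int_near {U : Set (ℝ × ℝ)} (hU : Bornology.IsBounded U) {F G : ℝ × ℝ → ℝ} (hF : Continuous F) (hG : Continuous G) {e : ℝ}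
    (h : ∀ p ∈ U, |F p - G p| ≤ e) : |(∫ p in U, F p) - ∫ p in U, G p| ≤ e * volume.real U := by
  rw [← integral_sub (int_on hU hF) (int_on hU hG)]
  have := norm_setIntegral_le_of_norm_le_const (f := fun p => F p - G p) (C := e) (fin_on hU) h
  exact this

lemma near_tendsto {a a' : ℕ → ℝ} {K l : ℝ} (ha : Tendsto a atTop (𝓝 l)) (h : ∀ N : ℕ, 1 ≤ N → |a' N - a N| ≤ K / N) :
    Tendsto a' atTop (𝓝 l) := by
  have h0 : Tendsto (fun N : ℕ => K / (N:ℝ)) atTop (𝓝 0) := tendsto_const_div_atTop_nhds_zero_nat K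
  have h1 : Tendsto (fun N => a' N - a N) atTop (𝓝 0) :=
    squeeze_zero_norm' (by filter_upwards [eventually_ge_atTop 1] with N hN; exact h N hN) h0
  have := h1.add ha
  simpa using this

lemma RL_on {U : Set (ℝ × ℝ)} {F : ℝ × ℝ → ℝ} (hF : Continuous F) (hc : HasCompactSupport F) (hs : tsupport F ⊆ U) :
    Tendsto (fun N : ℕ => ∫ p in U, F p * cN N p) atTop (𝓝 0) := by
  refine (riem_leb (hF.integrable_of_hasCompactSupport hc)).congr fun N => ?_
  symm
  apply setIntegral_eq_integral_of_forall_compl_eq_zero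
  intro p hp
  rw [image_eq_zero_of_notMem_tsupport (fun h => hp (hs h)), zero_mul]

lemma gam_add {φ ψ : ℝ × ℝ → ℝ} (hφ : Smooth φ) (hψ : Smooth ψ) (p : ℝ × ℝ) : gam w D (φ + ψ) p = gam w D φ p + D p * px (px ψ) p := by
  unfold gam; rw [px_add hφ hψ, px_add hφ.px hψ.px]; simp only [Pi.add_apply]; ring
lemma Bf_add {φ ψ : ℝ × ℝ → ℝ} (hφ : Smooth φ) (hψ : Smooth ψ) (p : ℝ × ℝ) :
    Bf B0 D b (φ + ψ) p = Bf B0 D b φ p + D p * (pt ψ p - b p * px ψ p) := by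
  unfold Bf; rw [px_add hφ hψ, pt_add hφ hψ]; simp only [Pi.add_apply]; ring

lemma step (h : CI U w B0 D b h1 h2 L) {φ : ℝ × ℝ → ℝ} (hφ : Adm U w B0 D b h1 h2 φ) {η : ℝ} (hη : 0 < η) (l : List (ℝ × ℝ → ℝ))
    (hl : ∀ g ∈ l, Continuous g) : ∃ ψ : ℝ × ℝ → ℝ, Smooth ψ ∧ (∀ p, |ψ p| ≤ η ∧ |px ψ p| ≤ η ∧ |pt ψ p| ≤ η ∧ |pt (px ψ) p| ≤ η) ∧
      Adm U w B0 D b h1 h2 (φ + ψ) ∧ (∀ g ∈ l, |∫ p in U, D p * px (px ψ) p * g p| ≤ η) ∧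
      (∫ p in U, (rho w B0 D b h1 h2 φ p)^2) ≤ 32 * L^2 * (∫ p in U, (D p * px (px ψ) p)^2) + η := by
  have hL := h.Lpos
  have crho := h.c_rho hφ.sm
  obtain ⟨Mr, Mr0, hMr⟩ := bdd_on h.bdd crho
  obtain ⟨MD, MD0, hMD⟩ := bdd_on h.bdd h.cD
  obtain ⟨MB, MB0, hMB⟩ := bdd_on h.bdd h.cb
  have hUf := fin_on h.bdd
  obtain ⟨K, hKU, hK, hKv⟩ := h.opn.measurableSet.exists_isCompact_sdiff_lt (μ := volume) hUf.ne
    (ε := ENNReal.ofReal (η / (2 * (Mr^2 + 1)))) (by simpa using by positivity)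
  obtain ⟨K', hK', hKK, hKU'⟩ := exists_compact_between hK h.opn hKU
  set r : ℝ × ℝ → ℝ := fun p => rho w B0 D b h1 h2 φ p / (2 * L * D p) with hr
  have cr : Continuous r := crho.div (continuous_const.mul h.cD) (fun p => by have := h.Dpos p; positivity)
  obtain ⟨A, sA, csA, tsA, A0, A1, A2⟩ := amplitude hK hK' hKK hKU' cr (fun p hp => by
    have := h.Dpos p; have := hφ.pos p hp; positivity)
  obtain ⟨MA, MA0, hMA⟩ := bdd_on h.bdd sA.continuous
  obtain ⟨ρ0, hρ0, hρ0'⟩ := hK'.exists_forall_le' (a := 0) crho.continuousOn (fun p hp => hφ.pos p (hKU' hp))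
  obtain ⟨C, C0, hosc⟩ := osc sA csA
  have : ∀ N : ℕ, ∃ ψ : ℝ × ℝ → ℝ, 1 ≤ N → Smooth ψ ∧
    HasCompactSupport ψ ∧ tsupport ψ ⊆ tsupport A ∧ ∀ p, |ψ p| ≤ C / N ∧ |px ψ p| ≤ C / N ∧ |pt ψ p| ≤ C / N ∧ |pt (px ψ) p| ≤ C / N ∧
      |px (px ψ) p + A p * cN N p| ≤ C / N := by
    intro N
    by_cases hN : 1 ≤ N
    · obtain ⟨ψ, hψ⟩ := hosc N hN; exact ⟨ψ, fun _ => hψ⟩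
    · exact ⟨0, fun h => absurd h hN⟩
  choose Ψ hΨ using this
  have bc : ∀ N p, |cN N p| ≤ 1 := fun N p => Real.abs_cos_le_one _
  have tC : ∀ X : ℝ, Tendsto (fun N : ℕ => X / (N:ℝ)) atTop (𝓝 0) := tendsto_const_div_atTop_nhds_zero_nat
  have E1 : ∀ᶠ N : ℕ in atTop, C / N ≤ η := ((tC C).eventually_lt_const hη).mono fun _ h => h.le
  have E2 : ∀ᶠ N : ℕ in atTop, C * (MD * (L + 1 + MB)) / N < ρ0 / 2 := (tC _).eventually_lt_const (by positivity)
  have cDA : Continuous (fun p => D p * A p) := h.cD.mul sA.continuous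
  have csG : ∀ G : ℝ × ℝ → ℝ, (∀ p, A p = 0 → G p = 0) → HasCompactSupport G ∧ tsupport G ⊆ U := by
    intro G hG
    have : Function.support G ⊆ Function.support A := fun p hp h0 => hp (hG p h0)
    exact ⟨csA.mono this, (closure_mono this).trans (tsA.trans hKU')⟩
  have E3 : ∀ g ∈ l, ∀ᶠ N : ℕ in atTop, |∫ p in U, D p * px (px (Ψ N)) p * g p| ≤ η := by
    intro g hg
    obtain ⟨Mg, Mg0, hMg⟩ := bdd_on h.bdd (hl g hg)
    have cF : Continuous (fun p => -(D p * A p) * g p) := cDA.neg.mul (hl g hg)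
    obtain ⟨q1, q2⟩ := csG (fun p => -(D p * A p) * g p) (fun p hp => by simp [hp])
    have t1 := RL_on cF q1 q2
    have t2 := near_tendsto (a' := fun N => ∫ p in U, D p * px (px (Ψ N)) p * g p) (K := MD * Mg * C * volume.real U) t1 (by
      intro N hN
      obtain ⟨k1, k2, k3, k4⟩ := hΨ N hN
      have := int_near h.bdd (F := fun p => D p * px (px (Ψ N)) p * g p) (G := fun p => -(D p * A p) * g p * cN N p) (e := MD * Mg * (C / N))
        ((h.cD.mul k1.px.px.continuous).mul (hl g hg)) (cF.mul (cN_smooth N).continuous) (by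
          intro p hp
          have e : D p * px (px (Ψ N)) p * g p - -(D p * A p) * g p * cN N p = D p * g p * (px (px (Ψ N)) p + A p * cN N p) := by ring
          rw [e, abs_mul, abs_mul]
          have := (k4 p).2.2.2.2
          have := hMD p hp
          have := hMg p hp
          gcongr)
      refine this.trans (le_of_eq ?_)
      ring)
    have := t2.abs
    rw [abs_zero] at this
    exact (this.eventually_lt_const hη).mono fun _ h => h.le
  have E3' : ∀ᶠ N : ℕ in atTop, ∀ g ∈ l, |∫ p in U, D p * px (px (Ψ N)) p * g p| ≤ η := by
    have : ∀ l' : List (ℝ × ℝ → ℝ), (∀ g ∈ l', g ∈ l) → ∀ᶠ N : ℕ in atTop, ∀ g ∈ l', |∫ p in U, D p * px (px (Ψ N)) p * g p| ≤ η := by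
      intro l'
      induction l' with
      | nil => intro _; simp
      | cons a t ih =>
        intro hs
        filter_upwards [E3 a (hs a (by simp)), ih (fun g hg => hs g (by simp [hg]))] with N h1 h2 g hg
        rcases List.mem_cons.1 hg with rfl | hg
        · exact h1
        · exact h2 g hg
    exact this l (fun _ h => h)
  set T2 := ∫ p in U, (D p * A p)^2 with hT2
  have c2 : Continuous (fun p => (D p * A p)^2) := cDA.pow 2
  have t4 : Tendsto (fun N : ℕ => ∫ p in U, (D p * px (px (Ψ N)) p)^2) atTop (𝓝 (T2 / 2)) := by
    obtain ⟨q1, q2⟩ := csG (fun p => (D p * A p)^2) (fun p hp => by simp [hp])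
    have t1 := (RL_on c2 q1 q2).comp (tendsto_id.const_mul_atTop' (show 0 < 2 by norm_num))
    have t2 : Tendsto (fun N : ℕ => ∫ p in U, (D p * A p * cN N p)^2) atTop (𝓝 (T2 / 2)) := by
      have t3 := (t1.const_mul (1/2)).const_add (T2 / 2)
      rw [mul_zero, add_zero] at t3
      refine t3.congr fun N => ?_
      simp only [Function.comp, id]
      rw [hT2, ← integral_div, ← integral_const_mul, ← integral_add ((int_on h.bdd c2).div_const 2)
        ((int_on h.bdd (F := fun p => (D p * A p)^2 * cN (2 * N) p) (c2.mul (cN_smooth _).continuous)).const_mul (1/2))]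
      refine integral_congr_ae (Eventually.of_forall fun p => ?_)
      simp only [cN]
      have : Real.cos ((2 * N : ℕ) * p.1) = 2 * Real.cos (N * p.1)^2 - 1 := by
        rw [← Real.cos_two_mul]; push_cast; ring_nf
      rw [this]; ring
    refine near_tendsto (K := MD * C * (MD * (C + 2 * MA)) * volume.real U) t2 ?_
    intro N hN
    have hN1 : (1:ℝ) ≤ N := by exact_mod_cast hN
    obtain ⟨k1, k2, k3, k4⟩ := hΨ N hN
    have := int_near h.bdd (F := fun p => (D p * px (px (Ψ N)) p)^2) (G := fun p => (D p * A p * cN N p)^2) (e := (MD * (C / N)) * (MD * (C + 2 * MA)))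
      ((h.cD.mul k1.px.px.continuous).pow 2) ((cDA.mul (cN_smooth N).continuous).pow 2) (by
        intro p hp
        have e : (D p * px (px (Ψ N)) p)^2 - (D p * A p * cN N p)^2 =
          (D p * (px (px (Ψ N)) p + A p * cN N p)) * (D p * ((px (px (Ψ N)) p + A p * cN N p) - 2 * (A p * cN N p))) := by ring
        rw [e, abs_mul, abs_mul, abs_mul]
        have i1 := (k4 p).2.2.2.2
        have i2 := hMD p hp
        have i3 := hMA p hp
        have i4 : |px (px (Ψ N)) p + A p * cN N p - 2 * (A p * cN N p)| ≤ C + 2 * MA := by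
          have j1 : |2 * (A p * cN N p)| ≤ 2 * MA := by
            rw [abs_mul, abs_mul, abs_two]
            have := mul_le_mul i3 (bc N p) (abs_nonneg _) MA0
            linarith
          have j2 : C / N ≤ C := div_le_self C0 hN1
          refine (abs_sub _ _).trans ?_
          linarith
        gcongr)
    refine this.trans (le_of_eq ?_)
    ring
  have E4 : ∀ᶠ N : ℕ in atTop, T2 / 2 - η / (64 * L^2) < ∫ p in U, (D p * px (px (Ψ N)) p)^2 :=
    t4.eventually_const_lt (by have : 0 < η / (64 * L^2) := by positivity
                               linarith)
  obtain ⟨N, n1, n2, n3, n4, n5⟩ := (E1.and (E2.and (E3'.and (E4.and (eventually_ge_atTop 1))))).exists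
  obtain ⟨k1, k2, k3, k4⟩ := hΨ N n5
  have hN0 : (0:ℝ) < N := by exact_mod_cast n5
  have CN0 : 0 ≤ C / N := by positivity
  refine ⟨Ψ N, k1, fun p => ⟨(k4 p).1.trans n1, (k4 p).2.1.trans n1, (k4 p).2.2.1.trans n1, (k4 p).2.2.2.1.trans n1⟩, ?_, n3, ?_⟩
  · refine ⟨hφ.sm.add k1, hφ.cs.add k2, ?_, ?_⟩
    · have s1 : Function.support (φ + Ψ N) ⊆ tsupport φ ∪ tsupport (Ψ N) := by
        intro p hp
        by_contra hh
        rw [Set.mem_union, not_or] at hh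
        apply hp
        simp [image_eq_zero_of_notMem_tsupport hh.1, image_eq_zero_of_notMem_tsupport hh.2]
      exact (closure_minimal s1 ((isClosed_tsupport _).union (isClosed_tsupport _))).trans
        (Set.union_subset hφ.ts (k3.trans (tsA.trans hKU')))
    · intro p hp
      have hpos := hφ.pos p hp
      unfold rho at hpos ⊢
      rw [gam_add hφ.sm k1, Bf_add hφ.sm k1]
      by_cases hpt : p ∈ tsupport (Ψ N)
      · have hpK : p ∈ K' := tsA (k3 hpt)
        have hr0 := hρ0' p hpK
        have hA1 := A1 p hp
        have hDp := h.Dpos p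
        set g := gam w D φ p with hg
        set B := Bf B0 D b φ p with hB
        set δ := D p * px (px (Ψ N)) p with hδ
        set β := D p * (pt (Ψ N) p - b p * px (Ψ N) p) with hβ
        have hMDp : D p ≤ MD := (le_abs_self _).trans (hMD p hp)
        have dδ : L * |δ| ≤ rho w B0 D b h1 h2 φ p / 2 + L * (MD * (C / N)) := by
          have i1 := (k4 p).2.2.2.2
          have i2 : |px (px (Ψ N)) p| ≤ A p + C / N := by
            have e : px (px (Ψ N)) p = (px (px (Ψ N)) p + A p * cN N p) - A p * cN N p := by ring
            rw [e]
            refine (abs_sub _ _).trans ?_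
            have : |A p * cN N p| ≤ A p := by
              rw [abs_mul, abs_of_nonneg (A0 p)]; exact mul_le_of_le_one_right (A0 p) (bc N p)
            linarith
          rw [hδ, abs_mul, abs_of_pos hDp]
          have i3 : L * (D p * A p) ≤ rho w B0 D b h1 h2 φ p / 2 := by
            rw [hr] at hA1
            rw [lt_div_iff₀ (by positivity)] at hA1
            linarith
          have i4 : D p * (C / N) ≤ MD * (C / N) := mul_le_mul_of_nonneg_right hMDp CN0
          have i5 := mul_le_mul_of_nonneg_left i2 hDp.le
          have i6 := mul_le_mul_of_nonneg_left i5 hL.le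
          have i7 := mul_le_mul_of_nonneg_left i4 hL.le
          linarith
        have dβ : |β| ≤ MD * ((1 + MB) * (C / N)) := by
          rw [hβ, abs_mul]
          have i1 : |pt (Ψ N) p - b p * px (Ψ N) p| ≤ (1 + MB) * (C / N) := by
            refine (abs_sub _ _).trans ?_
            rw [abs_mul]
            have := (k4 p).2.2.1
            have := mul_le_mul (hMB p hp) (k4 p).2.1 (abs_nonneg _) MB0
            linarith
          exact mul_le_mul (hMD p hp) i1 (abs_nonneg _) MD0
        have n2' : L * (MD * (C / N)) + MD * ((1 + MB) * (C / N)) < ρ0 / 2 := by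
          refine lt_of_eq_of_lt ?_ n2; ring
        have l1 := (abs_le.1 (h.lip1 (g + δ) g)).1
        have l2 := (abs_le.1 (h.lip2 (g + δ) g)).2
        rw [add_sub_cancel_left] at l1 l2
        have b1 := (abs_le.1 dβ).1
        have b2 := (abs_le.1 dβ).2
        have m1 : rho w B0 D b h1 h2 φ p ≤ h1 g - B := min_le_left _ _
        have m2 : rho w B0 D b h1 h2 φ p ≤ B - h2 g := min_le_right _ _
        refine lt_min ?_ ?_ <;> linarith
      · obtain ⟨z1, z2, z3⟩ := ds_zero hpt
        rw [z1, z2, z3]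
        simpa using hpos
  · have hvol : (volume (U \ K)).toReal ≤ η / (2 * (Mr^2 + 1)) :=
      ENNReal.toReal_le_of_le_ofReal (by positivity) hKv.le
    have mUK : MeasurableSet (U \ K) := h.opn.measurableSet.diff hK.measurableSet
    have f1 : ∫ p in U, (rho w B0 D b h1 h2 φ p)^2 ≤ ∫ p in U, (16 * L^2 * (D p * A p)^2 + (U \ K).indicator (fun _ => Mr^2) p) := by
      refine setIntegral_mono_on (int_on h.bdd (crho.pow 2)) ?_ h.opn.measurableSet ?_
      · refine ((int_on h.bdd c2).const_mul _).add ?_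
        exact (integrable_indicator_iff mUK).2 (integrableOn_const ((Measure.restrict_apply_le _ _).trans_lt ((measure_mono Set.sdiff_subset).trans_lt hUf)).ne)
      · intro p hp
        by_cases hpK : p ∈ K
        · rw [Set.indicator_of_notMem (fun hh => hh.2 hpK), add_zero]
          have a2 := A2 p hpK
          have hDp := h.Dpos p
          have : rho w B0 D b h1 h2 φ p ≤ 4 * L * (D p * A p) := by
            rw [hr] at a2
            simp only at a2
            rw [div_div, div_lt_iff₀ (by positivity)] at a2
            linarith
          have h0 := (hφ.pos p hp).le
          calc _ ≤ (4 * L * (D p * A p))^2 := by gcongr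
            _ = _ := by ring
        · rw [Set.indicator_of_mem (show p ∈ U \ K from ⟨hp, hpK⟩)]
          have : (rho w B0 D b h1 h2 φ p)^2 ≤ Mr^2 := sq_le_sq' (by linarith [(abs_le.1 (hMr p hp)).1]) (abs_le.1 (hMr p hp)).2
          have : 0 ≤ 16 * L^2 * (D p * A p)^2 := by positivity
          linarith
    have f2 : ∫ p in U, (16 * L^2 * (D p * A p)^2 + (U \ K).indicator (fun _ => Mr^2) p) ≤ 16 * L^2 * T2 + η / 2 := by
      rw [integral_add ((int_on h.bdd c2).const_mul _) ((integrable_indicator_iff mUK).2 (integrableOn_const ((Measure.restrict_apply_le _ _).trans_lt ((measure_mono Set.sdiff_subset).trans_lt hUf)).ne)),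
        integral_const_mul, ← hT2, setIntegral_indicator mUK, setIntegral_const]
      have e : U ∩ (U \ K) = U \ K := Set.inter_eq_right.2 Set.sdiff_subset
      rw [e, smul_eq_mul]
      have : volume.real (U \ K) * Mr^2 ≤ η / 2 := by
        have i1 : volume.real (U \ K) ≤ η / (2 * (Mr^2 + 1)) := hvol
        have i2 := mul_le_mul_of_nonneg_right i1 (sq_nonneg Mr)
        refine i2.trans ?_
        rw [div_mul_eq_mul_div, div_le_div_iff₀ (by positivity) (by norm_num)]
        nlinarith [sq_nonneg Mr]
      linarith
    have f3 : 16 * L^2 * T2 ≤ 32 * L^2 * (∫ p in U, (D p * px (px (Ψ N)) p)^2) + η / 2 := by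
      have := mul_le_mul_of_nonneg_left n4.le (by positivity : (0:ℝ) ≤ 32 * L^2)
      have e : 32 * L^2 * (T2 / 2 - η / (64 * L^2)) = 16 * L^2 * T2 - η / 2 := by field_simp; ring
      linarith
    linarith

end M6b
end FB

namespace FB
section M6c
open Filter Topology MeasureTheory

/-- almost orthogonal increments and boundedness give convergence -/
lemma hilb {H : Type*} [NormedAddCommGroup H] [InnerProductSpace ℝ H] {v : ℕ → H} {M C : ℝ} (hM : ∀ n, ‖v n‖ ≤ M)
    (h : ∀ k j, j ≤ k → |inner ℝ (v (k+1) - v k) (v j)| ≤ C / 2 / 2^k) : CauchySeq v := by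
  have C0 : 0 ≤ C := by
    have := (abs_nonneg _).trans (h 0 0 le_rfl)
    simp at this; linarith
  have key : ∀ n m, n ≤ m → |inner ℝ (v m - v n) (v n)| ≤ C / 2^n - C / 2^m := by
    intro n m hnm
    induction m, hnm using Nat.le_induction with
    | base => simp
    | succ m hnm ih =>
      have e : v (m+1) - v n = (v (m+1) - v m) + (v m - v n) := by abel
      rw [e, inner_add_left]
      refine (abs_add_le _ _).trans ?_
      have := h m n hnm
      have e2 : C / 2 / 2^m = C / 2^m - C / 2^(m+1) := by rw [pow_succ]; field_simp; ring
      linarith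
  have key' : ∀ n m, n ≤ m → |inner ℝ (v m - v n) (v n)| ≤ C / 2^n := by
    intro n m hnm
    have := key n m hnm
    have : 0 ≤ C / 2^m := by positivity
    linarith
  have ns : ∀ n m, ‖v m - v n‖^2 = ‖v m‖^2 - ‖v n‖^2 - 2 * inner ℝ (v m - v n) (v n) := by
    intro n m
    have e : v m = (v m - v n) + v n := by abel
    have := norm_add_sq_real (v m - v n) (v n)
    rw [← e] at this
    linarith
  set a : ℕ → ℝ := fun n => ‖v n‖^2 - 4 * (C / 2^n) with ha
  have am : Monotone a := by
    refine monotone_nat_of_le_succ fun n => ?_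
    have h1 := ns n (n+1)
    have h2 := (abs_le.1 (key' n (n+1) (Nat.le_succ n))).1
    have h3 := sq_nonneg ‖v (n+1) - v n‖
    have e : C / 2^(n+1) = C / 2^n / 2 := by rw [pow_succ]; field_simp
    simp only [ha, e]
    linarith
  have ab : BddAbove (Set.range a) := by
    refine ⟨M^2, ?_⟩
    rintro _ ⟨n, rfl⟩
    have h1 : 0 ≤ C / 2^n := by positivity
    have h2 : ‖v n‖^2 ≤ M^2 := by have := hM n; gcongr
    simp only [ha]; linarith
  have tC : Tendsto (fun n : ℕ => C / 2^n) atTop (𝓝 0) := by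
    have := (tendsto_pow_atTop_nhds_zero_of_lt_one (r := (1/2:ℝ)) (by norm_num) (by norm_num)).const_mul C
    rw [mul_zero] at this
    refine this.congr fun n => ?_
    rw [one_div, inv_pow]; rfl
  have ta := tendsto_atTop_ciSup am ab
  have tn : Tendsto (fun n => ‖v n‖^2) atTop (𝓝 (⨆ i, a i)) := by
    have := ta.add (tC.const_mul 4)
    rw [mul_zero, add_zero] at this
    refine this.congr fun n => ?_
    simp only [ha]; ring
  have cn := tn.cauchySeq
  rw [Metric.cauchySeq_iff'] at cn ⊢
  intro ε hε
  rw [Metric.tendsto_atTop] at tC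
  obtain ⟨N1, hN1⟩ := tn.cauchySeq |> Metric.cauchySeq_iff.1 |> fun h => h (ε^2/2) (by positivity)
  obtain ⟨N2, hN2⟩ := tC (ε^2/4) (by positivity)
  refine ⟨max N1 N2, fun n hn => ?_⟩
  have h1 := hN1 n ((le_max_left _ _).trans hn) (max N1 N2) (le_max_left _ _)
  have h2 := hN2 (max N1 N2) (le_max_right _ _)
  rw [Real.dist_eq] at h1 h2
  rw [sub_zero, abs_lt] at h2
  rw [abs_lt] at h1
  have h3 := ns (max N1 N2) n
  have h4 := (abs_le.1 (key' _ _ hn)).1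
  rw [dist_eq_norm]
  refine lt_of_pow_lt_pow_left₀ 2 hε.le ?_
  linarith

variable {U : Set (ℝ × ℝ)} {w B0 D b : ℝ × ℝ → ℝ} {h1 h2 : ℝ → ℝ} {L : ℝ}

lemma seq (h : CI U w B0 D b h1 h2 L) (h0 : Adm U w B0 D b h1 h2 0) {η : ℕ → ℝ} (hη : ∀ n, 0 < η n) :
    ∃ φ ψ : ℕ → ℝ × ℝ → ℝ, φ 0 = 0 ∧ ∀ n, φ (n+1) = φ n + ψ n ∧ Adm U w B0 D b h1 h2 (φ n) ∧ Smooth (ψ n) ∧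
      (∀ p, |ψ n p| ≤ η n ∧ |px (ψ n) p| ≤ η n ∧ |pt (ψ n) p| ≤ η n ∧ |pt (px (ψ n)) p| ≤ η n) ∧
      (∀ j ≤ n, |∫ p in U, D p * px (px (ψ n)) p * gam w D (φ j) p| ≤ η n) ∧
      (∫ p in U, (rho w B0 D b h1 h2 (φ n) p)^2) ≤ 32 * L^2 * (∫ p in U, (D p * px (px (ψ n)) p)^2) + η n := by
  let St := {s : (ℝ × ℝ → ℝ) × List (ℝ × ℝ → ℝ) // Adm U w B0 D b h1 h2 s.1 ∧ ∀ g ∈ s.2, Continuous g}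
  have hc : ∀ s : St, ∀ g ∈ gam w D s.1.1 :: s.1.2, Continuous g := by
    intro s g hg
    rcases List.mem_cons.1 hg with rfl | hg
    · exact h.c_gam s.2.1.sm
    · exact s.2.2 g hg
  have hs : ∀ (n : ℕ) (s : St), ∃ ψ : ℝ × ℝ → ℝ, Smooth ψ ∧ (∀ p, |ψ p| ≤ η n ∧ |px ψ p| ≤ η n ∧ |pt ψ p| ≤ η n ∧ |pt (px ψ) p| ≤ η n) ∧
      Adm U w B0 D b h1 h2 (s.1.1 + ψ) ∧ (∀ g ∈ gam w D s.1.1 :: s.1.2, |∫ p in U, D p * px (px ψ) p * g p| ≤ η n) ∧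
      (∫ p in U, (rho w B0 D b h1 h2 s.1.1 p)^2) ≤ 32 * L^2 * (∫ p in U, (D p * px (px ψ) p)^2) + η n :=
    fun n s => step h s.2.1 (hη n) _ (hc s)
  choose Ψ hΨ using hs
  let st : ℕ → St := fun n => Nat.rec ⟨(0, []), h0, by simp⟩
    (fun n s => ⟨(s.1.1 + Ψ n s, gam w D s.1.1 :: s.1.2), (hΨ n s).2.2.1, hc s⟩) n
  have hmem : ∀ n, ∀ j ≤ n, gam w D (st j).1.1 ∈ gam w D (st n).1.1 :: (st n).1.2 := by
    intro n
    induction n with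
    | zero => intro j hj; rw [Nat.le_zero.1 hj]; simp
    | succ n ih =>
      intro j hj
      rcases Nat.le_succ_iff.1 hj with hj | rfl
      · exact List.mem_cons_of_mem _ (ih j hj)
      · simp
  refine ⟨fun n => (st n).1.1, fun n => Ψ n (st n), rfl, fun n => ⟨rfl, (st n).2.1, (hΨ n (st n)).1, (hΨ n (st n)).2.1, ?_, (hΨ n (st n)).2.2.2.2⟩⟩
  intro j hj
  exact (hΨ n (st n)).2.2.2.1 _ (hmem n j hj)

lemma hd_px {f : ℝ × ℝ → ℝ} (hf : Smooth f) (x t : ℝ) : HasDerivAt (fun y => f (y, t)) (px f (x, t)) x := by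
  have h1 : HasDerivAt (fun y : ℝ => (y, t)) ((1:ℝ), (0:ℝ)) x := (hasDerivAt_id x).prodMk (hasDerivAt_const x t)
  exact (hf.diff (x, t)).hasFDerivAt.comp_hasDerivAt x h1
lemma hd_pt {f : ℝ × ℝ → ℝ} (hf : Smooth f) (x t : ℝ) : HasDerivAt (fun s => f (x, s)) (pt f (x, t)) t := by
  have h1 : HasDerivAt (fun s : ℝ => (x, s)) ((0:ℝ), (1:ℝ)) t := (hasDerivAt_const t x).prodMk (hasDerivAt_id t)
  exact (hf.diff (x, t)).hasFDerivAt.comp_hasDerivAt t h1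

lemma lip_of_deriv {f f' : ℝ → ℝ} {K : ℝ} (h : ∀ x, HasDerivAt f (f' x) x) (hK : ∀ x, |f' x| ≤ K) (x y : ℝ) : |f x - f y| ≤ K * |x - y| :=
  convex_univ.norm_image_sub_le_of_norm_hasDerivWithin_le (fun x _ => (h x).hasDerivWithinAt) (fun x _ => hK x) (Set.mem_univ y) (Set.mem_univ x)

/-- limit of a geometric series of functions -/
lemma geo_lim {f g : ℕ → ℝ × ℝ → ℝ} {ε : ℝ} (hε : 0 < ε) (h0 : f 0 = 0) (h : ∀ n, f (n+1) = f n + g n) (hg : ∀ n p, |g n p| ≤ ε / 2 / 2^n) :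
    (∀ n p, |f n p| ≤ ε) ∧ ∃ F : ℝ × ℝ → ℝ, (∀ n p, |f n p - F p| ≤ ε / 2^n) ∧ TendstoUniformly f F atTop ∧ ∀ p, |F p| ≤ ε := by
  have hd : ∀ p n, dist (f n p) (f (n+1) p) ≤ ε / 2 / 2^n := by
    intro p n
    rw [h n, Real.dist_eq, Pi.add_apply, sub_add_cancel_left, abs_neg]; exact hg n p
  have hF : ∀ p, ∃ a, Tendsto (fun n => f n p) atTop (𝓝 a) := fun p =>
    cauchySeq_tendsto_of_complete (cauchySeq_of_le_geometric_two (C := ε) (hd p))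
  choose F hF using hF
  have hb : ∀ n p, |f n p - F p| ≤ ε / 2^n := fun n p => dist_le_of_le_geometric_two_of_tendsto (hd p) (hF p) n
  have hFb : ∀ p, |F p| ≤ ε := by
    intro p
    have := hb 0 p
    rw [h0] at this; simpa using this
  refine ⟨?_, F, hb, ?_, hFb⟩
  · intro n p
    have : ∀ n, |f n p| ≤ ε - ε / 2^n := by
      intro n
      induction n with
      | zero => simp [h0]
      | succ n ih =>
        rw [h n, Pi.add_apply]
        refine (abs_add_le _ _).trans ?_
        have := hg n p
        have e2 : ε / 2 / 2^n = ε / 2^n - ε / 2^(n+1) := by rw [pow_succ]; field_simp; ring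
        linarith
    have h1 := this n
    have : 0 ≤ ε / 2^n := by positivity
    linarith
  · rw [Metric.tendstoUniformly_iff]
    intro e he
    have tC : Tendsto (fun n : ℕ => ε / 2^n) atTop (𝓝 0) := by
      have := (tendsto_pow_atTop_nhds_zero_of_lt_one (r := (1/2:ℝ)) (by norm_num) (by norm_num)).const_mul ε
      rw [mul_zero] at this
      refine this.congr fun n => ?_
      rw [one_div, inv_pow]; rfl
    filter_upwards [tC.eventually_lt_const he] with n hn p
    rw [dist_comm, Real.dist_eq]
    exact (hb n p).trans_lt hn

end M6c
end FB

namespace FB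
section M6d
open Filter Topology MeasureTheory

lemma px_zero : px (0 : ℝ × ℝ → ℝ) = 0 := by
  funext p; simp [px]
lemma pt_zero : pt (0 : ℝ × ℝ → ℝ) = 0 := by
  funext p; simp [pt]

lemma inner_toLp {μ : Measure (ℝ × ℝ)} {f g : ℝ × ℝ → ℝ} (hf : MemLp f 2 μ) (hg : MemLp g 2 μ) :
    inner ℝ (hf.toLp f) (hg.toLp g) = ∫ p, f p * g p ∂μ := by
  rw [L2.inner_def]
  refine integral_congr_ae ?_
  filter_upwards [hf.coeFn_toLp, hg.coeFn_toLp] with p h1 h2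
  rw [h1, h2]; simp [mul_comm]

variable {U : Set (ℝ × ℝ)} {w B0 D b : ℝ × ℝ → ℝ} {h1 h2 : ℝ → ℝ} {L : ℝ}

/-- L² part : almost everywhere convergence of a subsequence -/
lemma L2_part (h : CI U w B0 D b h1 h2 L) {φ ψ : ℕ → ℝ × ℝ → ℝ} {ε a1 a2 R : ℝ} (hε : 0 < ε)
    (hs : ∀ n, φ (n+1) = φ n + ψ n ∧ Adm U w B0 D b h1 h2 (φ n) ∧ Smooth (ψ n) ∧
      (∀ j ≤ n, |∫ p in U, D p * px (px (ψ n)) p * gam w D (φ j) p| ≤ ε / 2 / 2^n) ∧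
      (∫ p in U, (rho w B0 D b h1 h2 (φ n) p)^2) ≤ 32 * L^2 * (∫ p in U, (D p * px (px (ψ n)) p)^2) + ε / 2 / 2^n)
    (ha : ∀ n, ∀ p ∈ U, a1 < gam w D (φ n) p ∧ gam w D (φ n) p < a2) (hR : ∀ n, ∀ p ∈ U, rho w B0 D b h1 h2 (φ n) p ≤ R) :
    ∃ (Γ : ℝ × ℝ → ℝ) (ns : ℕ → ℕ), Measurable Γ ∧ StrictMono ns ∧
      (∀ᵐ p ∂(volume.restrict U), Tendsto (fun i => gam w D (φ (ns i)) p) atTop (𝓝 (Γ p))) ∧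
      (∀ ρ : ℝ × ℝ → ℝ, Measurable ρ → (∀ᵐ p ∂(volume.restrict U), Tendsto (fun i => rho w B0 D b h1 h2 (φ (ns i)) p) atTop (𝓝 (ρ p))) →
        ∀ᵐ p ∂(volume.restrict U), ρ p = 0) := by
  have hUm := h.opn.measurableSet
  set μ := volume.restrict U with hμ
  haveI : IsFiniteMeasure μ := ⟨by rw [hμ, Measure.restrict_apply_univ]; exact fin_on h.bdd⟩
  set C := max |a1| |a2| with hC
  have hgC : ∀ n, ∀ p ∈ U, |gam w D (φ n) p| ≤ C := fun n p hp => by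
    obtain ⟨k1, k2⟩ := ha n p hp
    rw [abs_le]
    have := neg_abs_le a1
    have := le_abs_self a2
    have := le_max_left |a1| |a2|
    have := le_max_right |a1| |a2|
    constructor <;> linarith
  have cg : ∀ n, Continuous (gam w D (φ n)) := fun n => h.c_gam (hs n).2.1.sm
  have mem : ∀ n, MemLp (gam w D (φ n)) 2 μ := fun n =>
    MemLp.of_bound (cg n).aestronglyMeasurable C ((ae_restrict_iff' hUm).2 (Eventually.of_forall (hgC n)))
  set v : ℕ → Lp ℝ 2 μ := fun n => (mem n).toLp _ with hv
  have e1 : ∀ n p, gam w D (φ (n+1)) p - gam w D (φ n) p = D p * px (px (ψ n)) p := fun n p => by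
    rw [(hs n).1, gam_add (hs n).2.1.sm (hs n).2.2.1]; ring
  have sub_eq : ∀ n, v (n+1) - v n = ((mem (n+1)).sub (mem n)).toLp _ := fun n => (MemLp.toLp_sub _ _).symm
  have inn : ∀ n j, inner ℝ (v (n+1) - v n) (v j) = ∫ p in U, D p * px (px (ψ n)) p * gam w D (φ j) p := by
    intro n j
    rw [sub_eq, inner_toLp]
    refine integral_congr_ae (Eventually.of_forall fun p => ?_)
    simp only [Pi.sub_apply]
    rw [e1]
  have nrm : ∀ n, ‖v (n+1) - v n‖^2 = ∫ p in U, (D p * px (px (ψ n)) p)^2 := by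
    intro n
    rw [← real_inner_self_eq_norm_sq, sub_eq, inner_toLp]
    refine integral_congr_ae (Eventually.of_forall fun p => ?_)
    simp only [Pi.sub_apply]
    rw [e1]; ring
  have C0 : 0 ≤ C := (abs_nonneg _).trans (le_max_left _ _)
  have bd : ∀ n, ‖v n‖ ≤ C^2 * μ.real Set.univ + 1 := by
    intro n
    have k1 : ‖v n‖^2 ≤ C^2 * μ.real Set.univ := by
      rw [← real_inner_self_eq_norm_sq, inner_toLp]
      have := norm_integral_le_of_norm_le_const (μ := μ) (f := fun p => gam w D (φ n) p * gam w D (φ n) p) (C := C^2)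
        ((ae_restrict_iff' hUm).2 (Eventually.of_forall fun p hp => by
          rw [Real.norm_eq_abs, abs_mul]
          have := hgC n p hp
          nlinarith [abs_nonneg (gam w D (φ n) p)]))
      exact (le_abs_self _).trans this
    have : 0 ≤ C^2 * μ.real Set.univ := by positivity
    nlinarith [norm_nonneg (v n), sq_nonneg (‖v n‖ - 1)]
  have hcau : CauchySeq v := hilb bd (C := ε) (fun k j hj => by rw [inn]; exact (hs k).2.2.2.1 j hj)
  obtain ⟨V, hV⟩ := cauchySeq_tendsto_of_complete hcau
  obtain ⟨ns, hns, hae⟩ := (tendstoInMeasure_of_tendsto_Lp hV).exists_seq_tendsto_ae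
  have hae' : ∀ᵐ p ∂μ, Tendsto (fun i => gam w D (φ (ns i)) p) atTop (𝓝 (V p)) := by
    filter_upwards [hae, ae_all_iff.2 fun i => (mem (ns i)).coeFn_toLp] with p k1 k2
    refine k1.congr fun i => ?_
    exact k2 i
  refine ⟨V, ns, (Lp.stronglyMeasurable V).measurable, hns, hae', ?_⟩
  intro ρ mρ hρ
  have tC : Tendsto (fun n : ℕ => ε / 2 / 2^n) atTop (𝓝 0) := by
    have := (tendsto_pow_atTop_nhds_zero_of_lt_one (r := (1/2:ℝ)) (by norm_num) (by norm_num)).const_mul (ε / 2)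
    rw [mul_zero] at this
    refine this.congr fun n => ?_
    rw [one_div, inv_pow]; rfl
  have t1 : Tendsto (fun n => ∫ p in U, (rho w B0 D b h1 h2 (φ n) p)^2) atTop (𝓝 0) := by
    have k1 : Tendsto (fun n => v (n+1) - v n) atTop (𝓝 0) := by
      have := (hV.comp (tendsto_add_atTop_nat 1)).sub hV
      simpa using this
    have k2 := (((k1.norm).pow 2).const_mul (32 * L^2)).add tC
    simp only [norm_zero, ne_eq, OfNat.ofNat_ne_zero, not_false_eq_true, zero_pow, mul_zero, add_zero] at k2
    refine squeeze_zero (fun n => integral_nonneg fun p => sq_nonneg _) (fun n => ?_) k2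
    rw [nrm]; exact (hs n).2.2.2.2
  have bR : ∀ᵐ p ∂μ, ∀ i, ‖(rho w B0 D b h1 h2 (φ (ns i)) p)^2‖ ≤ R^2 := by
    refine (ae_restrict_iff' hUm).2 (Eventually.of_forall fun p hp i => ?_)
    rw [Real.norm_eq_abs, abs_of_nonneg (sq_nonneg _)]
    have k1 := (hs (ns i)).2.1.pos p hp
    have k2 := hR (ns i) p hp
    gcongr
  have t2 : Tendsto (fun i => ∫ p in U, (rho w B0 D b h1 h2 (φ (ns i)) p)^2) atTop (𝓝 (∫ p in U, (ρ p)^2)) := by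
    refine tendsto_integral_of_dominated_convergence (fun _ => R^2) (fun i => ?_) (integrable_const _) (fun i => ?_) ?_
    · exact ((h.c_rho (hs (ns i)).2.1.sm).pow 2).aestronglyMeasurable
    · filter_upwards [bR] with p hp using hp i
    · filter_upwards [hρ] with p hp using hp.pow 2
  have e0 : ∫ p in U, (ρ p)^2 = 0 := tendsto_nhds_unique t2 (t1.comp hns.tendsto_atTop)
  have hi : Integrable (fun p => (ρ p)^2) μ := by
    refine Integrable.of_bound (mρ.pow_const 2).aestronglyMeasurable (R^2) ?_
    filter_upwards [hρ, bR] with p k1 k2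
    exact le_of_tendsto (k1.pow 2).norm (Eventually.of_forall k2)
  have := (integral_eq_zero_iff_of_nonneg (fun p => sq_nonneg (ρ p)) hi).1 e0
  filter_upwards [this] with p hp
  exact pow_eq_zero_iff (two_ne_zero) |>.1 hp

/-- swapped Fubini -/
lemma ae_swap {q : ℝ × ℝ → Prop} (hq : ∀ᵐ p : ℝ × ℝ, q p) : ∀ᵐ t : ℝ, ∀ᵐ x : ℝ, q (x, t) := by
  have h1 : ∀ᵐ p : ℝ × ℝ ∂((volume : Measure ℝ).prod volume), q p.swap :=
    (Measure.measurePreserving_swap (μ := (volume : Measure ℝ)) (ν := (volume : Measure ℝ))).quasiMeasurePreserving.ae hq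
  exact Measure.ae_ae_of_ae_prod h1

lemma ae_swap' {q : ℝ × ℝ → Prop} (mq : MeasurableSet {p | q p}) (hq : ∀ᵐ t : ℝ, ∀ᵐ x : ℝ, q (x, t)) : ∀ᵐ p : ℝ × ℝ, q p := by
  have := (Measure.ae_ae_comm (μ := (volume : Measure ℝ)) (ν := (volume : Measure ℝ)) (p := fun x t => q (x, t)) mq).2 hq
  exact (Measure.ae_prod_iff_ae_ae mq).2 this

/-- the derivative of an integral in the first variable -/
lemma ae_deriv {P G : ℝ × ℝ → ℝ} {K : ℝ} (cP : Continuous P) (mG : Measurable G) (hG : ∀ p, |G p| ≤ K)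
    (hi : ∀ᵐ t : ℝ, ∀ x y, P (y, t) - P (x, t) = ∫ z in x..y, G (z, t)) :
    ∀ᵐ p : ℝ × ℝ, HasDerivAt (fun y => P (y, p.2)) (G p) p.1 := by
  have c1 : Continuous (Function.uncurry fun t x => P (x, t)) := cP.comp (continuous_snd.prodMk continuous_fst)
  have m0 : MeasurableSet {p : ℝ × ℝ | DifferentiableAt ℝ (fun y => P (y, p.2)) p.1 ∧ deriv (fun y => P (y, p.2)) p.1 = G p} := by
    have k1 := measurableSet_of_differentiableAt_with_param ℝ c1
    have k2 := measurable_deriv_with_param c1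
    have sw : Measurable (fun p : ℝ × ℝ => (p.2, p.1)) := measurable_swap
    exact (sw k1).inter (measurableSet_eq_fun (k2.comp sw) mG)
  have key : ∀ᵐ p : ℝ × ℝ, DifferentiableAt ℝ (fun y => P (y, p.2)) p.1 ∧ deriv (fun y => P (y, p.2)) p.1 = G p := by
    refine ae_swap' m0 ?_
    filter_upwards [hi] with t ht
    have mGt : Measurable (fun z => G (z, t)) := mG.comp (measurable_id.prodMk measurable_const)
    have li : LocallyIntegrable (fun z => G (z, t)) volume := by
      intro x
      refine ⟨Set.Icc (x-1) (x+1), Icc_mem_nhds (by linarith) (by linarith), ?_⟩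
      exact Integrable.of_bound mGt.aestronglyMeasurable K (Eventually.of_forall fun z => hG (z, t))
    filter_upwards [_root_.LocallyIntegrable.ae_hasDerivAt_integral li] with x hx
    have h1 := hx 0
    have h2 : HasDerivAt (fun y => P (y, t)) (G (x, t)) x := by
      have := h1.add_const (P (0, t))
      refine this.congr_of_eventuallyEq (Eventually.of_forall fun y => ?_)
      have := ht 0 y
      simp only
      linarith
    exact ⟨h2.differentiableAt, h2.deriv⟩
  filter_upwards [key] with p hp
  have := hp.1.hasDerivAt
  rwa [hp.2] at this

end M6d
end FB

namespace FB
section M6e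
open Filter Topology MeasureTheory

variable {U : Set (ℝ × ℝ)} {w B0 D b : ℝ × ℝ → ℝ} {h1 h2 : ℝ → ℝ} {L : ℝ}

lemma lim_lip {f : ℕ → ℝ} {g : ℕ → ℝ} {F G c : ℝ} (hf : Tendsto f atTop (𝓝 F)) (hg : Tendsto g atTop (𝓝 G)) (h : ∀ n, |f n - g n| ≤ c) :
    |F - G| ≤ c := le_of_tendsto (hf.sub hg).abs (Eventually.of_forall h)

/-- convex integration -/
theorem conv_int (h : CI U w B0 D b h1 h2 L) (h0 : Adm U w B0 D b h1 h2 0) (m1 : StrictMono h1) (m2 : StrictMono h2)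
    {a1 a2 ε0 ε : ℝ} (hε0 : 0 < ε0) (hB1 : ∀ p ∈ U, h1 a1 + ε0 ≤ B0 p) (hB2 : ∀ p ∈ U, B0 p ≤ h2 a2 - ε0) (hε : 0 < ε) :
    ∃ (φ P Q G : ℝ × ℝ → ℝ) (K : ℝ), 0 ≤ K ∧ Continuous φ ∧ Continuous P ∧ Continuous Q ∧ Measurable G ∧
      (∀ x t, HasDerivAt (fun y => φ (y, t)) (P (x, t)) x) ∧ (∀ x t, HasDerivAt (fun s => φ (x, s)) (Q (x, t)) t) ∧
      (∀ p, |φ p| ≤ ε ∧ |P p| ≤ ε ∧ |Q p| ≤ ε ∧ |G p| ≤ K) ∧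
      (∀ p, p ∉ U → φ p = 0 ∧ P p = 0 ∧ Q p = 0 ∧ G p = 0) ∧
      (∀ x y t, |P (x, t) - P (y, t)| ≤ K * |x - y|) ∧ (∀ x t s, |P (x, t) - P (x, s)| ≤ K * |t - s|) ∧
      (∀ᵐ t : ℝ, ∀ x y, P (y, t) - P (x, t) = ∫ z in x..y, G (z, t)) ∧
      (∀ᵐ p : ℝ × ℝ, HasDerivAt (fun y => P (y, p.2)) (G p) p.1) ∧
      (∀ᵐ p : ℝ × ℝ, p ∈ U → h1 (w p + D p * G p) = B0 p + D p * (Q p - b p * P p) ∨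
        h2 (w p + D p * G p) = B0 p + D p * (Q p - b p * P p)) := by
  obtain ⟨MD, MD0, hMD⟩ := bdd_on h.bdd h.cD
  obtain ⟨Mb, Mb0, hMb⟩ := bdd_on h.bdd h.cb
  obtain ⟨Mw, Mw0, hMw⟩ := bdd_on h.bdd h.cw
  obtain ⟨Mi, Mi0, hMi⟩ := bdd_on h.bdd (h.cD.inv₀ fun p => (h.Dpos p).ne')
  set ε' := min ε (ε0 / ((MD + 1) * (1 + Mb) * 2)) with hε'd
  have hε' : 0 < ε' := lt_min hε (by positivity)
  have hε'1 : ε' ≤ ε := min_le_left _ _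
  have hε'2 : MD * (ε' + Mb * ε') ≤ ε0 / 2 := by
    have k1 : ε' ≤ ε0 / ((MD + 1) * (1 + Mb) * 2) := min_le_right _ _
    rw [le_div_iff₀ (by positivity)] at k1
    nlinarith [mul_nonneg Mb0 hε'.le]
  obtain ⟨φ, ψ, e0, hs⟩ := seq h h0 (η := fun n => ε' / 2 / 2^n) (fun n => by positivity)
  have smφ : ∀ n, Smooth (φ n) := fun n => (hs n).2.1.sm
  have smψ : ∀ n, Smooth (ψ n) := fun n => (hs n).2.2.1
  have aφ := geo_lim hε' e0 (fun n => (hs n).1) (fun n p => ((hs n).2.2.2.1 p).1)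
  have aP := geo_lim (f := fun n => px (φ n)) (g := fun n => px (ψ n)) hε' (by rw [e0, px_zero])
    (fun n => by rw [(hs n).1, px_add (smφ n) (smψ n)]) (fun n p => ((hs n).2.2.2.1 p).2.1)
  have aQ := geo_lim (f := fun n => pt (φ n)) (g := fun n => pt (ψ n)) hε' (by rw [e0, pt_zero])
    (fun n => by rw [(hs n).1, pt_add (smφ n) (smψ n)]) (fun n p => ((hs n).2.2.2.1 p).2.2.1)
  have aR := geo_lim (f := fun n => pt (px (φ n))) (g := fun n => pt (px (ψ n))) hε' (by rw [e0, px_zero, pt_zero])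
    (fun n => by rw [(hs n).1, px_add (smφ n) (smψ n), pt_add (smφ n).px (smψ n).px]) (fun n p => ((hs n).2.2.2.1 p).2.2.2)
  obtain ⟨-, F, -, tF, bF⟩ := aφ
  obtain ⟨bPn, P, -, tP, bP⟩ := aP
  obtain ⟨bQn, Q, -, tQ, bQ⟩ := aQ
  have bRn := aR.1
  have Bn : ∀ n, ∀ p ∈ U, |Bf B0 D b (φ n) p - B0 p| ≤ ε0 / 2 := by
    intro n p hp
    unfold Bf
    rw [add_sub_cancel_left, abs_mul]
    have k1 : |pt (φ n) p - b p * px (φ n) p| ≤ ε' + Mb * ε' := by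
      refine (abs_sub _ _).trans ?_
      rw [abs_mul]
      have := hMb p hp
      have := bPn n p
      have := bQn n p
      gcongr
    exact (mul_le_mul (hMD p hp) k1 (abs_nonneg _) MD0).trans hε'2
  have rp : ∀ n, ∀ p ∈ U, Bf B0 D b (φ n) p < h1 (gam w D (φ n) p) ∧ h2 (gam w D (φ n) p) < Bf B0 D b (φ n) p := by
    intro n p hp
    have := (hs n).2.1.pos p hp
    unfold rho at this
    rw [lt_min_iff] at this
    exact ⟨by linarith, by linarith⟩
  have ha : ∀ n, ∀ p ∈ U, a1 < gam w D (φ n) p ∧ gam w D (φ n) p < a2 := by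
    intro n p hp
    obtain ⟨k1, k2⟩ := rp n p hp
    have k3 := abs_le.1 (Bn n p hp)
    have := hB1 p hp
    have := hB2 p hp
    exact ⟨m1.lt_iff_lt.1 (by linarith), m2.lt_iff_lt.1 (by linarith)⟩
  have hR : ∀ n, ∀ p ∈ U, rho w B0 D b h1 h2 (φ n) p ≤ h1 a2 - h1 a1 := by
    intro n p hp
    have k3 := abs_le.1 (Bn n p hp)
    have := hB1 p hp
    have k4 := m1 (ha n p hp).2
    refine (min_le_left _ _).trans ?_
    linarith
  obtain ⟨Γ, ns, mΓ, hns, lim, hρ⟩ := L2_part h hε' (fun n => ⟨(hs n).1, (hs n).2.1, (hs n).2.2.1, (hs n).2.2.2.2.1, (hs n).2.2.2.2.2⟩) ha hR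
  have hUm := h.opn.measurableSet
  set K := (|a1| + |a2| + Mw) * Mi + ε with hK
  have K0 : 0 ≤ K := by positivity
  have hxx : ∀ n p, p ∈ U → px (px (φ n)) p = (gam w D (φ n) p - w p) / D p := by
    intro n p _
    have := (h.Dpos p).ne'
    unfold gam; field_simp; ring
  have bxx : ∀ n p, |px (px (φ n)) p| ≤ K := by
    intro n p
    by_cases hp : p ∈ U
    · rw [hxx n p hp, div_eq_mul_inv, abs_mul]
      have k1 : |gam w D (φ n) p - w p| ≤ |a1| + |a2| + Mw := by
        have := ha n p hp
        have := abs_le.1 (hMw p hp)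
        have := neg_abs_le a1
        have := le_abs_self a2
        have := abs_nonneg a1
        have := abs_nonneg a2
        rw [abs_le]; constructor <;> linarith
      have k2 : |gam w D (φ n) p - w p| * |(D p)⁻¹| ≤ _ := mul_le_mul k1 (hMi p hp) (abs_nonneg _) (by positivity)
      linarith
    · rw [(ds_zero fun h => hp ((hs n).2.1.ts h)).2.2, abs_zero]; exact K0
  set G : ℝ × ℝ → ℝ := U.indicator (fun p => max (-K) (min K ((Γ p - w p) / D p))) with hG
  have mG : Measurable G := by
    refine Measurable.indicator ?_ hUm
    exact measurable_const.max (measurable_const.min ((mΓ.sub h.cw.measurable).div h.cD.measurable))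
  have bG : ∀ p, |G p| ≤ K := by
    intro p
    by_cases hp : p ∈ U
    · rw [hG, Set.indicator_of_mem hp, abs_le]
      exact ⟨le_max_left _ _, max_le (by linarith) (min_le_left _ _)⟩
    · rw [hG, Set.indicator_of_notMem hp, abs_zero]; exact K0
  have lim' : ∀ᵐ p : ℝ × ℝ, p ∈ U → Tendsto (fun i => gam w D (φ (ns i)) p) atTop (𝓝 (Γ p)) := (ae_restrict_iff' hUm).1 lim
  have GΓ : ∀ p ∈ U, Tendsto (fun i => gam w D (φ (ns i)) p) atTop (𝓝 (Γ p)) → Tendsto (fun i => px (px (φ (ns i))) p) atTop (𝓝 (G p)) ∧ w p + D p * G p = Γ p := by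
    intro p hp ht
    have k1 : Tendsto (fun i => px (px (φ (ns i))) p) atTop (𝓝 ((Γ p - w p) / D p)) :=
      ((ht.sub_const (w p)).div_const (D p)).congr fun i => (hxx _ p hp).symm
    have k2 : |(Γ p - w p) / D p| ≤ K := le_of_tendsto k1.abs (Eventually.of_forall fun i => bxx _ p)
    have k3 : G p = (Γ p - w p) / D p := by
      rw [hG, Set.indicator_of_mem hp, min_eq_right (abs_le.1 k2).2, max_eq_right (abs_le.1 k2).1]
    rw [k3]
    refine ⟨k1, ?_⟩
    have := (h.Dpos p).ne'
    field_simp; ring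
  have limG : ∀ᵐ p : ℝ × ℝ, Tendsto (fun i => px (px (φ (ns i))) p) atTop (𝓝 (G p)) := by
    filter_upwards [lim'] with p k
    by_cases hp : p ∈ U
    · exact (GΓ p hp (k hp)).1
    · rw [hG, Set.indicator_of_notMem hp]
      refine tendsto_const_nhds.congr fun i => ?_
      rw [(ds_zero fun h => hp ((hs (ns i)).2.1.ts h)).2.2]
  have tPp : ∀ p, Tendsto (fun n => px (φ n) p) atTop (𝓝 (P p)) := fun p => tP.tendsto_at p
  have tQp : ∀ p, Tendsto (fun n => pt (φ n) p) atTop (𝓝 (Q p)) := fun p => tQ.tendsto_at p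
  have tFp : ∀ p, Tendsto (fun n => φ n p) atTop (𝓝 (F p)) := fun p => tF.tendsto_at p
  have cF : Continuous F := tF.continuous (Eventually.of_forall fun n => (smφ n).continuous).frequently
  have cP : Continuous P := tP.continuous (Eventually.of_forall fun n => (smφ n).px.continuous).frequently
  have cQ : Continuous Q := tQ.continuous (Eventually.of_forall fun n => (smφ n).pt.continuous).frequently
  have hintg : ∀ᵐ t : ℝ, ∀ x y, P (y, t) - P (x, t) = ∫ z in x..y, G (z, t) := by
    filter_upwards [ae_swap limG] with t ht x y
    have k1 : Tendsto (fun i => ∫ z in x..y, px (px (φ (ns i))) (z, t)) atTop (𝓝 (∫ z in x..y, G (z, t))) := by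
      refine intervalIntegral.tendsto_integral_filter_of_dominated_convergence (fun _ => K) (Eventually.of_forall fun i => ?_) (Eventually.of_forall fun i => ?_)
        (by simp) ?_
      · exact ((smφ (ns i)).px.px.continuous.comp (continuous_id.prodMk continuous_const)).aestronglyMeasurable
      · exact Eventually.of_forall fun z _ => bxx _ _
      · filter_upwards [ht] with z hz _ using hz
    have k2 : ∀ i, ∫ z in x..y, px (px (φ (ns i))) (z, t) = px (φ (ns i)) (y, t) - px (φ (ns i)) (x, t) := by
      intro i
      refine intervalIntegral.integral_eq_sub_of_hasDerivAt (f := fun z => px (φ (ns i)) (z, t)) (fun z _ => hd_px (smφ (ns i)).px z t) ?_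
      exact ((smφ (ns i)).px.px.continuous.comp (continuous_id.prodMk continuous_const)).intervalIntegrable _ _
    simp only [k2] at k1
    exact tendsto_nhds_unique (((tPp (y, t)).comp hns.tendsto_atTop).sub ((tPp (x, t)).comp hns.tendsto_atTop)) k1
  refine ⟨F, P, Q, G, K, K0, cF, cP, cQ, mG, ?_, ?_, ?_, ?_, ?_, ?_, hintg, ae_deriv cP mG bG hintg, ?_⟩
  · intro x t
    refine hasDerivAt_of_tendstoUniformly (l := atTop) (f := fun n y => φ n (y, t)) (f' := fun n y => px (φ n) (y, t)) (g' := fun y => P (y, t)) ?_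
      (Eventually.of_forall fun n y => hd_px (smφ n) y t) (fun y => tFp (y, t)) x
    exact tP.comp (fun y : ℝ => (y, t))
  · intro x t
    refine hasDerivAt_of_tendstoUniformly (l := atTop) (f := fun n s => φ n (x, s)) (f' := fun n s => pt (φ n) (x, s)) (g' := fun s => Q (x, s)) ?_
      (Eventually.of_forall fun n s => hd_pt (smφ n) x s) (fun s => tFp (x, s)) t
    exact tQ.comp (fun s : ℝ => (x, s))
  · exact fun p => ⟨(bF p).trans hε'1, (bP p).trans hε'1, (bQ p).trans hε'1, bG p⟩
  · intro p hp
    have z : ∀ n, p ∉ tsupport (φ n) := fun n hn => hp ((hs n).2.1.ts hn)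
    refine ⟨tendsto_nhds_unique (tFp p) (tendsto_const_nhds.congr fun n => ?_), tendsto_nhds_unique (tPp p) (tendsto_const_nhds.congr fun n => ?_),
      tendsto_nhds_unique (tQp p) (tendsto_const_nhds.congr fun n => ?_), Set.indicator_of_notMem hp _⟩
    · exact (image_eq_zero_of_notMem_tsupport (z n)).symm
    · exact (ds_zero (z n)).1.symm
    · exact (ds_zero (z n)).2.1.symm
  · intro x y t
    exact lim_lip (tPp _) (tPp _) fun n => lip_of_deriv (f := fun y => px (φ n) (y, t)) (fun y => hd_px (smφ n).px y t) (fun y => bxx n (y, t)) x y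
  · intro x t s
    refine lim_lip (tPp _) (tPp _) fun n => lip_of_deriv (f := fun s => px (φ n) (x, s)) (fun s => hd_pt (smφ n).px x s) (fun s => ?_) t s
    refine (bRn n (x, s)).trans (hε'1.trans ?_)
    have : 0 ≤ (|a1| + |a2| + Mw) * Mi := by positivity
    linarith
  · have c1 := cont_of_lip h.lip1
    have c2 := cont_of_lip h.lip2
    set Bl : ℝ × ℝ → ℝ := fun p => B0 p + D p * (Q p - b p * P p) with hBl
    have mBl : Measurable Bl := (h.cB.add (h.cD.mul (cQ.sub (h.cb.mul cP)))).measurable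
    have r0 := hρ (fun p => min (h1 (Γ p) - Bl p) (Bl p - h2 (Γ p)))
      (((c1.measurable.comp mΓ).sub mBl).min (mBl.sub (c2.measurable.comp mΓ))) (by
        filter_upwards [lim] with p hp
        have tB : Tendsto (fun i => Bf B0 D b (φ (ns i)) p) atTop (𝓝 (Bl p)) := by
          have k1 := (tQp p).comp hns.tendsto_atTop
          have k2 := (tPp p).comp hns.tendsto_atTop
          exact ((k1.sub (k2.const_mul (b p))).const_mul (D p)).const_add (B0 p)
        exact (((c1.tendsto _).comp hp).sub tB).min (tB.sub ((c2.tendsto _).comp hp)))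
    have r1 := (ae_restrict_iff' hUm).1 r0
    filter_upwards [r1, lim'] with p k1 k2 hp
    rw [(GΓ p hp (k2 hp)).2]
    have k3 := k1 hp
    rcases min_choice (h1 (Γ p) - Bl p) (Bl p - h2 (Γ p)) with k | k
    · left; rw [k] at k3; linarith
    · right; rw [k] at k3; linarith

end M6e
end FB

namespace FB
section M6f
open Filter Topology MeasureTheory

variable {U : Set (ℝ × ℝ)} {w B0 D b : ℝ × ℝ → ℝ} {h1 h2 : ℝ → ℝ} {L : ℝ}

lemma ae_pick {t1 t2 : ℝ} (ht : t1 < t2) {q : ℝ → Prop} (hq : ∀ᵐ t : ℝ, q t) : ∃ t ∈ Set.Ioo t1 t2, q t := by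
  by_contra! hc
  have h0 : volume (Set.Ioo t1 t2) = 0 := measure_mono_null (fun t ht hqt => hc t ht hqt) hq
  rw [Real.volume_Ioo, ENNReal.ofReal_eq_zero] at h0
  linarith

lemma ae_pick2 {x1 x2 t1 t2 : ℝ} (hx : x1 < x2) (ht : t1 < t2) {q : ℝ × ℝ → Prop} (hq : ∀ᵐ p : ℝ × ℝ, q p) :
    ∃ x ∈ Set.Ioo x1 x2, ∃ t ∈ Set.Ioo t1 t2, q (x, t) := by
  obtain ⟨t, ht', h⟩ := ae_pick ht (ae_swap hq)
  obtain ⟨x, hx', h⟩ := ae_pick hx h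
  exact ⟨x, hx', t, ht', h⟩

lemma two_phase (h : CI U w B0 D b h1 h2 L) (h0 : Adm U w B0 D b h1 h2 0) (m1 : StrictMono h1) (m2 : StrictMono h2) (hU : U.Nonempty) :
    ∃ ε1 : ℝ, 0 < ε1 ∧ ∀ (P Q G : ℝ × ℝ → ℝ) (ε K : ℝ), ε ≤ ε1 → Measurable G → (∀ p, |P p| ≤ ε ∧ |Q p| ≤ ε ∧ |G p| ≤ K) →
      (∀ᵐ t : ℝ, ∀ x y, P (y, t) - P (x, t) = ∫ z in x..y, G (z, t)) →
      (∀ᵐ p : ℝ × ℝ, HasDerivAt (fun y => P (y, p.2)) (G p) p.1) →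
      (∀ᵐ p : ℝ × ℝ, p ∈ U → h1 (w p + D p * G p) = B0 p + D p * (Q p - b p * P p) ∨
        h2 (w p + D p * G p) = B0 p + D p * (Q p - b p * P p)) →
      (¬ ∀ᵐ p : ℝ × ℝ, p ∈ U → h1 (w p + D p * G p) = B0 p + D p * (Q p - b p * P p)) ∧
      (¬ ∀ᵐ p : ℝ × ℝ, p ∈ U → h2 (w p + D p * G p) = B0 p + D p * (Q p - b p * P p)) ∧
      ∃ p ∈ U, P p ≠ 0 := by
  obtain ⟨⟨x0, t0⟩, hp0⟩ := hU
  obtain ⟨e, he, hb⟩ := Metric.isOpen_iff.1 h.opn _ hp0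
  set x1 := x0 - e/2 with hx1
  set x2 := x0 + e/2 with hx2
  set t1 := t0 - e/2 with ht1
  set t2 := t0 + e/2 with ht2
  have box : ∀ x t, x ∈ Set.Icc x1 x2 → t ∈ Set.Icc t1 t2 → (x, t) ∈ U := by
    intro x t hx ht
    apply hb
    rw [Metric.mem_ball, Prod.dist_eq, max_lt_iff, Real.dist_eq, Real.dist_eq]
    constructor
    · exact (abs_le.2 ⟨by linarith [hx.1], by linarith [hx.2]⟩ : |x - x0| ≤ e/2).trans_lt (by linarith)
    · exact (abs_le.2 ⟨by linarith [ht.1], by linarith [ht.2]⟩ : |t - t0| ≤ e/2).trans_lt (by linarith)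
  have hx12 : x1 < x2 := by linarith
  have ht12 : t1 < t2 := by linarith
  have hK : IsCompact (Set.Icc x1 x2 ×ˢ Set.Icc t1 t2) := isCompact_Icc.prod isCompact_Icc
  obtain ⟨pm, hpm, hmin⟩ := hK.exists_isMinOn ⟨(x0, t0), ⟨by linarith, by linarith⟩, ⟨by linarith, by linarith⟩⟩
    (h.c_rho h0.sm).continuousOn
  set r := rho w B0 D b h1 h2 0 pm with hr
  have hr0 : 0 < r := h0.pos pm (box pm.1 pm.2 hpm.1 hpm.2)
  obtain ⟨MD, MD0, hMD⟩ := bdd_on h.bdd h.cD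
  obtain ⟨Mb, Mb0, hMb⟩ := bdd_on h.bdd h.cb
  set g0 := r / (2 * L * (MD + 1)) with hg0
  have hLp := h.Lpos
  have g0p : 0 < g0 := by positivity
  have rb : ∀ x t, x ∈ Set.Icc x1 x2 → t ∈ Set.Icc t1 t2 → B0 (x, t) + r ≤ h1 (w (x, t)) ∧ h2 (w (x, t)) + r ≤ B0 (x, t) := by
    intro x t hx ht
    have := hmin (show (x, t) ∈ Set.Icc x1 x2 ×ˢ Set.Icc t1 t2 from ⟨hx, ht⟩)
    have k : r ≤ rho w B0 D b h1 h2 0 (x, t) := this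
    unfold rho gam Bf at k
    rw [px_zero, px_zero, pt_zero, le_min_iff] at k
    simp only [Pi.zero_apply, mul_zero, sub_zero, add_zero] at k
    exact ⟨by linarith, by linarith⟩
  refine ⟨min (r / (2 * (MD + 1) * (1 + Mb))) (g0 * (x2 - x1) / 4), lt_min (by positivity) (by have := sub_pos.2 hx12; positivity), ?_⟩
  intro P Q G ε K hε mG hbd hintg hder halt
  have hε1 : ε ≤ r / (2 * (MD + 1) * (1 + Mb)) := hε.trans (min_le_left _ _)
  have hε2 : ε ≤ g0 * (x2 - x1) / 4 := hε.trans (min_le_right _ _)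
  have ε0 : 0 ≤ ε := (abs_nonneg _).trans (hbd (0,0)).1
  have hB : ∀ p ∈ U, |D p * (Q p - b p * P p)| ≤ r / 2 := by
    intro p hp
    rw [abs_mul]
    have k1 : |Q p - b p * P p| ≤ ε + Mb * ε := by
      refine (abs_sub _ _).trans ?_
      rw [abs_mul]
      have := hMb p hp
      have := (hbd p).1
      have := (hbd p).2.1
      gcongr
    refine (mul_le_mul (hMD p hp) k1 (abs_nonneg _) MD0).trans ?_
    rw [le_div_iff₀ (by positivity)] at hε1
    nlinarith [mul_nonneg Mb0 ε0]
  have key : ∀ {D' g s : ℝ}, 0 < D' → D' ≤ MD → s ≤ L * |D' * g| → r / 2 ≤ s → g0 ≤ |g| := by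
    intro D' g s hD' hD'' k1 k2
    rw [hg0, div_le_iff₀ (by positivity)]
    rw [abs_mul, abs_of_pos hD'] at k1
    have : L * (D' * |g|) ≤ L * ((MD + 1) * |g|) := by
      have := abs_nonneg g
      gcongr; linarith
    nlinarith
  have c1 : ∀ x t, x ∈ Set.Icc x1 x2 → t ∈ Set.Icc t1 t2 →
      h1 (w (x,t) + D (x,t) * G (x,t)) = B0 (x,t) + D (x,t) * (Q (x,t) - b (x,t) * P (x,t)) → G (x, t) ≤ -g0 := by
    intro x t hx ht k
    have hU := box x t hx ht
    have k1 := (rb x t hx ht).1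
    have k2 := abs_le.1 (hB _ hU)
    have k3 := h.lip1 (w (x,t)) (w (x,t) + D (x,t) * G (x,t))
    rw [sub_add_cancel_left, abs_neg] at k3
    have k4 := key (h.Dpos (x,t)) ((le_abs_self _).trans (hMD _ hU)) ((le_abs_self _).trans k3) (by linarith)
    have k5 : G (x,t) < 0 := by
      have : w (x,t) + D (x,t) * G (x,t) < w (x, t) := m1.lt_iff_lt.1 (by linarith)
      have := h.Dpos (x,t)
      by_contra! hc
      nlinarith [mul_nonneg this.le hc]
    rw [abs_of_neg k5] at k4; linarith
  have c2 : ∀ x t, x ∈ Set.Icc x1 x2 → t ∈ Set.Icc t1 t2 →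
      h2 (w (x,t) + D (x,t) * G (x,t)) = B0 (x,t) + D (x,t) * (Q (x,t) - b (x,t) * P (x,t)) → g0 ≤ G (x, t) := by
    intro x t hx ht k
    have hU := box x t hx ht
    have k1 := (rb x t hx ht).2
    have k2 := abs_le.1 (hB _ hU)
    have k3 := h.lip2 (w (x,t) + D (x,t) * G (x,t)) (w (x,t))
    rw [add_sub_cancel_left] at k3
    have k4 := key (h.Dpos (x,t)) ((le_abs_self _).trans (hMD _ hU)) ((le_abs_self _).trans k3) (by linarith)
    have k5 : 0 < G (x,t) := by
      have : w (x,t) < w (x,t) + D (x,t) * G (x,t) := m2.lt_iff_lt.1 (by linarith)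
      have := h.Dpos (x,t)
      by_contra! hc
      nlinarith [mul_nonneg this.le (neg_nonneg.2 hc)]
    rwa [abs_of_pos k5] at k4
  have ii : ∀ t, IntervalIntegrable (fun z => G (z, t)) volume x1 x2 := by
    intro t
    have mGt : Measurable (fun z => G (z, t)) := mG.comp (measurable_id.prodMk measurable_const)
    rw [intervalIntegrable_iff, Set.uIoc_of_le hx12.le]
    exact Integrable.of_bound mGt.aestronglyMeasurable K (Eventually.of_forall fun z => (hbd (z, t)).2.2)
  have Pb : ∀ t, |P (x2, t) - P (x1, t)| ≤ 2 * ε := fun t => (abs_sub _ _).trans (by linarith [(hbd (x2, t)).1, (hbd (x1, t)).1])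
  have pos : 0 < g0 * (x2 - x1) := mul_pos g0p (sub_pos.2 hx12)
  refine ⟨?_, ?_, ?_⟩
  · intro hall
    obtain ⟨t, ht, k1, k2⟩ := ae_pick ht12 ((ae_swap hall).and hintg)
    have ht' := Set.Ioo_subset_Icc_self ht
    have k3 : ∫ z in x1..x2, G (z, t) ≤ ∫ z in x1..x2, -g0 := by
      refine intervalIntegral.integral_mono_ae_restrict hx12.le (ii t) (by simp) ?_
      refine (ae_restrict_iff' measurableSet_Icc).2 ?_
      filter_upwards [k1] with z hz hz'
      exact c1 z t hz' ht' (hz (box z t hz' ht'))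
    rw [← k2, intervalIntegral.integral_const, smul_eq_mul] at k3
    have := (abs_le.1 (Pb t)).1
    linarith
  · intro hall
    obtain ⟨t, ht, k1, k2⟩ := ae_pick ht12 ((ae_swap hall).and hintg)
    have ht' := Set.Ioo_subset_Icc_self ht
    have k3 : ∫ z in x1..x2, g0 ≤ ∫ z in x1..x2, G (z, t) := by
      refine intervalIntegral.integral_mono_ae_restrict hx12.le (by simp) (ii t) ?_
      refine (ae_restrict_iff' measurableSet_Icc).2 ?_
      filter_upwards [k1] with z hz hz'
      exact c2 z t hz' ht' (hz (box z t hz' ht'))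
    rw [← k2, intervalIntegral.integral_const, smul_eq_mul] at k3
    have := (abs_le.1 (Pb t)).2
    linarith
  · by_contra! hP
    obtain ⟨x, hx, t, ht, k1, k2⟩ := ae_pick2 hx12 ht12 (hder.and halt)
    have ht' := Set.Ioo_subset_Icc_self ht
    have hx' := Set.Ioo_subset_Icc_self hx
    have k3 : HasDerivAt (fun y => P (y, t)) 0 x := by
      refine (hasDerivAt_const x (0:ℝ)).congr_of_eventuallyEq ?_
      filter_upwards [Icc_mem_nhds hx.1 hx.2] with y hy
      exact hP _ (box y t hy ht')
    have k4 : G (x, t) = 0 := k1.unique k3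
    rcases k2 (box x t hx' ht') with k | k
    · have := c1 x t hx' ht' k; linarith
    · have := c2 x t hx' ht' k; linarith

end M6f
end FB

namespace FB
section M7a
open Filter Topology MeasureTheory

/-- product rule for an absolutely continuous function -/
lemma prod_int {p g q q' : ℝ → ℝ} {K : ℝ} (mg : Measurable g) (hg : ∀ x, |g x| ≤ K) (hp : ∀ x y, p y - p x = ∫ z in x..y, g z)
    (hq : ∀ x ∈ Set.Ioo (0:ℝ) 1, HasDerivAt q (q' x) x) {C : ℝ} (hl : ∀ x ∈ Set.Icc (0:ℝ) 1, ∀ y ∈ Set.Icc (0:ℝ) 1, |q x - q y| ≤ C * |x - y|)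
    {x : ℝ} (hx : x ∈ Set.Icc (0:ℝ) 1) : ∫ z in (0:ℝ)..x, (g z * q z + p z * q' z) = p x * q x - p 0 * q 0 := by
  have li : LocallyIntegrable g volume := by
    intro x
    refine ⟨Set.Icc (x-1) (x+1), Icc_mem_nhds (by linarith) (by linarith), ?_⟩
    exact Integrable.of_bound mg.aestronglyMeasurable K (Eventually.of_forall fun z => hg z)
  have acp : AbsolutelyContinuousOnInterval p 0 x := by
    have hl : LipschitzOnWith (Real.toNNReal K) p (Set.uIcc 0 x) := by
      refine LipschitzOnWith.of_dist_le_mul fun a _ c _ => ?_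
      rw [Real.dist_eq, Real.dist_eq, hp c a]
      have := intervalIntegral.norm_integral_le_of_norm_le_const (a := c) (b := a) (f := g) (C := K) (fun z _ => hg z)
      exact this.trans (mul_le_mul_of_nonneg_right (Real.le_coe_toNNReal K) (abs_nonneg _))
    exact hl.absolutelyContinuousOnInterval
  have acq : AbsolutelyContinuousOnInterval q 0 x := by
    have hl : LipschitzOnWith (Real.toNNReal C) q (Set.uIcc 0 x) := by
      refine LipschitzOnWith.of_dist_le_mul fun a ha c hc => ?_
      rw [Set.uIcc_of_le hx.1] at ha hc
      rw [Real.dist_eq, Real.dist_eq]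
      exact (hl a ⟨ha.1, ha.2.trans hx.2⟩ c ⟨hc.1, hc.2.trans hx.2⟩).trans (mul_le_mul_of_nonneg_right (Real.le_coe_toNNReal C) (abs_nonneg _))
    exact hl.absolutelyContinuousOnInterval
  rw [← acp.integral_deriv_mul_eq_sub acq]
  refine intervalIntegral.integral_congr_ae ?_
  have h1 : ∀ᵐ z : ℝ, z ≠ x := by
    rw [ae_iff]; simp
  filter_upwards [_root_.LocallyIntegrable.ae_hasDerivAt_integral li, h1] with z hz hzx hz'
  rw [Set.uIoc_of_le hx.1] at hz'
  have k1 : HasDerivAt p (g z) z := by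
    refine ((hz 0).add_const (p 0)).congr_of_eventuallyEq (Eventually.of_forall fun y => ?_)
    have := hp 0 y
    simp only
    linarith
  have k2 := hq z ⟨hz'.1, (lt_of_le_of_ne hz'.2 hzx).trans_le hx.2⟩
  rw [k1.deriv, k2.deriv]

lemma px_pt {ζ : ℝ × ℝ → ℝ} (hζ : Smooth ζ) (p : ℝ × ℝ) : px (pt ζ) p = pt (px ζ) p := by
  have hs : IsSymmSndFDerivAt ℝ ζ p := hζ.contDiffAt.isSymmSndFDerivAt (by rw [minSmoothness_of_isRCLikeNormedField]; exact WithTop.coe_le_coe.2 (le_top : (2:ℕ∞) ≤ ⊤))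
  have hd : DifferentiableAt ℝ (fderiv ℝ ζ) p := (hζ.fderiv_right (m := (⊤ : ℕ∞)) (by simp)).differentiable (by simp) p
  have e : ∀ v : ℝ × ℝ, fderiv ℝ (fun q => fderiv ℝ ζ q v) p = (fderiv ℝ (fderiv ℝ ζ) p).flip v := by
    intro v
    rw [fderiv_clm_apply hd (differentiableAt_const v)]
    simp
  unfold px pt
  rw [e, e]
  exact hs (1,0) (0,1)

lemma cx {f : ℝ × ℝ → ℝ} (hf : Continuous f) (t : ℝ) : Continuous fun x => f (x, t) := hf.comp (continuous_id.prodMk continuous_const)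
lemma ct {f : ℝ × ℝ → ℝ} (hf : Continuous f) (x : ℝ) : Continuous fun t => f (x, t) := hf.comp (continuous_const.prodMk continuous_id)

lemma ixm {f g : ℝ × ℝ → ℝ} (hf : Continuous f) (hg : Continuous g) (t a b : ℝ) : IntervalIntegrable (fun x => f (x, t) * g (x, t)) volume a b :=
  (cx (hf.mul hg) t).intervalIntegrable a b

lemma cpi {f : ℝ × ℝ → ℝ} (hf : Continuous f) : Continuous fun p : ℝ × ℝ => ∫ y in (0:ℝ)..p.1, f (y, p.2) := by
  have : Continuous (Function.uncurry fun (p : ℝ × ℝ) (y : ℝ) => f (y, p.2)) := by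
    unfold Function.uncurry; fun_prop
  exact intervalIntegral.continuous_parametric_intervalIntegral_of_continuous this continuous_fst
lemma cpi' {f : ℝ × ℝ → ℝ} (hf : Continuous f) : Continuous fun p : ℝ × ℝ => ∫ s in (0:ℝ)..p.2, f (p.1, s) := by
  have : Continuous (Function.uncurry fun (p : ℝ × ℝ) (s : ℝ) => f (p.1, s)) := by
    unfold Function.uncurry; fun_prop
  exact intervalIntegral.continuous_parametric_intervalIntegral_of_continuous this continuous_snd

lemma swap_int {f : ℝ × ℝ → ℝ} (hf : Continuous f) {s : ℝ} (hs : 0 ≤ s) :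
    ∫ x in (0:ℝ)..1, ∫ t in (0:ℝ)..s, f (x, t) = ∫ t in (0:ℝ)..s, ∫ x in (0:ℝ)..1, f (x, t) := by
  simp only [intervalIntegral.integral_of_le hs, intervalIntegral.integral_of_le (zero_le_one (α := ℝ))]
  refine integral_integral_swap (f := fun x t => f (x, t)) ?_
  rw [Measure.prod_restrict]
  have : IntegrableOn f (Set.Icc (0:ℝ) 1 ×ˢ Set.Icc 0 s) ((volume : Measure ℝ).prod volume) :=
    hf.continuousOn.integrableOn_compact (isCompact_Icc.prod isCompact_Icc)
  exact this.mono_set (Set.prod_mono Set.Ioc_subset_Icc_self Set.Ioc_subset_Icc_self)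

/-- potential lemma -/
lemma pot {v k ζ : ℝ × ℝ → ℝ} {T s : ℝ} (cv : Continuous v) (ck : Continuous k) (hζ : Smooth ζ)
    (hV : ∀ x ∈ Set.Icc (0:ℝ) 1, ∀ t ∈ Set.Icc (0:ℝ) T, ∫ y in (0:ℝ)..x, v (y, t) = ∫ τ in (0:ℝ)..t, k (x, τ)) (hs : s ∈ Set.Icc (0:ℝ) T) :
    ∫ x in (0:ℝ)..1, v (x, s) * ζ (x, s) =
      ∫ t in (0:ℝ)..s, ((k (1, t) * ζ (1, t) - ∫ x in (0:ℝ)..1, k (x, t) * px ζ (x, t)) + ∫ x in (0:ℝ)..1, v (x, t) * pt ζ (x, t)) := by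
  set V : ℝ × ℝ → ℝ := fun p => ∫ y in (0:ℝ)..p.1, v (y, p.2) with hVd
  set W : ℝ × ℝ → ℝ := fun p => ∫ τ in (0:ℝ)..p.2, k (p.1, τ) with hWd
  have cV : Continuous V := cpi cv
  have cW : Continuous W := cpi' ck
  have VW : ∀ x ∈ Set.Icc (0:ℝ) 1, ∀ t ∈ Set.Icc (0:ℝ) T, V (x, t) = W (x, t) := hV
  have dV : ∀ x t, HasDerivAt (fun y => V (y, t)) (v (x, t)) x := fun x t =>
    intervalIntegral.integral_hasDerivAt_right ((cx cv t).intervalIntegrable _ _)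
      ((cx cv t).stronglyMeasurableAtFilter _ _) (cx cv t).continuousAt
  have dW : ∀ x t, HasDerivAt (fun y => W (x, y)) (k (x, t)) t := fun x t =>
    intervalIntegral.integral_hasDerivAt_right ((ct ck x).intervalIntegrable _ _)
      ((ct ck x).stronglyMeasurableAtFilter _ _) (ct ck x).continuousAt
  have cζ := hζ.continuous
  have cζx := hζ.px.continuous
  have cζt := hζ.pt.continuous
  have cζxt := hζ.px.pt.continuous
  have V0 : ∀ t, V (0, t) = 0 := fun t => by simp [hVd]
  have W0 : ∀ x, W (x, 0) = 0 := fun x => by simp [hWd]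
  -- in space
  have A : ∀ (θ θ' : ℝ × ℝ → ℝ), Continuous θ → Continuous θ' → (∀ x t, HasDerivAt (fun y => θ (y, t)) (θ' (x, t)) x) → ∀ t,
      ∫ x in (0:ℝ)..1, v (x, t) * θ (x, t) = V (1, t) * θ (1, t) - ∫ x in (0:ℝ)..1, V (x, t) * θ' (x, t) := by
    intro θ θ' cθ cθ' hd t
    have k1 := intervalIntegral.integral_eq_sub_of_hasDerivAt (f := fun x => V (x, t) * θ (x, t)) (a := 0) (b := 1)
      (f' := fun x => v (x, t) * θ (x, t) + V (x, t) * θ' (x, t)) (fun x _ => (dV x t).mul (hd x t))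
      (((cx cv t).mul (cx cθ t)).add ((cx cV t).mul (cx cθ' t)) |>.intervalIntegrable _ _)
    rw [intervalIntegral.integral_add (ixm cv cθ t 0 1) (ixm cV cθ' t 0 1)] at k1
    rw [V0] at k1
    linarith
  -- in time
  have Bt : ∀ (θ θ' : ℝ × ℝ → ℝ), Continuous θ → Continuous θ' → (∀ x t, HasDerivAt (fun y => θ (x, y)) (θ' (x, t)) t) → ∀ x,
      W (x, s) * θ (x, s) = ∫ t in (0:ℝ)..s, (k (x, t) * θ (x, t) + W (x, t) * θ' (x, t)) := by
    intro θ θ' cθ cθ' hd x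
    have k1 := intervalIntegral.integral_eq_sub_of_hasDerivAt (f := fun t => W (x, t) * θ (x, t)) (a := 0) (b := s)
      (f' := fun t => k (x, t) * θ (x, t) + W (x, t) * θ' (x, t)) (fun t _ => (dW x t).mul (hd x t))
      (((ct ck x).mul (ct cθ x)).add ((ct cW x).mul (ct cθ' x)) |>.intervalIntegrable _ _)
    rw [W0] at k1
    linarith
  have h1 : (1:ℝ) ∈ Set.Icc (0:ℝ) 1 := by simp
  have e1 := A ζ (px ζ) cζ cζx (fun x t => hd_px hζ x t) s
  have e2 := Bt ζ (pt ζ) cζ cζt (fun x t => hd_pt hζ x t) 1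
  have e3 : ∫ x in (0:ℝ)..1, V (x, s) * px ζ (x, s) = ∫ x in (0:ℝ)..1, ∫ t in (0:ℝ)..s, (k (x, t) * px ζ (x, t) + W (x, t) * pt (px ζ) (x, t)) := by
    refine intervalIntegral.integral_congr fun x hx => ?_
    rw [Set.uIcc_of_le zero_le_one] at hx
    rw [VW x hx s hs]
    exact Bt (px ζ) (pt (px ζ)) cζx cζxt (fun x t => hd_pt hζ.px x t) x
  have cI : Continuous fun p : ℝ × ℝ => k p * px ζ p + W p * pt (px ζ) p := (ck.mul cζx).add (cW.mul cζxt)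
  have e4 : ∫ x in (0:ℝ)..1, ∫ t in (0:ℝ)..s, (k (x, t) * px ζ (x, t) + W (x, t) * pt (px ζ) (x, t)) =
      ∫ t in (0:ℝ)..s, ∫ x in (0:ℝ)..1, (k (x, t) * px ζ (x, t) + W (x, t) * pt (px ζ) (x, t)) := by
    exact swap_int cI hs.1
  have e5 : ∀ t ∈ Set.Icc 0 s, ∫ x in (0:ℝ)..1, (k (x, t) * px ζ (x, t) + W (x, t) * pt (px ζ) (x, t)) =
      (∫ x in (0:ℝ)..1, k (x, t) * px ζ (x, t)) + (W (1, t) * pt ζ (1, t) - ∫ x in (0:ℝ)..1, v (x, t) * pt ζ (x, t)) := by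
    intro t ht
    have ht' : t ∈ Set.Icc 0 T := ⟨ht.1, ht.2.trans hs.2⟩
    rw [intervalIntegral.integral_add (ixm ck cζx t 0 1) (ixm cW cζxt t 0 1),
      A (pt ζ) (pt (px ζ)) cζt cζxt (fun x t => (hd_px hζ.pt x t).congr_deriv (px_pt hζ _)) t, VW 1 h1 t ht']
    congr 1
    rw [sub_sub_cancel]
    refine intervalIntegral.integral_congr fun x hx => ?_
    rw [Set.uIcc_of_le zero_le_one] at hx
    rw [VW x hx t ht']
  have c1 : Continuous fun t => ∫ x in (0:ℝ)..1, (k (x, t) * px ζ (x, t) + W (x, t) * pt (px ζ) (x, t)) :=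
    ct (cpi cI) 1
  have c2 : IntervalIntegrable (fun t => k (1, t) * ζ (1, t) + W (1, t) * pt ζ (1, t)) volume 0 s :=
    (ct ((ck.mul cζ).add (cW.mul cζt)) 1).intervalIntegrable 0 s
  rw [e1, e3, e4, VW 1 h1 s hs, e2, ← intervalIntegral.integral_sub c2
    (c1.intervalIntegrable _ _)]
  refine intervalIntegral.integral_congr fun t ht => ?_
  rw [Set.uIcc_of_le hs.1] at ht
  rw [e5 t ht]
  ring

end M7a
end FB

namespace FB
section M7b
open Filter Topology MeasureTheory

lemma ii_of {g : ℝ → ℝ} {K a c : ℝ} (mg : Measurable g) (hac : a ≤ c) (hb : ∀ x ∈ Set.Icc a c, |g x| ≤ K) : IntervalIntegrable g volume a c := by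
  rw [intervalIntegrable_iff, Set.uIoc_of_le hac]
  exact Integrable.of_bound mg.aestronglyMeasurable K ((ae_restrict_iff' measurableSet_Ioc).2
    (Eventually.of_forall fun z hz => hb z (Set.Ioc_subset_Icc_self hz)))

lemma ibp {g ζ ζ' : ℝ → ℝ} {K : ℝ} (mg : Measurable g) (hb : ∀ x ∈ Set.Icc (0:ℝ) 1, |g x| ≤ K) (hζ : ∀ x, HasDerivAt ζ (ζ' x) x) (cζ' : Continuous ζ') :
    ∫ x in (0:ℝ)..1, g x * ζ x = (∫ x in (0:ℝ)..1, g x) * ζ 1 - ∫ x in (0:ℝ)..1, (∫ y in (0:ℝ)..x, g y) * ζ' x := by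
  have K0 : 0 ≤ K := (abs_nonneg _).trans (hb 0 (by simp))
  set G := (Set.Icc (0:ℝ) 1).indicator g with hG
  have mG : Measurable G := mg.indicator measurableSet_Icc
  have bG : ∀ x, |G x| ≤ K := by
    intro x
    by_cases hx : x ∈ Set.Icc (0:ℝ) 1
    · rw [hG, Set.indicator_of_mem hx]; exact hb x hx
    · rw [hG, Set.indicator_of_notMem hx, abs_zero]; exact K0
  have iG : ∀ a c, IntervalIntegrable G volume a c := by
    intro a c
    rcases le_total a c with h | h
    · exact ii_of mG h fun x _ => bG x
    · exact (ii_of mG h fun x _ => bG x).symm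
  have eG : ∀ x ∈ Set.Icc (0:ℝ) 1, ∫ y in (0:ℝ)..x, G y = ∫ y in (0:ℝ)..x, g y := by
    intro x hx
    refine intervalIntegral.integral_congr fun y hy => ?_
    rw [Set.uIcc_of_le hx.1] at hy
    exact Set.indicator_of_mem (show y ∈ Set.Icc (0:ℝ) 1 from ⟨hy.1, hy.2.trans hx.2⟩) _
  obtain ⟨C, hC⟩ := isCompact_Icc.exists_bound_of_continuousOn (s := Set.Icc (0:ℝ) 1) cζ'.continuousOn
  have hl : ∀ x ∈ Set.Icc (0:ℝ) 1, ∀ y ∈ Set.Icc (0:ℝ) 1, |ζ x - ζ y| ≤ C * |x - y| := fun x hx y hy =>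
    (convex_Icc (0:ℝ) 1).norm_image_sub_le_of_norm_hasDerivWithin_le (fun x _ => (hζ x).hasDerivWithinAt) hC hy hx
  have k := prod_int (p := fun x => ∫ y in (0:ℝ)..x, G y) mG bG
    (fun x y => intervalIntegral.integral_interval_sub_left (iG _ _) (iG _ _)) (fun x _ => hζ x) hl (x := 1) (by simp)
  have cp : Continuous fun x => ∫ y in (0:ℝ)..x, G y := intervalIntegral.continuous_primitive iG 0
  have cζ : Continuous ζ := continuous_iff_continuousAt.2 fun x => (hζ x).continuousAt
  have i1 : IntervalIntegrable (fun x => G x * ζ x) volume 0 1 := (iG 0 1).mul_continuousOn cζ.continuousOn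
  have i2 : IntervalIntegrable (fun x => (∫ y in (0:ℝ)..x, G y) * ζ' x) volume 0 1 := (cp.mul cζ').intervalIntegrable _ _
  rw [intervalIntegral.integral_add i1 i2] at k
  rw [intervalIntegral.integral_same, zero_mul, sub_zero, eG 1 (by simp)] at k
  have e1 : ∫ x in (0:ℝ)..1, g x * ζ x = ∫ x in (0:ℝ)..1, G x * ζ x := by
    refine intervalIntegral.integral_congr fun y hy => ?_
    rw [Set.uIcc_of_le zero_le_one] at hy
    simp only [hG]
    rw [Set.indicator_of_mem hy]
  have e2 : ∫ x in (0:ℝ)..1, (∫ y in (0:ℝ)..x, g y) * ζ' x = ∫ x in (0:ℝ)..1, (∫ y in (0:ℝ)..x, G y) * ζ' x := by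
    refine intervalIntegral.integral_congr fun y hy => ?_
    rw [Set.uIcc_of_le zero_le_one] at hy
    rw [eG y hy]
  rw [e1, e2]
  linarith

theorem weak_form {us w φ P Q G b c f : ℝ × ℝ → ℝ} {S σ E d : ℝ → ℝ} {T K Cb s : ℝ}
    (cus : Continuous us) (cw : Continuous w) (cφ : Continuous φ) (cP : Continuous P) (cQ : Continuous Q) (mG : Measurable G)
    (cb : Continuous b) (cc : Continuous c) (cf : Continuous f) (cS : Continuous S) (cE : Continuous E) (cd : Continuous d)
    (hE : ∀ t, HasDerivAt E (d t * E t) t) (hS0 : S 0 = 0) (hw1 : ∀ t ∈ Set.Icc 0 T, w (1, t) = 0)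
    (hI : ∀ x ∈ Set.Icc (0:ℝ) 1, ∀ t ∈ Set.Icc 0 T, ∫ y in (0:ℝ)..x, (us (y, t) - us (y, 0)) =
      ∫ τ in (0:ℝ)..t, (S (w (x, τ)) + ∫ y in (0:ℝ)..x, (b (y, τ) * w (y, τ) + c (y, τ) * us (y, τ) + f (y, τ))))
    (hφx : ∀ x t, HasDerivAt (fun y => φ (y, t)) (P (x, t)) x) (hφt : ∀ x t, HasDerivAt (fun τ => φ (x, τ)) (Q (x, t)) t)
    (hG : ∀ p, |G p| ≤ K) (z0 : ∀ t, φ (0, t) = 0 ∧ P (0, t) = 0) (z1 : ∀ t, P (1, t) = 0 ∧ Q (1, t) = 0) (zt : ∀ x, φ (x, 0) = 0)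
    (hintg : ∀ᵐ t : ℝ, ∀ x y, P (y, t) - P (x, t) = ∫ z in x..y, G (z, t))
    (hb : ∀ x ∈ Set.Ioo (0:ℝ) 1, ∀ t ∈ Set.Icc 0 T, HasDerivAt (fun y => b (y, t)) (c (x, t) - d t) x)
    (hbl : ∀ x ∈ Set.Icc (0:ℝ) 1, ∀ y ∈ Set.Icc (0:ℝ) 1, ∀ t ∈ Set.Icc 0 T, |b (x, t) - b (y, t)| ≤ Cb * |x - y|)
    (hσ : ∀ᵐ p : ℝ × ℝ, p.1 ∈ Set.Ioo (0:ℝ) 1 → p.2 ∈ Set.Ioo 0 T → σ (w p + E p.2 * G p) = S (w p) + E p.2 * (Q p - b p * P p))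
    {ζ : ℝ × ℝ → ℝ} (hζ : Smooth ζ) (hs : s ∈ Set.Icc 0 T) :
    ∫ t in (0:ℝ)..s, ∫ x in (0:ℝ)..1, ((us (x, t) + E t * P (x, t)) * pt ζ (x, t) - σ (w (x, t) + E t * G (x, t)) * px ζ (x, t)
      + (b (x, t) * (w (x, t) + E t * G (x, t)) + c (x, t) * (us (x, t) + E t * P (x, t)) + f (x, t)) * ζ (x, t)) =
    ∫ x in (0:ℝ)..1, ((us (x, s) + E s * P (x, s)) * ζ (x, s) - us (x, 0) * ζ (x, 0)) := by
  have cζ := hζ.continuous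
  have cζx := hζ.px.continuous
  have cζt := hζ.pt.continuous
  have cE2 : Continuous fun p : ℝ × ℝ => E p.2 := cE.comp continuous_snd
  have cd2 : Continuous fun p : ℝ × ℝ => d p.2 := cd.comp continuous_snd
  have cu0 : Continuous fun p : ℝ × ℝ => us (p.1, 0) := cus.comp (continuous_fst.prodMk continuous_const)
  set u : ℝ × ℝ → ℝ := fun p => us p + E p.2 * P p with hu
  have cu : Continuous u := cus.add (cE2.mul cP)
  set gs : ℝ × ℝ → ℝ := fun p => b p * w p + c p * us p + f p with hgs
  have cgs : Continuous gs := ((cb.mul cw).add (cc.mul cus)).add cf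
  set κ : ℝ × ℝ → ℝ := fun p => S (w p) + E p.2 * (Q p - b p * P p) with hκ
  have cκ : Continuous κ := (cS.comp cw).add (cE2.mul (cQ.sub (cb.mul cP)))
  set v : ℝ × ℝ → ℝ := fun p => u p - us (p.1, 0) with hv
  have cv : Continuous v := cu.sub cu0
  set m : ℝ × ℝ → ℝ := fun p => d p.2 * E p.2 * φ p + E p.2 * Q p with hm
  have cm : Continuous m := ((cd2.mul cE2).mul cφ).add (cE2.mul cQ)
  set k0 : ℝ × ℝ → ℝ := fun p => S (w p) + ∫ y in (0:ℝ)..p.1, gs (y, p.2) with hk0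
  have ck0 : Continuous k0 := (cS.comp cw).add (cpi cgs)
  set k : ℝ × ℝ → ℝ := fun p => k0 p + m p with hk
  have ck : Continuous k := ck0.add cm
  have hV : ∀ x ∈ Set.Icc (0:ℝ) 1, ∀ t ∈ Set.Icc (0:ℝ) T, ∫ y in (0:ℝ)..x, v (y, t) = ∫ τ in (0:ℝ)..t, k (x, τ) := by
    intro x hx t ht
    have e1 : ∫ y in (0:ℝ)..x, v (y, t) = (∫ y in (0:ℝ)..x, (us (y, t) - us (y, 0))) + ∫ y in (0:ℝ)..x, E t * P (y, t) := by
      have i1 : IntervalIntegrable (fun y => us (y, t) - us (y, 0)) volume 0 x := (cx (cus.sub cu0) t).intervalIntegrable 0 x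
      have i2 : IntervalIntegrable (fun y => E t * P (y, t)) volume 0 x := (cx (cE2.mul cP) t).intervalIntegrable 0 x
      rw [← intervalIntegral.integral_add i1 i2]
      refine intervalIntegral.integral_congr fun y _ => ?_
      simp only [hv, hu]; ring
    have e2 : ∫ y in (0:ℝ)..x, E t * P (y, t) = E t * φ (x, t) := by
      rw [intervalIntegral.integral_const_mul, intervalIntegral.integral_eq_sub_of_hasDerivAt (f := fun y => φ (y, t)) (fun y _ => hφx y t)
        ((cx cP t).intervalIntegrable _ _)]
      rw [(z0 t).1, sub_zero]
    have e3 : ∫ τ in (0:ℝ)..t, m (x, τ) = E t * φ (x, t) := by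
      rw [intervalIntegral.integral_eq_sub_of_hasDerivAt (f := fun τ => E τ * φ (x, τ)) (fun τ _ => (hE τ).mul (hφt x τ))
        ((ct cm x).intervalIntegrable _ _)]
      rw [zt, mul_zero, sub_zero]
    rw [e1, e2, hI x hx t ht]
    simp only [hk]
    rw [intervalIntegral.integral_add ((ct ck0 x).intervalIntegrable _ _) ((ct cm x).intervalIntegrable _ _), e3]
  have key := pot cv ck hζ hV hs
  -- pointwise in time
  have hslice : ∀ᵐ t : ℝ, t ∈ Set.Ioc 0 s → ∫ x in (0:ℝ)..1, (u (x, t) * pt ζ (x, t) - σ (w (x, t) + E t * G (x, t)) * px ζ (x, t)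
      + (b (x, t) * (w (x, t) + E t * G (x, t)) + c (x, t) * u (x, t) + f (x, t)) * ζ (x, t)) =
      ((k (1, t) * ζ (1, t) - ∫ x in (0:ℝ)..1, k (x, t) * px ζ (x, t)) + ∫ x in (0:ℝ)..1, v (x, t) * pt ζ (x, t))
        + ∫ x in (0:ℝ)..1, us (x, 0) * pt ζ (x, t) := by
    have hT : ∀ᵐ t : ℝ, t ≠ s := by rw [ae_iff]; simp
    filter_upwards [hintg, ae_swap hσ, hT] with t h1 h2 h3 ht
    have htT : t ∈ Set.Icc 0 T := ⟨ht.1.le, ht.2.trans hs.2⟩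
    have htO : t ∈ Set.Ioo 0 T := ⟨ht.1, (lt_of_le_of_ne ht.2 h3).trans_le hs.2⟩
    have mGt : Measurable (fun z => G (z, t)) := mG.comp (measurable_id.prodMk measurable_const)
    set g : ℝ → ℝ := fun x => b (x, t) * (w (x, t) + E t * G (x, t)) + c (x, t) * u (x, t) + f (x, t) with hg
    have mg : Measurable g := (((cx cb t).measurable.mul ((cx cw t).measurable.add (mGt.const_mul _))).add
      ((cx cc t).measurable.mul (cx cu t).measurable)).add (cx cf t).measurable
    obtain ⟨C1, hC1⟩ := isCompact_Icc.exists_bound_of_continuousOn (s := Set.Icc (0:ℝ) 1)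
      (cx ((cgs.add (cE2.mul (cc.mul cP)))) t).continuousOn
    obtain ⟨C2, hC2⟩ := isCompact_Icc.exists_bound_of_continuousOn (s := Set.Icc (0:ℝ) 1) (cx (cb.mul cE2) t).continuousOn
    have ge : ∀ x, g x = (gs (x, t) + E t * (c (x, t) * P (x, t))) + (b (x, t) * E t) * G (x, t) := fun x => by
      simp only [hg, hgs, hu]; ring
    have K0 : 0 ≤ K := (abs_nonneg _).trans (hG (0,0))
    have bg : ∀ x ∈ Set.Icc (0:ℝ) 1, |g x| ≤ C1 + C2 * K := by
      intro x hx
      rw [ge]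
      refine (abs_add_le _ _).trans (add_le_add (hC1 x hx) ?_)
      rw [abs_mul]
      have := (norm_nonneg _).trans (hC2 x hx)
      exact mul_le_mul (hC2 x hx) (hG _) (abs_nonneg _) this
    have iGb : ∀ x ∈ Set.Icc (0:ℝ) 1, IntervalIntegrable (fun z => G (z, t) * b (z, t)) volume 0 x := fun x hx =>
      (ii_of mGt hx.1 fun z _ => hG (z, t)).mul_continuousOn (cx cb t).continuousOn
    -- the lower order part
    have hJ : ∀ x ∈ Set.Icc (0:ℝ) 1, k (x, t) = κ (x, t) + ∫ y in (0:ℝ)..x, g y := by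
      intro x hx
      have k1 := prod_int (p := fun x => P (x, t)) (q := fun x => b (x, t)) (q' := fun x => c (x, t) - d t) mGt (fun z => hG (z, t)) h1
        (fun x hx => hb x hx t htT) (fun x hx y hy => hbl x hx y hy t htT) hx
      simp only [(z0 t).2, zero_mul, sub_zero] at k1
      have k2 : ∫ y in (0:ℝ)..x, P (y, t) = φ (x, t) := by
        rw [intervalIntegral.integral_eq_sub_of_hasDerivAt (f := fun y => φ (y, t)) (fun y _ => hφx y t)
          ((cx cP t).intervalIntegrable _ _), (z0 t).1, sub_zero]
      have iA : IntervalIntegrable (fun z => G (z, t) * b (z, t) + P (z, t) * (c (z, t) - d t)) volume 0 x :=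
        (iGb x hx).add ((cx (cP.mul (cc.sub cd2)) t).intervalIntegrable 0 x)
      have k3 : ∫ y in (0:ℝ)..x, g y = (∫ y in (0:ℝ)..x, gs (y, t)) + (E t * (P (x, t) * b (x, t)) + E t * d t * φ (x, t)) := by
        rw [← k1, ← k2, ← intervalIntegral.integral_const_mul, ← intervalIntegral.integral_const_mul,
          ← intervalIntegral.integral_add (iA.const_mul _) (((cx cP t).intervalIntegrable _ _).const_mul _),
          ← intervalIntegral.integral_add ((cx cgs t).intervalIntegrable _ _) ((iA.const_mul _).add (((cx cP t).intervalIntegrable _ _).const_mul _))]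
        refine intervalIntegral.integral_congr fun y _ => ?_
        simp only [ge]; ring
      rw [k3]
      simp only [hk, hk0, hm, hκ]
      ring
    have k1 := ibp (ζ := fun x => ζ (x, t)) mg bg (fun x => hd_px hζ x t) (cx cζx t)
    have κ1 : κ (1, t) = 0 := by simp only [hκ, hw1 t htT, hS0, (z1 t).1, (z1 t).2]; ring
    have e1 : ∫ x in (0:ℝ)..1, k (x, t) * px ζ (x, t) = (∫ x in (0:ℝ)..1, κ (x, t) * px ζ (x, t)) + ∫ x in (0:ℝ)..1, (∫ y in (0:ℝ)..x, g y) * px ζ (x, t) := by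
      have cJ : ContinuousOn (fun x => ∫ y in (0:ℝ)..x, g y) (Set.uIcc 0 1) := by
        rw [Set.uIcc_of_le zero_le_one]
        have : ContinuousOn (fun x => k (x, t) - κ (x, t)) (Set.Icc 0 1) := (cx (ck.sub cκ) t).continuousOn
        refine this.congr fun x hx => ?_
        simp only
        rw [hJ x hx]; ring
      have i2 : IntervalIntegrable (fun x => (∫ y in (0:ℝ)..x, g y) * px ζ (x, t)) volume 0 1 :=
        (cJ.mul (cx cζx t).continuousOn).intervalIntegrable
      rw [← intervalIntegral.integral_add (ixm cκ cζx t 0 1) i2]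
      refine intervalIntegral.integral_congr fun x hx => ?_
      rw [Set.uIcc_of_le zero_le_one] at hx
      rw [hJ x hx]; ring
    have e2 : ∫ x in (0:ℝ)..1, v (x, t) * pt ζ (x, t) = (∫ x in (0:ℝ)..1, u (x, t) * pt ζ (x, t)) - ∫ x in (0:ℝ)..1, us (x, 0) * pt ζ (x, t) := by
      rw [← intervalIntegral.integral_sub (ixm cu cζt t 0 1) (ixm cu0 cζt t 0 1)]
      refine intervalIntegral.integral_congr fun x hx => ?_
      simp only [hv]; ring
    have ig : IntervalIntegrable (fun x => g x * ζ (x, t)) volume 0 1 := (ii_of mg zero_le_one bg).mul_continuousOn (cx cζ t).continuousOn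
    have e3 : ∫ x in (0:ℝ)..1, (u (x, t) * pt ζ (x, t) - σ (w (x, t) + E t * G (x, t)) * px ζ (x, t) + g x * ζ (x, t)) =
        (∫ x in (0:ℝ)..1, u (x, t) * pt ζ (x, t)) - (∫ x in (0:ℝ)..1, κ (x, t) * px ζ (x, t)) + ∫ x in (0:ℝ)..1, g x * ζ (x, t) := by
      rw [← intervalIntegral.integral_sub (ixm cu cζt t 0 1) (ixm cκ cζx t 0 1),
        ← intervalIntegral.integral_add ((ixm cu cζt t 0 1).sub (ixm cκ cζx t 0 1)) ig]
      refine intervalIntegral.integral_congr_ae ?_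
      have hx1 : ∀ᵐ x : ℝ, x ≠ 1 := by rw [ae_iff]; simp
      filter_upwards [h2, hx1] with x k1 k2 k3
      rw [Set.uIoc_of_le zero_le_one] at k3
      have := k1 ⟨k3.1, lt_of_le_of_ne k3.2 k2⟩ htO
      rw [this]
    have e4 := hJ 1 (by simp)
    rw [κ1, zero_add] at e4
    rw [e1, e2, e3, k1, e4]
    ring
  have e5 : ∫ t in (0:ℝ)..s, ∫ x in (0:ℝ)..1, us (x, 0) * pt ζ (x, t) = ∫ x in (0:ℝ)..1, (us (x, 0) * ζ (x, s) - us (x, 0) * ζ (x, 0)) := by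
    rw [← swap_int (f := fun p => us (p.1, 0) * pt ζ p) (cu0.mul cζt) hs.1]
    refine intervalIntegral.integral_congr fun x _ => ?_
    simp only
    rw [intervalIntegral.integral_const_mul, intervalIntegral.integral_eq_sub_of_hasDerivAt (f := fun τ => ζ (x, τ)) (fun τ _ => hd_pt hζ x τ)
      ((ct cζt x).intervalIntegrable _ _)]
    ring
  have cL : Continuous fun t => (k (1, t) * ζ (1, t) - ∫ x in (0:ℝ)..1, k (x, t) * px ζ (x, t)) + ∫ x in (0:ℝ)..1, v (x, t) * pt ζ (x, t) :=
    ((ct (ck.mul cζ) 1).sub (ct (cpi (ck.mul cζx)) 1)).add (ct (cpi (cv.mul cζt)) 1)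
  have cR : Continuous fun t => ∫ x in (0:ℝ)..1, us (x, 0) * pt ζ (x, t) := ct (cpi (cu0.mul cζt)) 1
  have e6 : ∫ t in (0:ℝ)..s, ∫ x in (0:ℝ)..1, (u (x, t) * pt ζ (x, t) - σ (w (x, t) + E t * G (x, t)) * px ζ (x, t)
      + (b (x, t) * (w (x, t) + E t * G (x, t)) + c (x, t) * u (x, t) + f (x, t)) * ζ (x, t)) =
      ∫ t in (0:ℝ)..s, (((k (1, t) * ζ (1, t) - ∫ x in (0:ℝ)..1, k (x, t) * px ζ (x, t)) + ∫ x in (0:ℝ)..1, v (x, t) * pt ζ (x, t))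
        + ∫ x in (0:ℝ)..1, us (x, 0) * pt ζ (x, t)) := by
    refine intervalIntegral.integral_congr_ae ?_
    rw [Set.uIoc_of_le hs.1]
    exact hslice
  refine e6.trans ?_
  have i7 : IntervalIntegrable (fun x => us (x, 0) * ζ (x, s) - us (x, 0) * ζ (x, 0)) volume 0 1 :=
    (((cx cu0 s).mul (cx cζ s)).sub ((cx cu0 s).mul (cx cζ 0))).intervalIntegrable 0 1
  rw [intervalIntegral.integral_add (cL.intervalIntegrable _ _) (cR.intervalIntegrable _ _), ← key, e5,
    ← intervalIntegral.integral_add (ixm cv cζ s 0 1) i7]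
  refine intervalIntegral.integral_congr fun x _ => ?_
  simp only [hv, hu]
  ring

end M7b
end FB

namespace FB
section M7c
open Filter Topology MeasureTheory

/-- monotone extension of the left branch -/
noncomputable def hl (σ : ℝ → ℝ) (s1 s : ℝ) : ℝ := σ (min s s1) + max (s - s1) 0

lemma hl_le (σ : ℝ → ℝ) {s1 s : ℝ} (h : s ≤ s1) : hl σ s1 s = σ s := by
  unfold hl
  rw [min_eq_left h, max_eq_right (by linarith), add_zero]

lemma hl_mono {α s1 a lam Lam C : ℝ} {σ σ' : ℝ → ℝ} (H : LeftHyp α s1 a lam Lam C σ σ') : StrictMono (hl σ s1) := by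
  intro s t hst
  unfold hl
  have m := H.mono
  rcases lt_or_ge s s1 with h | h
  · have k1 : σ (min s s1) < σ (min t s1) := by
      refine m (show min s s1 ≤ s1 from min_le_right _ _) (show min t s1 ≤ s1 from min_le_right _ _) ?_
      rw [min_eq_left h.le]
      exact lt_min hst h
    have k2 : max (s - s1) 0 ≤ max (t - s1) 0 := max_le_max (by linarith) le_rfl
    linarith
  · rw [min_eq_right h, min_eq_right (h.trans hst.le), max_eq_left (by linarith), max_eq_left (by linarith)]
    linarith

lemma hl_lip {α s1 a lam Lam C : ℝ} {σ σ' : ℝ → ℝ} (H : LeftHyp α s1 a lam Lam C σ σ') :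
    ∃ L, 0 < L ∧ ∀ s t, |hl σ s1 s - hl σ s1 t| ≤ L * |s - t| := by
  obtain ⟨G, G0, hG⟩ := H.lip
  refine ⟨G + 1, by linarith, fun s t => ?_⟩
  unfold hl
  have k1 := hG (min s s1) (min_le_right _ _) (min t s1) (min_le_right _ _)
  have k2 : |min s s1 - min t s1| ≤ |s - t| := by
    have := abs_min_sub_min_le_max s s1 t s1
    simpa using this
  have k3 : |max (s - s1) 0 - max (t - s1) 0| ≤ |s - t| := by
    have := abs_max_sub_max_le_max (s - s1) 0 (t - s1) 0
    simpa using this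
  have k4 := mul_le_mul_of_nonneg_left k2 G0
  calc _ = |(σ (min s s1) - σ (min t s1)) + (max (s - s1) 0 - max (t - s1) 0)| := by congr 1; ring
    _ ≤ _ := abs_add_le _ _
    _ ≤ _ := by linarith

/-- the two monotone branches -/
theorem branches {α s1 s2 lam Lam : ℝ} {σ σ' : ℝ → ℝ} (hf : FluxHyp α s1 s2 lam Lam σ σ') :
    ∃ (h1 h2 : ℝ → ℝ) (L : ℝ), 0 < L ∧ StrictMono h1 ∧ StrictMono h2 ∧ (∀ s ≤ s1, h1 s = σ s) ∧ (∀ s ≥ s2, h2 s = σ s) ∧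
      (∀ s t, |h1 s - h1 t| ≤ L * |s - t|) ∧ (∀ s t, |h2 s - h2 t| ≤ L * |s - t|) := by
  obtain ⟨C1, H1⟩ := leftHyp_of hf
  obtain ⟨C2, H2⟩ := rightHyp_of hf
  obtain ⟨L1, L10, hL1⟩ := hl_lip H1
  obtain ⟨L2, L20, hL2⟩ := hl_lip H2
  refine ⟨hl σ s1, fun s => - hl (fun s => -σ (-s)) (-s2) (-s), L1 + L2, by positivity, hl_mono H1, ?_, fun s hs => hl_le σ hs, ?_, ?_, ?_⟩
  · intro s t hst
    exact neg_lt_neg (hl_mono H2 (neg_lt_neg hst))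
  · intro s hs
    simp only
    rw [hl_le _ (by linarith)]
    simp
  · intro s t
    exact (hL1 s t).trans (mul_le_mul_of_nonneg_right (by linarith) (abs_nonneg _))
  · intro s t
    have := hL2 (-t) (-s)
    rw [show -t - -s = s - t by ring] at this
    simp only
    rw [show ∀ a b : ℝ, -a - -b = b - a from fun a b => by ring]
    exact this.trans (mul_le_mul_of_nonneg_right (by linarith) (abs_nonneg _))

lemma cl_lip (a x y : ℝ) : |cl a x - cl a y| ≤ |x - y| := by
  unfold cl
  have k1 := abs_max_sub_max_le_max 0 (min a x) 0 (min a y)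
  have k2 := abs_min_sub_min_le_max a x a y
  simp only [sub_self, abs_zero, abs_nonneg, max_eq_right] at k1 k2
  exact k1.trans k2

lemma coef1 {α T : ℝ} {g : ℝ → ℝ → ℝ} (hT : 0 < T) (hα : 0 < α) (hg : ContinuousOn (fun p : ℝ × ℝ => g p.1 p.2) (ClOmegaT T)) (hh : ParabolicHolder α T g) :
    ∃ Q, 0 ≤ Q ∧ (∀ x t, |g (cl 1 x) (cl T t)| ≤ Q) ∧ (∀ x y t, |g (cl 1 x) (cl T t) - g (cl 1 y) (cl T t)| ≤ Q * |x - y| ^ α) ∧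
      Continuous (fun p : ℝ × ℝ => g (cl 1 p.1) (cl T p.2)) := by
  obtain ⟨C, hC⟩ := hh
  have cpt : IsCompact (ClOmegaT T) := isCompact_Icc.prod isCompact_Icc
  obtain ⟨M, hM⟩ := cpt.exists_bound_of_continuousOn hg
  have k : ∀ x t, |g (cl 1 x) (cl T t)| ≤ M := fun x t => hM (cl 1 x, cl T t) ⟨cl_mem zero_le_one x, cl_mem hT.le t⟩
  have M0 : 0 ≤ M := (abs_nonneg _).trans (k 0 0)
  refine ⟨M + |C|, by positivity, fun x t => (k x t).trans (by linarith [abs_nonneg C]), fun x y t => ?_, cl_cont2 hT.le hg⟩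
  have := hC (cl 1 x) (cl_mem zero_le_one x) (cl 1 y) (cl_mem zero_le_one y) (cl T t) (cl_mem hT.le t) (cl T t) (cl_mem hT.le t)
  rw [sub_self, abs_zero, Real.zero_rpow (by positivity), add_zero] at this
  refine this.trans ?_
  have k1 : |cl 1 x - cl 1 y| ^ α ≤ |x - y| ^ α := Real.rpow_le_rpow (abs_nonneg _) (cl_lip _ _ _) hα.le
  have k2 : 0 ≤ |cl 1 x - cl 1 y| ^ α := by positivity
  have k3 : 0 ≤ |x - y| ^ α := by positivity
  calc C * |cl 1 x - cl 1 y| ^ α ≤ |C| * |cl 1 x - cl 1 y| ^ α := mul_le_mul_of_nonneg_right (le_abs_self _) k2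
    _ ≤ |C| * |x - y| ^ α := mul_le_mul_of_nonneg_left k1 (abs_nonneg _)
    _ ≤ _ := mul_le_mul_of_nonneg_right (by linarith) k3

lemma coef_of {α T : ℝ} {b bx c f : ℝ → ℝ → ℝ} {d : ℝ → ℝ} (hT : 0 < T) (hα : 0 < α) (h : CoeffHyp α T b bx c f d) :
    ∃ Q, Coef α Q (fun x t => b (cl 1 x) (cl T t)) (fun x t => c (cl 1 x) (cl T t)) (fun x t => f (cl 1 x) (cl T t)) := by
  obtain ⟨Q1, q1, a1, b1, c1⟩ := coef1 hT hα h.b_cont h.b_holder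
  obtain ⟨Q2, q2, a2, b2, c2⟩ := coef1 hT hα h.c_cont h.c_holder
  obtain ⟨Q3, q3, a3, b3, c3⟩ := coef1 hT hα h.f_cont h.f_holder
  refine ⟨Q1 + Q2 + Q3, by positivity, fun x t => (a1 x t).trans (by linarith), fun x t => (a2 x t).trans (by linarith),
    fun x t => (a3 x t).trans (by linarith), fun x y t => (b1 x y t).trans (mul_le_mul_of_nonneg_right (by linarith) (by positivity)),
    fun x y t => (b2 x y t).trans (mul_le_mul_of_nonneg_right (by linarith) (by positivity)),
    fun x y t => (b3 x y t).trans (mul_le_mul_of_nonneg_right (by linarith) (by positivity)), c1, c2, c3⟩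

lemma b_props {α T : ℝ} {b bx c f : ℝ → ℝ → ℝ} {d : ℝ → ℝ} (h : CoeffHyp α T b bx c f d) :
    (∀ x ∈ Set.Ioo (0:ℝ) 1, ∀ t ∈ Set.Icc 0 T, HasDerivAt (fun y => b (cl 1 y) (cl T t)) (c (cl 1 x) (cl T t) - d (cl T t)) x) ∧
    ∃ Cb, ∀ x ∈ Set.Icc (0:ℝ) 1, ∀ y ∈ Set.Icc (0:ℝ) 1, ∀ t ∈ Set.Icc 0 T, |b (cl 1 x) (cl T t) - b (cl 1 y) (cl T t)| ≤ Cb * |x - y| := by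
  constructor
  · intro x hx t ht
    have hx' : x ∈ Set.Icc (0:ℝ) 1 := Set.Ioo_subset_Icc_self hx
    rw [cl_eq hx', cl_eq ht]
    have e := h.c_eq (x, t) ⟨hx', ht⟩
    simp only at e
    rw [e, add_sub_cancel_right]
    have k := (h.b_deriv (x, t) ⟨hx', ht⟩).hasDerivAt (Icc_mem_nhds hx.1 hx.2)
    refine k.congr_of_eventuallyEq ?_
    filter_upwards [Icc_mem_nhds hx.1 hx.2] with y hy
    rw [cl_eq hy]
  · have cpt : IsCompact (ClOmegaT T) := isCompact_Icc.prod isCompact_Icc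
    obtain ⟨M, hM⟩ := cpt.exists_bound_of_continuousOn h.bx_cont
    refine ⟨M, fun x hx y hy t ht => ?_⟩
    rw [cl_eq hx, cl_eq hy, cl_eq ht]
    exact (convex_Icc (0:ℝ) 1).norm_image_sub_le_of_norm_hasDerivWithin_le (f := fun y => b y t) (fun z hz => h.b_deriv (z, t) ⟨hz, ht⟩)
      (fun z hz => hM (z, t) ⟨hz, ht⟩) hy hx

lemma ini_of {α : ℝ} {u0 u0' u0'' : ℝ → ℝ} (hα : 0 < α) (h : InitHyp α u0 u0' u0'') : ∃ L, Ini L u0 u0' := by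
  obtain ⟨M0, h0⟩ := isCompact_Icc.exists_bound_of_continuousOn (s := Set.Icc (0:ℝ) 1) (f := u0) fun x hx => (h.deriv1 x hx).continuousWithinAt
  obtain ⟨M1, h1⟩ := isCompact_Icc.exists_bound_of_continuousOn (s := Set.Icc (0:ℝ) 1) (f := u0') fun x hx => (h.deriv2 x hx).continuousWithinAt
  obtain ⟨C, hC⟩ := h.holder
  have z : (0:ℝ) ∈ Set.Icc (0:ℝ) 1 := by simp
  have m0 : 0 ≤ M0 := (norm_nonneg _).trans (h0 0 z)
  have m1 : 0 ≤ M1 := (norm_nonneg _).trans (h1 0 z)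
  have h2 : ∀ x ∈ Set.Icc (0:ℝ) 1, |u0'' x| ≤ |u0'' 0| + |C| := by
    intro x hx
    have k := hC x hx 0 z
    have k1 : |x - 0| ^ α ≤ 1 := Real.rpow_le_one (abs_nonneg _) (by rw [sub_zero, abs_of_nonneg hx.1]; exact hx.2) hα.le
    have k2 : 0 ≤ |x - 0| ^ α := by positivity
    have k3 : C * |x - 0| ^ α ≤ |C| := (mul_le_mul_of_nonneg_right (le_abs_self _) k2).trans (by nlinarith [abs_nonneg C])
    have := abs_sub_abs_le_abs_sub (u0'' x) (u0'' 0)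
    linarith
  set M2 := |u0'' 0| + |C|
  have m2 : 0 ≤ M2 := (abs_nonneg _).trans (h2 0 z)
  refine ⟨M0 + M1 + M2, by positivity, h.deriv1, fun x hx => (h0 x hx).trans (by linarith), fun x hx => (h1 x hx).trans (by linarith), ?_, h.compat0, h.compat1⟩
  intro x hx y hy
  have := (convex_Icc (0:ℝ) 1).norm_image_sub_le_of_norm_hasDerivWithin_le h.deriv2 h2 hy hx
  exact this.trans (mul_le_mul_of_nonneg_right (by linarith) (abs_nonneg _))

lemma exp_fac {T : ℝ} {d : ℝ → ℝ} (hT : 0 < T) (hd : ContinuousOn d (Set.Icc 0 T)) : Continuous (fun t => d (cl T t)) ∧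
    ∃ E : ℝ → ℝ, Continuous E ∧ (∀ t, 0 < E t) ∧ (∀ t, HasDerivAt E (d (cl T t) * E t) t) := by
  have cd : Continuous (fun t => d (cl T t)) := hd.comp_continuous (cl_cont T) (fun t => cl_mem hT.le t)
  have hE : ∀ t, HasDerivAt (fun t => Real.exp (∫ τ in (0:ℝ)..t, d (cl T τ))) (d (cl T t) * Real.exp (∫ τ in (0:ℝ)..t, d (cl T τ))) t := by
    intro t
    have k : HasDerivAt (fun t => ∫ τ in (0:ℝ)..t, d (cl T τ)) (d (cl T t)) t :=
      intervalIntegral.integral_hasDerivAt_right (cd.intervalIntegrable _ _) (cd.stronglyMeasurableAtFilter _ _) cd.continuousAt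
    have := k.exp
    rwa [mul_comm] at this
  exact ⟨cd, _, continuous_iff_continuousAt.2 fun t => (hE t).continuousAt, fun t => Real.exp_pos _, hE⟩

end M7c
end FB

namespace FB
section M7d
open Filter Topology MeasureTheory

theorem fluxdata {α s1 s2 lam Lam s1star s2star z : ℝ} {σ σ' : ℝ → ℝ} (hf : FluxHyp α s1 s2 lam Lam σ σ')
    (hs0 : 0 ≤ s1star) (hs1star' : s1star < s1) (hs1star_eq : σ s1star = σ s2)
    (hs2star : s2 < s2star) (hs2star_eq : σ s2star = σ s1) (hz1 : s1star < z) (hz2 : z < s2star) :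
    ∃ (h1 h2 S S' : ℝ → ℝ) (r1 r2 L lam0 Lam0 Hs ε0 : ℝ), 0 < L ∧ StrictMono h1 ∧ StrictMono h2 ∧
      (∀ s t, |h1 s - h1 t| ≤ L * |s - t|) ∧ (∀ s t, |h2 s - h2 t| ≤ L * |s - t|) ∧ Flux lam0 Lam0 Hs α S S' ∧ 0 < ε0 ∧
      r1 < z ∧ z < r2 ∧ S 0 = 0 ∧
      (∀ s, r1 < s → s < r2 → h2 s < S s ∧ S s < h1 s ∧ h1 s1star + ε0 ≤ S s ∧ S s ≤ h2 s2star - ε0) ∧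
      (∀ s ≤ r1, S s = σ s ∧ s < s1) ∧ (∀ s ≥ r2, S s = σ s ∧ s2 < s) ∧
      (∀ γ B, h1 s1star < B → B < h2 s2star → h1 γ = B → s1star < γ ∧ γ < s1 ∧ σ γ = B) ∧
      (∀ γ B, h1 s1star < B → B < h2 s2star → h2 γ = B → s2 < γ ∧ γ < s2star ∧ σ γ = B) := by
  obtain ⟨h1, h2, L, L0, m1, m2, e1, e2, l1, l2⟩ := branches hf
  obtain ⟨r1, r2, S, S', lam0, Lam0, Hs, a1, a2, a3, a4, a5, a6, F, b1, b2, b3, b4⟩ :=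
    sigma_tilde hf hs1star' hs1star_eq hs2star hs2star_eq hz1 hz2
  have mS : StrictMono S := by
    refine strictMono_of_deriv_pos fun s => ?_
    rw [(F.deriv s).deriv]
    exact F.lam_pos.trans_le (F.lb s)
  have q1 : h1 s1star = σ s2 := by rw [e1 _ hs1star'.le, hs1star_eq]
  have q2 : h2 s2star = σ s1 := by rw [e2 _ hs2star.le, hs2star_eq]
  have q3 : h1 s1star < S r1 := by rw [b1 r1 le_rfl, ← e1 r1 a2.le]; exact m1 a1
  have q4 : S r2 < h2 s2star := by rw [b2 r2 le_rfl, ← e2 r2 a3.le]; exact m2 a4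
  have q5 : h1 s1 = σ s1 := e1 _ le_rfl
  have q6 : h2 s2 = σ s2 := e2 _ le_rfl
  refine ⟨h1, h2, S, S', r1, r2, L, lam0, Lam0, Hs, min (S r1 - h1 s1star) (h2 s2star - S r2), L0, m1, m2, l1, l2, F,
    lt_min (by linarith) (by linarith), a5, a6, ?_, ?_, ?_, ?_, ?_, ?_⟩
  · rw [b1 0 (by linarith), hf.sigma_zero]
  · intro s k1 k2
    have k3 := mS k1
    have k4 := mS k2
    refine ⟨?_, ?_, ?_, ?_⟩
    · rcases le_or_gt s2 s with h | h
      · rw [e2 s h]; exact b4 s h k2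
      · have := m2 h
        linarith
    · rcases le_or_gt s s1 with h | h
      · rw [e1 s h]; exact b3 s k1 h
      · have := m1 h
        linarith
    · have := min_le_left (S r1 - h1 s1star) (h2 s2star - S r2)
      linarith
    · have := min_le_right (S r1 - h1 s1star) (h2 s2star - S r2)
      linarith
  · exact fun s hs => ⟨b1 s hs, hs.trans_lt a2⟩
  · exact fun s hs => ⟨b2 s hs, a3.trans_le hs⟩
  · intro γ B k1 k2 k3
    have k4 : γ < s1 := m1.lt_iff_lt.1 (by rw [k3, q5, ← q2]; exact k2)
    refine ⟨m1.lt_iff_lt.1 (by rw [k3]; exact k1), k4, ?_⟩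
    rw [← k3, e1 γ k4.le]
  · intro γ B k1 k2 k3
    have k4 : s2 < γ := m2.lt_iff_lt.1 (by rw [k3, q6, ← q1]; exact k1)
    refine ⟨k4, m2.lt_iff_lt.1 (by rw [k3]; exact k2), ?_⟩
    rw [← k3, e2 γ k4.le]

/-- convert the weak formulation to the form of the statement -/
lemma weak_conv {T : ℝ} {σ : ℝ → ℝ} {b c f : ℝ → ℝ → ℝ} {u0 : ℝ → ℝ} {u ux : ℝ → ℝ → ℝ} {u0b : ℝ → ℝ} {bb cc ff : ℝ × ℝ → ℝ}
    (hb : ∀ x ∈ Set.Icc (0:ℝ) 1, ∀ t ∈ Set.Icc 0 T, bb (x, t) = b x t ∧ cc (x, t) = c x t ∧ ff (x, t) = f x t)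
    (h0 : ∀ x ∈ Set.Icc (0:ℝ) 1, u0b x = u0 x)
    (hw : ∀ ζ : ℝ × ℝ → ℝ, Smooth ζ → ∀ s ∈ Set.Icc 0 T, ∫ t in (0:ℝ)..s, ∫ x in (0:ℝ)..1, (u x t * pt ζ (x, t) - σ (ux x t) * px ζ (x, t)
      + (bb (x, t) * ux x t + cc (x, t) * u x t + ff (x, t)) * ζ (x, t)) =
    ∫ x in (0:ℝ)..1, (u x s * ζ (x, s) - u0b x * ζ (x, 0)))
    (ζ : ℝ → ℝ → ℝ) (hζ : ContDiff ℝ (⊤ : ℕ∞) (fun p : ℝ × ℝ => ζ p.1 p.2)) (s : ℝ) (hs : s ∈ Set.Icc (0:ℝ) T) :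
      (∫ t in Set.Ioo (0:ℝ) s, ∫ x in Set.Ioo (0:ℝ) 1,
        (u x t * deriv (fun τ => ζ x τ) t - σ (ux x t) * deriv (fun y => ζ y t) x
          + (b x t * ux x t + c x t * u x t + f x t) * ζ x t))
      = ∫ x in Set.Ioo (0:ℝ) 1, (u x s * ζ x s - u0 x * ζ x 0) := by
  have k := hw (fun p => ζ p.1 p.2) hζ s hs
  simp only [intervalIntegral.integral_of_le hs.1, intervalIntegral.integral_of_le (zero_le_one (α := ℝ)), integral_Ioc_eq_integral_Ioo] at k
  have e1 : ∀ x t, deriv (fun τ => ζ x τ) t = pt (fun p => ζ p.1 p.2) (x, t) := fun x t =>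
    (hd_pt (f := fun p : ℝ × ℝ => ζ p.1 p.2) hζ x t).deriv
  have e2 : ∀ x t, deriv (fun y => ζ y t) x = px (fun p => ζ p.1 p.2) (x, t) := fun x t =>
    (hd_px (f := fun p : ℝ × ℝ => ζ p.1 p.2) hζ x t).deriv
  simp only [e1, e2]
  have k2 : ∫ x in Set.Ioo (0:ℝ) 1, (u x s * ζ x s - u0 x * ζ x 0) = ∫ x in Set.Ioo (0:ℝ) 1, (u x s * ζ x s - u0b x * ζ x 0) := by
    refine setIntegral_congr_fun measurableSet_Ioo fun x hx => ?_
    simp only [h0 x (Set.Ioo_subset_Icc_self hx)]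
  rw [k2, ← k]
  refine setIntegral_congr_fun measurableSet_Ioo fun t ht => setIntegral_congr_fun measurableSet_Ioo fun x hx => ?_
  obtain ⟨q1, q2, q3⟩ := hb x (Set.Ioo_subset_Icc_self hx) t ⟨ht.1.le, ht.2.le.trans hs.2⟩
  simp only [q1, q2, q3]

end M7d
end FB

namespace FB
section M7e
open Filter Topology MeasureTheory

lemma deriv_of_taylor {g : ℝ → ℝ} {w M x : ℝ} (hx : x ∈ Set.Ioo (0:ℝ) 1) (h : ∀ y ∈ Set.Icc (0:ℝ) 1, |g y - g x - (y - x) * w| ≤ M * |y - x|^2) :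
    HasDerivAt g w x := by
  rw [hasDerivAt_iff_isLittleO]
  refine Asymptotics.IsBigO.trans_isLittleO (g := fun y => ‖y - x‖^2) ?_ (Asymptotics.isLittleO_pow_sub_sub x (m := 2) (by norm_num))
  refine Asymptotics.IsBigO.of_bound M ?_
  filter_upwards [Icc_mem_nhds hx.1 hx.2] with y hy
  rw [Real.norm_eq_abs, norm_pow, norm_norm, Real.norm_eq_abs]
  exact h y hy

lemma lip_part {T M : ℝ} {u : ℝ → ℝ → ℝ} (hM : 0 ≤ M)
    (hx : ∀ x ∈ Set.Icc (0:ℝ) 1, ∀ y ∈ Set.Icc (0:ℝ) 1, ∀ t ∈ Set.Icc (0:ℝ) T, |u x t - u y t| ≤ M * |x - y|)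
    (ht : ∀ x ∈ Set.Icc (0:ℝ) 1, ∀ t ∈ Set.Icc (0:ℝ) T, ∀ s ∈ Set.Icc (0:ℝ) T, |u x t - u x s| ≤ M * |t - s|) :
    ∃ K : NNReal, LipschitzOnWith K (fun p : ℝ × ℝ => u p.1 p.2) (ClOmegaT T) := by
  refine ⟨Real.toNNReal (2 * M), LipschitzOnWith.of_dist_le_mul ?_⟩
  rintro ⟨x, t⟩ ⟨px, pt⟩ ⟨y, s⟩ ⟨qx, qt⟩
  rw [Real.coe_toNNReal _ (by positivity), Real.dist_eq]
  simp only at *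
  have k1 : |x - y| ≤ dist (x, t) (y, s) := by rw [Prod.dist_eq, ← Real.dist_eq]; exact le_max_left _ _
  have k2 : |t - s| ≤ dist (x, t) (y, s) := by rw [Prod.dist_eq, ← Real.dist_eq]; exact le_max_right _ _
  calc |u x t - u y s| = |(u x t - u y t) + (u y t - u y s)| := by congr 1; ring
    _ ≤ _ := abs_add_le _ _
    _ ≤ M * |x - y| + M * |t - s| := add_le_add (hx x px y qx t pt) (ht y qx t pt s qt)
    _ ≤ M * dist (x, t) (y, s) + M * dist (x, t) (y, s) := add_le_add (mul_le_mul_of_nonneg_left k1 hM) (mul_le_mul_of_nonneg_left k2 hM)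
    _ = _ := by ring

lemma lip_sum {T M K ME MdE : ℝ} {us w : ℝ → ℝ → ℝ} {E dE : ℝ → ℝ} {P : ℝ × ℝ → ℝ} (hM : 0 ≤ M) (hK : 0 ≤ K)
    (cw : Continuous (fun p : ℝ × ℝ => w p.1 p.2))
    (h1 : ∀ x ∈ Set.Icc (0:ℝ) 1, ∀ y ∈ Set.Icc (0:ℝ) 1, ∀ t ∈ Set.Icc (0:ℝ) T, |us y t - us x t - (y - x) * w x t| ≤ M * |y - x|^2)
    (h2 : ∀ x ∈ Set.Icc (0:ℝ) 1, ∀ t ∈ Set.Icc (0:ℝ) T, ∀ s ∈ Set.Icc (0:ℝ) T, |us x t - us x s| ≤ M * |t - s|)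
    (hE0 : 0 ≤ ME) (hE1 : 0 ≤ MdE)
    (hE : ∀ t ∈ Set.Icc (0:ℝ) T, |E t| ≤ ME) (hEd : ∀ t, HasDerivAt E (dE t) t) (hdE : ∀ t ∈ Set.Icc (0:ℝ) T, |dE t| ≤ MdE)
    (hP : ∀ p, |P p| ≤ K) (px : ∀ x y t, |P (x, t) - P (y, t)| ≤ K * |x - y|) (pt : ∀ x t s, |P (x, t) - P (x, s)| ≤ K * |t - s|) :
    ∃ C : NNReal, LipschitzOnWith C (fun p : ℝ × ℝ => us p.1 p.2 + E p.2 * P (p.1, p.2)) (ClOmegaT T) := by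
  have cpt : IsCompact (ClOmegaT T) := isCompact_Icc.prod isCompact_Icc
  obtain ⟨Mw, hMw⟩ := cpt.exists_bound_of_continuousOn cw.continuousOn
  have Mw0 : 0 ≤ |Mw| := abs_nonneg _
  refine lip_part (u := fun x t => us x t + E t * P (x, t)) (M := |Mw| + M + ME * K + MdE * K) (by positivity) ?_ ?_
  · intro x hx y hy t ht
    have k1 := h1 y hy x hx t ht
    have k2 : |w y t| ≤ |Mw| := (hMw (y, t) ⟨hy, ht⟩).trans (le_abs_self _)
    have k3 : |x - y| ≤ 1 := by rw [abs_le]; constructor <;> linarith [hx.1, hx.2, hy.1, hy.2]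
    have k4 : |us x t - us y t| ≤ (|Mw| + M) * |x - y| := by
      calc |us x t - us y t| = |(us x t - us y t - (x - y) * w y t) + (x - y) * w y t| := by congr 1; ring
        _ ≤ |us x t - us y t - (x - y) * w y t| + |(x - y) * w y t| := abs_add_le _ _
        _ ≤ M * |x - y|^2 + |x - y| * |Mw| := by
          rw [abs_mul]
          exact add_le_add k1 (mul_le_mul_of_nonneg_left k2 (abs_nonneg _))
        _ ≤ M * |x - y| + |x - y| * |Mw| := by
          have : |x - y|^2 ≤ |x - y| := by nlinarith [abs_nonneg (x - y)]
          have := mul_le_mul_of_nonneg_left this hM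
          linarith
        _ = _ := by ring
    have k5 : |E t * P (x, t) - E t * P (y, t)| ≤ ME * (K * |x - y|) := by
      rw [← mul_sub, abs_mul]
      exact mul_le_mul (hE t ht) (px x y t) (abs_nonneg _) hE0
    have k6 : 0 ≤ MdE * K * |x - y| := by positivity
    calc |us x t + E t * P (x, t) - (us y t + E t * P (y, t))| = |(us x t - us y t) + (E t * P (x, t) - E t * P (y, t))| := by congr 1; ring
      _ ≤ _ := abs_add_le _ _
      _ ≤ _ := by linarith
  · intro x hx t ht s hs
    have k1 := h2 x hx t ht s hs
    have k2 : |E t - E s| ≤ MdE * |t - s| :=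
      (convex_Icc (0:ℝ) T).norm_image_sub_le_of_norm_hasDerivWithin_le (fun z _ => (hEd z).hasDerivWithinAt) hdE hs ht
    have k5 : |E t * (P (x, t) - P (x, s))| ≤ ME * (K * |t - s|) := by
      rw [abs_mul]
      exact mul_le_mul (hE t ht) (pt x t s) (abs_nonneg _) hE0
    have k6 : |(E t - E s) * P (x, s)| ≤ MdE * |t - s| * K := by
      rw [abs_mul]
      exact mul_le_mul k2 (hP _) (abs_nonneg _) (by positivity)
    have k7 : 0 ≤ |Mw| * |t - s| := by positivity
    calc |us x t + E t * P (x, t) - (us x s + E s * P (x, s))| = |(us x t - us x s) + (E t * (P (x, t) - P (x, s)) + (E t - E s) * P (x, s))| := by congr 1; ring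
      _ ≤ |us x t - us x s| + (|E t * (P (x, t) - P (x, s))| + |(E t - E s) * P (x, s)|) := (abs_add_le _ _).trans (add_le_add le_rfl (abs_add_le _ _))
      _ ≤ _ := by linarith

end M7e
end FB

namespace FB
section M7f
open Filter Topology MeasureTheory

theorem core {α s1 s2 lam Lam T s1star s2star x0 : ℝ} {sigma sigma' : ℝ → ℝ}
    {b bx c f : ℝ → ℝ → ℝ} {d : ℝ → ℝ} {u0 u0' u0'' : ℝ → ℝ}
    (hT : 0 < T)
    (hflux : FluxHyp α s1 s2 lam Lam sigma sigma')
    (hcoeff : CoeffHyp α T b bx c f d)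
    (hinit : InitHyp α u0 u0' u0'')
    (hs1star : 0 ≤ s1star) (hs1star' : s1star < s1) (hs1star_eq : sigma s1star = sigma s2)
    (hs2star : s2 < s2star) (hs2star_eq : sigma s2star = sigma s1)
    (hx0 : x0 ∈ Set.Ioo (0:ℝ) 1) (hx0l : s1star < u0' x0) (hx0r : u0' x0 < s2star) :
    ∃ us : ℝ → ℝ → ℝ, ∀ δ > 0, ∃ u : ℝ → ℝ → ℝ, (∃ p : ℝ × ℝ, u p.1 p.2 ≠ us p.1 p.2) ∧ (∀ p : ℝ × ℝ, |u p.1 p.2 - us p.1 p.2| ≤ δ) ∧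
      (∀ p ∉ OmegaT T, u p.1 p.2 = us p.1 p.2) ∧
      ∃ ux : ℝ → ℝ → ℝ,
        IsLipschitzSolution T sigma b c f u0 u ux ∧ ForwardRange T s1 s2 ux ∧
        0 < volume {p ∈ OmegaT T | s1star < ux p.1 p.2 ∧ ux p.1 p.2 < s1} ∧
        0 < volume {p ∈ OmegaT T | s2 < ux p.1 p.2 ∧ ux p.1 p.2 < s2star} := by
  obtain ⟨h1, h2, S, S', r1, r2, L, lam0, Lam0, Hs, ε0, L0, m1, m2, l1, l2, F, hε0, rz1, rz2, S0, hin, hle, hge, pw1, pw2⟩ :=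
    fluxdata hflux hs1star hs1star' hs1star_eq hs2star hs2star_eq hx0l hx0r
  obtain ⟨Q0, hc⟩ := coef_of hT hflux.alpha_pos hcoeff
  obtain ⟨hbd, Cb, hbl⟩ := b_props hcoeff
  obtain ⟨L1, hi⟩ := ini_of hflux.alpha_pos hinit
  obtain ⟨cd, E, cE, Epos, hE⟩ := exp_fac hT hcoeff.d_cont
  obtain ⟨us, w, M, M0, cus, cw, t1, t2, -, us0, -, w1, hI⟩ := thmE F hc hi hT
  have cS : Continuous S := continuous_iff_continuousAt.2 fun s => (F.deriv s).continuousAt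
  set W : ℝ × ℝ → ℝ := fun p => w p.1 p.2 with hW
  set bb : ℝ × ℝ → ℝ := fun p => b (cl 1 p.1) (cl T p.2) with hbb
  set D : ℝ × ℝ → ℝ := fun p => E p.2 with hD
  set B0 : ℝ × ℝ → ℝ := fun p => S (W p) with hB0
  set U : Set (ℝ × ℝ) := OmegaT T ∩ {p | r1 < W p ∧ W p < r2} with hU
  have oO : IsOpen (OmegaT T) := isOpen_Ioo.prod isOpen_Ioo
  have cD : Continuous D := cE.comp continuous_snd
  have ci : CI U W B0 D bb h1 h2 L := by
    refine ⟨oO.inter ((isOpen_lt continuous_const cw).inter (isOpen_lt cw continuous_const)), ?_, cw, cS.comp cw, cD, hc.cb, fun p => Epos _, L0, l1, l2⟩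
    exact (((Metric.isBounded_Ioo 0 1).prod (Metric.isBounded_Ioo 0 T))).subset Set.inter_subset_left
  have a0 : Adm U W B0 D bb h1 h2 0 := by
    refine ⟨contDiff_const, HasCompactSupport.zero, by simp [tsupport], ?_⟩
    intro p hp
    obtain ⟨k1, k2, -, -⟩ := hin _ hp.2.1 hp.2.2
    unfold rho gam Bf
    simp only [px_zero, pt_zero, Pi.zero_apply, mul_zero, add_zero, sub_zero]
    exact lt_min (by linarith) (by linarith)
  have Une : U.Nonempty := by
    have e0 : w x0 0 = u0' x0 := by
      have hx : x0 ∈ Set.Icc (0:ℝ) 1 := Set.Ioo_subset_Icc_self hx0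
      have z : (0:ℝ) ∈ Set.Icc 0 T := ⟨le_rfl, hT.le⟩
      have k1 : HasDerivAt u0 (w x0 0) x0 := deriv_of_taylor hx0 (M := M) fun y hy => by
        have := t1 x0 hx y hy 0 z
        rwa [us0 x0 hx, us0 y hy] at this
      exact k1.unique ((hinit.deriv1 x0 hx).hasDerivAt (Icc_mem_nhds hx0.1 hx0.2))
    have ctw : Continuous fun t => w x0 t := ct (f := W) cw x0
    have k1 : ∀ᶠ t in 𝓝[>] (0:ℝ), r1 < w x0 t ∧ w x0 t < r2 := by
      refine nhdsWithin_le_nhds ?_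
      have : IsOpen {t | r1 < w x0 t ∧ w x0 t < r2} := (isOpen_lt continuous_const ctw).inter (isOpen_lt ctw continuous_const)
      refine this.mem_nhds ?_
      simp only [Set.mem_setOf_eq, e0]
      exact ⟨rz1, rz2⟩
    obtain ⟨t, q1, q2⟩ := (k1.and (Ioo_mem_nhdsGT hT)).exists
    exact ⟨(x0, t), ⟨hx0, q2⟩, q1⟩
  obtain ⟨ε1, ε1pos, tp⟩ := two_phase ci a0 m1 m2 Une
  obtain ⟨ME, hME⟩ := isCompact_Icc.exists_bound_of_continuousOn (s := Set.Icc 0 T) cE.continuousOn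
  obtain ⟨MdE, hMdE⟩ := isCompact_Icc.exists_bound_of_continuousOn (s := Set.Icc 0 T) (cd.mul cE).continuousOn
  have z : (0:ℝ) ∈ Set.Icc 0 T := ⟨le_rfl, hT.le⟩
  have MEpos : 0 < ME := (Epos 0).trans_le ((le_abs_self _).trans (hME 0 z))
  have MdE0 : 0 ≤ MdE := (norm_nonneg _).trans (hMdE 0 z)
  have Q00 := hc.Q_nonneg
  refine ⟨us, fun δ hδ => ?_⟩
  set ε := min ε1 (min (ε0 / (2 * ME * (1 + Q0))) (δ / ME)) with hε
  have εpos : 0 < ε := lt_min ε1pos (lt_min (by positivity) (by positivity))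
  have εb1 : ε ≤ ε1 := min_le_left _ _
  have εb2 : ME * (ε + Q0 * ε) < ε0 := by
    have : ε ≤ ε0 / (2 * ME * (1 + Q0)) := (min_le_right _ _).trans (min_le_left _ _)
    rw [le_div_iff₀ (by positivity)] at this
    nlinarith
  have εb3 : ME * ε ≤ δ := by
    have : ε ≤ δ / ME := (min_le_right _ _).trans (min_le_right _ _)
    rw [le_div_iff₀ (by positivity)] at this
    linarith
  obtain ⟨φ, P, Q, G, K, K0, cφ, cP, cQ, mG, hφx, hφt, bds, off, lpx, lpt, hintg, hder, halt⟩ :=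
    conv_int ci a0 m1 m2 hε0 (fun p hp => (hin _ hp.2.1 hp.2.2).2.2.1) (fun p hp => (hin _ hp.2.1 hp.2.2).2.2.2) εpos
  obtain ⟨ph1, ph2, p0, hp0, hPp0⟩ := tp P Q G ε K εb1 mG (fun p => (bds p).2) hintg hder halt
  have offO : ∀ p, p ∉ OmegaT T → φ p = 0 ∧ P p = 0 ∧ Q p = 0 ∧ G p = 0 := fun p hp => off p fun h => hp h.1
  have inI : ∀ p, p ∈ OmegaT T → p.1 ∈ Set.Icc (0:ℝ) 1 ∧ p.2 ∈ Set.Icc (0:ℝ) T := fun p hp =>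
    ⟨Set.Ioo_subset_Icc_self hp.1, Set.Ioo_subset_Icc_self hp.2⟩
  -- bounds for the flux value on the region
  have hB : ∀ p ∈ U, h1 s1star < B0 p + D p * (Q p - bb p * P p) ∧ B0 p + D p * (Q p - bb p * P p) < h2 s2star := by
    intro p hp
    obtain ⟨-, -, k1, k2⟩ := hin _ hp.2.1 hp.2.2
    have k3 : |D p * (Q p - bb p * P p)| ≤ ME * (ε + Q0 * ε) := by
      rw [abs_mul]
      refine mul_le_mul (hME p.2 (inI p hp.1).2) ?_ (abs_nonneg _) MEpos.le
      refine (abs_sub _ _).trans (add_le_add (bds p).2.2.1 ?_)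
      rw [abs_mul]
      exact mul_le_mul (hc.bb p.1 p.2) (bds p).2.1 (abs_nonneg _) Q00
    have k4 := abs_lt.1 (k3.trans_lt εb2)
    simp only [hB0]
    constructor <;> linarith [k4.1, k4.2]
  have alt : ∀ᵐ p : ℝ × ℝ, p ∈ U → (s1star < W p + D p * G p ∧ W p + D p * G p < s1 ∧ sigma (W p + D p * G p) = B0 p + D p * (Q p - bb p * P p)) ∧
      h1 (W p + D p * G p) = B0 p + D p * (Q p - bb p * P p) ∨
      (s2 < W p + D p * G p ∧ W p + D p * G p < s2star ∧ sigma (W p + D p * G p) = B0 p + D p * (Q p - bb p * P p)) ∧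
      h2 (W p + D p * G p) = B0 p + D p * (Q p - bb p * P p) := by
    filter_upwards [halt] with p hp hU
    obtain ⟨k1, k2⟩ := hB p hU
    rcases hp hU with h | h
    · exact Or.inl ⟨pw1 _ _ k1 k2 h, h⟩
    · exact Or.inr ⟨pw2 _ _ k1 k2 h, h⟩
  have offU : ∀ p ∈ OmegaT T, p ∉ U → W p + D p * G p = W p ∧ B0 p + D p * (Q p - bb p * P p) = sigma (W p) ∧ (W p < s1 ∨ s2 < W p) := by
    intro p hp hn
    obtain ⟨-, k1, k2, k3⟩ := off p hn
    rw [k1, k2, k3]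
    have k4 : W p ≤ r1 ∨ r2 ≤ W p := by
      by_contra hcon
      push Not at hcon
      exact hn ⟨hp, hcon⟩
    refine ⟨by ring, ?_, ?_⟩
    · simp only [hB0]
      rcases k4 with h | h
      · rw [(hle _ h).1]; ring
      · rw [(hge _ h).1]; ring
    · rcases k4 with h | h
      · exact Or.inl (hle _ h).2
      · exact Or.inr (hge _ h).2
  have hσ : ∀ᵐ p : ℝ × ℝ, p.1 ∈ Set.Ioo (0:ℝ) 1 → p.2 ∈ Set.Ioo 0 T → sigma (W p + E p.2 * G p) = S (W p) + E p.2 * (Q p - bb p * P p) := by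
    filter_upwards [alt] with p hp k1 k2
    by_cases hU : p ∈ U
    · rcases hp hU with h | h
      · exact h.1.2.2
      · exact h.1.2.2
    · obtain ⟨e1, e2, -⟩ := offU p ⟨k1, k2⟩ hU
      exact (congrArg sigma e1).trans e2.symm
  have n0 : ∀ t, (0, t) ∉ OmegaT T := fun t h => lt_irrefl _ h.1.1
  have n1 : ∀ t, (1, t) ∉ OmegaT T := fun t h => lt_irrefl _ h.1.2
  have nt : ∀ x, (x, 0) ∉ OmegaT T := fun t h => lt_irrefl _ h.2.1
  refine ⟨fun x t => us x t + E t * P (x, t), ⟨p0, ?_⟩, ?_, ?_, fun x t => w x t + E t * G (x, t), ⟨?_, ?_, ?_⟩, ?_, ?_, ?_⟩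
  · intro h
    have h' : E p0.2 * P p0 = 0 := by simpa using h
    exact (mul_ne_zero (Epos _).ne' hPp0) h'
  · intro p
    rw [add_sub_cancel_left, abs_mul]
    by_cases hp : p ∈ OmegaT T
    · exact (mul_le_mul (hME p.2 (inI p hp).2) (bds p).2.1 (abs_nonneg _) MEpos.le).trans εb3
    · have : P (p.1, p.2) = 0 := (offO p hp).2.1
      rw [this, abs_zero, mul_zero]; exact hδ.le
  · intro p hp
    have : P (p.1, p.2) = 0 := (offO p hp).2.1
    simp only [this, mul_zero, add_zero]
  · refine lip_sum (K := K + ε) (dE := fun t => d (cl T t) * E t) M0 (by positivity) cw t1 t2 MEpos.le MdE0 hME hE hMdE (fun p => (bds p).2.1.trans (by linarith))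
      (fun x y t => (lpx x y t).trans (mul_le_mul_of_nonneg_right (by linarith) (abs_nonneg _)))
      (fun x t s => (lpt x t s).trans (mul_le_mul_of_nonneg_right (by linarith) (abs_nonneg _)))
  · rw [ae_restrict_iff' oO.measurableSet]
    filter_upwards [hder] with p k1 hp
    have hp' := inI p hp
    exact (deriv_of_taylor hp.1 fun y hy => t1 p.1 hp'.1 y hy p.2 hp'.2).add (k1.const_mul (E p.2))
  · refine weak_conv (bb := bb) (cc := fun p => c (cl 1 p.1) (cl T p.2)) (ff := fun p => f (cl 1 p.1) (cl T p.2)) (u0b := fun x => us x 0) ?_ us0 ?_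
    · intro x hx t ht
      simp only [hbb, cl_eq hx, cl_eq ht, and_self]
    · intro ζ hζ s hs
      exact weak_form (us := fun p => us p.1 p.2) (w := W) (S := S) (d := fun t => d (cl T t)) cus cw cφ cP cQ mG hc.cb hc.cc hc.cf cS cE cd hE S0 w1
        (fun x hx t ht => by have := hI x hx t ht; simp only [S0, sub_zero] at this; exact this) hφx hφt
        (fun p => (bds p).2.2.2) (fun t => ⟨(offO _ (n0 t)).1, (offO _ (n0 t)).2.1⟩) (fun t => ⟨(offO _ (n1 t)).2.1, (offO _ (n1 t)).2.2.1⟩)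
        (fun x => (offO _ (nt x)).1) hintg hbd hbl hσ hζ hs
  · unfold ForwardRange
    rw [ae_restrict_iff' oO.measurableSet]
    filter_upwards [alt] with p k1 hp
    by_cases hU : p ∈ U
    · rcases k1 hU with h | h
      · exact Or.inl h.1.2.1
      · exact Or.inr h.1.1
    · obtain ⟨e1, -, e3⟩ := offU p hp hU
      have e1' : w p.1 p.2 + E p.2 * G (p.1, p.2) = W p := e1
      rw [e1']; exact e3
  · rw [pos_iff_ne_zero]
    intro h
    refine ph2 ?_
    have h' : ∀ᵐ p : ℝ × ℝ, p ∉ {p ∈ OmegaT T | s1star < w p.1 p.2 + E p.2 * G (p.1, p.2) ∧ w p.1 p.2 + E p.2 * G (p.1, p.2) < s1} :=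
      measure_eq_zero_iff_ae_notMem.1 h
    filter_upwards [alt, h'] with p k1 k2 hU
    rcases k1 hU with h | h
    · exact absurd ⟨hU.1, h.1.1, h.1.2.1⟩ k2
    · exact h.2
  · rw [pos_iff_ne_zero]
    intro h
    refine ph1 ?_
    have h' : ∀ᵐ p : ℝ × ℝ, p ∉ {p ∈ OmegaT T | s2 < w p.1 p.2 + E p.2 * G (p.1, p.2) ∧ w p.1 p.2 + E p.2 * G (p.1, p.2) < s2star} :=
      measure_eq_zero_iff_ae_notMem.1 h
    filter_upwards [alt, h'] with p k1 k2 hU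
    rcases k1 hU with h | h
    · exact h.2
    · exact absurd ⟨hU.1, h.1.1, h.1.2.1⟩ k2

/-- infinitely many from arbitrarily small perturbations -/
lemma infinite_of_small {Ω : Set (ℝ × ℝ)} {V : (ℝ → ℝ → ℝ) → Prop} {us : ℝ → ℝ → ℝ}
    (h : ∀ δ > 0, ∃ u : ℝ → ℝ → ℝ, (∃ p : ℝ × ℝ, u p.1 p.2 ≠ us p.1 p.2) ∧ (∀ p : ℝ × ℝ, |u p.1 p.2 - us p.1 p.2| ≤ δ) ∧
      (∀ p ∉ Ω, u p.1 p.2 = us p.1 p.2) ∧ V u) :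
    ∃ S : Set (ℝ → ℝ → ℝ), S.Infinite ∧ (∀ u1 ∈ S, ∀ u2 ∈ S, u1 ≠ u2 → ∃ p ∈ Ω, u1 p.1 p.2 ≠ u2 p.1 p.2) ∧ ∀ u ∈ S, V u := by
  refine ⟨{u | (∃ p : ℝ × ℝ, u p.1 p.2 ≠ us p.1 p.2) ∧ (∀ p ∉ Ω, u p.1 p.2 = us p.1 p.2) ∧ V u}, ?_, ?_, fun u hu => hu.2.2⟩
  · intro hfin
    have hne : ∃ u, u ∈ {u : ℝ → ℝ → ℝ | (∃ p : ℝ × ℝ, u p.1 p.2 ≠ us p.1 p.2) ∧ (∀ p ∉ Ω, u p.1 p.2 = us p.1 p.2) ∧ V u} := by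
      obtain ⟨u, k1, -, k2, k3⟩ := h 1 one_pos
      exact ⟨u, k1, k2, k3⟩
    have hch : ∀ u : ℝ → ℝ → ℝ, ∃ m : ℝ, (u ∈ {u : ℝ → ℝ → ℝ | (∃ p : ℝ × ℝ, u p.1 p.2 ≠ us p.1 p.2) ∧ (∀ p ∉ Ω, u p.1 p.2 = us p.1 p.2) ∧ V u} →
        0 < m ∧ ∃ p : ℝ × ℝ, m = |u p.1 p.2 - us p.1 p.2|) := by
      intro u
      by_cases hu : ∃ p : ℝ × ℝ, u p.1 p.2 ≠ us p.1 p.2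
      · obtain ⟨p, hp⟩ := hu
        exact ⟨_, fun _ => ⟨abs_pos.2 (sub_ne_zero.2 hp), p, rfl⟩⟩
      · exact ⟨0, fun h => absurd h.1 hu⟩
    choose m hm using hch
    obtain ⟨v, hv, hmin⟩ := Set.exists_min_image _ m hfin hne
    have mv := (hm v hv).1
    obtain ⟨u, k1, k2, k3, k4⟩ := h (m v / 2) (by positivity)
    have hu := hmin u ⟨k1, k3, k4⟩
    obtain ⟨-, p, hp⟩ := hm u ⟨k1, k3, k4⟩
    have := k2 p
    rw [← hp] at this
    linarith
  · intro u1 hu1 u2 hu2 hne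
    by_contra hcon
    push Not at hcon
    refine hne (funext fun x => funext fun t => ?_)
    by_cases hp : (x, t) ∈ Ω
    · exact hcon (x, t) hp
    · exact (hu1.2.1 (x, t) hp).trans (hu2.2.1 (x, t) hp).symm

end M7f
end FB

/-- If moreover `s1* < u0'(x0) < s2*` for some `x0 ∈ (0,1)`, then there exist
infinitely many forward solutions whose spatial gradient lies in each of the two phase-transition
ranges `(s1*, s1)` and `(s2, s2*)` on sets of positive measure. -/
theorem exists_infinitely_many_two_phase_forward_solutions
    (α s1 s2 lam Lam T s1star s2star x0 : ℝ) (sigma sigma' : ℝ → ℝ)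
    (b bx c f : ℝ → ℝ → ℝ) (d : ℝ → ℝ) (u0 u0' u0'' : ℝ → ℝ)
    (hT : 0 < T)
    (hflux : FluxHyp α s1 s2 lam Lam sigma sigma')
    (hcoeff : CoeffHyp α T b bx c f d)
    (hinit : InitHyp α u0 u0' u0'')
    (hs1star : 0 ≤ s1star) (hs1star' : s1star < s1) (hs1star_eq : sigma s1star = sigma s2)
    (hs2star : s2 < s2star) (hs2star_eq : sigma s2star = sigma s1)
    (hx0 : x0 ∈ Ioo (0:ℝ) 1) (hx0l : s1star < u0' x0) (hx0r : u0' x0 < s2star) :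
    ∃ S : Set (ℝ → ℝ → ℝ), S.Infinite ∧
      (∀ u1 ∈ S, ∀ u2 ∈ S, u1 ≠ u2 → ∃ p ∈ OmegaT T, u1 p.1 p.2 ≠ u2 p.1 p.2) ∧
      ∀ u ∈ S, ∃ ux : ℝ → ℝ → ℝ,
        IsLipschitzSolution T sigma b c f u0 u ux ∧ ForwardRange T s1 s2 ux ∧
        0 < volume {p ∈ OmegaT T | s1star < ux p.1 p.2 ∧ ux p.1 p.2 < s1} ∧
        0 < volume {p ∈ OmegaT T | s2 < ux p.1 p.2 ∧ ux p.1 p.2 < s2star} := by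
  obtain ⟨us, h⟩ := FB.core hT hflux hcoeff hinit hs1star hs1star' hs1star_eq hs2star hs2star_eq hx0 hx0l hx0r
  exact FB.infinite_of_small h
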